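/- Let k ∈ {4,5} and let G be a 2-connected graph on n vertices with minimum degree at least k. Then G contains k admissible cycles, unless G is isomorphic to K_{k+1} or to K_{k,n-k}. -/

import Mathlib

open SimpleGraph

/-- `G` has a cycle of length `n`. -/
def HasCycleLen {V : Type*} (G : SimpleGraph V) (n : ℕ) : Prop :=
  ∃ (v : V) (c : G.Walk v v), c.IsCycle ∧ c.length = n

/-- `G` contains `k` admissible cycles: `k` cycles whose lengths form an arithmetic
progression with common difference 1 or 2. -/
def HasAdmissibleCycles {V : Type*} (G : SimpleGraph V) (k : ℕ) : Prop :=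
  ∃ a d : ℕ, (d = 1 ∨ d = 2) ∧ ∀ i < k, HasCycleLen G (a + i * d)

/-- `G` is `t`-connected: it has at least `t+1` vertices and the deletion of any set
of at most `t-1` vertices leaves a connected graph. -/
def KConnected {V : Type*} [Fintype V] (G : SimpleGraph V) (t : ℕ) : Prop :=
  t + 1 ≤ Fintype.card V ∧
    ∀ S : Finset V, S.card ≤ t - 1 → (G.induce ((↑S : Set V)ᶜ)).Connected

namespace Rooted

set_option linter.unusedSectionVars false
set_option linter.unusedVariables false

open scoped Classical

variable {V : Type*} [Fintype V] [DecidableEq V] {G : SimpleGraph V}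

/-- There is a path of length `n` from `a` to `b` inside `W`. -/
inductive PL (G : SimpleGraph V) : Finset V → V → V → ℕ → Prop
  | nil {W : Finset V} {a : V} (h : a ∈ W) : PL G W a a 0
  | cons {W : Finset V} {a b c : V} {n : ℕ} (h : a ∈ W) (hab : G.Adj a b)
      (p : PL G (W.erase a) b c n) : PL G W a c (n + 1)

/-- `v` can be reached from `u` inside `W`. -/
inductive Reach (G : SimpleGraph V) (W : Finset V) : V → V → Prop
  | refl {u : V} (h : u ∈ W) : Reach G W u u
  | head {u v w : V} (h : u ∈ W) (huv : G.Adj u v) (r : Reach G W v w) : Reach G W u w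

theorem PL.mono {W W' : Finset V} {a b : V} {n : ℕ} (p : PL G W a b n) (h : W ⊆ W') :
    PL G W' a b n := by
  induction p generalizing W' with
  | nil h1 => exact .nil (h h1)
  | cons h1 h2 _ ih => exact .cons (h h1) h2 (ih (Finset.erase_subset_erase _ h))

theorem PL.left {W : Finset V} {a b : V} {n : ℕ} (p : PL G W a b n) : a ∈ W := by
  cases p <;> assumption

theorem PL.right {W : Finset V} {a b : V} {n : ℕ} (p : PL G W a b n) : b ∈ W := by
  induction p with
  | nil h => exact h
  | cons _ _ _ ih => exact Finset.mem_of_mem_erase ih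

/-- Two paths in disjoint sets joined by an edge. -/
theorem PL.join {W₁ W₂ W : Finset V} {a b c d : V} {n m : ℕ} (p : PL G W₁ a b n)
    (h : G.Adj b c) (q : PL G W₂ c d m) (hd : Disjoint W₁ W₂) (h₁ : W₁ ⊆ W) (h₂ : W₂ ⊆ W) :
    PL G W a d (n + m + 1) := by
  induction p generalizing W with
  | nil h1 =>
    rw [zero_add]
    refine .cons (h₁ h1) h (q.mono fun x hx => ?_)
    exact Finset.mem_erase.2 ⟨fun e => Finset.disjoint_left.1 hd h1 (e ▸ hx), h₂ hx⟩
  | @cons W₁ a b' c' n h1 h2 p ih =>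
    have : PL G W a d ((n + m + 1) + 1) := by
      refine .cons (h₁ h1) h2 (ih h ?_ (Finset.erase_subset_erase _ h₁) ?_)
      · exact hd.mono_left (Finset.erase_subset _ _)
      · exact fun x hx => Finset.mem_erase.2 ⟨fun e => Finset.disjoint_left.1 hd h1 (e ▸ hx), h₂ hx⟩
    convert this using 1; ring

theorem PL.symm {W : Finset V} {a b : V} {n : ℕ} (p : PL G W a b n) : PL G W b a n := by
  induction p with
  | nil h => exact .nil h
  | @cons W a b c n h hab p ih =>
    exact ih.join hab.symm (PL.nil (W := {a}) (by simp)) (by simp) (Finset.erase_subset _ _)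
      (by simpa using h)

theorem PL.edge {W : Finset V} {a b : V} (h : G.Adj a b) (ha : a ∈ W) (hb : b ∈ W) :
    PL G W a b 1 :=
  .cons ha h (.nil (Finset.mem_erase.2 ⟨h.ne', hb⟩))

/-- Prepend a vertex. -/
theorem PL.cons' {W U : Finset V} {a b c : V} {n : ℕ} (p : PL G U b c n) (hab : G.Adj a b)
    (ha : a ∉ U) (haW : a ∈ W) (hU : U ⊆ W) : PL G W a c (n + 1) :=
  .cons haW hab (p.mono fun x hx => Finset.mem_erase.2 ⟨fun e => ha (e ▸ hx), hU hx⟩)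

theorem PL.snoc {W U : Finset V} {a b c : V} {n : ℕ} (p : PL G U a b n) (hbc : G.Adj b c)
    (hc : c ∉ U) (hcW : c ∈ W) (hU : U ⊆ W) : PL G W a c (n + 1) :=
  (p.symm.cons' hbc.symm hc hcW hU).symm

theorem PL.walk {W : Finset V} {a b : V} {n : ℕ} (p : PL G W a b n) :
    ∃ q : G.Walk a b, q.IsPath ∧ q.length = n ∧ ∀ v ∈ q.support, v ∈ W := by
  induction p with
  | nil h => exact ⟨.nil, by simp, rfl, by simpa using h⟩
  | @cons W a b c n h hab p ih =>
    obtain ⟨q, h1, h2, h3⟩ := ih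
    refine ⟨.cons hab q, ?_, by simp [h2], ?_⟩
    · rw [Walk.cons_isPath_iff]
      exact ⟨h1, fun h' => by simpa using h3 _ h'⟩
    · intro v hv
      rw [Walk.support_cons, List.mem_cons] at hv
      rcases hv with rfl | hv
      · exact h
      · exact Finset.mem_of_mem_erase (h3 _ hv)

theorem PL.cycle {W : Finset V} {a b : V} {n : ℕ} (p : PL G W a b n) (h : G.Adj b a) (hn : 2 ≤ n) :
    HasCycleLen G (n + 1) := by
  obtain ⟨q, h1, h2, _⟩ := p.walk
  refine ⟨b, .cons h q, ?_, by simp [h2]⟩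
  rw [Walk.cons_isCycle_iff]
  refine ⟨h1, fun hm => ?_⟩
  rw [Sym2.eq_swap] at hm
  have := Walk.IsPath.length_eq_one_of_mem_edges h1 hm
  omega

/-- Two disjoint paths whose ends are joined give a cycle. -/
theorem PL.cycle₂ {H D : Finset V} {u v a b : V} {n m : ℕ} (p : PL G H u v n) (q : PL G D a b m)
    (hd : Disjoint H D) (h₁ : G.Adj v a) (h₂ : G.Adj b u) (hn : 1 ≤ n + m) :
    HasCycleLen G (n + m + 2) :=
  (p.join h₁ q hd (Finset.subset_union_left (s₂ := D)) Finset.subset_union_right).cycle h₂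
    (by omega)

theorem Reach.left {W : Finset V} {u v : V} (r : Reach G W u v) : u ∈ W := by
  cases r <;> assumption

theorem Reach.right {W : Finset V} {u v : V} (r : Reach G W u v) : v ∈ W := by
  induction r <;> assumption

theorem Reach.mono {W W' : Finset V} {u v : V} (r : Reach G W u v) (h : W ⊆ W') :
    Reach G W' u v := by
  induction r with
  | refl h1 => exact .refl (h h1)
  | head h1 h2 _ ih => exact .head (h h1) h2 ih

theorem Reach.trans {W : Finset V} {u v w : V} (r : Reach G W u v) (s : Reach G W v w) :
    Reach G W u w := by
  induction r with
  | refl _ => exact s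
  | head h1 h2 _ ih => exact .head h1 h2 (ih s)

theorem Reach.edge {W : Finset V} {u v : V} (h : G.Adj u v) (hu : u ∈ W) (hv : v ∈ W) :
    Reach G W u v := .head hu h (.refl hv)

theorem Reach.symm {W : Finset V} {u v : V} (r : Reach G W u v) : Reach G W v u := by
  induction r with
  | refl h => exact .refl h
  | head h1 h2 r ih => exact ih.trans (.edge h2.symm r.left h1)

theorem Reach.tail {W : Finset V} {u v w : V} (r : Reach G W u v) (h : G.Adj v w) (hw : w ∈ W) :
    Reach G W u w := r.trans (.edge h r.right hw)

/-- A connection inside `W` starting in `E` stays inside `E` or leaves `E`. -/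
theorem Reach.exit {W : Finset V} {u t : V} (r : Reach G W u t) (E : Finset V) (hu : u ∈ E) :
    (Reach G (W ∩ E) u t) ∨ ∃ e s, Reach G (W ∩ E) u e ∧ s ∈ W ∧ s ∉ E ∧ G.Adj e s := by
  induction r with
  | refl h => exact .inl (.refl (Finset.mem_inter.2 ⟨h, hu⟩))
  | @head u v w h h2 r ih =>
    by_cases hv : v ∈ E
    · rcases ih hv with h3 | ⟨e, s, h3, h4⟩
      · exact .inl (.head (Finset.mem_inter.2 ⟨h, hu⟩) h2 h3)
      · exact .inr ⟨e, s, .head (Finset.mem_inter.2 ⟨h, hu⟩) h2 h3, h4⟩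
    · exact .inr ⟨u, v, .refl (Finset.mem_inter.2 ⟨h, hu⟩), r.left, hv, h2⟩

/-- The last visit of a connection to `S`. -/
theorem Reach.last_exit {U : Finset V} {x b : V} (r : Reach G U x b) (S : Finset V) :
    Reach G (U \ S) x b ∨ ∃ s ∈ S, s ∈ U ∧ Reach G (insert s (U \ S)) s b := by
  induction r with
  | @refl u h =>
    by_cases hs : u ∈ S
    · exact .inr ⟨u, hs, h, .refl (by simp)⟩
    · exact .inl (.refl (by simp [h, hs]))
  | @head u v w h h2 r ih =>
    rcases ih with h3 | h3
    · by_cases hs : u ∈ S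
      · exact .inr ⟨u, hs, h, .head (by simp) h2 (h3.mono (Finset.subset_insert _ _))⟩
      · exact .inl (.head (by simp [h, hs]) h2 h3)
    · exact .inr h3

theorem Reach.next {W : Finset V} {u v : V} (r : Reach G W u v) (h : v ≠ u) :
    ∃ c, G.Adj u c ∧ Reach G (W.erase u) c v := by
  suffices H : ∀ {x}, Reach G W x v → Reach G (W.erase u) x v ∨
      ∃ c, G.Adj u c ∧ Reach G (W.erase u) c v by
    rcases H r with h1 | h1
    · exact absurd h1.left (by simp)
    · exact h1
  intro x rx
  clear r
  induction rx with
  | refl h' => exact .inl (.refl (by simp [h, h']))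
  | @head x y w h1 h2 r ih =>
    rcases ih h with h3 | h3
    · by_cases hx : x = u
      · exact .inr ⟨y, hx ▸ h2, h3⟩
      · exact .inl (.head (by simp [hx, h1]) h2 h3)
    · exact .inr h3

theorem Reach.path {W : Finset V} {u v : V} (r : Reach G W u v) : ∃ n, PL G W u v n := by
  induction hn : W.card generalizing W u with
  | zero => rw [Finset.card_eq_zero] at hn; subst hn; exact absurd r.left (by simp)
  | succ n ih =>
    by_cases h : v = u
    · subst h; exact ⟨0, .nil r.left⟩
    · obtain ⟨c, h1, h2⟩ := r.next h
      obtain ⟨m, hm⟩ := ih h2 (by rw [Finset.card_erase_of_mem r.left, hn]; rfl)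
      exact ⟨m + 1, .cons r.left h1 hm⟩

/-- The component of `u` in `W`. -/
noncomputable def comp (G : SimpleGraph V) (W : Finset V) (u : V) : Finset V :=
  W.filter fun v => Reach G W u v

theorem mem_comp {W : Finset V} {u v : V} : v ∈ comp G W u ↔ Reach G W u v := by
  simp only [comp, Finset.mem_filter, and_iff_right_iff_imp]
  exact Reach.right

theorem comp_sub {W : Finset V} {u : V} : comp G W u ⊆ W := Finset.filter_subset _ _

theorem self_mem_comp {W : Finset V} {u : V} (h : u ∈ W) : u ∈ comp G W u :=
  mem_comp.2 (.refl h)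

theorem comp_closed {W : Finset V} {u v w : V} (h : v ∈ comp G W u) (hw : w ∈ W)
    (ha : G.Adj v w) : w ∈ comp G W u :=
  mem_comp.2 ((mem_comp.1 h).tail ha hw)

theorem Reach.in_comp {W : Finset V} {u v w : V} (r : Reach G W v w) (h : v ∈ comp G W u) :
    Reach G (comp G W u) v w := by
  rcases r.exit _ h with h1 | ⟨e, s, h1, h2, h3, h4⟩
  · exact h1.mono Finset.inter_subset_right
  · exact absurd (comp_closed (Finset.mem_inter.1 h1.right).2 h2 h4) h3

theorem comp_conn {W : Finset V} {u v w : V} (hv : v ∈ comp G W u) (hw : w ∈ comp G W u) :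
    Reach G (comp G W u) v w :=
  ((mem_comp.1 hv).symm.trans (mem_comp.1 hw)).in_comp hv

theorem comp_eq {W : Finset V} {u v : V} (hv : v ∈ comp G W u) : comp G W v = comp G W u := by
  ext x
  rw [mem_comp, mem_comp]
  exact ⟨fun h => (mem_comp.1 hv).trans h, fun h => (mem_comp.1 hv).symm.trans h⟩

/-- A component of `W \ S` sends an edge to `S`, if `W` connects it to `S`. -/
theorem attach {W S : Finset V} {u s : V} (r : Reach G W u s) (hu : u ∉ S) (hs : s ∈ S) :
    ∃ e ∈ comp G (W \ S) u, ∃ s' ∈ S, s' ∈ W ∧ G.Adj e s' := by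
  have huc : u ∈ comp G (W \ S) u := self_mem_comp (by simp [hu, r.left])
  rcases r.exit _ huc with h1 | ⟨e, s', h1, h2, h3, h4⟩
  · have := comp_sub (Finset.mem_inter.1 h1.right).2
    simp [hs] at this
  · have he := (Finset.mem_inter.1 h1.right).2
    refine ⟨e, he, s', ?_, h2, h4⟩
    by_contra hc
    exact h3 (comp_closed he (by simp [hc, h2]) h4)

/-- The neighbourhood of a set. -/
noncomputable def nb (G : SimpleGraph V) (T : Finset V) : Finset V :=
  Finset.univ.filter fun w => ∃ t ∈ T, G.Adj t w

@[simp] theorem mem_nb {T : Finset V} {w : V} : w ∈ nb G T ↔ ∃ t ∈ T, G.Adj t w := by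
  simp [nb]

theorem mem_nb1 {v w : V} : w ∈ nb G {v} ↔ G.Adj v w := by simp

/-- The degree into `W`. -/
noncomputable def dg (G : SimpleGraph V) (W : Finset V) (w : V) : ℕ := (W.filter (G.Adj w)).card

noncomputable def lab (A : Finset V) (w : V) : ℕ := if w ∈ A then 1 else 0

/-- The labelled degree. -/
noncomputable def ld (G : SimpleGraph V) (W A B : Finset V) (w : V) : ℕ :=
  dg G W w + lab A w + lab B w

theorem lab_le {A : Finset V} {w : V} : lab A w ≤ 1 := by unfold lab; split_ifs <;> omega
theorem lab_pos {A : Finset V} {w : V} (h : w ∈ A) : lab A w = 1 := by simp [lab, h]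
theorem lab_neg {A : Finset V} {w : V} (h : w ∉ A) : lab A w = 0 := by simp [lab, h]
theorem dg_le {W D H : Finset V} {w : V} (h : ∀ x ∈ W, G.Adj w x → x ∈ D ∨ x ∈ H) :
    dg G W w ≤ dg G D w + dg G H w := by
  unfold dg
  refine le_trans (Finset.card_le_card ?_) (Finset.card_union_le _ _)
  intro x hx
  simp only [Finset.mem_filter, Finset.mem_union] at hx ⊢
  rcases h x hx.1 hx.2 with h1 | h1
  · exact .inl ⟨h1, hx.2⟩
  · exact .inr ⟨h1, hx.2⟩

theorem dg_mono {W W' : Finset V} {w : V} (h : W ⊆ W') : dg G W w ≤ dg G W' w :=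
  Finset.card_le_card (Finset.filter_subset_filter _ h)

theorem dg_zero {H : Finset V} {w : V} (h : ∀ x ∈ H, ¬ G.Adj w x) : dg G H w = 0 := by
  unfold dg
  rw [Finset.card_eq_zero, Finset.filter_eq_empty_iff]
  exact fun {x} hx => h x hx

theorem dg_le_one {H : Finset V} {w : V}
    (h : ∀ x ∈ H, ∀ y ∈ H, G.Adj w x → G.Adj w y → x = y) : dg G H w ≤ 1 := by
  unfold dg
  rw [Finset.card_le_one]
  intro x hx y hy
  simp only [Finset.mem_filter] at hx hy
  exact h _ hx.1 _ hy.1 hx.2 hy.2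

theorem dg_le_card {H : Finset V} {w : V} : dg G H w ≤ H.card := Finset.card_filter_le _ _

theorem dg_union {H K : Finset V} {w : V} : dg G (H ∪ K) w ≤ dg G H w + dg G K w :=
  dg_le fun _ hx _ => Finset.mem_union.1 hx

theorem dg_pos {H : Finset V} {w : V} (h : 1 ≤ dg G H w) : ∃ x ∈ H, G.Adj w x := by
  by_contra hc
  push Not at hc
  rw [dg_zero hc] at h
  omega

/-- If every vertex adjacent to `w` in `H` forces a label, no degree is lost. -/
theorem dg_le_lab {H T : Finset V} {w : V} (h1 : dg G H w ≤ 1)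
    (h : ∀ x ∈ H, G.Adj w x → x ∈ T) : dg G H w ≤ lab (nb G T) w := by
  by_cases h0 : dg G H w = 0
  · omega
  · obtain ⟨x, hx, hwx⟩ := dg_pos (G := G) (H := H) (w := w) (by omega)
    rw [lab_pos]
    · exact h1
    · exact mem_nb.2 ⟨x, h x hx hwx, hwx.symm⟩

/-- Lengths of paths from `A` to `B` inside `W`. -/
def Lens (G : SimpleGraph V) (W A B : Finset V) (n : ℕ) : Prop :=
  ∃ a ∈ A, ∃ b ∈ B, PL G W a b n

theorem Lens.symm {W A B : Finset V} {n : ℕ} (h : Lens G W A B n) : Lens G W B A n := by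
  obtain ⟨a, ha, b, hb, p⟩ := h
  exact ⟨b, hb, a, ha, p.symm⟩

theorem Lens.mono {W A B W' A' B' : Finset V} {n : ℕ} (h : Lens G W A B n) (hW : W ⊆ W')
    (hA : ∀ a ∈ A, a ∈ W → a ∈ A') (hB : ∀ b ∈ B, b ∈ W → b ∈ B') : Lens G W' A' B' n := by
  obtain ⟨a, ha, b, hb, p⟩ := h
  exact ⟨a, hA a ha p.left, b, hB b hb p.right, p.mono hW⟩

theorem Lens.joinL {H D W T A B : Finset V} {k n : ℕ}
    (hK : ∀ t ∈ T, ∃ a ∈ A, PL G H a t k) (h : Lens G D (nb G T) B n)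
    (hd : Disjoint H D) (hH : H ⊆ W) (hD : D ⊆ W) : Lens G W A B (n + (k + 1)) := by
  obtain ⟨a, ha, b, hb, p⟩ := h
  obtain ⟨t, ht, hta⟩ := mem_nb.1 ha
  obtain ⟨a', ha', q⟩ := hK t ht
  refine ⟨a', ha', b, hb, ?_⟩
  convert q.join hta p hd hH hD using 1
  ring

theorem Lens.joinR {H D W T A B : Finset V} {k n : ℕ}
    (h : Lens G D A (nb G T) n) (hK : ∀ t ∈ T, ∃ b ∈ B, PL G H t b k)
    (hd : Disjoint H D) (hH : H ⊆ W) (hD : D ⊆ W) : Lens G W A B (n + (k + 1)) := by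
  refine (h.symm.joinL (H := H) (A := B) (k := k) (W := W) (fun t ht => ?_) hd hH hD).symm
  obtain ⟨b, hb, q⟩ := hK t ht
  exact ⟨b, hb, q.symm⟩

/-- `n` terms of an arithmetic progression with difference one or two. -/
def AP (n : ℕ) (S : ℕ → Prop) : Prop := ∃ a d, (d = 1 ∨ d = 2) ∧ ∀ i < n, S (a + i * d)

theorem AP.shift {n c : ℕ} {S S' : ℕ → Prop} (h : AP n S) (hc : ∀ x, S x → S' (x + c)) : AP n S' := by
  obtain ⟨a, d, hd, h⟩ := h
  exact ⟨a + c, d, hd, fun i hi => by have := hc _ (h i hi); convert this using 1; ring⟩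

theorem AP.le {n m : ℕ} {S : ℕ → Prop} (h : AP n S) (hm : m ≤ n) : AP m S := by
  obtain ⟨a, d, hd, h⟩ := h
  exact ⟨a, d, hd, fun i hi => h i (by omega)⟩

theorem AP.one {S : ℕ → Prop} {a : ℕ} (h : S a) : AP 1 S :=
  ⟨a, 1, .inl rfl, fun i hi => by obtain rfl : i = 0 := by omega
                                  simpa using h⟩

theorem AP.add {n m c : ℕ} {K S S' : ℕ → Prop} (hn : 1 ≤ n) (hm : 1 ≤ m) (h1 : AP n K) (h2 : AP m S)
    (h : ∀ x, K x → ∀ y, S y → S' (x + y + c)) : AP (n + m - 1) S' := by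
  have same : ∀ {d a b}, (d = 1 ∨ d = 2) → (∀ i < n, K (a + i * d)) → (∀ i < m, S (b + i * d)) →
      AP (n + m - 1) S' := by
    intro d a b hd h1 h2
    refine ⟨a + b + c, d, hd, fun i hi => ?_⟩
    by_cases hin : i < n
    · have := h _ (h1 i hin) _ (h2 0 (by omega))
      convert this using 1; ring
    · have := h _ (h1 (n - 1) (by omega)) _ (h2 (i - (n - 1)) (by omega))
      convert this using 1
      obtain ⟨j, rfl⟩ : ∃ j, i = (n - 1) + j := ⟨i - (n - 1), by omega⟩
      rw [Nat.add_sub_cancel_left]; ring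
  have mixed : ∀ {n m : ℕ} {a b : ℕ} {K S : ℕ → Prop}, 1 ≤ n → 1 ≤ m →
      (∀ x, K x → ∀ y, S y → S' (x + y + c)) →
      (∀ i < n, K (a + i * 1)) → (∀ i < m, S (b + i * 2)) → 2 ≤ n →
      AP (n + m - 1) S' := by
    intro n m a b K S hn hm h h1 h2 hn2
    refine ⟨a + b + c, 1, .inl rfl, fun i hi => ?_⟩
    by_cases hin : i / 2 < m
    · have := h _ (h1 (i % 2) (by omega)) _ (h2 (i / 2) hin)
      convert this using 1; omega
    · have := h _ (h1 (i - 2 * (m - 1)) (by omega)) _ (h2 (m - 1) (by omega))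
      convert this using 1; omega
  obtain ⟨a, d, hd, h1⟩ := h1
  obtain ⟨b, e, he, h2⟩ := h2
  by_cases hde : d = e
  · subst hde; exact same hd h1 h2
  by_cases hn1 : n = 1
  · subst hn1
    exact same he (a := a) (fun i hi => by have := h1 i hi; obtain rfl : i = 0 := by omega
                                           simpa using this) h2
  by_cases hm1 : m = 1
  · subst hm1
    exact same hd (b := b) h1 (fun i hi => by have := h2 i hi; obtain rfl : i = 0 := by omega
                                              simpa using this)
  rcases hd with rfl | rfl <;> rcases he with rfl | rfl
  · exact absurd rfl hde
  · exact mixed hn hm h h1 h2 (by omega)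
  · rw [show n + m - 1 = m + n - 1 by omega]
    exact mixed hm hn (fun x hx y hy => by have := h y hy x hx; rwa [add_comm y x] at this)
      h2 h1 (by omega)
  · exact absurd rfl hde

/-- Rooted instances. -/
structure RI (G : SimpleGraph V) (W A B : Finset V) : Prop where
  conn : ∀ u ∈ W, ∀ v ∈ W, Reach G W u v
  hA : ∃ a ∈ A, a ∈ W
  hB : ∃ b ∈ B, b ∈ W
  two : ∀ v ∈ W, ∀ u ∈ W, u ≠ v → ∃ t, (t ∈ A ∨ t ∈ B) ∧ Reach G (W.erase v) u t

theorem RI.symm {W A B : Finset V} (h : RI G W A B) : RI G W B A :=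
  ⟨h.conn, h.hB, h.hA, fun v hv u hu huv => by
    obtain ⟨t, ht, r⟩ := h.two v hv u hu huv
    exact ⟨t, ht.symm, r⟩⟩

theorem RI.sub {W A B D A' B' : Finset V} (h : RI G W A B) (hD : D ⊆ W)
    (hc : ∀ u ∈ D, ∀ v ∈ D, Reach G D u v) (hA : ∃ a ∈ A', a ∈ D) (hB : ∃ b ∈ B', b ∈ D)
    (h1 : ∀ w ∈ D, w ∈ A ∨ w ∈ B → w ∈ A' ∨ w ∈ B')
    (h2 : ∀ w ∈ D, ∀ s ∈ W, s ∉ D → G.Adj w s → w ∈ A' ∨ w ∈ B') : RI G D A' B' := by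
  refine ⟨hc, hA, hB, fun v hv u hu huv => ?_⟩
  obtain ⟨t, ht, r⟩ := h.two v (hD hv) u (hD hu) huv
  have e : W.erase v ∩ D ⊆ D.erase v := fun x => by simp; tauto
  rcases r.exit D hu with h3 | ⟨w, s, h3, h4, h5, h6⟩
  · exact ⟨t, h1 t (Finset.mem_inter.1 h3.right).2 ht, h3.mono e⟩
  · exact ⟨w, h2 w (Finset.mem_inter.1 h3.right).2 s (Finset.mem_of_mem_erase h4) h5 h6, h3.mono e⟩

theorem RI.cmp {W A B H A' B' : Finset V} {u : V} (h : RI G W A B)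
    (hA : ∃ a ∈ A', a ∈ comp G (W \ H) u) (hB : ∃ b ∈ B', b ∈ comp G (W \ H) u)
    (h1 : ∀ w ∈ comp G (W \ H) u, w ∈ A ∨ w ∈ B → w ∈ A' ∨ w ∈ B')
    (h2 : ∀ w ∈ comp G (W \ H) u, ∀ s ∈ W, s ∈ H → G.Adj w s → w ∈ A' ∨ w ∈ B') :
    RI G (comp G (W \ H) u) A' B' :=
  h.sub (comp_sub.trans Finset.sdiff_subset) (fun _ hu _ hv => comp_conn hu hv) hA hB h1
    fun w hw s hs hsD hws => by
      refine h2 w hw s hs ?_ hws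
      by_contra hc
      exact hsD (comp_closed hw (by simp [hs, hc]) hws)

theorem dg_comp {W H : Finset V} {u w : V} (hw : w ∈ comp G (W \ H) u) :
    dg G W w ≤ dg G (comp G (W \ H) u) w + dg G H w :=
  dg_le fun x hx hwx => by
    by_cases hxH : x ∈ H
    · exact .inr hxH
    · exact .inl (comp_closed hw (by simp [hx, hxH]) hwx)

/-- Every component of `W - v` meets both label sets. -/
def Star (G : SimpleGraph V) (W A B : Finset V) : Prop :=
  ∀ v ∈ W, ∀ u ∈ W, u ≠ v →
    (∃ a ∈ A, Reach G (W.erase v) u a) ∧ (∃ b ∈ B, Reach G (W.erase v) u b)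

theorem Star.symm {W A B : Finset V} (h : Star G W A B) : Star G W B A :=
  fun v hv u hu huv => (h v hv u hu huv).symm

/-- A reduction to a smaller rooted instance losing no labelled degree. -/
structure Red (G : SimpleGraph V) (W A B E A' B' : Finset V) : Prop where
  ri : RI G E A' B'
  sub : E ⊆ W
  lt : E.card < W.card
  deg : ∀ w ∈ E, ld G W A B w ≤ ld G E A' B' w
  lens : ∃ c, ∀ n, Lens G E A' B' n → Lens G W A B (n + c)
  lab : B' = B ∨ ∃ v, v ∉ E ∧ B' = nb G {v}

theorem erase_eq {W : Finset V} {v : V} : W.erase v = W \ {v} := Finset.erase_eq W v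

theorem conn_compl {W : Finset V} {u v : V} (hc : ∀ u ∈ W, ∀ v ∈ W, Reach G W u v) (hv : v ∈ W)
    {x : V} (hx : x ∈ W) (hxE : x ∉ comp G (W.erase v) u) :
    Reach G (W \ comp G (W.erase v) u) x v := by
  have e : W ∩ (W \ comp G (W.erase v) u) ⊆ W \ comp G (W.erase v) u := Finset.inter_subset_right
  rcases (hc x hx v hv).exit (W \ comp G (W.erase v) u) (by simp [hx, hxE])
    with h3 | ⟨w, s, h3, h4, h5, h6⟩
  · exact h3.mono e
  · have h7 := (Finset.mem_inter.1 h3.right).2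
    simp only [Finset.mem_sdiff] at h5 h7
    have hs : s ∈ comp G (W.erase v) u := by by_contra hc'; exact h5 ⟨h4, hc'⟩
    have : w = v := by
      by_contra hwv
      exact h7.2 (comp_closed hs (by simp [hwv, h7.1]) h6.symm)
    subst this
    exact h3.mono e

theorem comp_bdry {W : Finset V} {u v w s : V} (hw : w ∈ comp G (W.erase v) u) (hs : s ∈ W)
    (hsE : s ∉ comp G (W.erase v) u) (h : G.Adj w s) : s = v := by
  by_contra hc
  exact hsE (comp_closed hw (by simp [hc, hs]) h)

theorem RI.lobe {W A B : Finset V} {u v : V} (h : RI G W A B) (hv : v ∈ W) (hu : u ∈ W)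
    (huv : u ≠ v) (hE : ∀ b ∈ B, ¬ Reach G (W.erase v) u b) :
    RI G (comp G (W.erase v) u) A (nb G {v}) := by
  refine h.sub (comp_sub.trans (Finset.erase_subset _ _)) (fun _ hu _ hv => comp_conn hu hv)
    ?_ ?_ ?_ ?_
  · obtain ⟨t, ht, r⟩ := h.two v hv u hu huv
    rcases ht with ht | ht
    · exact ⟨t, ht, mem_comp.2 r⟩
    · exact absurd r (hE t ht)
  · obtain ⟨e, he, s', hs, _, hes⟩ := attach (S := {v}) (h.conn u hu v hv) (by simpa using huv)
      (by simp)
    rw [← erase_eq] at he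
    rw [Finset.mem_singleton] at hs
    subst hs
    exact ⟨e, mem_nb1.2 hes.symm, he⟩
  · rintro w hw (hwA | hwB)
    · exact .inl hwA
    · exact absurd (mem_comp.1 hw) (hE w hwB)
  · intro w hw s hs hsE hws
    obtain rfl := comp_bdry hw hs hsE hws
    exact .inr (mem_nb1.2 hws.symm)

theorem ld_lobe {W A B : Finset V} {u v w : V} (hw : w ∈ comp G (W.erase v) u)
    (hE : ∀ b ∈ B, ¬ Reach G (W.erase v) u b) :
    ld G W A B w ≤ ld G (comp G (W.erase v) u) A (nb G {v}) w := by
  have h1 : lab B w = 0 := lab_neg fun h => hE w h (mem_comp.1 hw)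
  have h2 : dg G W w ≤ dg G (comp G (W.erase v) u) w + dg G {v} w := dg_le fun x hx hwx => by
    by_cases hxE : x ∈ comp G (W.erase v) u
    · exact .inl hxE
    · exact .inr (by simp [comp_bdry hw hx hxE hwx])
  have h3 : dg G {v} w ≤ lab (nb G {v}) w :=
    dg_le_lab (dg_le_card.trans (by simp)) fun x hx _ => hx
  unfold ld; omega

theorem red_lobe {W A B : Finset V} {u v : V} (h : RI G W A B) (hv : v ∈ W) (hu : u ∈ W)
    (huv : u ≠ v) (hE : ∀ b ∈ B, ¬ Reach G (W.erase v) u b) :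
    Red G W A B (comp G (W.erase v) u) A (nb G {v}) := by
  have hEW : comp G (W.erase v) u ⊆ W.erase v := comp_sub
  refine ⟨h.lobe hv hu huv hE, hEW.trans (Finset.erase_subset _ _), ?_,
    fun w hw => ld_lobe hw hE, ?_, .inr ⟨v, fun hv => by simpa using hEW hv, rfl⟩⟩
  · exact (Finset.card_le_card hEW).trans_lt (Finset.card_erase_lt_of_mem hv)
  · obtain ⟨b, hb, hbW⟩ := h.hB
    obtain ⟨k, hk⟩ := (conn_compl h.conn hv (u := u) hbW
      (fun hh => hE b hb (mem_comp.1 hh))).symm.path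
    refine ⟨k + 1, fun n hn => hn.joinR (H := W \ comp G (W.erase v) u) (T := {v}) (B := B) ?_
      Finset.sdiff_disjoint Finset.sdiff_subset (hEW.trans (Finset.erase_subset _ _))⟩
    intro t ht
    rw [Finset.mem_singleton] at ht
    subst ht
    exact ⟨b, hb, hk⟩

theorem red_lobe' {W A B : Finset V} {u v : V} (h : RI G W A B) (hv : v ∈ W) (hu : u ∈ W)
    (huv : u ≠ v) (hE : ∀ a ∈ A, ¬ Reach G (W.erase v) u a) :
    Red G W A B (comp G (W.erase v) u) (nb G {v}) B := by
  have r := red_lobe h.symm hv hu huv hE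
  refine ⟨r.ri.symm, r.sub, r.lt, fun w hw => ?_, ?_, .inl rfl⟩
  · have := r.deg w hw
    unfold ld at *; omega
  · obtain ⟨c, hc⟩ := r.lens
    exact ⟨c, fun n hn => (hc n hn.symm).symm⟩

theorem star_or_red {W A B : Finset V} (h : RI G W A B) :
    Star G W A B ∨ ∃ E A' B', Red G W A B E A' B' := by
  by_contra hc
  push Not at hc
  refine hc.1 fun v hv u hu huv => ⟨?_, ?_⟩
  · by_contra h'
    push Not at h'
    exact hc.2 _ _ _ (red_lobe' h hv hu huv h')
  · by_contra h'
    push Not at h'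
    exact hc.2 _ _ _ (red_lobe h hv hu huv h')

/-- No vertex of `W` has two neighbours in `A ∩ W`. -/
def NoColl (G : SimpleGraph V) (W A : Finset V) : Prop :=
  ∀ p ∈ W, ∀ x ∈ A ∩ W, ∀ y ∈ A ∩ W, G.Adj p x → G.Adj p y → x = y

theorem red_contract_off {W A B : Finset V} {b : V} (h : RI G W A B) (hn : NoColl G W A)
    (hb : b ∈ B) (hbW : b ∈ W) (hbA : b ∉ A) :
    Red G W A B (comp G (W \ (A ∩ W)) b) (nb G (A ∩ W)) B := by
  have hX : comp G (W \ (A ∩ W)) b ⊆ W \ (A ∩ W) := comp_sub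
  have hXW : comp G (W \ (A ∩ W)) b ⊆ W := hX.trans Finset.sdiff_subset
  have hXA : ∀ w ∈ comp G (W \ (A ∩ W)) b, w ∉ A := fun w hw hwA => by
    have := hX hw
    simp only [Finset.mem_sdiff, Finset.mem_inter] at this
    exact this.2 ⟨hwA, this.1⟩
  obtain ⟨a, ha, haW⟩ := h.hA
  refine ⟨h.cmp ?_ ⟨b, hb, self_mem_comp (by simp [hbA, hbW])⟩ ?_ ?_, hXW, ?_, ?_, ⟨1, ?_⟩, .inl rfl⟩
  · obtain ⟨e, he, s, hs, _, hes⟩ := attach (S := A ∩ W) (h.conn b hbW a haW) (by simp [hbA])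
      (by simp [ha, haW])
    exact ⟨e, mem_nb.2 ⟨s, hs, hes.symm⟩, he⟩
  · rintro w hw (hwA | hwB)
    · exact absurd hwA (hXA w hw)
    · exact .inr hwB
  · intro w hw s _ hs hws
    exact .inl (mem_nb.2 ⟨s, hs, hws.symm⟩)
  · refine Finset.card_lt_card ⟨hXW, fun hh => hXA a (hh haW) ha⟩
  · intro w hw
    have h1 := lab_neg (hXA w hw)
    have h2 := dg_comp hw
    have h3 : dg G (A ∩ W) w ≤ lab (nb G (A ∩ W)) w :=
      dg_le_lab (dg_le_one (hn w (hXW hw))) fun x hx _ => hx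
    unfold ld; omega
  · intro n hn'
    refine hn'.joinL (H := A ∩ W) (k := 0) (fun t ht => ⟨t, (Finset.mem_inter.1 ht).1, .nil ht⟩) ?_
      Finset.inter_subset_right hXW
    exact Finset.disjoint_left.2 fun x hx hx' => hXA x hx' (Finset.mem_inter.1 hx).1

theorem red_contract_on {W A B K : Finset V} {b c y : V} {k : ℕ} (h : RI G W A B)
    (hs : Star G W A B) (hn : NoColl G W A) (hc : c ∈ A) (hcW : c ∈ W) (hcy : G.Adj c y)
    (hy : y ∈ W) (hyA : y ∉ A) (hXB : ∀ w ∈ comp G (W \ (A ∩ W)) y, w ∉ B) (hK : K ⊆ A ∩ W)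
    (hb : b ∈ B) (hp : PL G K c b k)
    (hKc : ∀ x ∈ K, x ≠ c → ∀ w ∈ W, w ∉ A → ¬ G.Adj x w) :
    Red G W A B (comp G (W \ (A ∩ W)) y) (nb G ((A ∩ W) \ K)) (nb G {c}) := by
  have hX : comp G (W \ (A ∩ W)) y ⊆ W \ (A ∩ W) := comp_sub
  have hXW : comp G (W \ (A ∩ W)) y ⊆ W := hX.trans Finset.sdiff_subset
  have hXA : ∀ w ∈ comp G (W \ (A ∩ W)) y, w ∉ A := fun w hw hwA => by
    have := hX hw
    simp only [Finset.mem_sdiff, Finset.mem_inter] at this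
    exact this.2 ⟨hwA, this.1⟩
  have key : ∀ s ∈ A ∩ W, ∀ w ∈ comp G (W \ (A ∩ W)) y, G.Adj w s →
      w ∈ nb G ((A ∩ W) \ K) ∨ w ∈ nb G {c} := by
    intro s hs w hw hws
    by_cases hsb : s = c
    · subst hsb; exact .inr (mem_nb1.2 hws.symm)
    · refine .inl (mem_nb.2 ⟨s, Finset.mem_sdiff.2 ⟨hs, fun hsK => ?_⟩, hws.symm⟩)
      exact hKc s hsK hsb w (hXW hw) (hXA w hw) hws.symm
  refine ⟨h.cmp ?_ ⟨y, mem_nb1.2 hcy, self_mem_comp (by simp [hyA, hy])⟩ ?_ ?_, hXW, ?_, ?_,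
    ⟨1 + (k + 1), ?_⟩, .inr ⟨c, fun hcX => hXA c hcX hc, rfl⟩⟩
  · obtain ⟨a, ha, r⟩ := (hs c hcW y hy hcy.ne').1
    obtain ⟨e, he, s, hs, hsW, hes⟩ := attach (S := A ∩ W) r (by simp [hyA])
      (by simp [ha, Finset.mem_of_mem_erase r.right])
    have e2 : W.erase c \ (A ∩ W) = W \ (A ∩ W) := by
      ext x; simp only [Finset.mem_sdiff, Finset.mem_erase, Finset.mem_inter]
      constructor
      · tauto
      · rintro ⟨h1, h2⟩
        exact ⟨⟨by rintro rfl; exact h2 ⟨hc, h1⟩, h1⟩, h2⟩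
    rw [e2] at he
    refine ⟨e, mem_nb.2 ⟨s, Finset.mem_sdiff.2 ⟨hs, fun hsK => ?_⟩, hes.symm⟩, he⟩
    exact hKc s hsK (Finset.mem_erase.1 hsW).1 e (hXW he) (hXA e he) hes.symm
  · rintro w hw (hwA | hwB)
    · exact absurd hwA (hXA w hw)
    · exact absurd hwB (hXB w hw)
  · intro w hw s _ hs hws
    exact key s hs w hw hws
  · exact Finset.card_lt_card ⟨hXW, fun hh => hXA c (hh hcW) hc⟩
  · intro w hw
    have h1 := lab_neg (hXA w hw)
    have h1' : lab B w = 0 := lab_neg (hXB w hw)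
    have h2 := dg_comp hw
    have h3 : dg G (A ∩ W) w ≤ lab (nb G ((A ∩ W) \ K)) w + lab (nb G {c}) w := by
      have h4 := dg_le_one (hn w (hXW hw))
      by_cases h0 : dg G (A ∩ W) w = 0
      · omega
      · obtain ⟨x, hx, hwx⟩ := dg_pos (G := G) (H := A ∩ W) (w := w) (by omega)
        rcases key x hx w hw hwx with h5 | h5
        · rw [lab_pos h5]; omega
        · rw [lab_pos h5]; omega
    unfold ld; omega
  · intro n hn'
    have h5 : Lens G (comp G (W \ (A ∩ W)) y ∪ ((A ∩ W) \ K)) A (nb G {c}) (n + 1) := by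
      refine hn'.joinL (H := (A ∩ W) \ K) (k := 0)
        (fun t ht => ⟨t, (Finset.mem_inter.1 (Finset.mem_sdiff.1 ht).1).1, .nil ht⟩) ?_
        Finset.subset_union_right Finset.subset_union_left
      exact Finset.disjoint_left.2 fun x hx hx' =>
        hXA x hx' (Finset.mem_inter.1 (Finset.mem_sdiff.1 hx).1).1
    have := h5.joinR (H := K) (k := k) (W := W) (B := B)
      (fun t ht => ⟨b, hb, by rw [Finset.mem_singleton.1 ht]; exact hp⟩) ?_
      (hK.trans Finset.inter_subset_right) ?_
    · rwa [add_assoc] at this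
    · refine Finset.disjoint_left.2 fun x hx hx' => ?_
      rcases Finset.mem_union.1 hx' with hh | hh
      · exact hXA x hh (Finset.mem_inter.1 (hK hx)).1
      · exact (Finset.mem_sdiff.1 hh).2 hx
    · exact Finset.union_subset hXW (Finset.sdiff_subset.trans Finset.inter_subset_right)

theorem red_contract {W A B : Finset V} (h : RI G W A B) (hs : Star G W A B)
    (hn : NoColl G W A) (hd : ∀ w ∈ W, 4 ≤ ld G W A B w) : ∃ E A' B', Red G W A B E A' B' := by
  by_cases hBA : ∀ b ∈ B, b ∈ W → b ∈ A
  · obtain ⟨b, hb, hbW⟩ := h.hB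
    have h1 : 2 ≤ dg G W b := by
      have := hd b hbW
      have := lab_le (A := A) (w := b)
      have := lab_le (A := B) (w := b)
      unfold ld at *; omega
    have h2 : dg G W b ≤ dg G (W \ A) b + dg G (A ∩ W) b :=
      dg_le fun x hx _ => by simp only [Finset.mem_sdiff, Finset.mem_inter]; tauto
    have h3 := dg_le_one (hn b hbW)
    obtain ⟨y, hy, hby⟩ := dg_pos (G := G) (H := W \ A) (w := b) (by omega)
    rw [Finset.mem_sdiff] at hy
    refine ⟨_, _, _, red_contract_on h hs hn (hBA b hb hbW) hbW hby hy.1 hy.2 (fun w hw hwB => ?_)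
      (K := {b}) (by simp [hBA b hb hbW, hbW]) hb (.nil (by simp)) (by simp)⟩
    have := Finset.mem_sdiff.1 (comp_sub hw)
    exact this.2 (Finset.mem_inter.2 ⟨hBA w hwB this.1, this.1⟩)
  · push Not at hBA
    obtain ⟨b, hb, hbW, hbA⟩ := hBA
    exact ⟨_, _, _, red_contract_off h hn hb hbW hbA⟩

def Exact2 (G : SimpleGraph V) (W A B : Finset V) : Prop :=
  ∃ l, Lens G W A B l ∧ Lens G W A B (l + 2)

theorem Exact2.shift {W A B E A' B' : Finset V} {c : ℕ} (h : Exact2 G E A' B')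
    (hc : ∀ n, Lens G E A' B' n → Lens G W A B (n + c)) : Exact2 G W A B := by
  obtain ⟨l, h1, h2⟩ := h
  exact ⟨l + c, hc _ h1, by have := hc _ h2; rwa [add_right_comm] at this⟩

theorem coll2 {W A B : Finset V} (h : RI G W A B) (hs : Star G W A B) (hn : ¬ NoColl G W A) :
    Exact2 G W A B := by
  unfold NoColl at hn
  push Not at hn
  obtain ⟨p, hp, x, hx, y, hy, hpx, hpy, hxy⟩ := hn
  rw [Finset.mem_inter] at hx hy
  obtain ⟨b, hb, r⟩ := (hs p hp x hx.2 hpx.ne').2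
  have key : ∀ s ∈ ({x, y} : Finset V), ∀ t ∈ ({x, y} : Finset V), s ≠ t →
      Reach G (insert s (W.erase p \ {x, y})) s b → Exact2 G W A B := by
    intro s hs t ht hst r
    obtain ⟨k, hk⟩ := r.path
    have hsA : s ∈ A ∧ s ∈ W ∧ G.Adj p s := by
      simp only [Finset.mem_insert, Finset.mem_singleton] at hs
      rcases hs with rfl | rfl <;> tauto
    have htA : t ∈ A ∧ t ∈ W ∧ G.Adj p t := by
      simp only [Finset.mem_insert, Finset.mem_singleton] at ht
      rcases ht with rfl | rfl <;> tauto
    have hsub : insert s (W.erase p \ {x, y}) ⊆ W.erase p := by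
      rw [Finset.insert_subset_iff]
      exact ⟨by simp [hsA, hsA.2.2.ne'], Finset.sdiff_subset⟩
    refine ⟨k, ⟨s, hsA.1, b, hb, hk.mono (hsub.trans (Finset.erase_subset _ _))⟩,
      t, htA.1, b, hb, .cons htA.2.1 htA.2.2.symm
        (.cons (by simp [hp, htA.2.2.ne]) hsA.2.2 (hk.mono ?_))⟩
    intro z hz
    have h1 := hsub hz
    rw [Finset.mem_erase] at h1
    simp only [Finset.mem_erase]
    refine ⟨h1.1, ?_, h1.2⟩
    rintro rfl
    rw [Finset.mem_insert, Finset.mem_sdiff] at hz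
    rcases hz with hz | hz
    · exact hst hz.symm
    · exact hz.2 ht
  rcases r.last_exit {x, y} with r | ⟨s, hs, _, r⟩
  · have := r.left
    simp at this
  · rcases Finset.mem_insert.1 hs with hs' | hs'
    · subst hs'
      exact key s hs y (by simp) hxy r
    · rw [Finset.mem_singleton] at hs'
      subst hs'
      exact key s hs x (by simp) (Ne.symm hxy) r

/-- Rooted graphs of labelled degree four have two path lengths differing by two. -/
theorem exact2_of_four (N : ℕ) : ∀ W A B : Finset V, W.card = N → RI G W A B →
    (∀ w ∈ W, 4 ≤ ld G W A B w) → Exact2 G W A B := by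
  induction N using Nat.strong_induction_on with
  | _ N ih =>
    intro W A B hN h hd
    have hrec : ∀ E A' B', Red G W A B E A' B' → Exact2 G W A B := by
      intro E A' B' hr
      obtain ⟨c, hc⟩ := hr.lens
      exact (ih _ (hN ▸ hr.lt) E A' B' rfl hr.ri fun w hw => (hd w (hr.sub hw)).trans
        (hr.deg w hw)).shift hc
    rcases star_or_red h with hs | ⟨E, A', B', hr⟩
    · by_cases hn : NoColl G W A
      · obtain ⟨E, A', B', hr⟩ := red_contract h hs hn hd
        exact hrec _ _ _ hr
      · exact coll2 h hs hn
    · exact hrec _ _ _ hr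

def NoTri (G : SimpleGraph V) : Prop := ∀ a b c, G.Adj a b → G.Adj b c → G.Adj a c → False

def NoSq (G : SimpleGraph V) : Prop :=
  ∀ x y u v, x ≠ y → G.Adj x u → G.Adj y u → G.Adj x v → G.Adj y v → u = v

/-- The elements of `B ∩ W` have pairwise distance at least three inside `W`. -/
def Sparse (G : SimpleGraph V) (W B : Finset V) : Prop :=
  ∀ b ∈ B, b ∈ W → ∀ c ∈ B, c ∈ W → b ≠ c → ¬ G.Adj b c ∧ ∀ x ∈ W, G.Adj x b → ¬ G.Adj x c

theorem Sparse.mono {W W' B : Finset V} (h : Sparse G W B) (hW : W' ⊆ W) : Sparse G W' B :=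
  fun b hb hbW c hc hcW hbc =>
    ⟨(h b hb (hW hbW) c hc (hW hcW) hbc).1, fun x hx => (h b hb (hW hbW) c hc (hW hcW) hbc).2 x (hW hx)⟩

theorem sparse_nb {W : Finset V} {v : V} (h3 : NoTri G) (h4 : NoSq G) (hv : v ∉ W) :
    Sparse G W (nb G {v}) := by
  intro b hb _ c hc _ hbc
  rw [mem_nb1] at hb hc
  refine ⟨fun h => h3 _ _ _ hb h hc, fun x hx hxb hxc => hbc ?_⟩
  exact h4 x v b c (fun e => hv (e ▸ hx)) hxb hb hxc hc

theorem Red.sparse {W A B E A' B' : Finset V} (h : Red G W A B E A' B') (h3 : NoTri G)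
    (h4 : NoSq G) (hs : Sparse G W B) : Sparse G E B' := by
  rcases h.lab with rfl | ⟨v, hv, rfl⟩
  · exact hs.mono h.sub
  · exact sparse_nb h3 h4 hv

/-- The exceptional two-vertex instance. -/
def Fz (G : SimpleGraph V) (W A B : Finset V) (z : V) : Prop :=
  ∃ b, b ∈ B ∧ z ∉ B ∧ b ∈ A ∧ z ∈ A ∧ G.Adj b z ∧ W = {b, z}

/-- Rooted instances of labelled degree three with an exceptional vertex. -/
structure TC (G : SimpleGraph V) (fl : Prop) (W A B : Finset V) (z : V) : Prop where
  ri : RI G W A B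
  wit : ∃ w ∈ W, w ≠ z
  deg : ∀ w ∈ W, w ≠ z → 3 ≤ ld G W A B w
  sp : fl → Sparse G W B
  nf : fl → ¬ Fz G W A B z
  g3 : fl → NoTri G
  g4 : fl → NoSq G

def TGoal (G : SimpleGraph V) (fl : Prop) (W A B : Finset V) : Prop :=
  Exact2 G W A B ∨ ¬ fl ∧ ∃ l, Lens G W A B l ∧ Lens G W A B (l + 1)

theorem TGoal.shift {fl : Prop} {W A B E A' B' : Finset V} (h : TGoal G fl E A' B')
    (hc : ∃ c, ∀ n, Lens G E A' B' n → Lens G W A B (n + c)) : TGoal G fl W A B := by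
  obtain ⟨c, hc⟩ := hc
  rcases h with h | ⟨h1, l, h2, h3⟩
  · exact .inl (h.shift hc)
  · exact .inr ⟨h1, l + c, hc _ h2, by have := hc _ h3; rwa [add_right_comm] at this⟩

def TIH (G : SimpleGraph V) (fl : Prop) (W : Finset V) : Prop :=
  ∀ E A' B' z, E.card < W.card → TC G fl E A' B' z → TGoal G fl E A' B'

theorem TC.red {fl : Prop} {W A B E A' B' : Finset V} {z : V} (h : TC G fl W A B z)
    (ih : TIH G fl W) (r : Red G W A B E A' B') (hw : ∃ w ∈ E, w ≠ z)
    (hf : fl → ¬ Fz G E A' B' z) : TGoal G fl W A B :=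
  (ih E A' B' z r.lt ⟨r.ri, hw, fun w hw hwz => (h.deg w (r.sub hw) hwz).trans (r.deg w hw),
    fun f => r.sparse (h.g3 f) (h.g4 f) (h.sp f), hf, h.g3, h.g4⟩).shift r.lens

theorem Fz.z_mem {W A B : Finset V} {z : V} (h : Fz G W A B z) : z ∈ W := by
  obtain ⟨b, _, _, _, _, _, rfl⟩ := h
  simp

theorem TC.red' {fl : Prop} {W A B E A' B' : Finset V} {z : V} (h : TC G fl W A B z)
    (ih : TIH G fl W) (r : Red G W A B E A' B') (hz : z ∉ E) : TGoal G fl W A B := by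
  refine h.red ih r ?_ fun _ hf => hz hf.z_mem
  obtain ⟨a, _, ha⟩ := r.ri.hA
  exact ⟨a, ha, fun e => hz (e ▸ ha)⟩

theorem dg_self_erase {W : Finset V} {v : V} : dg G W v = dg G (W.erase v) v := by
  refine le_antisymm ?_ (dg_mono (Finset.erase_subset _ _))
  refine Finset.card_le_card fun x hx => ?_
  simp only [Finset.mem_filter, Finset.mem_erase] at hx ⊢
  exact ⟨⟨hx.2.ne', hx.1⟩, hx.2⟩

/-- The two-vertex case. -/
theorem TC.pair {fl : Prop} {W A B : Finset V} {z a : V} (h : TC G fl W A B z)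
    (hW : ∀ w ∈ W, w = a ∨ w = z) (haW : a ∈ W) :
    a ≠ z ∧ z ∈ W ∧ G.Adj a z ∧ a ∈ A ∧ a ∈ B ∧ (z ∈ A ∨ z ∈ B) := by
  have haz : a ≠ z := by
    obtain ⟨w, hw, hwz⟩ := h.wit
    rcases hW w hw with rfl | rfl
    · exact hwz
    · exact absurd rfl hwz
  have h1 : dg G W a ≤ dg G {z} a := by
    rw [dg_self_erase]
    refine dg_mono fun x hx => ?_
    rw [Finset.mem_erase] at hx
    rcases hW x hx.2 with rfl | rfl
    · exact absurd rfl hx.1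
    · simp
  have h2 : dg G {z} a ≤ 1 := dg_le_card.trans (by simp)
  have h3 := h.deg a haW haz
  unfold ld at h3
  have h4 := lab_le (A := A) (w := a)
  have h5 := lab_le (A := B) (w := a)
  obtain ⟨x, hx, hax⟩ := dg_pos (G := G) (H := W) (w := a) (by omega)
  have hxz : x = z := by
    rcases hW x hx with rfl | rfl
    · exact absurd rfl hax.ne
    · rfl
  subst hxz
  refine ⟨haz, hx, hax, ?_, ?_, ?_⟩
  · by_contra hc; rw [lab_neg hc] at h3; omega
  · by_contra hc; rw [lab_neg hc] at h3; omega
  · obtain ⟨t, ht, r⟩ := h.ri.two a haW x hx haz.symm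
    have := r.right
    rw [Finset.mem_erase] at this
    rcases hW t this.2 with rfl | rfl
    · exact absurd rfl this.1
    · exact ht

theorem TC.oneA {fl : Prop} {W A B : Finset V} {z a : V} (h : TC G fl W A B z)
    (ih : TIH G fl W) (haW : a ∈ W) (ha : ∀ x ∈ A, x ∈ W → x = a) (haA : a ∈ A) :
    TGoal G fl W A B := by
  by_cases hu : ∃ u ∈ W, u ≠ a ∧ u ≠ z
  · obtain ⟨u, hu, hua, huz⟩ := hu
    refine h.red ih (red_lobe' h.ri haW hu hua fun x hx r => ?_)
      ⟨u, self_mem_comp (by simp [hu, hua]), huz⟩ ?_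
    · have := r.right
      rw [Finset.mem_erase] at this
      exact this.1 (ha x hx this.2)
    · rintro f ⟨b, _, _, hb, hz, hbz, _⟩
      rw [mem_nb1] at hb hz
      exact h.g3 f _ _ _ hb hbz hz
  · push Not at hu
    obtain ⟨haz, hz, hadj, _, haB, hzAB⟩ := h.pair
      (fun w hw => by by_cases e : w = a; exact .inl e; exact .inr (hu w hw e)) haW
    have hzB : z ∈ B := hzAB.resolve_left fun hzA => haz (ha z hzA hz).symm
    refine .inr ⟨fun f => (h.sp f a haB haW z hzB hz haz).1 hadj, 0, ?_, ?_⟩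
    · exact ⟨a, haA, a, haB, .nil haW⟩
    · exact ⟨a, haA, z, hzB, .edge hadj haW hz⟩

theorem TC.oneB {fl : Prop} {W A B : Finset V} {z b : V} (h : TC G fl W A B z)
    (ih : TIH G fl W) (hbW : b ∈ W) (hb : ∀ x ∈ B, x ∈ W → x = b) (hbB : b ∈ B) :
    TGoal G fl W A B := by
  have hlobe : ∀ u ∈ W, u ≠ b → Red G W A B (comp G (W.erase b) u) A (nb G {b}) := by
    intro u hu hub
    refine red_lobe h.ri hbW hu hub fun x hx r => ?_
    have := r.right
    rw [Finset.mem_erase] at this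
    exact this.1 (hb x hx this.2)
  by_cases hu : ∃ u ∈ W, u ≠ b ∧ u ≠ z
  · obtain ⟨u, hu, hub, huz⟩ := hu
    by_cases hF : fl ∧ Fz G (comp G (W.erase b) u) A (nb G {b}) z
    · obtain ⟨f, c, hcb, hzb, hcA, hzA, hcz, hE⟩ := hF
      rw [mem_nb1] at hcb hzb
      have hzE : z ∈ comp G (W.erase b) u := by rw [hE]; simp
      have hcE : c ∈ comp G (W.erase b) u := by rw [hE]; simp
      have hzW := Finset.mem_erase.1 (comp_sub hzE)
      have hcW := Finset.mem_erase.1 (comp_sub hcE)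
      by_cases hW : ∃ x ∈ W, x ≠ b ∧ x ∉ comp G (W.erase b) u
      · obtain ⟨x, hx, hxb, hxE⟩ := hW
        refine h.red' ih (hlobe x hx hxb) fun hz => hxE ?_
        have : x ∈ comp G (W.erase b) x := self_mem_comp (by simp [hx, hxb])
        rwa [← comp_eq hz, comp_eq hzE] at this
      · push Not at hW
        have hbz : b ≠ z := hzW.1.symm
        have h1 : dg G W b ≤ dg G {c} b := by
          refine Finset.card_le_card fun x hx => ?_
          simp only [Finset.mem_filter, Finset.mem_singleton] at hx ⊢
          have := hW x hx.1 hx.2.ne'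
          rw [hE] at this
          simp only [Finset.mem_insert, Finset.mem_singleton] at this
          refine ⟨this.resolve_right ?_, hx.2⟩
          rintro rfl; exact hzb hx.2
        have h2 : dg G {c} b ≤ 1 := dg_le_card.trans (by simp)
        have h3 := h.deg b hbW hbz
        unfold ld at h3
        have h4 := lab_le (A := A) (w := b)
        have h5 := lab_le (A := B) (w := b)
        have hbA : b ∈ A := by by_contra hc; rw [lab_neg hc] at h3; omega
        refine .inl ⟨0, ⟨b, hbA, b, hbB, .nil hbW⟩, z, hzA, b, hbB, ?_⟩
        refine .cons hzW.2 hcz.symm (.edge hcb.symm ?_ ?_)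
        · simp [hcW.2, hcz.ne]
        · simp [hbW, hbz]
    · exact h.red ih (hlobe u hu hub) ⟨u, self_mem_comp (by simp [hu, hub]), huz⟩
        fun f hf => hF ⟨f, hf⟩
  · push Not at hu
    obtain ⟨hbz, hz, hadj, hbA, _, hzAB⟩ := h.pair
      (fun w hw => by by_cases e : w = b; exact .inl e; exact .inr (hu w hw e)) hbW
    have hzB : z ∉ B := fun hzB => hbz (hb z hzB hz).symm
    have hzA := hzAB.resolve_right hzB
    refine .inr ⟨fun f => h.nf f ⟨b, hbB, hzB, hbA, hzA, hadj, ?_⟩, 0, ?_, ?_⟩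
    · ext w
      simp only [Finset.mem_insert, Finset.mem_singleton]
      constructor
      · intro hw; by_cases e : w = b
        · exact .inl e
        · exact .inr (hu w hw e)
      · rintro (rfl | rfl) <;> assumption
    · exact ⟨b, hbA, b, hbB, .nil hbW⟩
    · exact ⟨z, hzA, b, hbB, .edge hadj.symm hz hbW⟩

/-- Connections avoiding a set with one boundary vertex. -/
theorem Reach.bypass {W E : Finset V} {v x y : V} (r : Reach G W x y)
    (hE : ∀ e ∈ E, ∀ s ∈ W, s ∉ E → G.Adj e s → s = v) (hv : v ∉ E) (hy : y ∉ E) (hx : x ∉ E) :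
    Reach G (W \ E) x y := by
  have key : (x ∉ E → Reach G (W \ E) x y) ∧ (x ∈ E → Reach G (W \ E) v y) := by
    clear hx
    induction r with
    | refl h => exact ⟨fun hx => .refl (by simp [h, hx]), fun hx => absurd hx hy⟩
    | @head x x' w h h2 r ih =>
      refine ⟨fun hx => ?_, fun hx => ?_⟩
      · by_cases hx' : x' ∈ E
        · obtain rfl := hE x' hx' x h hx h2.symm
          exact (ih hy).2 hx'
        · exact .head (by simp [h, hx]) h2 ((ih hy).1 hx')
      · by_cases hx' : x' ∈ E
        · exact (ih hy).2 hx'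
        · obtain rfl := hE x hx x' r.left hx' h2
          exact (ih hy).1 hx'
  exact key.1 hx

/-- Deleting a lobe `E` hanging at `v`, all larger lobes meeting the roots. -/
theorem RI.prune {W A B E : Finset V} {v : V} (h : RI G W A B) (hEW : E ⊆ W)
    (hEc : ∀ x ∈ E, ∀ y ∈ E, Reach G E x y)
    (hE : ∀ e ∈ E, ∀ s ∈ W, s ∉ E → G.Adj e s → s = v) (hvW : v ∈ W) (hv : v ∉ E)
    (hA : ∃ a ∈ A, a ∈ W \ E) (hB : ∃ b ∈ B, b ∈ W \ E)
    (hmax : ∀ v' ∈ W, ∀ u' ∈ W, v' ∉ E → u' ∉ E → u' ≠ v' → E ⊆ comp G (W.erase v') u' →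
      ∃ t, (t ∈ A ∨ t ∈ B) ∧ t ∉ E ∧ Reach G (W.erase v') u' t) : RI G (W \ E) A B := by
  refine ⟨fun x hx y hy => ?_, hA, hB, fun v' hv' u' hu' huv => ?_⟩
  · rw [Finset.mem_sdiff] at hx hy
    exact (h.conn x hx.1 y hy.1).bypass hE hv hy.2 hx.2
  · rw [Finset.mem_sdiff] at hv' hu'
    have key : ∃ t, (t ∈ A ∨ t ∈ B) ∧ t ∉ E ∧ Reach G (W.erase v') u' t := by
      obtain ⟨t, ht, r⟩ := h.two v' hv'.1 u' hu'.1 huv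
      by_cases htE : t ∈ E
      · refine hmax v' hv'.1 u' hu'.1 hv'.2 hu'.2 huv fun x hx => mem_comp.2 (r.trans ?_)
        refine (hEc t htE x hx).mono fun y hy => Finset.mem_erase.2 ⟨?_, hEW hy⟩
        rintro rfl; exact hv'.2 hy
      · exact ⟨t, ht, htE, r⟩
    obtain ⟨t, ht, htE, r⟩ := key
    refine ⟨t, ht, (r.bypass (v := v) ?_ hv htE hu'.2).mono ?_⟩
    · exact fun e he s hs => hE e he s (Finset.mem_of_mem_erase hs)
    · intro x; simp; tauto

theorem ld_prune {W A B E : Finset V} {v w : V}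
    (hE : ∀ e ∈ E, ∀ s ∈ W, s ∉ E → G.Adj e s → s = v) (hw : w ∈ W \ E) (hwv : w ≠ v) :
    ld G W A B w ≤ ld G (W \ E) A B w := by
  have : dg G W w ≤ dg G (W \ E) w := by
    refine Finset.card_le_card fun x hx => ?_
    simp only [Finset.mem_filter, Finset.mem_sdiff] at hx hw ⊢
    exact ⟨⟨hx.1, fun hxE => hwv (hE x hxE w hw.1 hw.2 hx.2.symm)⟩, hx.2⟩
  unfold ld; omega

theorem TC.prune {fl : Prop} {W A B E : Finset V} {z v : V} (h : TC G fl W A B z)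
    (ih : TIH G fl W) (hE : ∀ e ∈ E, ∀ s ∈ W, s ∉ E → G.Adj e s → s = v) (hzE : z ∈ E)
    (hEW : E ⊆ W) (r : RI G (W \ E) A B) (hw : ∃ w ∈ W \ E, w ≠ v)
    (hf : fl → ¬ Fz G (W \ E) A B v) : TGoal G fl W A B := by
  refine (ih (W \ E) A B v ?_ ⟨r, hw, ?_, fun f => (h.sp f).mono Finset.sdiff_subset, hf,
    h.g3, h.g4⟩).shift ⟨0, fun n hn => hn.mono Finset.sdiff_subset (fun _ h _ => h) (fun _ h _ => h)⟩
  · refine Finset.card_lt_card ⟨Finset.sdiff_subset, fun hh => ?_⟩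
    have := hh (hEW hzE)
    simp [hzE] at this
  · intro w hw hwv
    refine (h.deg w (Finset.mem_sdiff.1 hw).1 ?_).trans (ld_prune hE hw hwv)
    rintro rfl; exact (Finset.mem_sdiff.1 hw).2 hzE

theorem TC.notStar {fl : Prop} {W A B : Finset V} {z : V} (h : TC G fl W A B z)
    (ih : TIH G fl W)
    (hA2 : ∀ v, ∃ a ∈ A, a ∈ W ∧ a ≠ v) (hB2 : ∀ v, ∃ b ∈ B, b ∈ W ∧ b ≠ v)
    (hs : ¬ Star G W A B) : TGoal G fl W A B := by
  by_contra hgoal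
  have hzE : ∀ v ∈ W, ∀ u ∈ W, u ≠ v → ((∀ a ∈ A, ¬ Reach G (W.erase v) u a) ∨
      (∀ b ∈ B, ¬ Reach G (W.erase v) u b)) → z ∈ comp G (W.erase v) u := by
    intro v hv u hu huv hh
    by_contra hz
    rcases hh with hh | hh
    · exact hgoal (h.red' ih (red_lobe' h.ri hv hu huv hh) hz)
    · exact hgoal (h.red' ih (red_lobe h.ri hv hu huv hh) hz)
  by_cases hBm : ∃ v ∈ W, ∃ u ∈ W, u ≠ v ∧ ∀ b ∈ B, ¬ Reach G (W.erase v) u b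
  · obtain ⟨E, hE, hmax⟩ := Finset.exists_max_image
      ((Finset.univ : Finset (Finset V)).filter fun E => ∃ v ∈ W, ∃ u ∈ W, u ≠ v ∧
        (∀ b ∈ B, ¬ Reach G (W.erase v) u b) ∧ E = comp G (W.erase v) u) Finset.card (by
          obtain ⟨v, hv, u, hu, huv, hb⟩ := hBm
          exact ⟨comp G (W.erase v) u, by simpa using ⟨v, hv, u, hu, huv, hb, rfl⟩⟩)
    simp only [Finset.mem_filter, Finset.mem_univ, true_and] at hE hmax
    obtain ⟨v, hv, u, hu, huv, hEB, hEe⟩ := hE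
    have hz : z ∈ E := hEe ▸ hzE v hv u hu huv (.inr hEB)
    have hEW : E ⊆ W := hEe ▸ comp_sub.trans (Finset.erase_subset _ _)
    have hvE : v ∉ E := by rw [hEe]; intro hh; simpa using comp_sub hh
    have hbd : ∀ e ∈ E, ∀ s ∈ W, s ∉ E → G.Adj e s → s = v := by
      subst hEe; exact fun e he s hs hsE hes => comp_bdry he hs hsE hes
    have hBE : ∀ b ∈ B, b ∉ E := fun b hb hbE => hEB b hb (mem_comp.1 (hEe ▸ hbE))
    obtain ⟨b, hb, hbW, hbv⟩ := hB2 v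
    have hAR : ∃ a ∈ A, a ∈ W \ E := by
      by_contra hc
      push Not at hc
      have : z ∈ comp G (W.erase v) b := by
        refine hzE v hv b hbW hbv (.inl fun a ha r => ?_)
        have haW := (Finset.mem_erase.1 r.right).2
        have haE : a ∈ E := by
          by_contra haE
          exact hc a ha (Finset.mem_sdiff.2 ⟨haW, haE⟩)
        rw [hEe] at haE
        exact hEB b hb ((mem_comp.1 haE).trans r.symm)
      have h2 := comp_eq this
      rw [hEe] at hz
      rw [comp_eq hz] at h2
      exact hEB b hb (mem_comp.1 (h2 ▸ self_mem_comp (by simp [hbW, hbv])))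
    refine hgoal (h.prune ih hbd hz hEW (h.ri.prune hEW ?_ hbd hv hvE hAR
      ⟨b, hb, by simp [hbW, hBE b hb]⟩ ?_) ⟨b, by simp [hbW, hBE b hb], hbv⟩ ?_)
    · subst hEe; exact fun x hx y hy => comp_conn hx hy
    · intro v' hv' u' hu' hvE' huE' huv' hsub
      by_contra hc
      push Not at hc
      have h1 : ∀ b ∈ B, ¬ Reach G (W.erase v') u' b := fun b hb r => hc b (.inr hb) (hBE b hb) r
      have := hmax _ ⟨v', hv', u', hu', huv', h1, rfl⟩
      have h3 := Finset.eq_of_subset_of_card_le hsub this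
      exact huE' (h3 ▸ self_mem_comp (by simp [hu', huv']))
    · rintro f ⟨c, hcB, hvB, _, _, hcv, hR⟩
      obtain ⟨b', hb', hbW', hbc'⟩ := hB2 c
      have : b' ∈ W \ E := by simp [hbW', hBE b' hb']
      rw [hR] at this
      simp only [Finset.mem_insert, Finset.mem_singleton] at this
      rcases this with e | e
      · exact hbc' e
      · exact hvB (e ▸ hb')
  · push Not at hBm
    have : ∃ v ∈ W, ∃ u ∈ W, u ≠ v ∧ ∀ a ∈ A, ¬ Reach G (W.erase v) u a := by
      by_contra hc
      push Not at hc
      exact hs fun v hv u hu huv => ⟨hc v hv u hu huv, hBm v hv u hu huv⟩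
    obtain ⟨v, hv, u, hu, huv, hEA⟩ := this
    have hz := hzE v hv u hu huv (.inl hEA)
    have hall : ∀ v ∈ W, ∀ u ∈ W, u ≠ v → (∀ a ∈ A, ¬ Reach G (W.erase v) u a) → u = z := by
      intro v hv u hu huv hEA
      by_contra huz
      refine hgoal (h.red ih (red_lobe' h.ri hv hu huv hEA)
        ⟨u, self_mem_comp (by simp [hu, huv]), huz⟩ ?_)
      rintro f ⟨b, _, _, hb, hz, hbz, _⟩
      rw [mem_nb1] at hb hz
      exact h.g3 f _ _ _ hb hbz hz
    obtain rfl := hall v hv u hu huv hEA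
    have hEu : comp G (W.erase v) u = {u} := by
      ext x
      simp only [Finset.mem_singleton]
      constructor
      · intro hx
        have hx' := Finset.mem_erase.1 (comp_sub hx)
        exact hall v hv x hx'.2 hx'.1 fun a ha r => hEA a ha ((mem_comp.1 hx).trans r)
      · rintro rfl; exact hz
    have hbd : ∀ e ∈ ({u} : Finset V), ∀ s ∈ W, s ∉ ({u} : Finset V) → G.Adj e s → s = v := by
      rw [← hEu]; exact fun e he s hs hsE hes => comp_bdry he hs hsE hes
    have huA : u ∉ A := fun hh => hEA u hh (mem_comp.1 hz)
    have huB : u ∈ B := by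
      obtain ⟨t, ht, r⟩ := h.ri.two v hv u hu huv
      have htE : t ∈ comp G (W.erase v) u := mem_comp.2 r
      rw [hEu, Finset.mem_singleton] at htE
      subst htE
      exact ht.resolve_left huA
    have hvu : G.Adj v u := by
      obtain ⟨x, hx, _⟩ := (h.ri.conn u hu v hv).next huv.symm
      have hxW := (‹Reach G (W.erase u) x v›).left
      rw [Finset.mem_erase] at hxW
      obtain rfl := hbd u (by simp) x hxW.2 (by simp [hxW.1]) hx
      exact hx.symm
    obtain ⟨a, ha, haW, hav⟩ := hA2 v
    obtain ⟨b, hb, hbW, hbu⟩ := hB2 u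
    have haR : a ∈ W \ {u} := by simp [haW]; rintro rfl; exact huA ha
    refine hgoal (h.prune ih hbd (by simp) (by simpa using hu) (h.ri.prune (by simpa using hu) ?_ hbd hv
      (by simpa using huv.symm) ⟨a, ha, haR⟩ ⟨b, hb, by simp [hbW, hbu]⟩ ?_) ⟨a, haR, hav⟩ ?_)
    · intro x hx y hy
      rw [Finset.mem_singleton] at hx hy
      subst hx; subst hy; exact .refl (by simp)
    · intro v' hv' u' hu' hvE' huE' huv' hsub
      by_contra hc
      push Not at hc
      rw [Finset.mem_singleton] at huE'
      refine huE' (hall v' hv' u' hu' huv' fun a ha => hc a (.inl ha) ?_)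
      rw [Finset.mem_singleton]; rintro rfl; exact huA ha
    · rintro f ⟨c, hcB, hvB, _, _, hcv, hR⟩
      have hc : c ∈ W \ {u} := by rw [hR]; simp
      simp only [Finset.mem_sdiff, Finset.mem_singleton] at hc
      exact (h.sp f c hcB hc.1 u huB hu hc.2).2 v hv hcv.symm hvu

theorem TC.noColl {fl : Prop} {W A B : Finset V} {z : V} (h : TC G fl W A B z)
    (ih : TIH G fl W) (hB2 : ∀ v, ∃ b ∈ B, b ∈ W ∧ b ≠ v) (hs : Star G W A B)
    (hn : NoColl G W A) : TGoal G fl W A B := by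
  have hX : ∀ {w y}, w ∈ comp G (W \ (A ∩ W)) y → w ∈ W ∧ w ∉ A := by
    intro w y hw
    have := comp_sub hw
    simp only [Finset.mem_sdiff, Finset.mem_inter] at this
    tauto
  have hself : ∀ {y}, y ∈ W → y ∉ A → y ∈ comp G (W \ (A ∩ W)) y :=
    fun h1 h2 => self_mem_comp (by simp [h1, h2])
  have off : ∀ b ∈ B, b ∈ W → b ∉ A → z ∉ comp G (W \ (A ∩ W)) b → TGoal G fl W A B :=
    fun b hb hbW hbA hz => h.red' ih (red_contract_off h.ri hn hb hbW hbA) hz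
  have on : ∀ c y K b k, c ∈ A → c ∈ W → G.Adj c y → y ∈ W → y ∉ A →
      (∀ w ∈ comp G (W \ (A ∩ W)) y, w ∉ B) → comp G (W \ (A ∩ W)) y ≠ {z} → K ⊆ A ∩ W →
      b ∈ B → PL G K c b k → (∀ x ∈ K, x ≠ c → ∀ w ∈ W, w ∉ A → ¬ G.Adj x w) →
      TGoal G fl W A B := by
    intro c y K b k hc hcW hcy hy hyA hXB hXz hK hb hp hKc
    refine h.red ih (red_contract_on h.ri hs hn hc hcW hcy hy hyA hXB hK hb hp hKc) ?_ ?_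
    · by_contra hcon
      push Not at hcon
      refine hXz (Finset.eq_singleton_iff_unique_mem.2 ⟨?_, hcon⟩)
      rw [← hcon y (hself hy hyA)]; exact hself hy hyA
    · rintro f ⟨x, hx1, _, hx2, _, _, hE⟩
      have hxW : x ∈ W := (hX (by rw [hE]; simp)).1
      rw [mem_nb1] at hx1
      obtain ⟨t, ht, htx⟩ := mem_nb.1 hx2
      rw [Finset.mem_sdiff] at ht
      have := hn x hxW c (by simp [hc, hcW]) t ht.1 hx1.symm htx.symm
      subst this
      exact ht.2 hp.left
  have nbr : ∀ c ∈ A, c ∈ W → c ≠ z → (∃ y ∈ W, y ∉ A ∧ G.Adj c y) ∨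
      (c ∈ B ∧ (∃ d ∈ A, d ∈ W ∧ G.Adj c d) ∧ ∀ w ∈ W, w ∉ A → ¬ G.Adj c w) := by
    intro c hc hcW hcz
    by_cases hy : ∃ y ∈ W, y ∉ A ∧ G.Adj c y
    · exact .inl hy
    · push Not at hy
      have h1 : dg G W c ≤ dg G (A ∩ W) c := by
        refine Finset.card_le_card fun x hx => ?_
        simp only [Finset.mem_filter, Finset.mem_inter] at hx ⊢
        refine ⟨⟨?_, hx.1⟩, hx.2⟩
        by_contra hxA
        exact hy x hx.1 hxA hx.2
      have h2 := dg_le_one (hn c hcW)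
      have h3 := h.deg c hcW hcz
      unfold ld at h3
      have h4 := lab_le (A := A) (w := c)
      have h5 := lab_le (A := B) (w := c)
      refine .inr ⟨?_, ?_, hy⟩
      · by_contra hcB; rw [lab_neg hcB] at h3; omega
      · obtain ⟨d, hd, hcd⟩ := dg_pos (G := G) (H := A ∩ W) (w := c) (by omega)
        rw [Finset.mem_inter] at hd
        exact ⟨d, hd.1, hd.2, hcd⟩
  by_cases h3 : ∃ b ∈ B, b ∈ W ∧ b ∉ A ∧ comp G (W \ (A ∩ W)) b ≠ {z}
  · obtain ⟨b, hb, hbW, hbA, hXb⟩ := h3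
    by_cases hF : fl ∧ Fz G (comp G (W \ (A ∩ W)) b) (nb G (A ∩ W)) B z
    · obtain ⟨f, b0, hb0, hzB, _, _, hbz, hE⟩ := hF
      have hbE : b ∈ comp G (W \ (A ∩ W)) b := hself hbW hbA
      have hzE : z ∈ comp G (W \ (A ∩ W)) b := by rw [hE]; simp
      have hb0e : b = b0 := by
        rw [hE] at hbE
        simp only [Finset.mem_insert, Finset.mem_singleton] at hbE
        rcases hbE with e | e
        · exact e
        · exact absurd (e ▸ hb) hzB
      subst hb0e
      have hzW := (hX hzE).1
      have hzA := (hX hzE).2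
      have sp := h.sp f
      obtain ⟨b', hb', hbW', hbb'⟩ := hB2 b
      have hzX : ∀ y, y ∈ W → y ∉ A → y ≠ b → y ≠ z → z ∉ comp G (W \ (A ∩ W)) y := by
        intro y hy hyA hyb hyz hzy
        have h1 := hself hy hyA
        rw [← comp_eq hzy, comp_eq hzE, hE] at h1
        simp only [Finset.mem_insert, Finset.mem_singleton] at h1
        tauto
      have fin : ∀ c y K k, c ∈ A → c ∈ W → G.Adj c y → y ∈ W → y ∉ A → y ≠ b → y ≠ z →
          K ⊆ A ∩ W → PL G K c b' k → (∀ x ∈ K, x ≠ c → ∀ w ∈ W, w ∉ A → ¬ G.Adj x w) →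
          TGoal G fl W A B := by
        intro c y K k hc hcW hcy hy hyA hyb hyz hK hp hKc
        by_cases hXB : ∃ w ∈ comp G (W \ (A ∩ W)) y, w ∈ B
        · obtain ⟨w, hw, hwB⟩ := hXB
          refine off w hwB (hX hw).1 (hX hw).2 ?_
          rw [comp_eq hw]; exact hzX y hy hyA hyb hyz
        · push Not at hXB
          refine on c y K b' k hc hcW hcy hy hyA hXB (fun e => ?_) hK hb' hp hKc
          have := hself hy hyA
          rw [e, Finset.mem_singleton] at this
          exact hyz this
      have hbz' : b' ≠ z := fun e => hzB (e ▸ hb')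
      by_cases hbA' : b' ∈ A
      · rcases nbr b' hbA' hbW' hbz' with ⟨y, hy, hyA, hby⟩ | ⟨_, ⟨c, hcA, hcW, hbc⟩, hall⟩
        · refine fin b' y {b'} 0 hbA' hbW' hby hy hyA ?_ ?_ (by simp [hbA', hbW'])
            (.nil (by simp)) (by simp)
          · rintro rfl; exact (sp b' hb' hbW' y hb hbW hbb').1 hby
          · rintro rfl; exact (sp b' hb' hbW' b hb hbW hbb').2 y hzW hby.symm hbz.symm
        · have hcB : c ∉ B := fun hcB => (sp b' hb' hbW' c hcB hcW hbc.ne).1 hbc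
          have hcz : c ≠ z := fun e => hzA (e ▸ hcA)
          rcases nbr c hcA hcW hcz with ⟨y, hy, hyA, hcy⟩ | ⟨hcB', _⟩
          · by_cases hyz : y = z
            · subst hyz
              refine .inl ⟨1, ⟨c, hcA, b', hb', .edge hbc.symm hcW hbW'⟩, b', hbA', b, hb, ?_⟩
              refine .cons hbW' hbc (.cons ?_ hcy (.edge hbz.symm ?_ ?_))
              · simp [hbc.ne', hcW]
              · simp [hzW, hcy.ne', hbz'.symm]
              · have : b ≠ c := fun e => hbA (e ▸ hcA)
                simp [hbW, hbb'.symm, this]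
            · refine fin c y {c, b'} 1 hcA hcW hcy hy hyA ?_ hyz ?_
                (.edge hbc.symm (by simp) (by simp)) ?_
              · rintro rfl
                exact (sp b' hb' hbW' y hb hbW hbb').2 c hcW hbc.symm hcy
              · intro x hx
                simp only [Finset.mem_insert, Finset.mem_singleton] at hx
                rcases hx with rfl | rfl <;> simp [*]
              · intro x hx hxc
                simp only [Finset.mem_insert, Finset.mem_singleton] at hx
                obtain rfl := hx.resolve_left hxc
                exact hall
          · exact absurd hcB' hcB
      · exact off b' hb' hbW' hbA' (hzX b' hbW' hbA' hbb' hbz')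
    · refine h.red ih (red_contract_off h.ri hn hb hbW hbA) ?_ fun f hf => hF ⟨f, hf⟩
      by_contra hcon
      push Not at hcon
      refine hXb (Finset.eq_singleton_iff_unique_mem.2 ⟨?_, hcon⟩)
      rw [← hcon b (hself hbW hbA)]; exact hself hbW hbA
  · push Not at h3
    have fin : ∀ c y K b k, c ∈ A → c ∈ W → G.Adj c y → y ∈ W → y ∉ A → b ∈ B →
        K ⊆ A ∩ W → PL G K c b k → (∀ x ∈ K, x ≠ c → ∀ w ∈ W, w ∉ A → ¬ G.Adj x w) →
        TGoal G fl W A B := by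
      intro c y K b k hc hcW hcy hy hyA hb hK hp hKc
      have hXz : comp G (W \ (A ∩ W)) y ≠ {z} := by
        intro e
        have hyz := hself hy hyA
        rw [e, Finset.mem_singleton] at hyz
        subst hyz
        obtain ⟨a, ha, r⟩ := (hs c hcW y hy hcy.ne').1
        obtain ⟨d, hyd, r'⟩ := r.next (fun e => hyA (e ▸ ha))
        have hd := r'.left
        simp only [Finset.mem_erase] at hd
        by_cases hdA : d ∈ A
        · exact hd.2.1 (hn y hy d (by simp [hdA, hd]) c (by simp [hc, hcW]) hyd hcy.symm)
        · have := comp_closed (hself hy hyA) (w := d) (by simp [hdA, hd.2.2]) hyd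
          rw [e, Finset.mem_singleton] at this
          exact hd.1 this
      refine on c y K b k hc hcW hcy hy hyA (fun w hw hwB => hXz ?_) hXz hK hb hp hKc
      rw [← comp_eq hw]
      exact h3 w hwB (hX hw).1 (hX hw).2
    have claim : ∀ b ∈ B, b ∈ W → b ≠ z → TGoal G fl W A B ∨ (fl ∧ G.Adj b z ∧ z ∈ W) := by
      intro b hb hbW hbz
      have hbA : b ∈ A := by
        by_contra hbA
        have := hself hbW hbA
        rw [h3 b hb hbW hbA, Finset.mem_singleton] at this
        exact hbz this
      rcases nbr b hbA hbW hbz with ⟨y, hy, hyA, hby⟩ | ⟨_, ⟨c, hcA, hcW, hbc⟩, hall⟩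
      · exact .inl (fin b y {b} b 0 hbA hbW hby hy hyA hb (by simp [hbA, hbW])
            (.nil (by simp)) (by simp))
      · by_cases f : fl
        · by_cases hcz : c = z
          · subst hcz; exact .inr ⟨f, hbc, hcW⟩
          · left
            rcases nbr c hcA hcW hcz with ⟨y, hy, hyA, hcy⟩ | ⟨hcB, _⟩
            · refine fin c y {c, b} b 1 hcA hcW hcy hy hyA hb ?_
                (.edge hbc.symm (by simp) (by simp)) ?_
              · intro x hx
                simp only [Finset.mem_insert, Finset.mem_singleton] at hx
                rcases hx with rfl | rfl <;> simp [*]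
              · intro x hx hxc
                simp only [Finset.mem_insert, Finset.mem_singleton] at hx
                obtain rfl := hx.resolve_left hxc
                exact hall
            · exact absurd hbc (h.sp f b hb hbW c hcB hcW hbc.ne).1
        · exact .inl (.inr ⟨f, 0, ⟨b, hbA, b, hb, .nil hbW⟩, c, hcA, b, hb, .edge hbc.symm hcW hbW⟩)
    obtain ⟨b, hb, hbW, hbz⟩ := hB2 z
    rcases claim b hb hbW hbz with hg | ⟨f, hbz', hzW⟩
    · exact hg
    · obtain ⟨b', hb', hbW', hbb'⟩ := hB2 b
      have hzB : z ∉ B := fun hzB => (h.sp f b hb hbW z hzB hzW hbz).1 hbz'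
      rcases claim b' hb' hbW' (fun e => hzB (e ▸ hb')) with hg | ⟨_, hbz'', _⟩
      · exact hg
      · exact absurd hbz''.symm ((h.sp f b hb hbW b' hb' hbW' hbb'.symm).2 z hzW hbz'.symm)

theorem TC.main {fl : Prop} : ∀ {W A B : Finset V} {z : V}, TC G fl W A B z →
    TGoal G fl W A B := by
  intro W
  induction hN : W.card using Nat.strong_induction_on generalizing W with
  | _ N IH =>
    intro A B z h
    have ih : TIH G fl W := fun E A' B' z' hE hT => IH E.card (hN ▸ hE) rfl hT
    obtain ⟨a, ha, haW⟩ := h.ri.hA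
    obtain ⟨b, hb, hbW⟩ := h.ri.hB
    by_cases hA2 : ∀ v, ∃ a ∈ A, a ∈ W ∧ a ≠ v
    · by_cases hB2 : ∀ v, ∃ b ∈ B, b ∈ W ∧ b ≠ v
      · by_cases hs : Star G W A B
        · by_cases hn : NoColl G W A
          · exact h.noColl ih hB2 hs hn
          · exact .inl (coll2 h.ri hs hn)
        · exact h.notStar ih hA2 hB2 hs
      · push Not at hB2
        obtain ⟨v, hv⟩ := hB2
        obtain rfl := hv b hb hbW
        exact h.oneB ih hbW hv hb
    · push Not at hA2
      obtain ⟨v, hv⟩ := hA2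
      obtain rfl := hv a ha haW
      exact h.oneA ih haW hv ha

/-- Rooted graphs of labelled degree three, one vertex excepted. -/
theorem ap2_of_three' {W A B : Finset V} {z : V} (h : RI G W A B) (hw : ∃ w ∈ W, w ≠ z)
    (hd : ∀ w ∈ W, w ≠ z → 3 ≤ ld G W A B w) :
    ∃ l, Lens G W A B l ∧ (Lens G W A B (l + 2) ∨ Lens G W A B (l + 1)) := by
  have := TC.main (fl := False) ⟨h, hw, hd, nofun, nofun, nofun, nofun⟩
  rcases this with ⟨l, h1, h2⟩ | ⟨_, l, h1, h2⟩
  · exact ⟨l, h1, .inl h2⟩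
  · exact ⟨l, h1, .inr h2⟩

/-- Rooted graphs of labelled degree three. -/
theorem ap2_of_three {W A B : Finset V} (h : RI G W A B) (hd : ∀ w ∈ W, 3 ≤ ld G W A B w) :
    ∃ l, Lens G W A B l ∧ (Lens G W A B (l + 2) ∨ Lens G W A B (l + 1)) := by
  by_cases hw : ∃ z, ∃ w ∈ W, w ≠ z
  · obtain ⟨z, hw⟩ := hw
    exact ap2_of_three' h hw fun w hw _ => hd w hw
  · push Not at hw
    obtain ⟨a, _, ha⟩ := h.hA
    have h1 : W.card ≤ 1 := Finset.card_le_one.2 fun x hx y hy => (hw y x hx)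
    have h2 : dg G W a = 0 := dg_zero fun x hx hax => hax.ne (hw x a ha)
    have := hd a ha
    have := lab_le (A := A) (w := a)
    have := lab_le (A := B) (w := a)
    unfold ld at *; omega

/-- Girth at least five: exact difference two. -/
theorem exact2_of_three' {W A B : Finset V} {z : V} (h3 : NoTri G) (h4 : NoSq G)
    (h : RI G W A B) (hw : ∃ w ∈ W, w ≠ z) (hd : ∀ w ∈ W, w ≠ z → 3 ≤ ld G W A B w)
    (hs : Sparse G W B) (hF : ¬ Fz G W A B z) : Exact2 G W A B := by
  have := TC.main (fl := True) ⟨h, hw, hd, fun _ => hs, fun _ => hF, fun _ => h3, fun _ => h4⟩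
  rcases this with h | ⟨h, _⟩
  · exact h
  · exact absurd trivial h

theorem exact2_of_three {W A B : Finset V} (h3 : NoTri G) (h4 : NoSq G)
    (h : RI G W A B) (hd : ∀ w ∈ W, 3 ≤ ld G W A B w) (hs : Sparse G W B) : Exact2 G W A B := by
  by_cases hz : ∃ z, z ∉ W
  · obtain ⟨z, hz⟩ := hz
    obtain ⟨a, _, ha⟩ := h.hA
    exact exact2_of_three' (z := z) h3 h4 h ⟨a, ha, fun e => hz (e ▸ ha)⟩ (fun w hw _ => hd w hw) hs
      fun hf => hz hf.z_mem
  · push Not at hz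
    obtain ⟨b, hb, hbW⟩ := h.hB
    have hd' := hd b hbW
    by_cases hex : ∃ z, z ≠ b ∧ (z ∈ B ∨ z ∉ A ∨ ¬ G.Adj b z)
    · obtain ⟨z, hzb, hz'⟩ := hex
      refine exact2_of_three' h3 h4 h ⟨b, hbW, hzb.symm⟩ (fun w hw _ => hd w hw) hs ?_
      rintro ⟨c, hcB, hzB, hcA, hzA, hcz, hW⟩
      have : b = c := by
        rw [hW] at hbW
        simp only [Finset.mem_insert, Finset.mem_singleton] at hbW
        exact hbW.resolve_right hzb.symm
      subst this
      tauto
    · push Not at hex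
      by_cases hz2 : ∃ z, z ≠ b
      · obtain ⟨z, hzb⟩ := hz2
        refine exact2_of_three' h3 h4 h ⟨b, hbW, hzb.symm⟩ (fun w hw _ => hd w hw) hs ?_
        rintro ⟨c, hcB, hzB, hcA, hzA, hcz, hW⟩
        have h5 := hd z (hz z)
        have h6 : dg G W z ≤ 1 := by
          have : dg G W z ≤ dg G {c} z := by
            rw [dg_self_erase]
            refine dg_mono fun x hx => ?_
            rw [Finset.mem_erase, hW] at hx
            simp only [Finset.mem_insert, Finset.mem_singleton] at hx ⊢
            tauto
          exact this.trans (dg_le_card.trans (by simp))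
        have h7 := lab_neg hzB
        have h8 := lab_le (A := A) (w := z)
        unfold ld at h5; omega
      · push Not at hz2
        have h2 : dg G W b = 0 := dg_zero fun x hx hax => hax.ne (hz2 x).symm
        have := lab_le (A := A) (w := b)
        have := lab_le (A := B) (w := b)
        unfold ld at *; omega

/-- Deleting any vertex leaves `W` connected. -/
def NC (G : SimpleGraph V) (W : Finset V) : Prop :=
  ∀ v ∈ W, ∀ x ∈ W, ∀ y ∈ W, x ≠ v → y ≠ v → Reach G (W.erase v) x y

theorem star_lobe {W A B : Finset V} {u v : V} (h : RI G W A B) (hs : Star G W A B) (hv : v ∈ W)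
    (hu : u ∈ W) (huv : u ≠ v) : RI G (comp G (W.erase v) u) A (nb G {v}) := by
  refine ⟨fun x hx y hy => comp_conn hx hy, ?_, ?_, ?_⟩
  · obtain ⟨a, ha, r⟩ := (hs v hv u hu huv).1
    exact ⟨a, ha, mem_comp.2 r⟩
  · obtain ⟨e, he, s', hs, _, hes⟩ := attach (S := {v}) (h.conn u hu v hv) (by simpa using huv)
      (by simp)
    rw [← erase_eq] at he
    rw [Finset.mem_singleton] at hs
    subst hs
    exact ⟨e, mem_nb1.2 hes.symm, he⟩
  · intro x hx y hy hyx
    have hxW := (Finset.mem_erase.1 (comp_sub hx)).2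
    have hyW := (Finset.mem_erase.1 (comp_sub hy)).2
    obtain ⟨a, ha, r⟩ := (hs x hxW y hyW hyx).1
    have e : W.erase x ∩ comp G (W.erase v) u ⊆ (comp G (W.erase v) u).erase x :=
      fun z => by simp; tauto
    rcases r.exit _ hy with h3 | ⟨w, s, h3, h4, h5, h6⟩
    · exact ⟨a, .inl ha, h3.mono e⟩
    · obtain rfl := comp_bdry (Finset.mem_inter.1 h3.right).2 (Finset.mem_of_mem_erase h4) h5 h6
      exact ⟨w, .inr (mem_nb1.2 h6.symm), h3.mono e⟩

theorem ld_star_lobe {W A B : Finset V} {u v w : V} (hw : w ∈ comp G (W.erase v) u) :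
    ld G W A B w ≤ ld G (comp G (W.erase v) u) A (nb G {v}) w + 1 := by
  have h2 : dg G W w ≤ dg G (comp G (W.erase v) u) w + dg G {v} w := dg_le fun x hx hwx => by
    by_cases hxE : x ∈ comp G (W.erase v) u
    · exact .inl hxE
    · exact .inr (by simp [comp_bdry hw hx hxE hwx])
  have h3 : dg G {v} w ≤ lab (nb G {v}) w :=
    dg_le_lab (dg_le_card.trans (by simp)) fun x hx _ => hx
  have := lab_le (A := B) (w := w)
  unfold ld; omega

theorem nc_or_cut {W A B : Finset V} (h : RI G W A B) (hs : Star G W A B) :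
    NC G W ∨ ∃ X Y v, RI G X A (nb G {v}) ∧ RI G Y (nb G {v}) B ∧ v ∉ X ∧ v ∉ Y ∧ X ⊆ W ∧ Y ⊆ W ∧
      (∀ w ∈ X, ld G W A B w ≤ ld G X A (nb G {v}) w + 1) ∧
      (∀ w ∈ Y, ld G W A B w ≤ ld G Y (nb G {v}) B w + 1) ∧
      ∀ n m, Lens G X A (nb G {v}) n → Lens G Y (nb G {v}) B m → Lens G W A B (n + m + 2) := by
  by_cases hn : NC G W
  · exact .inl hn
  right
  unfold NC at hn
  push Not at hn
  obtain ⟨v, hv, x, hx, y, hy, hxv, hyv, hxy⟩ := hn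
  have hYs := star_lobe h.symm hs.symm hv hy hyv
  refine ⟨comp G (W.erase v) x, comp G (W.erase v) y, v, star_lobe h hs hv hx hxv, hYs.symm,
    fun hh => by simpa using comp_sub hh, fun hh => by simpa using comp_sub hh,
    comp_sub.trans (Finset.erase_subset _ _), comp_sub.trans (Finset.erase_subset _ _),
    fun w hw => ld_star_lobe hw, fun w hw => ?_, ?_⟩
  · have := ld_star_lobe (A := B) (B := A) hw
    unfold ld at *; omega
  · intro n m hn hm
    have hd : Disjoint (comp G (W.erase v) x) (comp G (W.erase v) y) :=
      Finset.disjoint_left.2 fun z hz hz' => hxy ((mem_comp.1 hz).trans (mem_comp.1 hz').symm)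
    have hvy : v ∉ comp G (W.erase v) y := fun hh => by simpa using comp_sub hh
    have hvx : v ∉ comp G (W.erase v) x := fun hh => by simpa using comp_sub hh
    obtain ⟨c, hc, b, hb, q⟩ := hm
    have := hn.joinR (H := insert v (comp G (W.erase v) y)) (W := W) (k := m + 1) (B := B)
      (fun t ht => ⟨b, hb, by
        rw [Finset.mem_singleton.1 ht]
        exact q.cons' (mem_nb1.1 hc) hvy (by simp) (Finset.subset_insert _ _)⟩) ?_ ?_ ?_
    · exact this
    · rw [Finset.disjoint_insert_left]
      exact ⟨hvx, hd.symm⟩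
    · rw [Finset.insert_subset_iff]
      exact ⟨hv, comp_sub.trans (Finset.erase_subset _ _)⟩
    · exact comp_sub.trans (Finset.erase_subset _ _)

/-- Pruning lobes without roots that contain the exceptional vertex. -/
theorem ap2_prune {X A B : Finset V} {z a b : V} (hc : ∀ x ∈ X, ∀ y ∈ X, Reach G X x y)
    (ha : a ∈ A) (haX : a ∈ X) (hb : b ∈ B) (hbX : b ∈ X) (hab : a ≠ b)
    (hz : ∀ x ∈ X, ∀ y ∈ X, y ≠ x → (∀ t, (t ∈ A ∨ t ∈ B) → ¬ Reach G (X.erase x) y t) →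
      Reach G (X.erase x) y z)
    (hd : ∀ w ∈ X, w ≠ z → 3 ≤ ld G X A B w) :
    ∃ l, Lens G X A B l ∧ (Lens G X A B (l + 2) ∨ Lens G X A B (l + 1)) := by
  induction hN : X.card using Nat.strong_induction_on generalizing X z with
  | _ N ih =>
    by_cases h2 : ∀ v ∈ X, ∀ u ∈ X, u ≠ v → ∃ t, (t ∈ A ∨ t ∈ B) ∧ Reach G (X.erase v) u t
    · refine ap2_of_three' ⟨hc, ⟨a, ha, haX⟩, ⟨b, hb, hbX⟩, h2⟩ ?_ hd
      by_cases h : a = z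
      · exact ⟨b, hbX, fun e => hab (h.trans e.symm)⟩
      · exact ⟨a, haX, h⟩
    · push Not at h2
      obtain ⟨x, hx, y, hy, hyx, hF⟩ := h2
      have hzF : z ∈ comp G (X.erase x) y := mem_comp.2 (hz x hx y hy hyx hF)
      have hFX : comp G (X.erase x) y ⊆ X := comp_sub.trans (Finset.erase_subset _ _)
      have hxF : x ∉ comp G (X.erase x) y := fun hh => by simpa using comp_sub hh
      have hbd : ∀ e ∈ comp G (X.erase x) y, ∀ s ∈ X, s ∉ comp G (X.erase x) y → G.Adj e s →
        s = x := fun e he s hs hsE hes => comp_bdry he hs hsE hes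
      have haF : a ∉ comp G (X.erase x) y := fun hh => hF a (.inl ha) (mem_comp.1 hh)
      have hbF : b ∉ comp G (X.erase x) y := fun hh => hF b (.inr hb) (mem_comp.1 hh)
      set F := comp G (X.erase x) y with hFdef
      have := ih (X \ F).card (hN ▸ Finset.card_lt_card ⟨Finset.sdiff_subset, fun hh => by
          have := hh (hFX hzF); simp [hzF] at this⟩) (X := X \ F) (z := x)
        (fun u hu v hv => by
          rw [Finset.mem_sdiff] at hu hv
          exact (hc u hu.1 v hv.1).bypass hbd hxF hv.2 hu.2) (by simp [haX, haF])
        (by simp [hbX, hbF]) ?_ ?_ rfl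
      · obtain ⟨l, h1, h2⟩ := this
        have hm : ∀ {n}, Lens G (X \ F) A B n → Lens G X A B n := fun hn =>
          hn.mono Finset.sdiff_subset (fun _ h _ => h) fun _ h _ => h
        exact ⟨l, hm h1, h2.imp hm hm⟩
      · intro x' hx' y' hy' hyx' hdead
        by_contra hxn
        rw [Finset.mem_sdiff] at hx' hy'
        have key : ∀ t, Reach G (X.erase x') y' t → Reach G ((X \ F).erase x') y' t := by
          intro t r
          have hyc : y' ∈ comp G ((X \ F).erase x') y' := self_mem_comp (by simp [hyx', hy'])
          rcases r.exit _ hyc with h3 | ⟨w, s, h3, h4, h5, h6⟩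
          · exact mem_comp.1 (Finset.mem_inter.1 h3.right).2
          · exfalso
            have hw := (Finset.mem_inter.1 h3.right).2
            have hwX := comp_sub hw
            rw [Finset.mem_erase, Finset.mem_sdiff] at hwX
            rw [Finset.mem_erase] at h4
            by_cases hsF : s ∈ F
            · obtain rfl := hbd s hsF w hwX.2.1 hwX.2.2 h6.symm
              exact hxn (mem_comp.1 hw)
            · exact h5 (comp_closed hw (by simp [h4, hsF]) h6)
        have := (key z (hz x' hx'.1 y' hy'.1 hyx' fun t ht r => hdead t ht (key t r))).right
        simp [hzF] at this
      · intro w hw hwx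
        refine (hd w (Finset.mem_sdiff.1 hw).1 ?_).trans (ld_prune hbd hw hwx)
        rintro rfl; exact (Finset.mem_sdiff.1 hw).2 hzF

/-- A collision at `p`: either the component of `W \ ({p} ∪ T)` containing `b₀` is a rooted
instance, or there is a reduction. -/
theorem trouble {W A B T : Finset V} {p b₀ τ : V} {m : ℕ} (hm : 4 ≤ m) (h : RI G W A B)
    (hs : Star G W A B) (hnc : NC G W) (hd : ∀ w ∈ W, m ≤ ld G W A B w) (hp : p ∈ W)
    (hT : ∀ t ∈ T, t ∈ A ∧ t ∈ W ∧ G.Adj p t) (hτ : τ ∈ T) (hb : b₀ ∈ B) (hbW : b₀ ∈ W)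
    (hbH : b₀ ∉ insert p T) :
    RI G (comp G (W \ insert p T) b₀) (nb G T) B ∨
    (∃ E v, Red G W A B E (nb G {p}) (nb G {v})) ∨
    ∃ E v l δ, RI G E A (nb G {v}) ∧ E ⊆ W ∧ v ∉ E ∧ (δ = 1 ∨ δ = 2) ∧
      (∀ w ∈ E, ld G W A B w ≤ ld G E A (nb G {v}) w + 1) ∧
      ∀ n, Lens G E A (nb G {v}) n → Lens G W A B (n + l) ∧ Lens G W A B (n + (l + δ)) := by
  have hDH : comp G (W \ insert p T) b₀ ⊆ W \ insert p T := comp_sub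
  have hDself : b₀ ∈ comp G (W \ insert p T) b₀ := self_mem_comp (Finset.mem_sdiff.2 ⟨hbW, hbH⟩)
  have hDconn : ∀ x ∈ comp G (W \ insert p T) b₀, ∀ y ∈ comp G (W \ insert p T) b₀,
    Reach G (comp G (W \ insert p T) b₀) x y := fun x hx y hy => comp_conn hx hy
  have hDbd : ∀ e ∈ comp G (W \ insert p T) b₀, ∀ s ∈ W, s ∉ comp G (W \ insert p T) b₀ →
      G.Adj e s → s = p ∨ s ∈ T := by
    intro e he s hs hsD hes
    by_contra hc
    exact hsD (comp_closed he (by simp [hs]; tauto) hes)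
  set D := comp G (W \ insert p T) b₀ with hD
  have hDW : D ⊆ W := hDH.trans Finset.sdiff_subset
  have hpD : p ∉ D := fun hh => by simpa using hDH hh
  have hTD : ∀ t ∈ T, t ∉ D := fun t ht hh => by
    have := hDH hh
    simp [ht] at this
  have hpτ := hT τ hτ
  have hbp : b₀ ≠ p := fun e => hbH (by simp [e])
  have hbT : b₀ ∉ T := fun e => hbH (by simp [e])
  by_cases h2 : ∀ v ∈ D, ∀ u ∈ D, u ≠ v → ∃ t, (t ∈ nb G T ∨ t ∈ B) ∧ Reach G (D.erase v) u t
  · refine .inl ⟨hDconn, ?_, ⟨b₀, hb, hDself⟩, h2⟩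
    obtain ⟨e, he, s, hs, _, hes⟩ := attach (S := T) (hnc p hp b₀ hbW τ hpτ.2.1 hbp hpτ.2.2.ne')
      hbT hτ
    have e2 : W.erase p \ T = W \ insert p T := by
      ext x; simp only [Finset.mem_sdiff, Finset.mem_erase, Finset.mem_insert]; tauto
    rw [e2] at he
    exact ⟨e, mem_nb.2 ⟨s, hs, hes.symm⟩, he⟩
  right
  have bad : ∀ v ∈ D, ∀ u ∈ D, u ≠ v →
      (∀ t, (t ∈ nb G T ∨ t ∈ B) → ¬ Reach G (D.erase v) u t) →
      ∀ e ∈ comp G (D.erase v) u, ∀ s ∈ W, s ∉ comp G (D.erase v) u → G.Adj e s → s = v ∨ s = p := by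
    intro v hv u hu huv hE e he s hs hsE hes
    by_cases hsD : s ∈ D
    · exact .inl (comp_bdry he hsD hsE hes)
    · rcases hDbd e (Finset.mem_of_mem_erase (comp_sub he)) s hs hsD hes with h1 | h1
      · exact .inr h1
      · exact absurd (mem_comp.1 he) (hE e (.inl (mem_nb.2 ⟨s, h1, hes.symm⟩)))
  have tail : ∀ v ∈ D, ∀ u ∈ D, (∀ t, (t ∈ nb G T ∨ t ∈ B) → ¬ Reach G (D.erase v) u t) →
      ∃ k, PL G (D \ comp G (D.erase v) u) v b₀ k := by
    intro v hv u hu hE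
    exact (conn_compl hDconn hv hDself fun hh => hE b₀ (.inr hb) (mem_comp.1 hh)).symm.path
  have attp : ∀ v ∈ D, ∀ u ∈ D, u ≠ v →
      (∀ t, (t ∈ nb G T ∨ t ∈ B) → ¬ Reach G (D.erase v) u t) →
      ∃ e ∈ comp G (D.erase v) u, G.Adj p e := by
    intro v hv u hu huv hE
    have hvp : p ≠ v := fun e => hpD (e ▸ hv)
    rcases (hnc v (hDW hv) u (hDW hu) p hp huv hvp).exit (comp G (D.erase v) u)
      (self_mem_comp (by simp [huv, hu])) with h3 | ⟨w, s, h3, h4, h5, h6⟩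
    · exact absurd (Finset.mem_of_mem_erase (comp_sub (Finset.mem_inter.1 h3.right).2)) hpD
    · have hw := (Finset.mem_inter.1 h3.right).2
      rw [Finset.mem_erase] at h4
      obtain rfl := (bad v hv u hu huv hE w hw s h4.2 h5 h6).resolve_left h4.1
      exact ⟨w, hw, h6.symm⟩
  have attv : ∀ v ∈ D, ∀ u ∈ D, u ≠ v →
      (∀ t, (t ∈ nb G T ∨ t ∈ B) → ¬ Reach G (D.erase v) u t) →
      ∃ e ∈ comp G (D.erase v) u, G.Adj v e := by
    intro v hv u hu huv hE
    obtain ⟨e, he, s, hs, _, hes⟩ := attach (S := {v}) (hDconn u hu v hv) (by simpa using huv)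
      (by simp)
    rw [← erase_eq] at he
    rw [Finset.mem_singleton] at hs
    subst hs
    exact ⟨e, he, hes.symm⟩
  by_cases hA : ∃ v ∈ D, ∃ u ∈ D, u ≠ v ∧
      (∀ t, (t ∈ nb G T ∨ t ∈ B) → ¬ Reach G (D.erase v) u t) ∧
      ∀ a ∈ A, a ∉ comp G (D.erase v) u
  · left
    obtain ⟨v, hv, u, hu, huv, hE, hEA⟩ := hA
    have hED : comp G (D.erase v) u ⊆ D.erase v := comp_sub
    have hEW : comp G (D.erase v) u ⊆ W := hED.trans ((Finset.erase_subset _ _).trans hDW)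
    have hEB : ∀ w ∈ comp G (D.erase v) u, w ∉ B := fun w hw hwB => hE w (.inr hwB) (mem_comp.1 hw)
    have hb2 := bad v hv u hu huv hE
    have hvE : v ∉ comp G (D.erase v) u := fun hh => by simpa using hED hh
    have hpE : p ∉ comp G (D.erase v) u := fun hh => hpD (Finset.mem_of_mem_erase (hED hh))
    refine ⟨comp G (D.erase v) u, v, h.sub hEW (fun x hx y hy => comp_conn hx hy) ?_ ?_ ?_ ?_, hEW,
      Finset.card_lt_card ⟨hEW, fun hh => hpE (hh hp)⟩, ?_, ?_, .inr ⟨v, hvE, rfl⟩⟩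
    · obtain ⟨e, he, hpe⟩ := attp v hv u hu huv hE
      exact ⟨e, mem_nb1.2 hpe, he⟩
    · obtain ⟨e, he, hpe⟩ := attv v hv u hu huv hE
      exact ⟨e, mem_nb1.2 hpe, he⟩
    · rintro w hw (hwA | hwB)
      · exact absurd hw (hEA w hwA)
      · exact absurd hwB (hEB w hw)
    · intro w hw s hs hsE hws
      rcases hb2 w hw s hs hsE hws with rfl | rfl
      · exact .inr (mem_nb1.2 hws.symm)
      · exact .inl (mem_nb1.2 hws.symm)
    · intro w hw
      have h1 : lab A w = 0 := lab_neg fun hh => hEA w hh hw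
      have h1' : lab B w = 0 := lab_neg (hEB w hw)
      have h2 : dg G W w ≤ dg G (comp G (D.erase v) u) w + dg G ({v} ∪ {p}) w := dg_le fun x hx hwx => by
        by_cases hxE : x ∈ comp G (D.erase v) u
        · exact .inl hxE
        · exact .inr (by simpa using hb2 w hw x hx hxE hwx)
      have h3 := dg_union (G := G) (H := {v}) (K := {p}) (w := w)
      have h4 : dg G {v} w ≤ lab (nb G {v}) w :=
        dg_le_lab (dg_le_card.trans (by simp)) fun x hx _ => hx
      have h5 : dg G {p} w ≤ lab (nb G {p}) w :=
        dg_le_lab (dg_le_card.trans (by simp)) fun x hx _ => hx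
      unfold ld; omega
    · obtain ⟨k, hk⟩ := tail v hv u hu hE
      refine ⟨(1 + 1) + (k + 1), fun n hn => ?_⟩
      have h5 : Lens G (comp G (D.erase v) u ∪ {τ, p}) A (nb G {v}) (n + (1 + 1)) := by
        refine hn.joinL (H := {τ, p}) (k := 1) (fun t ht => ⟨τ, hpτ.1, ?_⟩) ?_
          Finset.subset_union_right Finset.subset_union_left
        · rw [Finset.mem_singleton.1 ht]
          exact .edge hpτ.2.2.symm (by simp) (by simp)
        · rw [Finset.disjoint_insert_left, Finset.disjoint_singleton_left]
          exact ⟨fun hh => hTD τ hτ (Finset.mem_of_mem_erase (hED hh)), hpE⟩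
      rw [← add_assoc]
      refine h5.joinR (H := D \ comp G (D.erase v) u) (fun t ht => ⟨b₀, hb, ?_⟩) ?_
        (Finset.sdiff_subset.trans hDW) ?_
      · rw [Finset.mem_singleton.1 ht]; exact hk
      · refine Finset.disjoint_left.2 fun x hx hx' => ?_
        rw [Finset.mem_sdiff] at hx
        simp only [Finset.mem_union, Finset.mem_insert, Finset.mem_singleton] at hx'
        rcases hx' with h6 | rfl | rfl
        · exact hx.2 h6
        · exact hTD _ hτ hx.1
        · exact hpD hx.1
      · refine Finset.union_subset hEW ?_
        simp [Finset.insert_subset_iff, hp, hpτ]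
  · right
    push Not at h2
    obtain ⟨v, hv, u, hu, huv, hE⟩ := h2
    have hED : comp G (D.erase v) u ⊆ D.erase v := comp_sub
    have hEW : comp G (D.erase v) u ⊆ W := hED.trans ((Finset.erase_subset _ _).trans hDW)
    have hEB : ∀ w ∈ comp G (D.erase v) u, w ∉ B := fun w hw hwB => hE w (.inr hwB) (mem_comp.1 hw)
    have hb2 := bad v hv u hu huv hE
    have hvE : v ∉ comp G (D.erase v) u := fun hh => by simpa using hED hh
    have hpE : p ∉ comp G (D.erase v) u := fun hh => hpD (Finset.mem_of_mem_erase (hED hh))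
    have hvW := hDW hv
    have hvp : p ≠ v := fun e => hpD (e ▸ hv)
    have hτv : τ ≠ v := fun e => hTD τ hτ (e ▸ hv)
    push Not at hA
    have hri : RI G (comp G (D.erase v) u) A (nb G {v}) := by
      refine ⟨fun x hx y hy => comp_conn hx hy, hA v hv u hu huv hE, ?_, ?_⟩
      · obtain ⟨e, he, hpe⟩ := attv v hv u hu huv hE
        exact ⟨e, mem_nb1.2 hpe, he⟩
      · intro x hx y hy hyx
        by_contra hcon
        push Not at hcon
        have key : ∀ t, Reach G (D.erase x) y t → Reach G ((comp G (D.erase v) u).erase x) y t := by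
          intro t r
          rcases r.exit ((comp G (D.erase v) u)) hy with h3 | ⟨w, s, h3, h4, h5, h6⟩
          · exact h3.mono fun z => by simp; tauto
          · exfalso
            have hw := (Finset.mem_inter.1 h3.right).2
            obtain rfl := comp_bdry hw (Finset.mem_of_mem_erase h4) h5 h6
            refine hcon w (.inr (mem_nb1.2 h6.symm)) (h3.mono fun z => by simp; tauto)
        have hn : ∀ t, t ∈ nb G T ∨ t ∈ B → ¬ Reach G (D.erase x) y t := by
          intro t ht r
          exact hE t ht ((mem_comp.1 hy).trans ((key t r).mono (Finset.erase_subset _ _)|>.mono hED))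
        obtain ⟨a, ha, har⟩ := hA x (Finset.mem_of_mem_erase (hED hx)) y
          (Finset.mem_of_mem_erase (hED hy)) hyx fun t ht r => hn t ht r
        exact hcon a (.inl ha) (key a (mem_comp.1 har))
    set E := comp G (D.erase v) u with hEdef
    have hW2 : ∀ x, ∃ b ∈ B, b ∈ W ∧ b ≠ x := by
      intro x
      by_cases hx : b₀ = x
      · subst hx
        obtain ⟨b, hb, r⟩ := (hs b₀ hbW p hp hbp.symm).2
        have := r.right
        rw [Finset.mem_erase] at this
        exact ⟨b, hb, this.2, this.1⟩
      · exact ⟨b₀, hb, hbW, hx⟩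
    obtain ⟨a, hva, haX⟩ : ∃ a, G.Adj v a ∧ a ∈ (W \ E).erase v := by
      rcases (hnc p hp v hvW τ hpτ.2.1 hvp.symm hpτ.2.2.ne').exit (insert v E) (by simp)
        with h3 | ⟨w, s, h3, h4, h5, h6⟩
      · have := (Finset.mem_inter.1 h3.right).2
        rw [Finset.mem_insert] at this
        rcases this with e | e
        · exact absurd e hτv
        · exact absurd (Finset.mem_of_mem_erase (hED e)) (hTD τ hτ)
      · have hw := (Finset.mem_inter.1 h3.right).2
        rw [Finset.mem_insert] at hw h5
        rw [Finset.mem_erase] at h4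
        push Not at h5
        rcases hw with rfl | hw
        · exact ⟨s, h6, by simp [h5, h4]⟩
        · rcases hb2 w hw s h4.2 h5.2 h6 with e | e
          · exact absurd e h5.1
          · exact absurd e h4.1
    have two : ∃ l δ, (δ = 1 ∨ δ = 2) ∧ (∃ b ∈ B, PL G (W \ E) v b l) ∧
        ∃ b ∈ B, PL G (W \ E) v b (l + δ) := by
      by_cases hab : ∃ a ∈ nb G {v}, a ∈ (W \ E).erase v ∧ ∃ b ∈ B, b ∈ (W \ E).erase v ∧ a ≠ b
      · obtain ⟨a, ha, haX, b, hb, hbX, hab⟩ := hab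
        have hvE' : v ∉ E := hvE
        have hset : (W.erase v) \ E = (W \ E).erase v := by
          ext x; simp only [Finset.mem_sdiff, Finset.mem_erase]; tauto
        have hbp' : ∀ e ∈ E, ∀ s ∈ W.erase v, s ∉ E → G.Adj e s → s = p := by
          intro e he s hs hsE hes
          rw [Finset.mem_erase] at hs
          exact (hb2 e he s hs.2 hsE hes).resolve_left hs.1
        have hXc : ∀ x ∈ (W \ E).erase v, ∀ y ∈ (W \ E).erase v, Reach G ((W \ E).erase v) x y := by
          intro x hx y hy
          rw [← hset, Finset.mem_sdiff, Finset.mem_erase] at hx hy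
          rw [← hset]
          exact (hnc v hvW x hx.1.2 y hy.1.2 hx.1.1 hy.1.1).bypass hbp' hpE hy.2 hx.2
        have hz : ∀ x ∈ (W \ E).erase v, ∀ y ∈ (W \ E).erase v, y ≠ x →
            (∀ t, (t ∈ nb G {v} ∨ t ∈ B) → ¬ Reach G (((W \ E).erase v).erase x) y t) →
            Reach G (((W \ E).erase v).erase x) y p := by
            intro x hx y hy hyx hdead
            by_contra hpn
            simp only [Finset.mem_erase, Finset.mem_sdiff] at hx hy
            have hyc : y ∈ comp G (((W \ E).erase v).erase x) y := self_mem_comp (by simp [hyx, hy])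
            rcases (hnc x hx.2.1 y hy.2.1 v hvW hyx (Ne.symm hx.1)).exit _ hyc
              with h3 | ⟨w, s, h3, h4, h5, h6⟩
            · have := comp_sub (Finset.mem_inter.1 h3.right).2
              simp at this
            · have hw := (Finset.mem_inter.1 h3.right).2
              have hwX := comp_sub hw
              simp only [Finset.mem_erase, Finset.mem_sdiff] at hwX h4
              by_cases hsE : s ∈ E
              · rcases hb2 s hsE w hwX.2.2.1 hwX.2.2.2 h6.symm with e | e
                · exact hwX.2.1 e
                · exact hpn (e ▸ mem_comp.1 hw)
              · by_cases hsv : s = v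
                · subst hsv
                  exact hdead w (.inl (mem_nb1.2 h6.symm)) (mem_comp.1 hw)
                · exact h5 (comp_closed hw (by simp [h4, hsE, hsv]) h6)
        have hdeg : ∀ w ∈ (W \ E).erase v, w ≠ p → 3 ≤ ld G ((W \ E).erase v) (nb G {v}) B w := by
            intro w hw hwp
            simp only [Finset.mem_erase, Finset.mem_sdiff] at hw
            have h1 := hd w hw.2.1
            have h2 : dg G W w ≤ dg G ((W \ E).erase v) w + dg G {v} w := dg_le fun x hx hwx => by
              by_cases hxv : x = v
              · exact .inr (by simp [hxv])
              · refine .inl ?_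
                simp only [Finset.mem_erase, Finset.mem_sdiff]
                refine ⟨hxv, hx, fun hxE => ?_⟩
                rcases hb2 x hxE w hw.2.1 hw.2.2 hwx.symm with e | e
                · exact hw.1 e
                · exact hwp e
            have h4 : dg G {v} w ≤ lab (nb G {v}) w :=
              dg_le_lab (dg_le_card.trans (by simp)) fun x hx _ => hx
            have h5 := lab_le (A := A) (w := w)
            unfold ld at *; omega
        obtain ⟨l, hl, hl'⟩ := ap2_prune (X := (W \ E).erase v) (A := nb G {v}) (B := B) (z := p)
          hXc ha haX hb hbX hab hz hdeg
        have fin : ∀ n, Lens G ((W \ E).erase v) (nb G {v}) B n → ∃ b ∈ B, PL G (W \ E) v b (n + 1) := by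
          rintro n ⟨c, hc, b, hb, q⟩
          exact ⟨b, hb, .cons (by simp [hvW, hvE]) (mem_nb1.1 hc) q⟩
        rcases hl' with hl' | hl'
        · exact ⟨l + 1, 2, .inr rfl, fin _ hl, by have := fin _ hl'; rwa [add_right_comm] at this⟩
        · exact ⟨l + 1, 1, .inl rfl, fin _ hl, fin _ hl'⟩
      · push Not at hab
        have hall : ∀ b ∈ B, b ∈ W → b ≠ v → b = a := fun b hb hbW hbv =>
          (hab a (mem_nb1.2 hva) haX b hb (by
            simp only [Finset.mem_erase, Finset.mem_sdiff]
            exact ⟨hbv, hbW, fun hh => hEB b hh hb⟩)).symm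
        have hvR : v ∈ W \ E := by simp [hvW, hvE]
        have haB : a ∈ B := by
          obtain ⟨b, hb, hbW, hbv⟩ := hW2 v
          exact hall b hb hbW hbv ▸ hb
        have hvB : v ∈ B := by
          obtain ⟨b, hb, hbW, hba⟩ := hW2 a
          by_cases hbv : b = v
          · exact hbv ▸ hb
          · exact absurd (hall b hb hbW hbv) hba
        exact ⟨0, 1, .inl rfl, ⟨v, hvB, .nil hvR⟩, a, haB,
          .edge hva hvR (Finset.mem_of_mem_erase haX)⟩
    obtain ⟨l, δ, hδ, ⟨b1, hb1, q1⟩, b2, hb2', q2⟩ := two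
    refine ⟨E, v, l + 1, δ, hri, hEW, hvE, hδ, ?_, ?_⟩
    · intro w hw
      have h1' : lab B w = 0 := lab_neg (hEB w hw)
      have h2 : dg G W w ≤ dg G E w + dg G ({v} ∪ {p}) w := dg_le fun x hx hwx => by
        by_cases hxE : x ∈ E
        · exact .inl hxE
        · exact .inr (by simpa using hb2 w hw x hx hxE hwx)
      have h3 := dg_union (G := G) (H := {v}) (K := {p}) (w := w)
      have h4 : dg G {v} w ≤ lab (nb G {v}) w :=
        dg_le_lab (dg_le_card.trans (by simp)) fun x hx _ => hx
      have h5 : dg G {p} w ≤ 1 := dg_le_card.trans (by simp)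
      unfold ld; omega
    · intro n hn
      constructor
      · exact hn.joinR (H := W \ E) (fun t ht => ⟨b1, hb1, by
          rw [Finset.mem_singleton.1 ht]; exact q1⟩) Finset.sdiff_disjoint Finset.sdiff_subset hEW
      · rw [show l + 1 + δ = (l + δ) + 1 by ring]
        exact hn.joinR (H := W \ E) (fun t ht => ⟨b2, hb2', by
          rw [Finset.mem_singleton.1 ht]; exact q2⟩) Finset.sdiff_disjoint Finset.sdiff_subset hEW

theorem lab_nb {H : Finset V} {w : V} (h : 1 ≤ dg G H w) : lab (nb G H) w = 1 := by
  obtain ⟨x, hx, hwx⟩ := dg_pos h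
  exact lab_pos (mem_nb.2 ⟨x, hx, hwx.symm⟩)

theorem dg_lt_card {H : Finset V} {w x : V} (hx : x ∈ H) (h : ¬ G.Adj w x) :
    dg G H w + 1 ≤ H.card := by
  have h1 : dg G H w ≤ dg G (H.erase x) w + dg G {x} w := dg_le fun y hy _ => by
    by_cases e : y = x <;> simp [e, hy]
  have h2 : dg G {x} w = 0 := dg_zero fun y hy => by rw [Finset.mem_singleton.1 hy]; exact h
  have h3 : dg G (H.erase x) w ≤ _ := dg_le_card
  rw [Finset.card_erase_of_mem hx] at h3
  have := Finset.card_pos.2 ⟨x, hx⟩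
  omega

theorem exact2_of_four' {W A B : Finset V} (h : RI G W A B) (hd : ∀ w ∈ W, 4 ≤ ld G W A B w) :
    Exact2 G W A B := exact2_of_four _ W A B rfl h hd

/-- Every vertex of `K` is adjacent to every other one. -/
def Clq (G : SimpleGraph V) (K : Finset V) : Prop := ∀ x ∈ K, ∀ y ∈ K, x ≠ y → G.Adj x y

theorem Clq.mono {K K' : Finset V} (h : Clq G K) (hK : K' ⊆ K) : Clq G K' :=
  fun x hx y hy => h x (hK hx) y (hK hy)

theorem Clq.path {j : ℕ} : ∀ {K : Finset V} {s : V}, Clq G K → s ∈ K → j < K.card →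
    ∃ a ∈ K, PL G K a s j := by
  induction j with
  | zero => exact fun _ hs _ => ⟨_, hs, .nil hs⟩
  | succ j ih =>
    intro K s hK hs hj
    have hc := Finset.card_erase_of_mem hs
    obtain ⟨y, hy⟩ : (K.erase s).Nonempty := Finset.card_pos.1 (by omega)
    obtain ⟨a, ha, q⟩ := ih (hK.mono (Finset.erase_subset s K)) hy (by omega)
    rw [Finset.mem_erase] at hy ha
    exact ⟨a, ha.2, q.snoc (hK y hy.2 s hs hy.1) (by simp) hs (Finset.erase_subset _ _)⟩

theorem Clq.path₂ {K : Finset V} {u v : V} {j : ℕ} (hK : Clq G K) (hu : u ∈ K) (hv : v ∈ K)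
    (huv : u ≠ v) (h1 : 1 ≤ j) (hj : j < K.card) : PL G K u v j := by
  obtain ⟨i, rfl⟩ : ∃ i, j = i + 1 := ⟨j - 1, by omega⟩
  have hc := Finset.card_erase_of_mem hv
  obtain ⟨a, ha, q⟩ := (hK.mono (Finset.erase_subset v K)).path (s := u) (j := i)
    (by simp [huv, hu]) (by omega)
  rw [Finset.mem_erase] at ha
  exact q.symm.snoc (hK a ha.2 v hv ha.1) (by simp) hv (Finset.erase_subset _ _)

theorem RI.star_cmp {W A B H A' B' : Finset V} {u : V} (h : RI G W A B) (hs : Star G W A B)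
    (hA : ∃ a ∈ A', a ∈ comp G (W \ H) u) (hB : ∃ b ∈ B', b ∈ comp G (W \ H) u)
    (h1 : ∀ w ∈ comp G (W \ H) u, w ∈ B → w ∈ A' ∨ w ∈ B')
    (h2 : ∀ w ∈ comp G (W \ H) u, ∀ s ∈ W, s ∈ H → G.Adj w s → w ∈ A' ∨ w ∈ B') :
    RI G (comp G (W \ H) u) A' B' := by
  have hDW : comp G (W \ H) u ⊆ W := comp_sub.trans Finset.sdiff_subset
  refine ⟨fun x hx y hy => comp_conn hx hy, hA, hB, fun v hv x hx hxv => ?_⟩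
  obtain ⟨b, hb, r⟩ := (hs v (hDW hv) x (hDW hx) hxv).2
  rcases r.exit ((comp G (W \ H) u).erase v) (by simp [hx, hxv]) with h3 | ⟨w, s, h3, h4, h5, h6⟩
  · have h4 := h3.right
    simp only [Finset.mem_inter, Finset.mem_erase] at h4
    exact ⟨b, h1 b h4.2.2 hb, h3.mono Finset.inter_subset_right⟩
  · have h7 := h3.right
    simp only [Finset.mem_inter, Finset.mem_erase] at h7 h4 h5
    refine ⟨w, h2 w h7.2.2 s h4.2 ?_ h6, h3.mono Finset.inter_subset_right⟩
    by_contra hsH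
    exact h5 ⟨h4.1, comp_closed h7.2.2 (by simp [h4, hsH]) h6⟩

/-- The set contains `l, l+2, l+4` or `l, l+1, l+2, l+3`. -/
def Y3 (S : ℕ → Prop) : Prop := ∃ l, S l ∧ S (l + 2) ∧ (S (l + 4) ∨ (S (l + 1) ∧ S (l + 3)))

theorem Y3.shift {S R : ℕ → Prop} {c : ℕ} (h : Y3 S) (hc : ∀ n, S n → R (n + c)) : Y3 R := by
  obtain ⟨l, h1, h2, h3⟩ := h
  refine ⟨l + c, hc _ h1, by have := hc _ h2; rwa [add_right_comm] at this, ?_⟩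
  rcases h3 with h3 | ⟨h3, h4⟩
  · exact .inl (by have := hc _ h3; rwa [add_right_comm] at this)
  · exact .inr ⟨by have := hc _ h3; rwa [add_right_comm] at this,
      by have := hc _ h4; rwa [add_right_comm] at this⟩

theorem Y3.of_exact2 {S K R : ℕ → Prop} {c l k δ : ℕ} (h1 : S l) (h2 : S (l + 2)) (k1 : K k)
    (k2 : K (k + δ)) (hδ : δ = 1 ∨ δ = 2) (hc : ∀ n, S n → ∀ m, K m → R (n + m + c)) : Y3 R := by
  have e1 := hc _ h1 _ k1
  have e2 := hc _ h1 _ k2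
  have e3 := hc _ h2 _ k1
  have e4 := hc _ h2 _ k2
  refine ⟨l + k + c, e1, by convert e3 using 1; omega, ?_⟩
  rcases hδ with rfl | rfl
  · exact .inr ⟨by convert e2 using 1; omega, by convert e4 using 1; omega⟩
  · exact .inl (by convert e4 using 1; omega)

theorem Y3.of_exact2' {S K R : ℕ → Prop} {c l k : ℕ} (h1 : S l) (h2 : S (l + 2)) (k1 : K k)
    (k2 : K (k + 2) ∨ K (k + 1)) (hc : ∀ n, S n → ∀ m, K m → R (n + m + c)) : Y3 R := by
  rcases k2 with k2 | k2
  · exact .of_exact2 h1 h2 k1 k2 (.inr rfl) hc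
  · exact .of_exact2 h1 h2 k1 k2 (.inl rfl) hc

theorem Y3.of_three {S K R : ℕ → Prop} {c l k : ℕ} (h1 : S l) (h2 : S (l + 1)) (h3 : S (l + 2))
    (k1 : K k) (k2 : K (k + 2) ∨ K (k + 1)) (hc : ∀ n, S n → ∀ m, K m → R (n + m + c)) : Y3 R := by
  have e1 := hc _ h1 _ k1
  have e2 := hc _ h2 _ k1
  have e3 := hc _ h3 _ k1
  refine ⟨l + k + c, e1, by convert e3 using 1; omega, ?_⟩
  rcases k2 with k2 | k2
  · exact .inl (by have := hc _ h3 _ k2; convert this using 1; omega)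
  · exact .inr ⟨by convert e2 using 1; omega, by have := hc _ h3 _ k2; convert this using 1; omega⟩

theorem Star.two {W A B : Finset V} {u v : V} (hs : Star G W A B) (hu : u ∈ W) (hv : v ∈ W)
    (huv : u ≠ v) (x : V) : ∃ b ∈ B, b ∈ W ∧ b ≠ x := by
  have key : ∀ x ∈ W, ∃ b ∈ B, b ∈ W ∧ b ≠ x := by
    intro x hx
    obtain ⟨y, hy, hyx⟩ : ∃ y ∈ W, y ≠ x := by
      by_cases e : u = x
      · exact ⟨v, hv, fun e' => huv (e.trans e'.symm)⟩
      · exact ⟨u, hu, e⟩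
    obtain ⟨b, hb, r⟩ := (hs x hx y hy hyx).2
    have := r.right
    rw [Finset.mem_erase] at this
    exact ⟨b, hb, this.2, this.1⟩
  by_cases hx : x ∈ W
  · exact key x hx
  · obtain ⟨b, hb, hbW, _⟩ := key u hu
    exact ⟨b, hb, hbW, fun e => hx (e ▸ hbW)⟩

/-- The component of `W \ H` at a root of `B` keeps a rooted structure with `nb T`, where `T ⊆ H`
meets every edge leaving the component. -/
theorem RI.star_out {W A B H : Finset V} {b₀ τ : V} (h : RI G W A B) (hs : Star G W A B)
    (hb : b₀ ∈ B) (hbW : b₀ ∈ W) (hbH : b₀ ∉ H) (hτ : τ ∈ H) (hτW : τ ∈ W) :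
    RI G (comp G (W \ H) b₀) (nb G H) B := by
  refine h.star_cmp hs ?_ ⟨b₀, hb, self_mem_comp (by simp [hbW, hbH])⟩ (fun w _ hw => .inr hw)
    fun w _ s _ hs hws => .inl (mem_nb.2 ⟨s, hs, hws.symm⟩)
  obtain ⟨e, he, s', hs', _, hes⟩ := attach (h.conn b₀ hbW τ hτW) hbH hτ
  exact ⟨e, mem_nb.2 ⟨s', hs', hes.symm⟩, he⟩

theorem Lens.clq {W A B D K : Finset V} {n j : ℕ} (hK : Clq G K) (hKA : K ⊆ A) (hKW : K ⊆ W)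
    (hDW : D ⊆ W) (hd : Disjoint K D) (hn : Lens G D (nb G K) B n) (hj : j < K.card) :
    Lens G W A B (n + j + 1) :=
  hn.joinL (k := j) (fun t ht => by
    obtain ⟨a, ha, q⟩ := hK.path ht hj
    exact ⟨a, hKA ha, q⟩) hd hKW hDW

theorem clq_side {W A B K : Finset V} {b₀ : V} (h : RI G W A B) (hs : Star G W A B)
    (hd : ∀ w ∈ W, 5 ≤ ld G W A B w) (hK : Clq G K) (hKA : K ⊆ A) (hKW : K ⊆ W) (h2 : 2 ≤ K.card)
    (hmax : ∀ w ∈ A, w ∈ W → w ∉ K → ∃ x ∈ K, ¬ G.Adj w x) (hb : b₀ ∈ B) (hbW : b₀ ∈ W)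
    (hbK : b₀ ∉ K) : Y3 (Lens G W A B) := by
  obtain ⟨τ, hτ⟩ : K.Nonempty := Finset.card_pos.1 (by omega)
  have hr := h.star_out hs hb hbW hbK hτ (hKW hτ)
  have hDW' : comp G (W \ K) b₀ ⊆ W \ K := comp_sub
  have hDW : comp G (W \ K) b₀ ⊆ W := hDW'.trans Finset.sdiff_subset
  have hdis : Disjoint K (comp G (W \ K) b₀) :=
    Finset.disjoint_right.2 fun x hx => (Finset.mem_sdiff.1 (hDW' hx)).2
  have hjoin : ∀ n, Lens G (comp G (W \ K) b₀) (nb G K) B n → ∀ m, m < K.card →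
      Lens G W A B (n + m + 1) := fun n hn m hm => hn.clq hK hKA hKW hDW hdis hm
  have hdeg : ∀ w ∈ comp G (W \ K) b₀, 5 ≤ ld G (comp G (W \ K) b₀) (nb G K) B w + (K.card - 1) := by
    intro w hw
    have h1 := hd w (hDW hw)
    have h2 := dg_comp hw
    have h3 : dg G K w ≤ K.card := dg_le_card
    have h4 := lab_le (A := A) (w := w)
    have h5 : dg G K w + lab A w ≤ K.card := by
      by_cases hwA : w ∈ A
      · obtain ⟨x, hx, hwx⟩ := hmax w hwA (hDW hw) (Finset.mem_sdiff.1 (hDW' hw)).2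
        have := dg_lt_card hx hwx
        omega
      · rw [lab_neg hwA]; omega
    by_cases h6 : 1 ≤ dg G K w
    · have := lab_nb h6
      unfold ld at *; omega
    · unfold ld at *; omega
  rcases (by omega : K.card = 2 ∨ K.card = 3 ∨ 4 ≤ K.card) with hc | hc | hc
  · obtain ⟨l, hl, hl'⟩ := exact2_of_four' hr fun w hw => by have := hdeg w hw; omega
    exact .of_exact2 (K := fun m => m < K.card) hl hl' (k := 0) (δ := 1) (by omega) (by omega)
      (.inl rfl) hjoin
  · obtain ⟨l, hl, hl'⟩ := ap2_of_three hr fun w hw => by have := hdeg w hw; omega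
    exact .of_three (S := fun m => m < K.card) (l := 0) (c := 1) (by omega) (by omega) (by omega)
      hl hl' fun n hn m hm => by rw [add_comm n]; exact hjoin m hm n hn
  · obtain ⟨a, ha, haD⟩ := hr.hA
    obtain ⟨n, q⟩ := (hr.conn a haD b₀ (self_mem_comp (by simp [hbW, hbK]))).path
    have hl : Lens G (comp G (W \ K) b₀) (nb G K) B n := ⟨a, ha, b₀, hb, q⟩
    refine ⟨n + 1, hjoin n hl 0 (by omega), ?_, .inr ⟨?_, ?_⟩⟩
    · have := hjoin n hl 2 (by omega); exact this
    · have := hjoin n hl 1 (by omega); convert this using 1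
    · have := hjoin n hl 3 (by omega); exact this

/-- When both root sets are the same pair of vertices, delete it. -/
theorem two_roots {W A B : Finset V} {x y u : V} (h : RI G W A B) (hs : Star G W A B)
    (hxA : x ∈ A) (hyB : y ∈ B) (hxW : x ∈ W) (hyW : y ∈ W)
    (hA : ∀ a ∈ A, a ∈ W → a = x ∨ a = y) (hB : ∀ b ∈ B, b ∈ W → b = x ∨ b = y) (hxy : x ≠ y)
    (huW : u ∈ W) (hux : u ≠ x) (huy : u ≠ y) :
    Red G W A B (comp G (W \ {x, y}) u) (nb G {x}) (nb G {y}) := by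
  have hu : u ∉ ({x, y} : Finset V) := by simp [hux, huy]
  have hDW' : comp G (W \ {x, y}) u ⊆ W \ {x, y} := comp_sub
  have hDW : comp G (W \ {x, y}) u ⊆ W := hDW'.trans Finset.sdiff_subset
  have hDx : ∀ w ∈ comp G (W \ {x, y}) u, w ≠ x ∧ w ≠ y := fun w hw => by
    have := hDW' hw
    simp only [Finset.mem_sdiff, Finset.mem_insert, Finset.mem_singleton] at this
    tauto
  refine ⟨h.star_cmp hs ?_ ?_ (fun w hw hwB => ?_) fun w _ s _ hs hws => ?_, hDW, ?_, ?_, ?_, ?_⟩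
  · obtain ⟨a, ha, r⟩ := (hs y hyW u huW huy).1
    have har := r.right
    rw [Finset.mem_erase] at har
    obtain rfl := (hA a ha har.2).resolve_right har.1
    obtain ⟨e, he, s', hs', _, hes⟩ := attach (S := {a}) r (by simpa using hux) (by simp)
    rw [Finset.mem_singleton.1 hs'] at hes
    refine ⟨e, mem_nb1.2 hes.symm, ?_⟩
    have e2 : W.erase y \ {a} = W \ {a, y} := by
      ext z; simp only [Finset.mem_sdiff, Finset.mem_erase, Finset.mem_insert, Finset.mem_singleton]
      tauto
    rwa [e2] at he
  · obtain ⟨b, hb, r⟩ := (hs x hxW u huW hux).2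
    have hbr := r.right
    rw [Finset.mem_erase] at hbr
    obtain rfl := (hB b hb hbr.2).resolve_left hbr.1
    obtain ⟨e, he, s', hs', _, hes⟩ := attach (S := {b}) r (by simpa using huy) (by simp)
    rw [Finset.mem_singleton.1 hs'] at hes
    refine ⟨e, mem_nb1.2 hes.symm, ?_⟩
    have e2 : W.erase x \ {b} = W \ {x, b} := by
      ext z; simp only [Finset.mem_sdiff, Finset.mem_erase, Finset.mem_insert, Finset.mem_singleton]
      tauto
    rwa [e2] at he
  · have := hDx w hw
    rcases hB w hwB (hDW hw) with e | e <;> simp_all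
  · rw [Finset.mem_insert, Finset.mem_singleton] at hs
    rcases hs with rfl | rfl
    · exact .inl (mem_nb1.2 hws.symm)
    · exact .inr (mem_nb1.2 hws.symm)
  · exact Finset.card_lt_card ⟨hDW, fun hh => (hDx x (hh hxW)).1 rfl⟩
  · intro w hw
    have h1 := dg_comp hw
    have h2 : dg G ({x} ∪ {y}) w ≤ _ := dg_union
    have h3 : dg G {x} w ≤ lab (nb G {x}) w :=
      dg_le_lab (dg_le_card.trans (by simp)) fun x hx _ => hx
    have h4 : dg G {y} w ≤ lab (nb G {y}) w :=
      dg_le_lab (dg_le_card.trans (by simp)) fun x hx _ => hx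
    have h5 : lab A w = 0 := lab_neg fun hh => by
      have := hDx w hw
      rcases hA w hh (hDW hw) with e | e <;> simp_all
    have h6 : lab B w = 0 := lab_neg fun hh => by
      have := hDx w hw
      rcases hB w hh (hDW hw) with e | e <;> simp_all
    have e : ({x} ∪ {y} : Finset V) = {x, y} := by ext; simp
    rw [e] at h2
    unfold ld; omega
  · refine ⟨2, ?_⟩
    rintro n ⟨a, ha, b, hb, q⟩
    have hxD : x ∉ comp G (W \ {x, y}) u := fun hh => (hDx x hh).1 rfl
    have hyD : y ∉ comp G (W \ {x, y}) u := fun hh => (hDx y hh).2 rfl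
    refine ⟨x, hxA, y, hyB, ?_⟩
    have h1 : PL G (insert y (comp G (W \ {x, y}) u)) a y (n + 1) :=
      q.snoc (mem_nb1.1 hb).symm hyD (by simp) (Finset.subset_insert _ _)
    exact h1.cons' (mem_nb1.1 ha) (by simp [hxy, hxD]) hxW
      (Finset.insert_subset hyW hDW)
  · exact .inr ⟨y, fun hh => (hDx y hh).2 rfl, rfl⟩

theorem coll_lens {W A B D T : Finset V} {p x y : V} {n : ℕ} (hp : p ∈ W)
    (hT : ∀ t ∈ T, t ∈ A ∧ t ∈ W ∧ G.Adj p t) (hx : x ∈ T) (hy : y ∈ T) (hxy : x ≠ y)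
    (hD : D ⊆ W \ insert p T) (hn : Lens G D (nb G T) B n) :
    Lens G W A B (n + 1) ∧ Lens G W A B (n + 3) := by
  have hdis : Disjoint (insert p T) D := Finset.disjoint_right.2 fun z hz =>
    (Finset.mem_sdiff.1 (hD hz)).2
  have hH : insert p T ⊆ W := Finset.insert_subset hp fun t ht => (hT t ht).2.1
  have hDW := hD.trans Finset.sdiff_subset
  refine ⟨hn.joinL (k := 0) (fun t ht => ⟨t, (hT t ht).1, .nil (by simp [ht])⟩) hdis hH hDW,
    hn.joinL (k := 2) (fun t ht => ?_) hdis hH hDW⟩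
  obtain ⟨s, hs, hst⟩ : ∃ s ∈ T, s ≠ t := by
    by_cases e : x = t
    · exact ⟨y, hy, fun e' => hxy (e.trans e'.symm)⟩
    · exact ⟨x, hx, e⟩
  refine ⟨s, (hT s hs).1, .cons (by simp [hs]) (hT s hs).2.2.symm (.edge (hT t ht).2.2 ?_ ?_)⟩
  · simp [(hT s hs).2.2.ne]
  · simp [ht, hst.symm]

theorem coll_side {W A B : Finset V} {p x y b₀ : V} (h : RI G W A B) (hs : Star G W A B)
    (hnc : NC G W) (hd : ∀ w ∈ W, 5 ≤ ld G W A B w)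
    (hrec : ∀ E A' B', Red G W A B E A' B' → Y3 (Lens G W A B))
    (hind : ∀ u ∈ A, u ∈ W → ∀ v ∈ A, v ∈ W → ¬ G.Adj u v) (hp : p ∈ W)
    (hx : x ∈ A) (hxW : x ∈ W) (hy : y ∈ A) (hyW : y ∈ W) (hxy : x ≠ y) (hpx : G.Adj p x)
    (hpy : G.Adj p y) (hb : b₀ ∈ B) (hbW : b₀ ∈ W) (hbp : b₀ ≠ p) (hbx : b₀ ≠ x) (hby : b₀ ≠ y) :
    Y3 (Lens G W A B) := by
  have hT : ∀ t ∈ ({x, y} : Finset V), t ∈ A ∧ t ∈ W ∧ G.Adj p t := by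
    intro t ht
    rw [Finset.mem_insert, Finset.mem_singleton] at ht
    rcases ht with rfl | rfl <;> tauto
  rcases trouble (m := 5) (τ := x) (by omega) h hs hnc hd hp hT (by simp) hb hbW
    (by simp [hbp, hbx, hby]) with hr | ⟨E, v, hr⟩ | ⟨E, v, l, δ, hr, hEW, hv, hδ, hdeg, hl⟩
  · obtain ⟨l, hl, hl'⟩ := ap2_of_three hr fun w hw => by
      have hwW := comp_sub.trans Finset.sdiff_subset hw
      have h1 := hd w hwW
      have h2 := dg_comp hw
      have h3 : dg G (insert p {x, y}) w ≤ dg G {p} w + dg G {x, y} w := by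
        rw [Finset.insert_eq]; exact dg_union
      have h4 : dg G {p} w ≤ _ := dg_le_card
      have h5 : dg G {x, y} w ≤ _ := dg_le_card
      have h6 : ({x, y} : Finset V).card = 2 := Finset.card_pair hxy
      rw [Finset.card_singleton] at h4
      have h7 := lab_le (A := A) (w := w)
      by_cases h8 : 1 ≤ dg G {x, y} w
      · have h9 := lab_nb h8
        obtain ⟨t, ht, hwt⟩ := dg_pos h8
        have : lab A w = 0 := lab_neg fun hh => hind w hh hwW t (hT t ht).1 (hT t ht).2.1 hwt
        unfold ld at *; omega
      · unfold ld at *; omega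
    refine .of_exact2' (S := fun m => m = 0 ∨ m = 2) (l := 0) (c := 1) (by simp) (by simp) hl hl' ?_
    rintro m hm n hn
    have := coll_lens hp hT (x := x) (y := y) (by simp) (by simp) hxy comp_sub hn
    rcases hm with rfl | rfl
    · convert this.1 using 1; omega
    · convert this.2 using 1; omega
  · exact hrec _ _ _ hr
  · obtain ⟨n, hn, hn'⟩ := exact2_of_four' hr fun w hw => by
      have := hdeg w hw
      have := hd w (hEW hw)
      omega
    refine .of_exact2 (K := fun m => m = l ∨ m = l + δ) (c := 0) hn hn' (k := l) (δ := δ)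
      (by simp) (by simp) hδ ?_
    rintro n hn m (rfl | rfl)
    · exact (hl n hn).1
    · exact (hl n hn).2

theorem Red.card_lt {W A B E A' B' : Finset V} (h : Red G W A B E A' B')
    (hd : ∀ w ∈ W, 5 ≤ ld G W A B w) : ∀ w ∈ E, 5 ≤ ld G E A' B' w :=
  fun w hw => (hd w (h.sub hw)).trans (h.deg w hw)

theorem ld_comm {W A B : Finset V} {w : V} : ld G W A B w = ld G W B A w := by
  unfold ld; omega

theorem clq_max {W A : Finset V} {x y : V} (hx : x ∈ A) (hxW : x ∈ W) (hy : y ∈ A) (hyW : y ∈ W)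
    (hxy : G.Adj x y) : ∃ K, Clq G K ∧ K ⊆ A ∧ K ⊆ W ∧ 2 ≤ K.card ∧
      ∀ w ∈ A, w ∈ W → w ∉ K → ∃ x ∈ K, ¬ G.Adj w x := by
  have h0 : ({x, y} : Finset V) ∈ (A ∩ W).powerset.filter (Clq G) := by
    rw [Finset.mem_filter, Finset.mem_powerset]
    refine ⟨?_, ?_⟩
    · intro z hz
      rw [Finset.mem_insert, Finset.mem_singleton] at hz
      rcases hz with rfl | rfl <;> simp [*]
    · intro a ha b hb hab
      rw [Finset.mem_insert, Finset.mem_singleton] at ha hb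
      rcases ha with rfl | rfl <;> rcases hb with rfl | rfl <;>
        first | exact absurd rfl hab | exact hxy | exact hxy.symm
  obtain ⟨K, hK, hmax⟩ := Finset.exists_max_image ((A ∩ W).powerset.filter (Clq G)) Finset.card
    ⟨_, h0⟩
  have h1 := hmax _ h0
  rw [Finset.card_pair hxy.ne] at h1
  rw [Finset.mem_filter, Finset.mem_powerset] at hK
  refine ⟨K, hK.2, hK.1.trans Finset.inter_subset_left, hK.1.trans Finset.inter_subset_right, h1, ?_⟩
  intro w hw hwW hwK
  by_contra hcon
  push Not at hcon
  have h2 := hmax (insert w K) (by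
    rw [Finset.mem_filter, Finset.mem_powerset]
    refine ⟨Finset.insert_subset (by simp [hw, hwW]) hK.1, fun a ha b hb hab => ?_⟩
    rw [Finset.mem_insert] at ha hb
    rcases ha with rfl | ha <;> rcases hb with rfl | hb
    · exact absurd rfl hab
    · exact hcon b hb
    · exact (hcon a ha).symm
    · exact hK.2 a ha b hb hab)
  rw [Finset.card_insert_of_notMem hwK] at h2
  omega

theorem edge_case {W A B : Finset V} {x y : V} (h : RI G W A B) (hs : Star G W A B)
    (hd : ∀ w ∈ W, 5 ≤ ld G W A B w)
    (hrec : ∀ E A' B', Red G W A B E A' B' → Y3 (Lens G W A B))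
    (hx : x ∈ A) (hxW : x ∈ W) (hy : y ∈ A) (hyW : y ∈ W) (hxy : G.Adj x y) :
    Y3 (Lens G W A B) := by
  obtain ⟨K, hK, hKA, hKW, h2, hmax⟩ := clq_max hx hxW hy hyW hxy
  by_cases hBK : ∃ b ∈ B, b ∈ W ∧ b ∉ K
  · obtain ⟨b, hb, hbW, hbK⟩ := hBK
    exact clq_side h hs hd hK hKA hKW h2 hmax hb hbW hbK
  push Not at hBK
  obtain ⟨b₁, hb₁, hb₁W, _⟩ := hs.two hxW hyW hxy.ne x
  obtain ⟨b₂, hb₂, hb₂W, hb₁₂⟩ := hs.two hxW hyW hxy.ne b₁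
  by_cases hAB : ∃ a ∈ A, a ∈ W ∧ a ∉ B
  · obtain ⟨a, ha, haW, haB⟩ := hAB
    have hBK' : B ∩ W ⊆ K := fun z hz => hBK z (Finset.mem_inter.1 hz).1 (Finset.mem_inter.1 hz).2
    refine (clq_side (K := B ∩ W) h.symm hs.symm (fun w hw => (hd w hw).trans_eq ld_comm) (hK.mono hBK')
      Finset.inter_subset_left Finset.inter_subset_right ?_ (fun w hw hwW hn => ?_) ha haW
      (fun hh => haB (Finset.mem_inter.1 hh).1)).shift (c := 0) fun n hn => hn.symm
    · have : ({b₁, b₂} : Finset V) ⊆ B ∩ W := by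
        intro z hz
        rw [Finset.mem_insert, Finset.mem_singleton] at hz
        rcases hz with rfl | rfl <;> simp [*]
      have := Finset.card_le_card this
      rwa [Finset.card_pair hb₁₂.symm] at this
    · exact absurd (Finset.mem_inter.2 ⟨hw, hwW⟩) hn
  push Not at hAB
  have hAK : ∀ a ∈ A, a ∈ W → a ∈ K := fun a ha haW => hBK a (hAB a ha haW) haW
  have hKB : K ⊆ B := fun z hz => hAB z (hKA hz) (hKW hz)
  have dir : ∀ j < K.card, Lens G W A B j := fun j hj => by
    obtain ⟨τ, hτ⟩ : K.Nonempty := Finset.card_pos.1 (by omega)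
    obtain ⟨a, ha, q⟩ := hK.path hτ hj
    exact ⟨a, hKA ha, τ, hKB hτ, q.mono hKW⟩
  by_cases h4 : 4 ≤ K.card
  · exact ⟨0, dir 0 (by omega), dir 2 (by omega), .inr ⟨dir 1 (by omega), dir 3 (by omega)⟩⟩
  obtain ⟨τ, hτ⟩ : K.Nonempty := Finset.card_pos.1 (by omega)
  obtain ⟨u, huW, huK⟩ : ∃ u ∈ W, u ∉ K := by
    by_contra hcon
    push Not at hcon
    have h1 := hd τ (hKW hτ)
    have h3 : dg G W τ ≤ dg G K τ := dg_mono fun z hz => hcon z hz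
    have h5 := dg_lt_card hτ (G.loopless.irrefl τ)
    have := lab_le (A := A) (w := τ)
    have := lab_le (A := B) (w := τ)
    unfold ld at h1; omega
  rcases (by omega : K.card = 2 ∨ K.card = 3) with hc | hc
  · obtain ⟨a, b, hab, rfl⟩ := Finset.card_eq_two.1 hc
    simp only [Finset.mem_insert, Finset.mem_singleton] at hAK hBK huK
    refine hrec _ _ _ (two_roots h hs (hKA (by simp)) (hKB (by simp)) (hKW (by simp))
      (hKW (by simp)) hAK hBK hab huW ?_ ?_)
    · exact fun e => huK (.inl e)
    · exact fun e => huK (.inr e)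
  · -- `D` is attached to at least two vertices of the triangle
    have hDW' : comp G (W \ K) u ⊆ W \ K := comp_sub
    have hDW := hDW'.trans Finset.sdiff_subset
    have att : ∀ v ∈ K, ∃ e ∈ comp G (W \ K) u, ∃ s ∈ K, s ≠ v ∧ G.Adj e s := by
      intro v hv
      have huv : u ≠ v := fun e => huK (e ▸ hv)
      obtain ⟨b, hb, r⟩ := (hs v (hKW hv) u huW huv).2
      have hb' := r.right
      rw [Finset.mem_erase] at hb'
      obtain ⟨e, he, s, hs', _, hes⟩ := attach (S := K.erase v) r (by simp [huK])
        (Finset.mem_erase.2 ⟨hb'.1, hBK b hb hb'.2⟩)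
      rw [Finset.mem_erase] at hs'
      refine ⟨e, ?_, s, hs'.2, hs'.1, hes⟩
      have e2 : W.erase v \ K.erase v = W \ K := by
        ext z; simp only [Finset.mem_sdiff, Finset.mem_erase]
        by_cases e : z = v
        · simp [e, hv]
        · simp [e]
      rwa [e2] at he
    obtain ⟨e₁, he₁, a, ha, _, hea⟩ := att τ hτ
    obtain ⟨e₂, he₂, b, hb, hba, heb⟩ := att a ha
    have hKb : (K.erase b).card = 2 := by rw [Finset.card_erase_of_mem hb]; omega
    have hri : RI G (comp G (W \ K) u) (nb G (K.erase b)) (nb G {b}) := by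
      refine h.star_cmp hs ⟨e₁, mem_nb.2 ⟨a, by simp [ha, hba.symm], hea.symm⟩, he₁⟩
        ⟨e₂, mem_nb1.2 heb.symm, he₂⟩ (fun w hw hwB => ?_) fun w hw s _ hs hws => ?_
      · exact absurd (hBK w hwB (hDW hw)) (Finset.mem_sdiff.1 (hDW' hw)).2
      · by_cases e : s = b
        · subst e; exact .inr (mem_nb1.2 hws.symm)
        · exact .inl (mem_nb.2 ⟨s, by simp [e, hs], hws.symm⟩)
    obtain ⟨l, hl, hl'⟩ := exact2_of_four' hri fun w hw => by
      have hwW := hDW hw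
      have hwK := (Finset.mem_sdiff.1 (hDW' hw)).2
      have h1 := hd w hwW
      have h3 := dg_comp hw
      have h5 : dg G K w ≤ dg G (K.erase b) w + dg G {b} w := dg_le fun z hz _ => by
        by_cases e : z = b <;> simp [e, hz]
      have h6 : dg G (K.erase b) w ≤ _ := dg_le_card
      have h7 : dg G {b} w ≤ lab (nb G {b}) w :=
        dg_le_lab (dg_le_card.trans (by simp)) fun x hx _ => hx
      have h8 : lab A w = 0 := lab_neg fun hh => hwK (hAK w hh hwW)
      have h9 : lab B w = 0 := lab_neg fun hh => hwK (hBK w hh hwW)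
      by_cases h10 : 1 ≤ dg G (K.erase b) w
      · have := lab_nb h10
        unfold ld at *; omega
      · unfold ld at *; omega
    have hbD : b ∉ comp G (W \ K) u := fun hh => (Finset.mem_sdiff.1 (hDW' hh)).2 hb
    refine .of_exact2 (K := fun m => m < 2) (c := 2) hl hl' (k := 0) (δ := 1) (by omega) (by omega)
      (.inl rfl) fun n hn m hm => ?_
    have h11 : Lens G (comp G (W \ K) u ∪ {b}) (nb G (K.erase b)) B (n + 1) :=
      hn.joinR (k := 0) (fun t ht => ⟨t, hKB (by rw [Finset.mem_singleton.1 ht]; exact hb),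
        .nil ht⟩) (by simp [hbD]) Finset.subset_union_right
        Finset.subset_union_left
    have := h11.clq (W := W) (A := A) (hK.mono (Finset.erase_subset b K))
      ((Finset.erase_subset _ _).trans hKA)
      ((Finset.erase_subset _ _).trans hKW) (Finset.union_subset hDW (by simpa using hKW hb)) ?_
      (hm.trans_le hKb.ge)
    · convert this using 1; omega
    · refine Finset.disjoint_left.2 fun z hz hz' => ?_
      rw [Finset.mem_erase] at hz
      rw [Finset.mem_union, Finset.mem_singleton] at hz'
      rcases hz' with hz' | hz'
      · exact (Finset.mem_sdiff.1 (hDW' hz')).2 hz.2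
      · exact hz.1 hz'

theorem y3_of_five_aux (N : ℕ) : ∀ W A B : Finset V, W.card = N → RI G W A B →
    (∀ w ∈ W, 5 ≤ ld G W A B w) → Y3 (Lens G W A B) := by
  induction N using Nat.strong_induction_on with
  | _ N ih =>
    intro W A B hN h hd
    have hrec : ∀ A B, RI G W A B → (∀ w ∈ W, 5 ≤ ld G W A B w) →
        ∀ E A' B', Red G W A B E A' B' → Y3 (Lens G W A B) := by
      intro A B h hd E A' B' hr
      obtain ⟨c, hc⟩ := hr.lens
      exact (ih _ (hN ▸ hr.lt) E A' B' rfl hr.ri (hr.card_lt hd)).shift hc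
    have hd' : ∀ w ∈ W, 5 ≤ ld G W B A w := fun w hw => (hd w hw).trans_eq ld_comm
    have swap : Y3 (Lens G W B A) → Y3 (Lens G W A B) := fun hh =>
      hh.shift (c := 0) fun n hn => hn.symm
    rcases star_or_red h with hs | ⟨E, A', B', hr⟩
    swap
    · exact hrec _ _ h hd _ _ _ hr
    rcases nc_or_cut h hs with hnc | ⟨X, Y, v, hX, hY, _, _, hXW, hYW, hXd, hYd, hl⟩
    swap
    · obtain ⟨l, h1, h2⟩ := exact2_of_four' hX fun w hw => by
        have := hXd w hw
        have := hd w (hXW hw)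
        omega
      obtain ⟨k, k1, k2⟩ := ap2_of_three hY fun w hw => by
        have := hYd w hw
        have := hd w (hYW hw)
        omega
      exact .of_exact2' h1 h2 k1 k2 (c := 2) fun n hn m hm => hl n m hn hm
    by_cases hA : ∃ x ∈ A, x ∈ W ∧ ∃ y ∈ A, y ∈ W ∧ G.Adj x y
    · obtain ⟨x, hx, hxW, y, hy, hyW, hxy⟩ := hA
      exact edge_case h hs hd (hrec _ _ h hd) hx hxW hy hyW hxy
    by_cases hB : ∃ x ∈ B, x ∈ W ∧ ∃ y ∈ B, y ∈ W ∧ G.Adj x y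
    · obtain ⟨x, hx, hxW, y, hy, hyW, hxy⟩ := hB
      exact swap (edge_case h.symm hs.symm hd' (hrec _ _ h.symm hd') hx hxW hy hyW hxy)
    push Not at hA hB
    by_cases hn : NoColl G W A
    · obtain ⟨E, A', B', hr⟩ := red_contract h hs hn fun w hw => (by omega : 4 ≤ 5).trans (hd w hw)
      exact hrec _ _ h hd _ _ _ hr
    unfold NoColl at hn
    push Not at hn
    obtain ⟨p, hp, x, hx, y, hy, hpx, hpy, hxy⟩ := hn
    rw [Finset.mem_inter] at hx hy
    by_cases hb : ∃ b ∈ B, b ∈ W ∧ b ≠ p ∧ b ≠ x ∧ b ≠ y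
    · obtain ⟨b, hb, hbW, hbp, hbx, hby⟩ := hb
      exact coll_side h hs hnc hd (hrec _ _ h hd) (fun u hu huW v hv hvW => hA u hu huW v hv hvW) hp
        hx.1 hx.2 hy.1 hy.2 hxy hpx hpy hb hbW hbp hbx hby
    push Not at hb
    have hpB : p ∉ B := by
      intro hpB
      obtain ⟨b, hbB, hbW, hbp⟩ := hs.two hp hx.2 hpx.ne p
      by_cases e : b = x
      · exact hB p hpB hp b hbB hbW (e ▸ hpx)
      · exact hB p hpB hp b hbB hbW (hb b hbB hbW hbp e ▸ hpy)
    have hBxy : ∀ b ∈ B, b ∈ W → b = x ∨ b = y := fun b hbB hbW => by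
      by_cases e : b = x
      · exact .inl e
      · exact .inr (hb b hbB hbW (fun e => hpB (e ▸ hbB)) e)
    have hyB : y ∈ B := by
      obtain ⟨b, hbB, hbW, hbx⟩ := hs.two hp hx.2 hpx.ne x
      exact (hBxy b hbB hbW).resolve_left hbx ▸ hbB
    have hxB : x ∈ B := by
      obtain ⟨b, hbB, hbW, hbx⟩ := hs.two hp hx.2 hpx.ne y
      exact (hBxy b hbB hbW).resolve_right hbx ▸ hbB
    have hpA : p ∉ A := fun hh => hA p hh hp x hx.1 hx.2 hpx
    by_cases ha : ∃ a ∈ A, a ∈ W ∧ a ≠ x ∧ a ≠ y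
    · obtain ⟨a, haA, haW, hax, hay⟩ := ha
      exact swap (coll_side h.symm hs.symm hnc hd' (hrec _ _ h.symm hd')
        (fun u hu huW v hv hvW => hB u hu huW v hv hvW) hp
        hxB hx.2 hyB hy.2 hxy hpx hpy haA haW (fun e => hpA (e ▸ haA)) hax hay)
    push Not at ha
    refine hrec _ _ h hd _ _ _ (two_roots h hs hx.1 hyB hx.2 hy.2 (fun a haA haW => ?_) hBxy hxy hp
      hpx.ne hpy.ne)
    by_cases e : a = x
    · exact .inl e
    · exact .inr (ha a haA haW e)

theorem y3_of_five {W A B : Finset V} (h : RI G W A B) (hd : ∀ w ∈ W, 5 ≤ ld G W A B w) :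
    Y3 (Lens G W A B) := y3_of_five_aux _ W A B rfl h hd

theorem y3_coll_sparse {W A B : Finset V} {p x y : V} (h3 : NoTri G) (h4 : NoSq G)
    (h : RI G W A B) (hs : Star G W A B) (hnc : NC G W) (hd : ∀ w ∈ W, 4 ≤ ld G W A B w)
    (hsp : Sparse G W B) (hrec : ∀ E A' B', Red G W A B E A' B' → Y3 (Lens G W A B))
    (hp : p ∈ W) (hx : x ∈ A) (hxW : x ∈ W) (hy : y ∈ A) (hyW : y ∈ W) (hxy : x ≠ y)
    (hpx : G.Adj p x) (hpy : G.Adj p y) : Y3 (Lens G W A B) := by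
  obtain ⟨T, hTdef⟩ : ∃ T : Finset V, ∀ t, t ∈ T ↔ t ∈ A ∧ t ∈ W ∧ G.Adj p t :=
    ⟨(A ∩ W).filter (G.Adj p), fun t => by simp [and_assoc]⟩
  have hT : ∀ t ∈ T, t ∈ A ∧ t ∈ W ∧ G.Adj p t := fun t ht => (hTdef t).1 ht
  have hxT : x ∈ T := (hTdef x).2 ⟨hx, hxW, hpx⟩
  have hyT : y ∈ T := (hTdef y).2 ⟨hy, hyW, hpy⟩
  obtain ⟨b₁, hb₁, hb₁W, _⟩ := hs.two hxW hyW hxy x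
  obtain ⟨b₂, hb₂, hb₂W, hb₂₁⟩ := hs.two hxW hyW hxy b₁
  have hsb := hsp b₁ hb₁ hb₁W b₂ hb₂ hb₂W hb₂₁.symm
  obtain ⟨b₀, hb, hbW, hbH⟩ : ∃ b ∈ B, b ∈ W ∧ b ∉ insert p T := by
    by_contra hcon
    push Not at hcon
    have e1 := hcon b₁ hb₁ hb₁W
    have e2 := hcon b₂ hb₂ hb₂W
    rw [Finset.mem_insert] at e1 e2
    rcases e1 with rfl | e1 <;> rcases e2 with rfl | e2
    · exact hb₂₁ rfl
    · exact hsb.1 (hT _ e2).2.2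
    · exact hsb.1 (hT _ e1).2.2.symm
    · exact hsb.2 p hp (hT _ e1).2.2 (hT _ e2).2.2
  rcases trouble (m := 4) (τ := x) le_rfl h hs hnc hd hp hT hxT hb hbW hbH
    with hr | ⟨E, v, hr⟩ | ⟨E, v, l, δ, hr, hEW, hv, hδ, hdeg, hl⟩
  · obtain ⟨l, hl, hl'⟩ := ap2_of_three hr fun w hw => by
      have hwS := comp_sub hw
      rw [Finset.mem_sdiff, Finset.mem_insert, not_or] at hwS
      have h1 := hd w hwS.1
      have h2 := dg_comp hw
      have h7 := lab_le (A := A) (w := w)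
      have h5 : dg G (insert p T) w ≤ 1 := dg_le_one fun u hu v hv hwu hwv => by
        rw [Finset.mem_insert] at hu hv
        rcases hu with rfl | hu <;> rcases hv with rfl | hv
        · rfl
        · exact (h3 w u v hwu (hT v hv).2.2 hwv).elim
        · exact (h3 w v u hwv (hT u hu).2.2 hwu).elim
        · exact h4 p w u v (Ne.symm hwS.2.1) (hT u hu).2.2 hwu (hT v hv).2.2 hwv
      by_cases h8 : 1 ≤ dg G T w
      · have h9 := lab_nb h8
        unfold ld at *; omega
      · by_cases hwp : G.Adj p w
        · have : lab A w = 0 := lab_neg fun hh => hwS.2.2 ((hTdef w).2 ⟨hh, hwS.1, hwp⟩)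
          unfold ld at *; omega
        · have h10 : dg G (insert p T) w ≤ dg G {p} w + dg G T w := by
            rw [Finset.insert_eq]; exact dg_union
          have h11 : dg G {p} w = 0 := dg_zero fun z hz => by
            rw [Finset.mem_singleton.1 hz]; exact fun hh => hwp hh.symm
          unfold ld at *; omega
    refine .of_exact2' (S := fun m => m = 0 ∨ m = 2) (l := 0) (c := 1) (by simp) (by simp) hl hl' ?_
    rintro m hm n hn
    have := coll_lens hp hT hxT hyT hxy comp_sub hn
    rcases hm with rfl | rfl
    · convert this.1 using 1; omega
    · convert this.2 using 1; omega
  · exact hrec _ _ _ hr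
  · obtain ⟨n, hn, hn'⟩ := exact2_of_three h3 h4 hr (fun w hw => by
      have := hdeg w hw
      have := hd w (hEW hw)
      omega) (sparse_nb h3 h4 hv)
    refine .of_exact2 (K := fun m => m = l ∨ m = l + δ) (c := 0) hn hn' (k := l) (δ := δ)
      (by simp) (by simp) hδ ?_
    rintro n hn m (rfl | rfl)
    · exact (hl n hn).1
    · exact (hl n hn).2

theorem y3_of_four_aux (h3 : NoTri G) (h4 : NoSq G) (N : ℕ) : ∀ W A B : Finset V, W.card = N →
    RI G W A B → (∀ w ∈ W, 4 ≤ ld G W A B w) → Sparse G W B → Y3 (Lens G W A B) := by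
  induction N using Nat.strong_induction_on with
  | _ N ih =>
    intro W A B hN h hd hsp
    have hrec : ∀ E A' B', Red G W A B E A' B' → Y3 (Lens G W A B) := by
      intro E A' B' hr
      obtain ⟨c, hc⟩ := hr.lens
      exact (ih _ (hN ▸ hr.lt) E A' B' rfl hr.ri (fun w hw => (hd w (hr.sub hw)).trans (hr.deg w hw))
        (hr.sparse h3 h4 hsp)).shift hc
    rcases star_or_red h with hs | ⟨E, A', B', hr⟩
    swap
    · exact hrec _ _ _ hr
    rcases nc_or_cut h hs with hnc | ⟨X, Y, v, hX, hY, hvX, hvY, hXW, hYW, hXd, hYd, hl⟩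
    swap
    · obtain ⟨l, h1, h2⟩ := exact2_of_three h3 h4 hX (fun w hw => by
        have := hXd w hw
        have := hd w (hXW hw)
        omega) (sparse_nb h3 h4 hvX)
      obtain ⟨k, k1, k2⟩ := ap2_of_three hY fun w hw => by
        have := hYd w hw
        have := hd w (hYW hw)
        omega
      exact .of_exact2' h1 h2 k1 k2 (c := 2) fun n hn m hm => hl n m hn hm
    by_cases hn : NoColl G W A
    · obtain ⟨E, A', B', hr⟩ := red_contract h hs hn hd
      exact hrec _ _ _ hr
    unfold NoColl at hn
    push Not at hn
    obtain ⟨p, hp, x, hx, y, hy, hpx, hpy, hxy⟩ := hn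
    rw [Finset.mem_inter] at hx hy
    exact y3_coll_sparse h3 h4 h hs hnc hd hsp hrec hp hx.1 hx.2 hy.1 hy.2 hxy hpx hpy

theorem y3_of_four {W A B : Finset V} (h3 : NoTri G) (h4 : NoSq G) (h : RI G W A B)
    (hd : ∀ w ∈ W, 4 ≤ ld G W A B w) (hs : Sparse G W B) : Y3 (Lens G W A B) :=
  y3_of_four_aux h3 h4 _ W A B rfl h hd hs

/-- All edges between `S` and `T` are present. -/
def Bip (G : SimpleGraph V) (S T : Finset V) : Prop := ∀ σ ∈ S, ∀ τ ∈ T, G.Adj σ τ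

theorem Bip.symm {S T : Finset V} (h : Bip G S T) : Bip G T S := fun τ hτ σ hσ => (h σ hσ τ hτ).symm

theorem Bip.mono {S T S' T' : Finset V} (h : Bip G S T) (hS : S' ⊆ S) (hT : T' ⊆ T) : Bip G S' T' :=
  fun σ hσ τ hτ => h σ (hS hσ) τ (hT hτ)

theorem Bip.disj {S T : Finset V} (h : Bip G S T) : Disjoint S T :=
  Finset.disjoint_left.2 fun x hx hx' => (h x hx x hx').ne rfl

theorem Bip.even {j : ℕ} : ∀ {S T : Finset V} {τ : V}, Bip G S T → τ ∈ T → j ≤ S.card →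
    j + 1 ≤ T.card → ∃ τ' ∈ T, PL G (S ∪ T) τ' τ (2 * j) := by
  induction j with
  | zero => exact fun {S T τ} _ hτ _ _ => ⟨τ, hτ, .nil (by simp [hτ])⟩
  | succ j ih =>
    intro S T τ h hτ hS hT
    have hc := Finset.card_erase_of_mem hτ
    obtain ⟨σ, hσ⟩ : S.Nonempty := Finset.card_pos.1 (by omega)
    have hc' := Finset.card_erase_of_mem hσ
    obtain ⟨τ₁, hτ₁⟩ : (T.erase τ).Nonempty := Finset.card_pos.1 (by omega)
    obtain ⟨τ', hτ', q⟩ := ih (h.mono (Finset.erase_subset σ S) (Finset.erase_subset τ T)) hτ₁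
      (by omega) (by omega)
    have hd := Finset.disjoint_left.1 h.disj
    have q1 : PL G (S ∪ T.erase τ) τ' σ (2 * j + 1) :=
      q.snoc (h σ hσ τ₁ (Finset.mem_of_mem_erase hτ₁)).symm
        (by simpa using fun _ => hd hσ) (by simp [hσ])
        (Finset.union_subset_union_left (Finset.erase_subset _ _))
    exact ⟨τ', Finset.mem_of_mem_erase hτ', q1.snoc (h σ hσ τ hτ)
      (by simpa using fun hh => hd hh hτ) (by simp [hτ])
      (Finset.union_subset_union_right (Finset.erase_subset _ _))⟩

theorem Bip.odd {S T : Finset V} {σ : V} {j : ℕ} (h : Bip G S T) (hσ : σ ∈ S) (hS : j + 1 ≤ S.card)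
    (hT : j + 1 ≤ T.card) : ∃ τ' ∈ T, PL G (S ∪ T) τ' σ (2 * j + 1) := by
  have hc' := Finset.card_erase_of_mem hσ
  obtain ⟨τ, hτ⟩ : T.Nonempty := Finset.card_pos.1 (by omega)
  obtain ⟨τ', hτ', q⟩ := (h.mono (Finset.erase_subset σ S) subset_rfl).even (j := j) hτ
    (by omega) (by omega)
  exact ⟨τ', hτ', q.snoc (h σ hσ τ hτ).symm
    (by simpa using Finset.disjoint_left.1 h.disj hσ) (by simp [hσ])
    (Finset.union_subset_union_left (Finset.erase_subset _ _))⟩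

theorem Bip.odd₂ {S T : Finset V} {σ τ : V} {j : ℕ} (h : Bip G S T) (hσ : σ ∈ S) (hτ : τ ∈ T)
    (hS : j + 1 ≤ S.card) (hT : j + 1 ≤ T.card) : PL G (S ∪ T) τ σ (2 * j + 1) := by
  have hc' := Finset.card_erase_of_mem hσ
  obtain ⟨τ', hτ', q⟩ := (h.mono (Finset.erase_subset σ S) subset_rfl).even (j := j) hτ
    (by omega) (by omega)
  exact q.symm.snoc (h σ hσ τ' hτ').symm
    (by simpa using Finset.disjoint_left.1 h.disj hσ) (by simp [hσ])
    (Finset.union_subset_union_left (Finset.erase_subset _ _))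

theorem Bip.even₂ {S T : Finset V} {τ τ' : V} {j : ℕ} (h : Bip G S T) (hτ : τ ∈ T) (hτ' : τ' ∈ T)
    (hne : τ ≠ τ') (h1 : 1 ≤ j) (hS : j ≤ S.card) (hT : j + 1 ≤ T.card) :
    PL G (S ∪ T) τ τ' (2 * j) := by
  obtain ⟨i, rfl⟩ : ∃ i, j = i + 1 := ⟨j - 1, by omega⟩
  have hc := Finset.card_erase_of_mem hτ'
  obtain ⟨σ, hσ⟩ : S.Nonempty := Finset.card_pos.1 (by omega)
  have q := (h.mono subset_rfl (Finset.erase_subset τ' T)).odd₂ (j := i) hσ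
    (Finset.mem_erase.2 ⟨hne, hτ⟩) (by omega) (by omega)
  exact q.snoc (h σ hσ τ' hτ') (by simpa using fun hh => Finset.disjoint_left.1 h.disj hh hτ')
    (by simp [hτ']) (Finset.union_subset_union_right (Finset.erase_subset _ _))

theorem Lens.even {W A B D S T : Finset V} {n j : ℕ} (h : Bip G S T) (hTA : T ⊆ A) (hTW : T ⊆ W)
    (hSW : S ⊆ W) (hDW : D ⊆ W) (hd : Disjoint (S ∪ T) D) (hn : Lens G D (nb G T) B n)
    (hS : j ≤ S.card) (hT : j + 1 ≤ T.card) : Lens G W A B (2 * j + n + 1) := by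
  have := hn.joinL (W := W) (A := A) (k := 2 * j) (fun t ht => by
    obtain ⟨τ, hτ, q⟩ := h.even ht hS hT
    exact ⟨τ, hTA hτ, q⟩) hd (Finset.union_subset hSW hTW) hDW
  convert this using 1; omega

theorem Lens.odd {W A B D S T : Finset V} {n j : ℕ} (h : Bip G S T) (hTA : T ⊆ A) (hTW : T ⊆ W)
    (hSW : S ⊆ W) (hDW : D ⊆ W) (hd : Disjoint (S ∪ T) D) (hn : Lens G D (nb G S) B n)
    (hS : j + 1 ≤ S.card) (hT : j + 1 ≤ T.card) : Lens G W A B (2 * j + n + 2) := by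
  have := hn.joinL (W := W) (A := A) (k := 2 * j + 1) (fun t ht => by
    obtain ⟨τ, hτ, q⟩ := h.odd ht hS hT
    exact ⟨τ, hTA hτ, q⟩) hd (Finset.union_subset hSW hTW) hDW
  convert this using 1; omega

theorem AP.evens {s : ℕ} : AP s fun m => ∃ j < s, m = 2 * j :=
  ⟨0, 2, .inr rfl, fun i hi => ⟨i, hi, by omega⟩⟩

theorem AP.two {S : ℕ → Prop} {l δ : ℕ} (hδ : δ = 1 ∨ δ = 2) (h1 : S l) (h2 : S (l + δ)) :
    AP 2 S := ⟨l, δ, hδ, fun i hi => by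
  rcases (by omega : i = 0 ∨ i = 1) with rfl | rfl
  · simpa using h1
  · simpa using h2⟩

theorem RI.lens {W A B : Finset V} (h : RI G W A B) : ∃ n, Lens G W A B n := by
  obtain ⟨a, ha, haW⟩ := h.hA
  obtain ⟨b, hb, hbW⟩ := h.hB
  obtain ⟨n, q⟩ := (h.conn a haW b hbW).path
  exact ⟨n, a, ha, b, hb, q⟩

/-- Rooted instances of minimum labelled degree `d + 1` have `d` path lengths in progression. -/
def Th (G : SimpleGraph V) (d : ℕ) : Prop := ∀ W A B : Finset V, RI G W A B →
  (∀ w ∈ W, d + 1 ≤ ld G W A B w) → AP d (Lens G W A B)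

theorem th_one : Th G 1 := fun W A B h _ => by
  obtain ⟨n, hn⟩ := h.lens
  exact .one hn

theorem th_two : Th G 2 := fun W A B h hd => by
  obtain ⟨l, h1, h2 | h2⟩ := ap2_of_three h hd
  · exact .two (.inr rfl) h1 h2
  · exact .two (.inl rfl) h1 h2

theorem th_loss {d r c : ℕ} {E A' B' : Finset V} {K S' : ℕ → Prop}
    (ih : ∀ d', 1 ≤ d' → d' < d → Th G d') (h : RI G E A' B')
    (hd : ∀ w ∈ E, d + 1 ≤ ld G E A' B' w + r) (hr : 1 ≤ r) (hK : AP (r + 1) K)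
    (hc : ∀ x, K x → ∀ y, Lens G E A' B' y → S' (x + y + c)) : AP d S' := by
  by_cases hrd : d ≤ r
  · obtain ⟨n, hn⟩ := h.lens
    exact (AP.add (by omega) le_rfl hK (.one hn) hc).le (by omega)
  · exact (AP.add (by omega) (by omega) hK (ih (d - r) (by omega) (by omega) E A' B' h
      fun w hw => by have := hd w hw; omega) hc).le (by omega)

theorem RI.nc {W E A' B' : Finset V} {z : V} (hnc : NC G W) (hE : E ⊆ W) (hz : z ∈ W) (hzE : z ∉ E)
    (hc : ∀ x ∈ E, ∀ y ∈ E, Reach G E x y) (hA : ∃ a ∈ A', a ∈ E) (hB : ∃ b ∈ B', b ∈ E)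
    (h2 : ∀ w ∈ E, ∀ s ∈ W, s ∉ E → G.Adj w s → w ∈ A' ∨ w ∈ B') : RI G E A' B' := by
  refine ⟨hc, hA, hB, fun x hx y hy hyx => ?_⟩
  have hzx : z ≠ x := fun e => hzE (e ▸ hx)
  rcases (hnc x (hE hx) y (hE hy) z hz hyx hzx).exit (E.erase x) (by simp [hy, hyx])
    with h3 | ⟨w, s, h3, h4, h5, h6⟩
  · have := h3.right
    simp only [Finset.mem_inter, Finset.mem_erase] at this
    exact absurd this.2.2 hzE
  · have h7 := h3.right
    simp only [Finset.mem_inter, Finset.mem_erase] at h7 h4 h5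
    exact ⟨w, h2 w h7.2.2 s h4.2 (fun hh => h5 ⟨h4.1, hh⟩) h6, h3.mono Finset.inter_subset_right⟩

/-- A connected proper part of `W` is adjacent to some vertex outside it other than `v`. -/
theorem NC.exit {W E : Finset V} {v u z : V} (hnc : NC G W) (hE : E ⊆ W) (hu : u ∈ E) (hv : v ∈ W)
    (hvE : v ∉ E) (hz : z ∈ W) (hzE : z ∉ E) (hzv : z ≠ v) :
    ∃ e ∈ E, ∃ s ∈ W, s ∉ E ∧ s ≠ v ∧ G.Adj e s := by
  rcases (hnc v hv u (hE hu) z hz (fun e => hvE (e ▸ hu)) hzv).exit E hu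
    with h3 | ⟨w, s, h3, h4, h5, h6⟩
  · exact absurd (Finset.mem_inter.1 h3.right).2 hzE
  · rw [Finset.mem_erase] at h4
    exact ⟨w, (Finset.mem_inter.1 h3.right).2, s, h4.2, h5, h4.1, h6⟩

structure Ctx (G : SimpleGraph V) (d : ℕ) (W A B : Finset V) : Prop where
  ri : RI G W A B
  star : Star G W A B
  nc : NC G W
  deg : ∀ w ∈ W, d + 1 ≤ ld G W A B w
  three : 3 ≤ d
  tri : NoTri G
  ih : ∀ d', 1 ≤ d' → d' < d → Th G d'
  hrec : ∀ E A' B' c, E.card < W.card → RI G E A' B' → (∀ w ∈ E, d + 1 ≤ ld G E A' B' w) →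
    (∀ n, Lens G E A' B' n → Lens G W A B (n + c)) → AP d (Lens G W A B)

theorem AP.swap {d : ℕ} {W A B : Finset V} (h : AP d (Lens G W B A)) : AP d (Lens G W A B) :=
  h.shift (c := 0) fun _ hn => hn.symm

theorem Ctx.symm {d : ℕ} {W A B : Finset V} (h : Ctx G d W A B) : Ctx G d W B A :=
  ⟨h.ri.symm, h.star.symm, h.nc, fun w hw => (h.deg w hw).trans_eq ld_comm, h.three, h.tri, h.ih,
    fun E A' B' c h1 h2 h3 h4 => (h.hrec E A' B' c h1 h2 h3 fun n hn => (h4 n hn).symm).swap⟩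

theorem Ctx.red {d : ℕ} {W A B E A' B' : Finset V} (h : Ctx G d W A B) (r : Red G W A B E A' B') :
    AP d (Lens G W A B) := by
  obtain ⟨c, hc⟩ := r.lens
  exact h.hrec E A' B' c r.lt r.ri (fun w hw => (h.deg w (r.sub hw)).trans (r.deg w hw)) hc

theorem dg_tri {x y w : V} (h3 : NoTri G) (hxy : G.Adj x y) : dg G {x, y} w ≤ 1 :=
  dg_le_one fun u hu v hv hwu hwv => by
    simp only [Finset.mem_insert, Finset.mem_singleton] at hu hv
    rcases hu with rfl | rfl <;> rcases hv with rfl | rfl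
    · rfl
    · exact (h3 w u v hwu hxy hwv).elim
    · exact (h3 w v u hwv hxy hwu).elim
    · rfl

theorem Ctx.edge_side {d : ℕ} {W A B : Finset V} {x y b₀ : V} (h : Ctx G d W A B)
    (hx : x ∈ A) (hxW : x ∈ W) (hy : y ∈ A) (hyW : y ∈ W) (hxy : G.Adj x y) (hb : b₀ ∈ B)
    (hbW : b₀ ∈ W) (hbx : b₀ ≠ x) (hby : b₀ ≠ y) : AP d (Lens G W A B) := by
  have hK : Clq G {x, y} := fun a ha b hb hab => by
    rw [Finset.mem_insert, Finset.mem_singleton] at ha hb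
    rcases ha with rfl | rfl <;> rcases hb with rfl | rfl <;>
      first | exact absurd rfl hab | exact hxy | exact hxy.symm
  have hKA : ({x, y} : Finset V) ⊆ A := by simp [Finset.insert_subset_iff, hx, hy]
  have hKW : ({x, y} : Finset V) ⊆ W := by simp [Finset.insert_subset_iff, hxW, hyW]
  have hr := h.ri.star_out (H := {x, y}) (τ := x) h.star hb hbW (by simp [hbx, hby]) (by simp) hxW
  have hDW' : comp G (W \ {x, y}) b₀ ⊆ W \ {x, y} := comp_sub
  have hDW := hDW'.trans Finset.sdiff_subset
  refine th_loss (K := fun m => m < 2) (r := 1) (c := 1) h.ih hr (fun w hw => ?_) le_rfl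
    (.two (l := 0) (δ := 1) (.inl rfl) (by omega) (by omega)) fun m hm n hn => ?_
  · have h1 := h.deg w (hDW hw)
    have h2 := dg_comp hw
    have h3 := dg_tri (w := w) h.tri hxy
    have h4 := lab_le (A := A) (w := w)
    by_cases h6 : 1 ≤ dg G {x, y} w
    · have := lab_nb h6
      unfold ld at *; omega
    · unfold ld at *; omega
  · rw [add_comm m]
    exact hn.clq hK hKA hKW hDW (Finset.disjoint_right.2 fun x hx => (Finset.mem_sdiff.1 (hDW' hx)).2)
      (by rwa [Finset.card_pair hxy.ne])

theorem Ctx.edge {d : ℕ} {W A B : Finset V} {x y : V} (h : Ctx G d W A B)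
    (hx : x ∈ A) (hxW : x ∈ W) (hy : y ∈ A) (hyW : y ∈ W) (hxy : G.Adj x y) :
    AP d (Lens G W A B) := by
  by_cases hb : ∃ b ∈ B, b ∈ W ∧ b ≠ x ∧ b ≠ y
  · obtain ⟨b, hb, hbW, hbx, hby⟩ := hb
    exact h.edge_side hx hxW hy hyW hxy hb hbW hbx hby
  push Not at hb
  have hBxy : ∀ b ∈ B, b ∈ W → b = x ∨ b = y := fun b hbB hbW => by
    by_cases e : b = x
    · exact .inl e
    · exact .inr (hb b hbB hbW e)
  have hyB : y ∈ B := by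
    obtain ⟨b, hbB, hbW, hbx⟩ := h.star.two hxW hyW hxy.ne x
    exact (hBxy b hbB hbW).resolve_left hbx ▸ hbB
  have hxB : x ∈ B := by
    obtain ⟨b, hbB, hbW, hbx⟩ := h.star.two hxW hyW hxy.ne y
    exact (hBxy b hbB hbW).resolve_right hbx ▸ hbB
  by_cases ha : ∃ a ∈ A, a ∈ W ∧ a ≠ x ∧ a ≠ y
  · obtain ⟨a, haA, haW, hax, hay⟩ := ha
    exact (h.symm.edge_side hxB hxW hyB hyW hxy haA haW hax hay).swap
  push Not at ha
  obtain ⟨u, huW, hux, huy⟩ : ∃ u ∈ W, u ≠ x ∧ u ≠ y := by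
    by_contra hcon
    push Not at hcon
    have h1 := h.deg x hxW
    have h2 : dg G W x ≤ dg G {y} x := by
      rw [dg_self_erase]
      exact dg_mono fun z hz => by
        rw [Finset.mem_erase] at hz
        simp [hcon z hz.2 hz.1]
    have h3 : dg G {y} x ≤ 1 := dg_le_card
    have := lab_le (A := A) (w := x)
    have := lab_le (A := B) (w := x)
    have := h.three
    unfold ld at h1; omega
  refine h.red (two_roots h.ri h.star hx hyB hxW hyW (fun a haA haW => ?_) hBxy hxy.ne huW hux huy)
  by_cases e : a = x
  · exact .inl e
  · exact .inr (ha a haA haW e)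

def Indep (G : SimpleGraph V) (W A : Finset V) : Prop :=
  ∀ x ∈ A, x ∈ W → ∀ y ∈ A, y ∈ W → ¬ G.Adj x y

structure Mx (G : SimpleGraph V) (W A S T : Finset V) : Prop where
  sub : S ⊆ W
  ne : S.Nonempty
  disj : ∀ x ∈ S, x ∉ A
  mem : ∀ x, x ∈ T ↔ x ∈ A ∧ x ∈ W ∧ ∀ σ ∈ S, G.Adj σ x
  card : S.card + 1 ≤ T.card
  max : ∀ S' T' : Finset V, S' ⊆ W → S'.Nonempty → (∀ x ∈ S', x ∉ A) →
    (∀ x, x ∈ T' ↔ x ∈ A ∧ x ∈ W ∧ ∀ σ ∈ S', G.Adj σ x) → S'.card + 1 ≤ T'.card →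
    S'.card ≤ S.card

theorem exists_mx {W A : Finset V} (hI : Indep G W A) (hn : ¬ NoColl G W A) :
    ∃ S T, Mx G W A S T := by
  unfold NoColl at hn
  push Not at hn
  obtain ⟨p, hp, x, hx, y, hy, hpx, hpy, hxy⟩ := hn
  rw [Finset.mem_inter] at hx hy
  let P : Finset V → Prop := fun S => S.Nonempty ∧ (∀ x ∈ S, x ∉ A) ∧
    S.card + 1 ≤ ((A ∩ W).filter fun x => ∀ σ ∈ S, G.Adj σ x).card
  have hpP : {p} ∈ W.powerset.filter P := by
    refine Finset.mem_filter.2 ⟨by simpa using hp, by simp, fun z hz hzA => ?_, ?_⟩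
    · rw [Finset.mem_singleton] at hz
      subst hz
      exact hI z hzA hp x hx.1 hx.2 hpx
    · rw [Finset.card_singleton]
      exact Finset.one_lt_card.2 ⟨x, by simp [hx, hpx], y, by simp [hy, hpy], hxy⟩
  obtain ⟨S, hS, hmax⟩ := Finset.exists_max_image (W.powerset.filter P) Finset.card ⟨_, hpP⟩
  rw [Finset.mem_filter, Finset.mem_powerset] at hS
  refine ⟨S, _, hS.1, hS.2.1, hS.2.2.1, fun x => ?_, hS.2.2.2, fun S' T' h1 h2 h3 h4 h5 => ?_⟩
  · simp [and_assoc]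
  · refine hmax S' (Finset.mem_filter.2 ⟨Finset.mem_powerset.2 h1, h2, h3, ?_⟩)
    convert h5 using 2
    ext x
    simp [h4, and_assoc]

section
variable {W A B S T : Finset V} (m : Mx G W A S T)
include m

theorem Mx.bip : Bip G S T := fun σ hσ τ hτ => ((m.mem τ).1 hτ).2.2 σ hσ
theorem Mx.subA : T ⊆ A := fun τ hτ => ((m.mem τ).1 hτ).1
theorem Mx.subW : T ⊆ W := fun τ hτ => ((m.mem τ).1 hτ).2.1
theorem Mx.pos : 1 ≤ S.card := m.ne.card_pos

theorem Mx.dgT {w : V} (hw : w ∈ W) (hwA : w ∉ A) (hwS : w ∉ S) : dg G T w ≤ S.card + 1 := by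
  by_contra hcon
  have h1 := m.max (insert w S) (T.filter fun x => G.Adj w x)
    (Finset.insert_subset hw m.sub) (Finset.insert_nonempty _ _)
    (fun x hx => by
      rcases Finset.mem_insert.1 hx with rfl | hx
      · exact hwA
      · exact m.disj x hx)
    (fun x => by
      simp only [Finset.mem_filter, m.mem, Finset.mem_insert, forall_eq_or_imp]
      tauto)
    (by
      rw [Finset.card_insert_of_notMem hwS]
      unfold dg at hcon
      exact (by omega : S.card + 1 + 1 ≤ (T.filter (G.Adj w)).card))
  rw [Finset.card_insert_of_notMem hwS] at h1
  omega

theorem Mx.dgS {w : V} (hw : w ∈ W) (hwA : w ∈ A) (hwT : w ∉ T) : dg G S w + 1 ≤ S.card := by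
  obtain ⟨σ, hσ, hn⟩ : ∃ σ ∈ S, ¬ G.Adj σ w := by
    by_contra hcon
    push Not at hcon
    exact hwT ((m.mem w).2 ⟨hwA, hw, hcon⟩)
  exact dg_lt_card hσ fun hh => hn hh.symm

theorem Mx.degS {w : V} (h2 : 2 ≤ S.card) (hw : w ∈ W) (hwT : w ∉ T) :
    dg G S w + lab A w ≤ lab (nb G S) w + (S.card - 1) := by
  have h3 : dg G S w ≤ S.card := dg_le_card
  have h4 := lab_le (A := A) (w := w)
  by_cases h : 1 ≤ dg G S w
  · rw [lab_nb h]
    by_cases hA : w ∈ A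
    · have := m.dgS hw hA hwT
      omega
    · rw [lab_neg hA]; omega
  · omega

theorem Mx.degT {w : V} (h3 : NoTri G) (hI : Indep G W A) (hw : w ∈ W) (hwT : w ∉ T)
    (hwS : w ∉ S) : dg G (S ∪ T) w + lab A w ≤ lab (nb G T) w + S.card := by
  have h4 := lab_le (A := A) (w := w)
  have h5 := dg_union (G := G) (H := S) (K := T) (w := w)
  have h6 : dg G S w ≤ S.card := dg_le_card
  by_cases hA : w ∈ A
  · have := m.dgS hw hA hwT
    have : dg G T w = 0 := dg_zero fun x hx => hI w hA hw x (m.subA hx) (m.subW hx)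
    omega
  · rw [lab_neg hA]
    have h7 := m.dgT hw hA hwS
    by_cases h : 1 ≤ dg G T w
    · rw [lab_nb h]
      obtain ⟨τ, hτ, hwτ⟩ := dg_pos h
      have : dg G S w = 0 := dg_zero fun σ hσ hwσ => h3 w σ τ hwσ (m.bip σ hσ τ hτ) hwτ
      omega
    · omega
end

theorem Ctx.lobe {d c : ℕ} {W A B S T E B' U : Finset V} (h : Ctx G d W A B) (hb : Bip G S T)
    (hTA : T ⊆ A) (hTW : T ⊆ W) (hSW : S ⊆ W) (h1 : 1 ≤ S.card) (hST : S.card ≤ T.card)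
    (hE : RI G E (nb G S) B') (hd : ∀ w ∈ E, d + 1 ≤ ld G E (nb G S) B' w + (S.card - 1))
    (hEU : E ⊆ U) (hU : U ⊆ W) (hdis : Disjoint (S ∪ T) U)
    (hr : ∀ n, Lens G E (nb G S) B' n → Lens G U (nb G S) B (n + c)) : AP d (Lens G W A B) := by
  have key : ∀ j, j < S.card → ∀ n, Lens G E (nb G S) B' n → Lens G W A B (2 * j + n + (c + 2)) :=
    fun j hj n hn => by
      have := Lens.odd (j := j) hb hTA hTW hSW hU hdis (hr n hn) (by omega) (by omega)
      convert this using 1; omega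
  by_cases h2 : S.card = 1
  · refine h.hrec E _ _ (c + 2) (Finset.card_lt_card ?_) hE (fun w hw => ?_) fun n hn => ?_
    · obtain ⟨σ, hσ⟩ := Finset.card_pos.1 h1
      refine ⟨hEU.trans hU, fun hh => ?_⟩
      exact Finset.disjoint_left.1 hdis (Finset.mem_union_left _ hσ) (hEU (hh (hSW hσ)))
    · have := hd w hw
      omega
    · simpa using key 0 (by omega) n hn
  · refine th_loss (K := fun m => ∃ j < S.card, m = 2 * j) (r := S.card - 1) (c := c + 2) h.ih hE hd
      (by omega) (AP.evens.le (by omega)) ?_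
    rintro _ ⟨j, hj, rfl⟩ n hn
    exact key j hj n hn

theorem lobe_bdry {W H : Finset V} {u v x w s : V} (hw : w ∈ comp G ((comp G (W \ H) u).erase v) x)
    (hs : s ∈ W) (hsE : s ∉ comp G ((comp G (W \ H) u).erase v) x) (h : G.Adj w s) :
    s = v ∨ s ∈ H := by
  by_contra hcon
  push Not at hcon
  have h1 := comp_closed (Finset.mem_of_mem_erase (comp_sub hw))
    (Finset.mem_sdiff.2 ⟨hs, hcon.2⟩) h
  exact hsE (comp_closed hw (Finset.mem_erase.2 ⟨hcon.1, h1⟩) h)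

theorem Ctx.mid {d : ℕ} {W A B S T : Finset V} {b₀ : V} (h : Ctx G d W A B) (m : Mx G W A S T)
    (hI : Indep G W A) (hr : RI G (comp G (W \ (S ∪ T)) b₀) (nb G T) B) :
    AP d (Lens G W A B) := by
  have hDW' : comp G (W \ (S ∪ T)) b₀ ⊆ W \ (S ∪ T) := comp_sub
  have hDW := hDW'.trans Finset.sdiff_subset
  refine th_loss (K := fun m => ∃ j < S.card + 1, m = 2 * j) (r := S.card) (c := 1) h.ih hr
    (fun w hw => ?_) m.pos AP.evens ?_
  · have h1 := h.deg w (hDW hw)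
    have h2 := dg_comp hw
    have h3 := (Finset.mem_sdiff.1 (hDW' hw)).2
    rw [Finset.mem_union, not_or] at h3
    have h4 := m.degT h.tri hI (hDW hw) h3.2 h3.1
    unfold ld at *; omega
  · rintro _ ⟨j, hj, rfl⟩ n hn
    exact Lens.even m.bip m.subA m.subW m.sub hDW
      (Finset.disjoint_right.2 fun x hx => (Finset.mem_sdiff.1 (hDW' hx)).2) hn (by omega)
      (by have := m.card; omega)

theorem bad_lobe {W H D A B : Finset V} (hc : ∀ x ∈ D, ∀ y ∈ D, Reach G D x y)
    (hA : ∃ a ∈ A, a ∈ D) (hB : ∃ b ∈ B, b ∈ D) :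
    RI G D A B ∨ ∃ v ∈ D, ∃ x ∈ D, x ≠ v ∧ ∀ t ∈ comp G (D.erase v) x, t ∉ A ∧ t ∉ B := by
  by_contra hcon
  push Not at hcon
  refine hcon.1 ⟨hc, hA, hB, fun v hv x hx hxv => ?_⟩
  obtain ⟨t, ht, h1⟩ := hcon.2 v hv x hx hxv
  exact ⟨t, by tauto, mem_comp.1 ht⟩

/-- A part of a component of `W \ H` that is cut off by `v` and touches only `S ⊆ H`. -/
theorem NC.lobe {W H S : Finset V} {u v x z : V} (hnc : NC G W) (hS : S ⊆ H) (hH : H ⊆ W)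
    (hv : v ∈ comp G (W \ H) u) (hx : x ∈ comp G (W \ H) u) (hxv : x ≠ v) (hz : z ∈ H)
    (hE : ∀ w ∈ comp G ((comp G (W \ H) u).erase v) x, ∀ s ∈ H, G.Adj w s → s ∈ S) :
    RI G (comp G ((comp G (W \ H) u).erase v) x) (nb G S) (nb G {v}) ∧
    ∀ w ∈ comp G ((comp G (W \ H) u).erase v) x,
      dg G W w ≤ dg G (comp G ((comp G (W \ H) u).erase v) x) w + dg G S w +
        lab (nb G {v}) w := by
  have hDW' : comp G (W \ H) u ⊆ W \ H := comp_sub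
  have hE1 : comp G ((comp G (W \ H) u).erase v) x ⊆ comp G (W \ H) u :=
    comp_sub.trans (Finset.erase_subset _ _)
  have hEW := (hE1.trans hDW').trans Finset.sdiff_subset
  have hzD : z ∉ comp G (W \ H) u := fun hh => (Finset.mem_sdiff.1 (hDW' hh)).2 hz
  have hvE : v ∉ comp G ((comp G (W \ H) u).erase v) x := fun hh => by
    simpa using comp_sub hh
  have hxE : x ∈ comp G ((comp G (W \ H) u).erase v) x :=
    self_mem_comp (Finset.mem_erase.2 ⟨hxv, hx⟩)
  have hvW := (Finset.mem_sdiff.1 (hDW' hv)).1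
  have hzv : z ≠ v := fun e => hzD (e ▸ hv)
  have hb : ∀ w ∈ comp G ((comp G (W \ H) u).erase v) x, ∀ s ∈ W,
      s ∉ comp G ((comp G (W \ H) u).erase v) x → G.Adj w s → s = v ∨ s ∈ S :=
    fun w hw s hs hsE hws => (lobe_bdry hw hs hsE hws).imp id fun hsH => hE w hw s hsH hws
  refine ⟨RI.nc hnc hEW (hH hz) (fun hh => hzD (hE1 hh)) (fun a ha b hb => comp_conn ha hb) ?_ ?_
    fun w hw s hs hsE hws => ?_, fun w hw => ?_⟩
  · obtain ⟨e, he, s, hs, hsE, hsv, hes⟩ := hnc.exit hEW hxE hvW hvE (hH hz)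
      (fun hh => hzD (hE1 hh)) hzv
    exact ⟨e, mem_nb.2 ⟨s, (hb e he s hs hsE hes).resolve_left hsv, hes.symm⟩, he⟩
  · obtain ⟨e, he, s, hs, hsW, hes⟩ := attach (S := {v}) (comp_conn hx hv) (by simpa using hxv)
      (by simp)
    rw [Finset.mem_singleton] at hs
    subst hs
    rw [← erase_eq] at he
    exact ⟨e, mem_nb1.2 hes.symm, he⟩
  · rcases hb w hw s hs hsE hws with rfl | hsS
    · exact .inr (mem_nb1.2 hws.symm)
    · exact .inl (mem_nb.2 ⟨s, hsS, hws.symm⟩)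
  · have h1 : dg G W w ≤ dg G (comp G ((comp G (W \ H) u).erase v) x ∪ S) w + dg G {v} w :=
      dg_le fun s hs hws => by
        by_cases hsE : s ∈ comp G ((comp G (W \ H) u).erase v) x
        · exact .inl (Finset.mem_union_left _ hsE)
        · rcases hb w hw s hs hsE hws with rfl | hsS
          · exact .inr (by simp)
          · exact .inl (Finset.mem_union_right _ hsS)
    have h2 := dg_union (G := G) (H := comp G ((comp G (W \ H) u).erase v) x) (K := S) (w := w)
    have h3 : dg G {v} w ≤ lab (nb G {v}) w :=
      dg_le_lab (dg_le_one fun a ha b hb _ _ => by simp_all) fun a ha _ => ha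
    omega

theorem Ctx.outside {d : ℕ} {W A B S T : Finset V} {b₀ : V} (h : Ctx G d W A B)
    (m : Mx G W A S T) (hI : Indep G W A) (hb : b₀ ∈ B) (hbW : b₀ ∈ W) (hbH : b₀ ∉ S ∪ T) :
    AP d (Lens G W A B) := by
  have hpos := m.pos
  have hcard := m.card
  have h3 := h.three
  obtain ⟨τ, hτ⟩ : T.Nonempty := Finset.card_pos.1 (by omega)
  by_cases hS1 : S.card = 1
  · obtain ⟨p, rfl⟩ := Finset.card_eq_one.1 hS1
    rcases trouble (m := d + 1) (by omega) h.ri h.star h.nc h.deg (m.sub (Finset.mem_singleton_self p))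
      (fun t ht => ⟨m.subA ht, m.subW ht, m.bip p (by simp) t ht⟩) hτ hb hbW
      (by simpa using hbH) with h4 | ⟨E, v, r⟩ | ⟨E, v, l, δ, hE, hEW, hv, hδ, hdeg, hl⟩
    · rw [Finset.insert_eq] at h4
      exact h.mid m hI h4
    · exact h.red r
    · refine th_loss (K := fun x => x = 0 ∨ x = δ) (r := 1) (c := l) h.ih hE (fun w hw => ?_) le_rfl
        (.two (l := 0) hδ (.inl rfl) (.inr (by omega))) ?_
      · exact (h.deg w (hEW hw)).trans (hdeg w hw)
      · rintro x (rfl | rfl) y hy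
        · simpa using (hl y hy).1
        · have := (hl y hy).2
          convert this using 1; omega
  have hS2 : 2 ≤ S.card := by omega
  have hDW' : comp G (W \ (S ∪ T)) b₀ ⊆ W \ (S ∪ T) := comp_sub
  have hDW := hDW'.trans Finset.sdiff_subset
  have hdis : Disjoint (S ∪ T) (comp G (W \ (S ∪ T)) b₀) :=
    Finset.disjoint_right.2 fun x hx => (Finset.mem_sdiff.1 (hDW' hx)).2
  have hHW : S ∪ T ⊆ W := Finset.union_subset m.sub m.subW
  have hbD : b₀ ∈ comp G (W \ (S ∪ T)) b₀ := self_mem_comp (Finset.mem_sdiff.2 ⟨hbW, hbH⟩)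
  have hnT : ∀ w ∈ comp G (W \ (S ∪ T)) b₀, w ∉ T := fun w hw hh =>
    (Finset.mem_sdiff.1 (hDW' hw)).2 (Finset.mem_union_right _ hh)
  by_cases ha : ∃ a ∈ nb G T, a ∈ comp G (W \ (S ∪ T)) b₀
  · rcases bad_lobe (W := W) (H := S ∪ T) (fun x hx y hy => comp_conn hx hy) ha ⟨b₀, hb, hbD⟩
      with hr | ⟨v, hv, x, hx, hxv, hbad⟩
    · exact h.mid m hI hr
    · have hE1 : comp G ((comp G (W \ (S ∪ T)) b₀).erase v) x ⊆ comp G (W \ (S ∪ T)) b₀ :=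
        comp_sub.trans (Finset.erase_subset _ _)
      obtain ⟨h4, h5⟩ := h.nc.lobe (S := S) (z := τ) Finset.subset_union_left hHW hv hx hxv
        (Finset.mem_union_right _ hτ) fun w hw s hs hws => by
          rcases Finset.mem_union.1 hs with hs | hs
          · exact hs
          · exact absurd (mem_nb.2 ⟨s, hs, hws.symm⟩) (hbad w hw).1
      have hbE : b₀ ∉ comp G ((comp G (W \ (S ∪ T)) b₀).erase v) x := fun hh => (hbad _ hh).2 hb
      obtain ⟨k, q⟩ := (conn_compl (fun x hx y hy => comp_conn hx hy) hv hbD hbE).symm.path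
      refine h.lobe (c := k + 1) m.bip m.subA m.subW m.sub hpos (by omega) h4 (fun w hw => ?_) hE1 hDW hdis
        fun n hn => hn.joinR (H := comp G (W \ (S ∪ T)) b₀ \
          comp G ((comp G (W \ (S ∪ T)) b₀).erase v) x) (k := k) (fun t ht => ?_)
          Finset.sdiff_disjoint Finset.sdiff_subset hE1
      · have h6 := h.deg w (hDW (hE1 hw))
        have h7 := h5 w hw
        have h8 := m.degS hS2 (hDW (hE1 hw)) (hnT w (hE1 hw))
        have h9 := lab_neg (hbad w hw).2
        unfold ld at *; omega
      · rw [Finset.mem_singleton] at ht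
        subst ht
        exact ⟨b₀, hb, q⟩
  · push Not at ha
    have hTn : ∀ w ∈ comp G (W \ (S ∪ T)) b₀, ∀ t ∈ T, ¬ G.Adj w t := fun w hw t ht hwt =>
      ha w (mem_nb.2 ⟨t, ht, hwt.symm⟩) hw
    have hbd : ∀ w ∈ comp G (W \ (S ∪ T)) b₀, ∀ s ∈ W, s ∉ comp G (W \ (S ∪ T)) b₀ → G.Adj w s →
        s ∈ S := fun w hw s hs hsD hws => by
      by_contra hsS
      refine hsD (comp_closed hw (Finset.mem_sdiff.2 ⟨hs, fun hh => ?_⟩) hws)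
      rcases Finset.mem_union.1 hh with hh | hh
      · exact hsS hh
      · exact hTn w hw s hh hws
    obtain ⟨τ', hτ', hne⟩ := Finset.exists_mem_ne (by omega : 1 < T.card) τ
    have hr : RI G (comp G (W \ (S ∪ T)) b₀) (nb G S) B := by
      refine RI.nc h.nc hDW (m.subW hτ) (fun hh => hnT _ hh hτ) (fun x hx y hy => comp_conn hx hy) ?_
        ⟨b₀, hb, hbD⟩ fun w hw s hs hsD hws => .inl (mem_nb.2 ⟨s, hbd w hw s hs hsD hws, hws.symm⟩)
      obtain ⟨e, he, s, hs, hsE, hsv, hes⟩ := h.nc.exit hDW hbD (m.subW hτ) (fun hh => hnT _ hh hτ)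
        (m.subW hτ') (fun hh => hnT _ hh hτ') hne
      exact ⟨e, mem_nb.2 ⟨s, hbd e he s hs hsE hes, hes.symm⟩, he⟩
    refine h.lobe (c := 0) m.bip m.subA m.subW m.sub hpos (by omega) hr (fun w hw => ?_) subset_rfl
      hDW hdis fun n hn => hn
    have h6 := h.deg w (hDW hw)
    have h7 := dg_comp hw
    have h8 := m.degS hS2 (hDW hw) (hnT w hw)
    have h9 := dg_union (G := G) (H := S) (K := T) (w := w)
    have h10 := dg_zero (hTn w hw)
    unfold ld at *; omega

theorem Mx.same {W A B S T S' T' : Finset V} (m : Mx G W A S T) (m' : Mx G W B S' T')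
    (hIA : Indep G W A) (hIB : Indep G W B) (h1 : ∀ b ∈ B, b ∈ W → b ∈ S ∪ T)
    (h2 : ∀ a ∈ A, a ∈ W → a ∈ S' ∪ T') : (∀ x ∈ W, x ∈ A ↔ x ∈ T) ∧ ∀ x ∈ W, x ∈ B ↔ x ∈ T := by
  have hc := m.card
  have hc' := m'.card
  have aux : ∀ {A B S T S' T' : Finset V}, Mx G W A S T → Mx G W B S' T' → Indep G W B →
      (∀ b ∈ B, b ∈ W → b ∈ S ∪ T) → (∀ a ∈ A, a ∈ W → a ∈ S' ∪ T') → ∀ b ∈ B, b ∈ W → b ∈ T := by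
    intro A B S T S' T' m m' hIB h1 h2 b hb hbW
    have hc := m.card
    have hc' := m'.card
    by_contra hbT
    have hbS : b ∈ S := (Finset.mem_union.1 (h1 b hb hbW)).resolve_right hbT
    have hBS : ∀ x ∈ B, x ∈ W → x ∈ S := fun x hx hxW => by
      by_contra hxS
      have hxT := (Finset.mem_union.1 (h1 x hx hxW)).resolve_left hxS
      exact hIB b hb hbW x hx hxW (m.bip b hbS x hxT)
    have h3 : T' ⊆ S := fun x hx => hBS x (m'.subA hx) (m'.subW hx)
    have h4 : T ⊆ S' := fun x hx => by
      rcases Finset.mem_union.1 (h2 x (m.subA hx) (m.subW hx)) with h | h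
      · exact h
      · exact absurd (m.subA hx) (m.disj x (h3 h))
    have := Finset.card_le_card h3
    have := Finset.card_le_card h4
    omega
  have hB := aux m m' hIB h1 h2
  have hA := aux m' m hIA h2 h1
  exact ⟨fun x hx => ⟨fun hxA => hB x (m'.subA (hA x hxA hx)) hx, fun hxT => m.subA hxT⟩,
    fun x hx => ⟨fun hxB => hB x hxB hx, fun hxT => m'.subA (hA x (m.subA hxT) hx)⟩⟩

theorem Ctx.coincide {d : ℕ} {W A B S T : Finset V} (h : Ctx G d W A B) (m : Mx G W A S T)
    (hI : Indep G W A) (hA : ∀ x ∈ W, x ∈ A ↔ x ∈ T) (hB : ∀ x ∈ W, x ∈ B ↔ x ∈ T) :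
    AP d (Lens G W A B) := by
  have hpos := m.pos
  have hcard := m.card
  have h3 := h.three
  by_cases ht : T.card = 2
  · obtain ⟨x, y, hxy, rfl⟩ := Finset.card_eq_two.1 ht
    obtain ⟨u, hu⟩ := m.ne
    have hx : x ∈ W := m.subW (by simp)
    have hy : y ∈ W := m.subW (by simp)
    have huA := m.disj u hu
    refine h.red (two_roots (u := u) h.ri h.star (m.subA (by simp)) ((hB y hy).2 (by simp)) hx hy
      (fun a ha haW => by simpa using (hA a haW).1 ha)
      (fun b hb hbW => by simpa using (hB b hbW).1 hb) hxy (m.sub hu) ?_ ?_)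
    · rintro rfl
      exact huA (m.subA (by simp))
    · rintro rfl
      exact huA (m.subA (by simp))
  obtain ⟨R, hRS, hR⟩ := Finset.exists_subset_card_eq (s := S) (n := min S.card (T.card - 2))
    (Nat.min_le_left _ _)
  have hR1 : 1 ≤ R.card := by omega
  have hR2 : R.card + 2 ≤ T.card := by omega
  have hRW := hRS.trans m.sub
  have hRT : Bip G R T := m.bip.mono hRS subset_rfl
  by_cases hd : d ≤ R.card + 1
  · refine AP.le (m := d) (n := R.card + 1) ⟨0, 2, .inr rfl, fun j hj => ?_⟩ hd
    obtain ⟨τ, hτ⟩ : T.Nonempty := Finset.card_pos.1 (by omega)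
    obtain ⟨τ', hτ', q⟩ := hRT.even (j := j) hτ (by omega) (by omega)
    exact ⟨τ', m.subA hτ', τ, (hB τ (m.subW hτ)).2 hτ, by
      have := q.mono (Finset.union_subset hRW m.subW)
      convert this using 1; omega⟩
  obtain ⟨i, hi⟩ : T.Nonempty := Finset.card_pos.1 (by omega)
  obtain ⟨u, huW, huR, hiu⟩ : ∃ u ∈ W, u ∉ R ∧ G.Adj i u := by
    by_contra hcon
    push Not at hcon
    have h1 := h.deg i (m.subW hi)
    have h2 : dg G W i ≤ dg G R i + dg G ∅ i := dg_le fun x hx hix => .inl (by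
      by_contra hxR
      exact hcon x hx hxR hix)
    have h4 : dg G R i ≤ R.card := dg_le_card
    have h5 : dg G ∅ i ≤ (∅ : Finset V).card := dg_le_card
    rw [Finset.card_empty] at h5
    have := lab_le (A := A) (w := i)
    have := lab_le (A := B) (w := i)
    unfold ld at h1; omega
  have huT : u ∉ T := fun hh => hI i (m.subA hi) (m.subW hi) u (m.subA hh) huW hiu
  have huC : u ∈ comp G (W \ (R ∪ T)) u := self_mem_comp (by simp [huW, huR, huT])
  have hCW' : comp G (W \ (R ∪ T)) u ⊆ W \ (R ∪ T) := comp_sub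
  have hCW := hCW'.trans Finset.sdiff_subset
  have hdis : ∀ x ∈ comp G (W \ (R ∪ T)) u, x ∉ R ∧ x ∉ T := fun x hx => by
    have := (Finset.mem_sdiff.1 (hCW' hx)).2
    rwa [Finset.mem_union, not_or] at this
  have hHW : R ∪ T ⊆ W := Finset.union_subset hRW m.subW
  -- the label count when `b` is the right end
  have hdeg : ∀ b ∈ T, ∀ w ∈ comp G (W \ (R ∪ T)) u,
      d + 1 ≤ dg G (comp G (W \ (R ∪ T)) u) w + dg G R w + dg G (T.erase b) w + lab (nb G {b}) w ∧
      (1 ≤ dg G T w → dg G R w = 0) ∧ dg G R w ≤ R.card ∧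
      dg G (T.erase b) w ≤ lab (nb G (T.erase b)) w + R.card := by
    intro b hb w hw
    have h1 := h.deg w (hCW hw)
    have hwA : w ∉ A := fun hh => (hdis w hw).2 ((hA w (hCW hw)).1 hh)
    have hwB : w ∉ B := fun hh => (hdis w hw).2 ((hB w (hCW hw)).1 hh)
    have h2 := dg_comp hw
    have h4 := dg_union (G := G) (H := R) (K := T) (w := w)
    have h5 : dg G T w ≤ dg G (T.erase b) w + dg G {b} w := dg_le fun x hx _ => by
      by_cases e : x = b
      · exact .inr (by simp [e])
      · exact .inl (Finset.mem_erase.2 ⟨e, hx⟩)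
    have h6 : dg G {b} w ≤ lab (nb G {b}) w :=
      dg_le_lab (dg_le_one fun a ha b hb _ _ => by simp_all) fun a ha _ => ha
    have h7 := lab_neg hwA
    have h8 := lab_neg hwB
    refine ⟨by unfold ld at h1; omega, fun h9 => ?_, dg_le_card, ?_⟩
    · obtain ⟨τ, hτ, hwτ⟩ := dg_pos h9
      exact dg_zero fun σ hσ hwσ => h.tri w σ τ hwσ (hRT σ hσ τ hτ) hwτ
    · have h9 : dg G (T.erase b) w ≤ (T.erase b).card := dg_le_card
      rw [Finset.card_erase_of_mem hb] at h9
      by_cases h10 : 1 ≤ dg G (T.erase b) w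
      · rw [lab_nb h10]
        by_cases h11 : S.card ≤ T.card - 2
        · have hRS' : R = S := Finset.eq_of_subset_of_card_le hRS (by omega)
          have h12 := m.dgT (hCW hw) hwA (hRS' ▸ (hdis w hw).1)
          have h13 : dg G (T.erase b) w ≤ dg G T w := dg_mono (Finset.erase_subset _ _)
          by_cases h14 : G.Adj w b
          · have h15 : dg G (T.erase b) w + 1 ≤ dg G T w := by
              have e : T.filter (G.Adj w) = insert b ((T.erase b).filter (G.Adj w)) := by
                ext z
                by_cases hz : z = b
                · subst hz
                  simp [hb, h14]
                · simp [hz]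
              unfold dg
              rw [e, Finset.card_insert_of_notMem (by simp)]
            omega
          · rw [← hRS'] at h12
            omega
        · omega
      · omega
  have huc : ∀ b ∈ T, comp G (W \ (R ∪ T)) u ⊆ insert b (comp G (W \ (R ∪ T)) u) :=
    fun b _ => Finset.subset_insert _ _
  have hbip : ∀ b ∈ T, Bip G R (T.erase b) := fun b _ => hRT.mono subset_rfl (Finset.erase_subset _ _)
  -- lobes touching only `R` and one further vertex
  have hlobe : ∀ b ∈ T, ∀ E B' c, RI G E (nb G R) B' → E ⊆ comp G (W \ (R ∪ T)) u →
      (∀ w ∈ E, d + 1 ≤ ld G E (nb G R) B' w + (R.card - 1)) →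
      (∀ n, Lens G E (nb G R) B' n →
        Lens G (comp G (W \ (R ∪ T)) u) (nb G R) (nb G {b}) (n + c)) → AP d (Lens G W A B) := by
    intro b hb E B' c hE hEC hdE hl
    have hbC : b ∉ comp G (W \ (R ∪ T)) u := fun hh => (hdis b hh).2 hb
    refine h.lobe (c := c + 1) (hbip b hb) ((Finset.erase_subset _ _).trans m.subA)
      ((Finset.erase_subset _ _).trans m.subW) hRW hR1
      (by rw [Finset.card_erase_of_mem hb]; omega) hE hdE (hEC.trans (huc b hb))
      (Finset.insert_subset (m.subW hb) hCW) (Finset.disjoint_right.2 fun x hx => ?_) fun n hn => ?_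
    · rcases Finset.mem_insert.1 hx with rfl | hx
      · simpa using fun hh => Finset.disjoint_left.1 hRT.disj hh hb
      · simpa using ⟨(hdis x hx).1, fun _ => (hdis x hx).2⟩
    · exact (hl n hn).joinR (H := {b}) (k := 0) (fun t ht => by
        rw [Finset.mem_singleton] at ht
        subst ht
        exact ⟨t, (hB t (m.subW hb)).2 hb, .nil (by simp)⟩)
        (by simpa using hbC) (by simp) (huc b hb)
  by_cases hatt : ∃ b ∈ T, b ≠ i ∧ ∃ w ∈ comp G (W \ (R ∪ T)) u, G.Adj b w
  · obtain ⟨b, hb, hbi, w₀, hw₀, hbw⟩ := hatt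
    have hbC : b ∉ comp G (W \ (R ∪ T)) u := fun hh => (hdis b hh).2 hb
    rcases bad_lobe (A := nb G (T.erase b)) (B := nb G {b}) (W := W) (H := R ∪ T)
      (fun x hx y hy => comp_conn hx hy)
      ⟨u, mem_nb.2 ⟨i, Finset.mem_erase.2 ⟨hbi.symm, hi⟩, hiu⟩, huC⟩ ⟨w₀, mem_nb1.2 hbw, hw₀⟩
      with hr | ⟨v, hv, x, hx, hxv, hbad⟩
    · refine th_loss (K := fun m => ∃ j < R.card + 1, m = 2 * j) (r := R.card) (c := 2) h.ih hr
        (fun w hw => ?_) hR1 AP.evens ?_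
      · obtain ⟨h4, h5, h6, h7⟩ := hdeg b hb w hw
        have h8 : dg G (T.erase b) w ≤ dg G T w := dg_mono (Finset.erase_subset _ _)
        unfold ld; omega
      · rintro _ ⟨j, hj, rfl⟩ n hn
        have h4 : Lens G (W.erase b) A (nb G {b}) (2 * j + n + 1) := by
          refine Lens.even (hbip b hb) ((Finset.erase_subset _ _).trans m.subA)
            (Finset.erase_subset_erase _ m.subW) (fun x hx => Finset.mem_erase.2 ⟨?_, hRW hx⟩)
            (fun x hx => Finset.mem_erase.2 ⟨?_, hCW hx⟩)
            (Finset.disjoint_right.2 fun x hx => ?_) hn (by omega)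
            (by rw [Finset.card_erase_of_mem hb]; omega)
          · rintro rfl
            exact Finset.disjoint_left.1 hRT.disj hx hb
          · rintro rfl
            exact hbC hx
          · simpa using ⟨(hdis x hx).1, fun _ => (hdis x hx).2⟩
        exact h4.joinR (H := {b}) (k := 0) (fun t ht => by
          rw [Finset.mem_singleton] at ht
          subst ht
          exact ⟨t, (hB t (m.subW hb)).2 hb, .nil (by simp)⟩) (by simp)
          (by simpa using m.subW hb) (Finset.erase_subset _ _)
    · have hE1 : comp G ((comp G (W \ (R ∪ T)) u).erase v) x ⊆ comp G (W \ (R ∪ T)) u :=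
        comp_sub.trans (Finset.erase_subset _ _)
      have hnT : ∀ w ∈ comp G ((comp G (W \ (R ∪ T)) u).erase v) x, ∀ s ∈ T, ¬ G.Adj w s :=
        fun w hw s hs hws => by
          by_cases e : s = b
          · subst e
            exact (hbad w hw).2 (mem_nb1.2 hws.symm)
          · exact (hbad w hw).1 (mem_nb.2 ⟨s, Finset.mem_erase.2 ⟨e, hs⟩, hws.symm⟩)
      obtain ⟨h4, h5⟩ := h.nc.lobe (S := R) (z := b) Finset.subset_union_left hHW hv hx hxv
        (Finset.mem_union_right _ hb) fun w hw s hs hws =>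
          (Finset.mem_union.1 hs).resolve_right fun hs => hnT w hw s hs hws
      have hwE : w₀ ∉ comp G ((comp G (W \ (R ∪ T)) u).erase v) x := fun hh =>
        (hbad _ hh).2 (mem_nb1.2 hbw)
      obtain ⟨k, q⟩ := (conn_compl (fun x hx y hy => comp_conn hx hy) hv hw₀ hwE).symm.path
      refine hlobe b hb _ _ (k + 1) h4 hE1 (fun w hw => ?_) fun n hn => hn.joinR
        (H := comp G (W \ (R ∪ T)) u \ comp G ((comp G (W \ (R ∪ T)) u).erase v) x) (k := k)
          (fun t ht => ?_) Finset.sdiff_disjoint Finset.sdiff_subset hE1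
      · have h6 := h.deg w (hCW (hE1 hw))
        have h7 := h5 w hw
        have hwA : w ∉ A := fun hh => (hdis w (hE1 hw)).2 ((hA w (hCW (hE1 hw))).1 hh)
        have hwB : w ∉ B := fun hh => (hdis w (hE1 hw)).2 ((hB w (hCW (hE1 hw))).1 hh)
        have h8 := lab_neg hwA
        have h9 := lab_neg hwB
        have h10 : dg G R w ≤ R.card := dg_le_card
        by_cases h11 : 1 ≤ dg G R w
        · have := lab_nb h11
          unfold ld at *; omega
        · unfold ld at *; omega
      · rw [Finset.mem_singleton] at ht
        subst ht
        exact ⟨w₀, mem_nb1.2 hbw, q⟩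
  · push Not at hatt
    have hiC : i ∉ comp G (W \ (R ∪ T)) u := fun hh => (hdis i hh).2 hi
    have hbd : ∀ w ∈ comp G (W \ (R ∪ T)) u, ∀ s ∈ W, s ∉ comp G (W \ (R ∪ T)) u → G.Adj w s →
        s = i ∨ s ∈ R := fun w hw s hs hsC hws => by
      by_contra hcon
      push Not at hcon
      have hsT : s ∉ T := fun hh => hatt s hh hcon.1 w hw hws.symm
      exact hsC (comp_closed hw (by simp [hs, hsT, hcon.2]) hws)
    obtain ⟨z, hz, hzi⟩ := Finset.exists_mem_ne (by omega : 1 < T.card) i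
    have hr : RI G (comp G (W \ (R ∪ T)) u) (nb G R) (nb G {i}) := by
      refine RI.nc h.nc hCW (m.subW hi) hiC (fun x hx y hy => comp_conn hx hy) ?_
        ⟨u, mem_nb1.2 hiu, huC⟩ fun w hw s hs hsC hws => ?_
      · obtain ⟨e, he, s, hs, hsE, hsv, hes⟩ := h.nc.exit hCW huC (m.subW hi) hiC (m.subW hz)
          (fun hh => (hdis z hh).2 hz) hzi
        exact ⟨e, mem_nb.2 ⟨s, (hbd e he s hs hsE hes).resolve_left hsv, hes.symm⟩, he⟩
      · rcases hbd w hw s hs hsC hws with rfl | hsR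
        · exact .inr (mem_nb1.2 hws.symm)
        · exact .inl (mem_nb.2 ⟨s, hsR, hws.symm⟩)
    refine hlobe i hi _ _ 0 hr subset_rfl (fun w hw => ?_) fun n hn => hn
    obtain ⟨h4, h5, h6, h7⟩ := hdeg i hi w hw
    have h8 : dg G (T.erase i) w = 0 := dg_zero fun s hs hws =>
      hatt s (Finset.mem_of_mem_erase hs) (Finset.ne_of_mem_erase hs) w hw hws.symm
    by_cases h11 : 1 ≤ dg G R w
    · have := lab_nb h11
      unfold ld; omega
    · unfold ld; omega

theorem Ctx.main {d : ℕ} {W A B : Finset V} (h : Ctx G d W A B) : AP d (Lens G W A B) := by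
  have h3 := h.three
  by_cases hIA : Indep G W A
  swap
  · unfold Indep at hIA
    push Not at hIA
    obtain ⟨x, hx, hxW, y, hy, hyW, hxy⟩ := hIA
    exact h.edge hx hxW hy hyW hxy
  by_cases hIB : Indep G W B
  swap
  · unfold Indep at hIB
    push Not at hIB
    obtain ⟨x, hx, hxW, y, hy, hyW, hxy⟩ := hIB
    exact (h.symm.edge hx hxW hy hyW hxy).swap
  have hd4 : ∀ w ∈ W, 4 ≤ ld G W A B w := fun w hw => by
    have := h.deg w hw
    omega
  by_cases hnA : NoColl G W A
  · obtain ⟨E, A', B', r⟩ := red_contract h.ri h.star hnA hd4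
    exact h.red r
  by_cases hnB : NoColl G W B
  · obtain ⟨E, A', B', r⟩ := red_contract h.ri.symm h.star.symm hnB
      fun w hw => (hd4 w hw).trans_eq ld_comm
    exact (h.symm.red r).swap
  obtain ⟨S, T, m⟩ := exists_mx hIA hnA
  obtain ⟨S', T', m'⟩ := exists_mx hIB hnB
  by_cases h1 : ∃ b ∈ B, b ∈ W ∧ b ∉ S ∪ T
  · obtain ⟨b, hb, hbW, hbH⟩ := h1
    exact h.outside m hIA hb hbW hbH
  by_cases h2 : ∃ a ∈ A, a ∈ W ∧ a ∉ S' ∪ T'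
  · obtain ⟨a, ha, haW, haH⟩ := h2
    exact (h.symm.outside m' hIB ha haW haH).swap
  push Not at h1 h2
  obtain ⟨hA, hB⟩ := m.same m' hIA hIB h1 h2
  exact h.coincide m hIA hA hB

theorem th_aux (h3 : NoTri G) {d : ℕ} (hd : 3 ≤ d) (ih : ∀ d', 1 ≤ d' → d' < d → Th G d') (N : ℕ) :
    ∀ W A B : Finset V, W.card = N → RI G W A B → (∀ w ∈ W, d + 1 ≤ ld G W A B w) →
      AP d (Lens G W A B) := by
  induction N using Nat.strong_induction_on with
  | _ N IH =>
    intro W A B hN hri hdeg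
    have hrec : ∀ E A' B' c, E.card < W.card → RI G E A' B' → (∀ w ∈ E, d + 1 ≤ ld G E A' B' w) →
        (∀ n, Lens G E A' B' n → Lens G W A B (n + c)) → AP d (Lens G W A B) :=
      fun E A' B' c h1 h2 h4 h5 => (IH E.card (by omega) E A' B' rfl h2 h4).shift h5
    rcases star_or_red hri with hs | ⟨E, A', B', r⟩
    swap
    · obtain ⟨c, hc⟩ := r.lens
      exact hrec E A' B' c r.lt r.ri (fun w hw => (hdeg w (r.sub hw)).trans (r.deg w hw)) hc
    rcases nc_or_cut hri hs with hnc | ⟨X, Y, v, hX, hY, -, -, hXW, hYW, hXd, hYd, hl⟩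
    · exact Ctx.main ⟨hri, hs, hnc, hdeg, hd, h3, ih, hrec⟩
    · refine (AP.add (by omega) (by omega) (ih (d - 1) (by omega) (by omega) X _ _ hX fun w hw => ?_)
        (ih (d - 1) (by omega) (by omega) Y _ _ hY fun w hw => ?_)
        fun x hx y hy => hl x y hx hy).le (by omega)
      · have := hdeg w (hXW hw)
        have := hXd w hw
        omega
      · have := hdeg w (hYW hw)
        have := hYd w hw
        omega

theorem th_all (h3 : NoTri G) {d : ℕ} (hd : 1 ≤ d) : Th G d := by
  induction d using Nat.strong_induction_on with
  | _ d ih =>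
    rcases (by omega : d = 1 ∨ d = 2 ∨ 3 ≤ d) with rfl | rfl | h
    · exact th_one
    · exact th_two
    · exact fun W A B hr hdeg => th_aux h3 h (fun d' h1 h2 => ih d' h2 h1) _ W A B rfl hr hdeg

/-- A 2-connected graph of minimum degree at least `k`. -/
structure Gr (G : SimpleGraph V) (k : ℕ) : Prop where
  ne : Nonempty V
  conn : ∀ x y, Reach G Finset.univ x y
  nc : NC G Finset.univ
  deg : ∀ v, k ≤ dg G Finset.univ v

theorem reach_of_induce {S : Finset V} (h : (G.induce ((↑S : Set V)ᶜ)).Connected) {x y : V}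
    (hx : x ∉ S) (hy : y ∉ S) : Reach G (Finset.univ \ S) x y := by
  obtain ⟨p⟩ := h.preconnected ⟨x, by simpa using hx⟩ ⟨y, by simpa using hy⟩
  have key : ∀ {a b : ((↑S : Set V)ᶜ : Set V)}, (G.induce ((↑S : Set V)ᶜ)).Walk a b →
      Reach G (Finset.univ \ S) a b := by
    intro a b q
    induction q with
    | @nil a =>
      exact .refl (Finset.mem_sdiff.2 ⟨Finset.mem_univ _, fun hh => a.2 (Finset.mem_coe.2 hh)⟩)
    | @cons a b c hab q ih =>
      exact .head (Finset.mem_sdiff.2 ⟨Finset.mem_univ _, fun hh => a.2 (Finset.mem_coe.2 hh)⟩)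
        hab ih
  exact key p

theorem Gr.of {k : ℕ} [DecidableRel G.Adj] (h2 : KConnected G 2) (hδ : ∀ v : V, k ≤ G.degree v) :
    Gr G k := by
  refine ⟨Fintype.card_pos_iff.1 (by have := h2.1; omega), fun x y => ?_,
    fun v _ x _ y _ hx hy => ?_, fun v => ?_⟩
  · simpa using reach_of_induce (h2.2 ∅ (by simp)) (x := x) (y := y) (by simp) (by simp)
  · rw [erase_eq]
    exact reach_of_induce (h2.2 {v} (by simp)) (by simpa using hx) (by simpa using hy)
  · refine (hδ v).trans_eq ?_
    rw [← SimpleGraph.card_neighborFinset_eq_degree]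
    unfold dg
    congr 1
    ext x
    simp

theorem cyc_lens {H D P Q : Finset V} {x n : ℕ} (hd : Disjoint H D)
    (hx : ∀ p ∈ P, ∀ q ∈ Q, PL G H p q x) (hn : Lens G D (nb G P) (nb G Q) n) (h1 : 1 ≤ x + n) :
    HasCycleLen G (x + n + 2) := by
  obtain ⟨a, ha, b, hb, q⟩ := hn
  obtain ⟨p, hp, hpa⟩ := mem_nb.1 ha
  obtain ⟨r, hr, hrb⟩ := mem_nb.1 hb
  exact (hx p hp r hr).symm.cycle₂ q hd hpa hrb.symm h1

theorem cyc_add {H D P Q : Finset V} {m n : ℕ} {K : ℕ → Prop} (hd : Disjoint H D) (hm : 1 ≤ m)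
    (hn : 1 ≤ n) (hK : AP m K) (h1 : ∀ x, K x → 1 ≤ x)
    (hx : ∀ x, K x → ∀ p ∈ P, ∀ q ∈ Q, PL G H p q x) (hl : AP n (Lens G D (nb G P) (nb G Q))) :
    AP (m + n - 1) (HasCycleLen G) :=
  AP.add (c := 2) hm hn hK hl fun x hKx y hy =>
    cyc_lens hd (hx x hKx) hy (by have := h1 x hKx; omega)

/-- All lengths `1 ≤ x₀ ≤ x < x₀ + m` occur for paths in `H` from `P` to `Q`. -/
def Cons (G : SimpleGraph V) (H P Q : Finset V) (m : ℕ) : Prop :=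
  ∃ x₀, 1 ≤ x₀ ∧ ∀ i < m, ∀ p ∈ P, ∀ q ∈ Q, PL G H p q (x₀ + i)

section
variable {H D P Q : Finset V} {m : ℕ}

theorem Cons.two (hK : Cons G H P Q m) (hd : Disjoint H D) (h2 : 2 ≤ m) {l : ℕ}
    (h1 : Lens G D (nb G P) (nb G Q) l)
    (h3 : Lens G D (nb G P) (nb G Q) (l + 2) ∨ Lens G D (nb G P) (nb G Q) (l + 1)) :
    AP (m + 1) (HasCycleLen G) := by
  obtain ⟨x₀, hx₀, hx⟩ := hK
  refine ⟨x₀ + l + 2, 1, .inl rfl, fun i hi => ?_⟩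
  by_cases him : i < m
  · have := cyc_lens hd (hx i him) h1 (by omega)
    convert this using 1; omega
  · obtain rfl : i = m := by omega
    rcases h3 with h3 | h3
    · have := cyc_lens hd (hx (i - 2) (by omega)) h3 (by omega)
      convert this using 1; omega
    · have := cyc_lens hd (hx (i - 1) (by omega)) h3 (by omega)
      convert this using 1; omega

theorem Cons.exact (hK : Cons G H P Q m) (hd : Disjoint H D) (h2 : 2 ≤ m)
    (h1 : Exact2 G D (nb G P) (nb G Q)) : AP (m + 2) (HasCycleLen G) := by
  obtain ⟨x₀, hx₀, hx⟩ := hK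
  obtain ⟨l, h1, h3⟩ := h1
  refine ⟨x₀ + l + 2, 1, .inl rfl, fun i hi => ?_⟩
  by_cases him : i < m
  · have := cyc_lens hd (hx i him) h1 (by omega)
    convert this using 1; omega
  · have := cyc_lens hd (hx (i - 2) (by omega)) h3 (by omega)
    convert this using 1; omega

theorem Cons.five (hK : Cons G H P Q 2) (hd : Disjoint H D)
    (h1 : Y3 (Lens G D (nb G P) (nb G Q))) : AP 5 (HasCycleLen G) := by
  obtain ⟨x₀, hx₀, hx⟩ := hK
  have key : ∀ l i, i < 2 → Lens G D (nb G P) (nb G Q) l → HasCycleLen G (x₀ + l + i + 2) :=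
    fun l i hi h => by
      have := cyc_lens hd (hx i hi) h (by omega)
      convert this using 1; omega
  obtain ⟨l, h0, h2, h4 | ⟨h1, h3⟩⟩ := h1
  · refine ⟨x₀ + l + 2, 1, .inl rfl, fun i hi => ?_⟩
    rcases (by omega : i = 0 ∨ i = 1 ∨ i = 2 ∨ i = 3 ∨ i = 4) with rfl | rfl | rfl | rfl | rfl
    · exact key l 0 (by omega) h0
    · convert key l 1 (by omega) h0 using 1
    · convert key _ 0 (by omega) h2 using 1; omega
    · convert key _ 1 (by omega) h2 using 1; omega
    · convert key _ 0 (by omega) h4 using 1; omega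
  · refine ⟨x₀ + l + 2, 1, .inl rfl, fun i hi => ?_⟩
    rcases (by omega : i = 0 ∨ i = 1 ∨ i = 2 ∨ i = 3 ∨ i = 4) with rfl | rfl | rfl | rfl | rfl
    · exact key l 0 (by omega) h0
    · convert key l 1 (by omega) h0 using 1
    · convert key _ 0 (by omega) h2 using 1; omega
    · convert key _ 1 (by omega) h2 using 1; omega
    · convert key _ 1 (by omega) h3 using 1; omega

theorem Cons.fin {k : ℕ} (hk : k = 4 ∨ k = 5) (hK : Cons G H P Q 2) (hd : Disjoint H D)
    (hr : RI G D (nb G P) (nb G Q)) (hdeg : ∀ w ∈ D, k ≤ ld G D (nb G P) (nb G Q) w) :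
    AP k (HasCycleLen G) := by
  rcases hk with rfl | rfl
  · exact hK.exact hd le_rfl (exact2_of_four' hr hdeg)
  · exact hK.five hd (y3_of_five hr hdeg)

theorem Cons.fin₃ {k : ℕ} (hk : k = 4 ∨ k = 5) (hK : Cons G H P Q 3) (hd : Disjoint H D)
    (hr : RI G D (nb G P) (nb G Q)) (hdeg : ∀ w ∈ D, k ≤ ld G D (nb G P) (nb G Q) w + 1) :
    AP k (HasCycleLen G) := by
  rcases hk with rfl | rfl
  · obtain ⟨l, h1, h2⟩ := ap2_of_three hr fun w hw => by have := hdeg w hw; omega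
    exact hK.two hd (by omega) h1 h2
  · exact hK.exact hd (by omega) (exact2_of_four' hr fun w hw => by have := hdeg w hw; omega)
end

section
variable {k : ℕ} (g : Gr G k)
include g

theorem Gr.exists_notMem {H : Finset V} (h : H.card ≤ k) : ∃ u, u ∉ H := by
  by_contra hcon
  push Not at hcon
  by_cases hne : ∃ x, x ∈ H
  · obtain ⟨x, hx⟩ := hne
    have h1 := g.deg x
    have h2 := dg_mono (G := G) (w := x) (fun z _ => hcon z : Finset.univ ⊆ H)
    have h3 := dg_lt_card (G := G) (w := x) hx (by simp)
    omega
  · obtain ⟨v⟩ := g.ne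
    exact hne ⟨v, hcon v⟩

theorem Gr.att {H : Finset V} {u v z : V} (hu : u ∉ H) (hv : v ∈ H) (hz : z ∈ H) (hzv : z ≠ v) :
    ∃ w ∈ comp G (Finset.univ \ H) u, ∃ s ∈ H, s ≠ v ∧ G.Adj w s := by
  have hD' : comp G (Finset.univ \ H) u ⊆ Finset.univ \ H := comp_sub
  have hD : ∀ x ∈ H, x ∉ comp G (Finset.univ \ H) u := fun x hx hh =>
    (Finset.mem_sdiff.1 (hD' hh)).2 hx
  obtain ⟨e, he, s, hs, hsE, hsv, hes⟩ := g.nc.exit (Finset.subset_univ _)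
    (self_mem_comp (by simpa using hu)) (Finset.mem_univ v) (hD v hv) (Finset.mem_univ z) (hD z hz) hzv
  refine ⟨e, he, s, ?_, hsv, hes⟩
  by_contra hsH
  exact hsE (comp_closed he (by simpa using hsH) hes)

theorem Gr.att₂ {H : Finset V} {u : V} (hu : u ∉ H) (h2 : 2 ≤ H.card) :
    ∃ s ∈ H, ∃ t ∈ H, s ≠ t ∧ (∃ w ∈ comp G (Finset.univ \ H) u, G.Adj w s) ∧
      ∃ w ∈ comp G (Finset.univ \ H) u, G.Adj w t := by
  obtain ⟨v, hv, z, hz, hvz⟩ := Finset.one_lt_card.1 h2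
  obtain ⟨w, hw, s, hs, -, hws⟩ := g.att hu hv hz hvz.symm
  obtain ⟨z', hz', hne⟩ := Finset.exists_mem_ne h2 s
  obtain ⟨w', hw', t, ht, hts, hwt⟩ := g.att hu hs hz' hne
  exact ⟨s, hs, t, ht, hts.symm, ⟨w, hw, hws⟩, w', hw', hwt⟩

theorem Gr.ri {H P Q : Finset V} {u z : V} (hz : z ∈ H)
    (hP : ∃ w ∈ comp G (Finset.univ \ H) u, ∃ p ∈ P, G.Adj w p)
    (hQ : ∃ w ∈ comp G (Finset.univ \ H) u, ∃ p ∈ Q, G.Adj w p)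
    (hcov : ∀ w ∈ comp G (Finset.univ \ H) u, ∀ s ∈ H, G.Adj w s → s ∈ P ∨ s ∈ Q) :
    RI G (comp G (Finset.univ \ H) u) (nb G P) (nb G Q) := by
  have hD' : comp G (Finset.univ \ H) u ⊆ Finset.univ \ H := comp_sub
  obtain ⟨w, hw, p, hp, hwp⟩ := hP
  obtain ⟨w', hw', q, hq, hwq⟩ := hQ
  refine RI.nc g.nc (Finset.subset_univ _) (Finset.mem_univ z)
    (fun hh => (Finset.mem_sdiff.1 (hD' hh)).2 hz) (fun x hx y hy => comp_conn hx hy)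
    ⟨w, mem_nb.2 ⟨p, hp, hwp.symm⟩, hw⟩ ⟨w', mem_nb.2 ⟨q, hq, hwq.symm⟩, hw'⟩
    fun e he s _ hsE hes => ?_
  have hsH : s ∈ H := by
    by_contra hsH
    exact hsE (comp_closed he (by simpa using hsH) hes)
  rcases hcov e he s hsH hes with h | h
  · exact .inl (mem_nb.2 ⟨s, h, hes.symm⟩)
  · exact .inr (mem_nb.2 ⟨s, h, hes.symm⟩)

theorem Gr.degc {H : Finset V} {u w : V} (hw : w ∈ comp G (Finset.univ \ H) u) :
    k ≤ dg G (comp G (Finset.univ \ H) u) w + dg G H w := (g.deg w).trans (dg_comp hw)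
end

theorem disj_comp {W H : Finset V} {u : V} : Disjoint H (comp G (W \ H) u) := by
  have hD' : comp G (W \ H) u ⊆ W \ H := comp_sub
  exact Finset.disjoint_right.2 fun x hx => (Finset.mem_sdiff.1 (hD' hx)).2

theorem Clq.card_mono {K : Finset V} {w : V} (h : Clq G K) (hw : ∀ x ∈ K, G.Adj w x) :
    Clq G (insert w K) := by
  intro a ha b hb hab
  rcases Finset.mem_insert.1 ha with rfl | ha' <;> rcases Finset.mem_insert.1 hb with rfl | hb'
  · exact absurd rfl hab
  · exact hw b hb'
  · exact (hw a ha').symm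
  · exact h a ha' b hb' hab

theorem Gr.big_clique {k : ℕ} (g : Gr G k) (hk : 1 ≤ k) {K : Finset V} (hK : Clq G K)
    (hc : K.card = k + 1) {u : V} (hu : u ∉ K) : AP k (HasCycleLen G) := by
  obtain ⟨s, hs, t, ht, hst, ⟨w, hw, hws⟩, w', hw', hwt⟩ := g.att₂ hu (by omega)
  obtain ⟨n, q⟩ := (comp_conn hw hw').path
  refine ⟨n + 3, 1, .inl rfl, fun i hi => ?_⟩
  have := cyc_lens (P := {s}) (Q := {t}) (x := i + 1) disj_comp (fun p hp q hq => by
    rw [Finset.mem_singleton] at hp hq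
    subst hp hq
    exact hK.path₂ (j := i + 1) hs ht hst (by omega) (by omega))
    ⟨w, mem_nb1.2 hws.symm, w', mem_nb1.2 hwt.symm, q⟩ (by omega)
  convert this using 1; omega

theorem dg_insert_le {H : Finset V} {x w : V} : dg G (insert x H) w ≤ dg G {x} w + dg G H w := by
  rw [Finset.insert_eq]
  exact dg_union

theorem Gr.clique {k : ℕ} (hk : k = 4 ∨ k = 5) (g : Gr G k) {K : Finset V} (hK : Clq G K)
    (h4 : 4 ≤ K.card) (hm : ∀ K', Clq G K' → K'.card ≤ K.card) (hKk : K.card ≤ k) :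
    AP k (HasCycleLen G) := by
  obtain ⟨u, hu⟩ := g.exists_notMem hKk
  obtain ⟨p, hp, q, hq, hpq, ⟨w, hw, hwp⟩, w', hw', hwq⟩ := g.att₂ hu (by omega)
  obtain ⟨p', hp'⟩ : ((K.erase p).erase q).Nonempty := by
    have h1 := Finset.card_erase_of_mem hp
    have h2 := Finset.card_erase_of_mem (Finset.mem_erase.2 ⟨hpq.symm, hq⟩)
    exact Finset.card_pos.1 (by omega)
  simp only [Finset.mem_erase] at hp'
  have hPK : ({p, p'} : Finset V) ⊆ K := by simp [Finset.insert_subset_iff, hp, hp'.2.2]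
  have hPc : ({p, p'} : Finset V).card = 2 := Finset.card_pair hp'.2.1.symm
  have hQc := Finset.card_sdiff_add_card_eq_card hPK
  have hr := g.ri (P := {p, p'}) (Q := K \ {p, p'}) (u := u) hp ⟨w, hw, p, by simp, hwp⟩
    ⟨w', hw', q, by simp [hq, hpq.symm, hp'.1.symm], hwq⟩ fun w _ s hs _ => by
      by_cases h : s ∈ ({p, p'} : Finset V)
      · exact .inl h
      · exact .inr (Finset.mem_sdiff.2 ⟨hs, h⟩)
  have hcons : Cons G K {p, p'} (K \ {p, p'}) (K.card - 1) := ⟨1, le_rfl, fun i hi a ha b hb => by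
    rw [Finset.mem_sdiff] at hb
    exact hK.path₂ (hPK ha) hb.1 (fun e => hb.2 (e ▸ ha)) (by omega) (by omega)⟩
  have hdeg : ∀ w ∈ comp G (Finset.univ \ K) u,
      k ≤ ld G (comp G (Finset.univ \ K) u) (nb G {p, p'}) (nb G (K \ {p, p'})) w +
        (K.card - 3) := fun w hw => by
    have hwK : w ∉ K := Finset.disjoint_right.1 disj_comp hw
    have h1 := g.degc hw
    have h2 : dg G K w + 1 ≤ K.card := by
      obtain ⟨x, hx, hn⟩ : ∃ x ∈ K, ¬ G.Adj w x := by
        by_contra hcon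
        push Not at hcon
        have := hm _ (hK.card_mono hcon)
        rw [Finset.card_insert_of_notMem hwK] at this
        omega
      exact dg_lt_card hx hn
    have h3 : dg G K w ≤ dg G {p, p'} w + dg G (K \ {p, p'}) w := dg_le fun x hx _ => by
      by_cases h : x ∈ ({p, p'} : Finset V)
      · exact .inl h
      · exact .inr (Finset.mem_sdiff.2 ⟨hx, h⟩)
    have h5 : dg G {p, p'} w ≤ _ := dg_le_card
    have h6 : dg G (K \ {p, p'}) w ≤ _ := dg_le_card
    have h7 : 1 ≤ dg G {p, p'} w → lab (nb G {p, p'}) w = 1 := lab_nb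
    have h8 : 1 ≤ dg G (K \ {p, p'}) w → lab (nb G (K \ {p, p'})) w = 1 := lab_nb
    unfold ld
    by_cases h9 : 1 ≤ dg G {p, p'} w
    · have := h7 h9
      by_cases h10 : 1 ≤ dg G (K \ {p, p'}) w
      · have := h8 h10
        omega
      · omega
    · by_cases h10 : 1 ≤ dg G (K \ {p, p'}) w
      · have := h8 h10
        omega
      · omega
  by_cases h44 : K.card = 4
  · rw [h44] at hcons hdeg
    exact hcons.fin₃ hk disj_comp hr hdeg
  · obtain ⟨rfl, h5⟩ : k = 5 ∧ K.card = 5 := by omega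
    rw [h5] at hcons hdeg
    obtain ⟨l, h1, h2⟩ := ap2_of_three hr fun w hw => by have := hdeg w hw; omega
    exact hcons.two disj_comp (by omega) h1 h2

theorem clq_pair {x y : V} (h : G.Adj x y) : Clq G {x, y} := by
  have := Clq.card_mono (K := {y}) (w := x) (G := G) (fun a ha b hb hab => by simp_all) (by simpa using h)
  exact this

theorem clq_triple {x y z : V} (h : G.Adj x y) (h1 : G.Adj x z) (h2 : G.Adj y z) :
    Clq G {x, y, z} :=
  (clq_pair h2).card_mono (by simp [h, h1])

theorem clq_quad {x y z w : V} (h : G.Adj x y) (h1 : G.Adj x z) (h2 : G.Adj y z)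
    (h3 : G.Adj w x) (h4 : G.Adj w y) (h5 : G.Adj w z) : Clq G {w, x, y, z} :=
  (clq_triple h h1 h2).card_mono (by simp [h3, h4, h5])

theorem no_quad (h4 : ∀ K, Clq G K → K.card ≤ 3) {x y z w : V} (h : G.Adj x y) (h1 : G.Adj x z)
    (h2 : G.Adj y z) (h3 : G.Adj w x) (h5 : G.Adj w y) : ¬ G.Adj w z := fun h6 => by
  have := h4 _ (clq_quad h h1 h2 h3 h5 h6)
  rw [Finset.card_insert_of_notMem (by simp [h3.ne, h5.ne, h6.ne]),
    Finset.card_insert_of_notMem (by simp [h.ne, h1.ne]), Finset.card_pair h2.ne] at this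
  omega

theorem diamond_path {a b c d : V} (hab : G.Adj a b) (hac : G.Adj a c) (hbc : G.Adj b c)
    (had : G.Adj a d) (hbd : G.Adj b d) (hcd : c ≠ d) {H : Finset V} (ha : a ∈ H) (hb : b ∈ H)
    (hc : c ∈ H) (hd : d ∈ H) : ∀ i < 3, PL G H a c (1 + i) := by
  intro i hi
  rcases (by omega : i = 0 ∨ i = 1 ∨ i = 2) with rfl | rfl | rfl
  · exact .edge hac ha hc
  · exact .cons ha hab (.edge hbc (by simp [hb, hab.ne']) (by simp [hc, hac.ne']))
  · exact .cons ha had (.cons (by simp [hd, had.ne']) hbd.symm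
      (.edge hbc (by simp [hb, hab.ne', hbd.ne]) (by simp [hc, hac.ne', hcd])))

theorem dg_pair_two {x y w : V} (h : ¬ (G.Adj w x ∧ G.Adj w y)) : dg G {x, y} w ≤ 1 :=
  dg_le_one fun u hu v hv hwu hwv => by
    simp only [Finset.mem_insert, Finset.mem_singleton] at hu hv
    rcases hu with rfl | rfl <;> rcases hv with rfl | rfl
    · rfl
    · exact (h ⟨hwu, hwv⟩).elim
    · exact (h ⟨hwv, hwu⟩).elim
    · rfl

theorem dg_single_lab {v w : V} : dg G {v} w ≤ lab (nb G {v}) w :=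
  dg_le_lab (dg_le_one fun a ha b hb _ _ => by simp_all) fun a ha _ => ha

/-- If the component `D` of `G - H` touches only `p, q ∈ H`, which are joined in `H` by paths of two
consecutive lengths, there are `k` admissible cycles. -/
theorem Gr.pair {k : ℕ} (hk : k = 4 ∨ k = 5) (g : Gr G k) {H : Finset V} {u p q : V} {x₀ : ℕ}
    (hu : u ∉ H) (hp : p ∈ H) (hq : q ∈ H) (hpq : p ≠ q)
    (hcov : ∀ w ∈ comp G (Finset.univ \ H) u, ∀ s ∈ H, G.Adj w s → s = p ∨ s = q)
    (hx₀ : 1 ≤ x₀) (h1 : PL G H p q x₀) (h2 : PL G H p q (x₀ + 1)) : AP k (HasCycleLen G) := by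
  obtain ⟨w, hw, s, hs, hsp, hws⟩ := g.att hu hp hq hpq.symm
  obtain ⟨w', hw', s', hs', hsq, hws'⟩ := g.att hu hq hp hpq
  obtain rfl := (hcov w hw s hs hws).resolve_left hsp
  obtain rfl := (hcov w' hw' s' hs' hws').resolve_right hsq
  have hr := g.ri (P := {s'}) (Q := {s}) (u := u) hp ⟨w', hw', s', by simp, hws'⟩
    ⟨w, hw, s, by simp, hws⟩ fun w hw x hx hwx => by simpa using hcov w hw x hx hwx
  refine Cons.fin hk ⟨x₀, hx₀, fun i hi a ha b hb => ?_⟩ disj_comp hr fun w hw => ?_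
  · rw [Finset.mem_singleton] at ha hb
    subst ha hb
    rcases (by omega : i = 0 ∨ i = 1) with rfl | rfl
    · exact h1
    · exact h2
  · have h3 := g.degc hw
    have h4 : dg G H w ≤ dg G {s'} w + dg G {s} w := dg_le fun x hx hwx => by
      simpa using hcov w hw x hx hwx
    have h5 := dg_single_lab (G := G) (v := s) (w := w)
    have h6 := dg_single_lab (G := G) (v := s') (w := w)
    unfold ld; omega

theorem Gr.diamond {k : ℕ} (hk : k = 4 ∨ k = 5) (g : Gr G k) (h4 : ∀ K, Clq G K → K.card ≤ 3)
    {x y z w : V} (hxy : G.Adj x y) (hxz : G.Adj x z) (hyz : G.Adj y z) (hxw : G.Adj x w)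
    (hyw : G.Adj y w) (hzw : z ≠ w) : AP k (HasCycleLen G) := by
  have hnzw : ¬ G.Adj w z := no_quad h4 hxy hxz hyz hxw.symm hyw.symm
  let H : Finset V := {x, y, z, w}
  have hx : x ∈ H := by simp [H]
  have hy : y ∈ H := by simp [H]
  have hz : z ∈ H := by simp [H]
  have hw : w ∈ H := by simp [H]
  have hHc : H.card ≤ k := (Finset.card_le_four).trans (by omega)
  obtain ⟨u, hu⟩ := g.exists_notMem hHc
  have hcov : ∀ s ∈ H, s = x ∨ s = y ∨ s = z ∨ s = w := fun s hs => by simpa [H] using hs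
  by_cases hQ : ∃ v ∈ comp G (Finset.univ \ H) u, ∃ q ∈ ({z, w} : Finset V), G.Adj v q
  swap
  · push Not at hQ
    refine g.pair hk hu hx hy hxy.ne (fun v hv s hs hvs => ?_) le_rfl (.edge hxy hx hy)
      (.cons hx hxz (.edge hyz.symm (by simp [hz, hxz.ne']) (by simp [hy, hxy.ne'])))
    have h1 := hQ v hv s
    rcases hcov s hs with h | h | h | h <;> simp_all
  by_cases hP : ∃ v ∈ comp G (Finset.univ \ H) u, ∃ q ∈ ({x, y} : Finset V), G.Adj v q
  swap
  · push Not at hP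
    refine g.pair (x₀ := 2) hk hu hz hw hzw (fun v hv s hs hvs => ?_) (by omega)
      (.cons hz hxz.symm (.edge hxw (by simp [hx, hxz.ne]) (by simp [hw, hzw.symm])))
      (.cons hz hxz.symm (.cons (by simp [hx, hxz.ne]) hxy
        (.edge hyw (by simp [hy, hxy.ne', hyz.ne]) (by simp [hw, hzw.symm, hxw.ne']))))
    have h1 := hP v hv s
    rcases hcov s hs with h | h | h | h <;> simp_all
  have hr := g.ri hx hP hQ fun v _ s hs _ => by
    rcases hcov s hs with h | h | h | h <;> simp [h]
  refine Cons.fin₃ hk ⟨1, le_rfl, fun i hi a ha b hb => ?_⟩ disj_comp hr fun v hv => ?_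
  · simp only [Finset.mem_insert, Finset.mem_singleton] at ha hb
    rcases ha with rfl | rfl <;> rcases hb with rfl | rfl
    · exact diamond_path hxy hxz hyz hxw hyw hzw hx hy hz hw i hi
    · exact diamond_path hxy hxw hyw hxz hyz hzw.symm hx hy hw hz i hi
    · exact diamond_path hxy.symm hyz hxz hyw hxw hzw hy hx hz hw i hi
    · exact diamond_path hxy.symm hyw hxw hyz hxz hzw.symm hy hx hw hz i hi
  · have h3 := g.degc hv
    have h5 : dg G H v ≤ dg G {x, y} v + dg G {z, w} v := dg_le fun s hs _ => by
      rcases hcov s hs with h | h | h | h <;> simp [h]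
    have h6 : 1 ≤ dg G {x, y} v → lab (nb G {x, y}) v = 1 := lab_nb
    have h7 : 1 ≤ dg G {z, w} v → lab (nb G {z, w}) v = 1 := lab_nb
    have h8 : dg G {z, w} v ≤ _ := dg_le_card
    have h9 : dg G {x, y} v ≤ _ := dg_le_card
    rw [Finset.card_pair hzw] at h8
    rw [Finset.card_pair hxy.ne] at h9
    unfold ld
    by_cases hb : G.Adj v x ∧ G.Adj v y
    · have h10 : dg G {z, w} v = 0 := dg_zero fun s hs => by
        rcases Finset.mem_insert.1 hs with rfl | hs
        · exact no_quad h4 hxy hxz hyz hb.1 hb.2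
        · rw [Finset.mem_singleton] at hs
          subst hs
          exact no_quad h4 hxy hxw hyw hb.1 hb.2
      by_cases h11 : 1 ≤ dg G {x, y} v
      · have := h6 h11; omega
      · omega
    · have := dg_pair_two hb
      by_cases h11 : 1 ≤ dg G {x, y} v
      · have := h6 h11
        by_cases h12 : 1 ≤ dg G {z, w} v
        · have := h7 h12; omega
        · omega
      · by_cases h12 : 1 ≤ dg G {z, w} v
        · have := h7 h12; omega
        · omega

theorem Gr.triangle {k : ℕ} (hk : k = 4 ∨ k = 5) (g : Gr G k) (h4 : ∀ K, Clq G K → K.card ≤ 3)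
    (hd : ∀ x y z w, G.Adj x y → G.Adj x z → G.Adj y z → G.Adj x w → G.Adj y w → z = w)
    {x y z : V} (hxy : G.Adj x y) (hxz : G.Adj x z) (hyz : G.Adj y z) : AP k (HasCycleLen G) := by
  have hHc : ({x, y, z} : Finset V).card ≤ k := (Finset.card_le_three).trans (by omega)
  obtain ⟨u, hu⟩ := g.exists_notMem hHc
  have key : ∀ {x y z : V}, G.Adj x y → G.Adj x z → G.Adj y z → u ∉ ({x, y, z} : Finset V) →
      (∃ v ∈ comp G (Finset.univ \ {x, y, z}) u, G.Adj v x) → AP k (HasCycleLen G) := by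
    intro x y z hxy hxz hyz hu ⟨v, hv, hvx⟩
    obtain ⟨w, hw, s, hs, hsx, hws⟩ := g.att hu (v := x) (z := y) (by simp) (by simp) hxy.ne'
    have hr := g.ri (P := {x}) (Q := {y, z}) (z := x) (by simp) ⟨v, hv, x, by simp, hvx⟩
      ⟨w, hw, s, by simpa [hsx] using hs, hws⟩ fun v _ s hs _ => by simpa using hs
    refine Cons.fin hk ⟨1, le_rfl, fun i hi a ha b hb => ?_⟩ disj_comp hr fun v hv => ?_
    · simp only [Finset.mem_insert, Finset.mem_singleton] at ha hb
      subst ha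
      have hK := clq_triple hxy hxz hyz
      have hc : ({a, y, z} : Finset V).card = 3 := by
        rw [Finset.card_insert_of_notMem (by simp [hxy.ne, hxz.ne]), Finset.card_pair hyz.ne]
      refine hK.path₂ (by simp) (by simpa using .inr hb) ?_ (by omega) (by omega)
      rcases hb with rfl | rfl
      · exact hxy.ne
      · exact hxz.ne
    · have h3 := g.degc hv
      have h5 : dg G {x, y, z} v ≤ dg G {x} v + dg G {y, z} v := dg_insert_le
      have h6 := dg_single_lab (G := G) (v := x) (w := v)
      have h7 : dg G {y, z} v ≤ 1 := dg_pair_two fun hb => by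
        have := hd y z x v hyz hxy.symm hxz.symm hb.1.symm hb.2.symm
        subst this
        exact Finset.disjoint_right.1 disj_comp hv (by simp)
      have h8 := dg_le_lab (T := {y, z}) h7 fun a ha _ => ha
      unfold ld; omega
  obtain ⟨s, hs, t, ht, hst, ⟨v, hv, hvs⟩, -⟩ := g.att₂ hu
    (by rw [Finset.card_insert_of_notMem (by simp [hxy.ne, hxz.ne]), Finset.card_pair hyz.ne]; omega)
  simp only [Finset.mem_insert, Finset.mem_singleton] at hs
  rcases hs with rfl | rfl | rfl
  · exact key hxy hxz hyz hu ⟨v, hv, hvs⟩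
  · have e : ({x, s, z} : Finset V) = {s, x, z} := Finset.insert_comm _ _ _
    rw [e] at hu hv
    exact key hxy.symm hyz hxz hu ⟨v, hv, hvs⟩
  · have e : ({x, y, s} : Finset V) = {s, x, y} := by
      ext; simp; tauto
    rw [e] at hu hv
    exact key hxz.symm hyz.symm hxy hu ⟨v, hv, hvs⟩

/-- Two-vertex separations of a triangle-free graph. -/
theorem cycle_two_lens {x y : V} {D D' : Finset V} {m n : ℕ} (hxy : x ≠ y) (hx : x ∉ D) (hy : y ∉ D)
    (hx' : x ∉ D') (hy' : y ∉ D') (hd : Disjoint D D') (hm : Lens G D (nb G {x}) (nb G {y}) m)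
    (hn : Lens G D' (nb G {x}) (nb G {y}) n) : HasCycleLen G (m + n + 4) := by
  obtain ⟨a, ha, b, hb, p⟩ := hm
  obtain ⟨a', ha', b', hb', q⟩ := hn
  have p1 : PL G (insert x D) x b (m + 1) :=
    p.cons' (mem_nb1.1 ha) hx (Finset.mem_insert_self _ _) (Finset.subset_insert _ _)
  have hyx : y ∉ insert x D := fun h => by
    rcases Finset.mem_insert.1 h with h | h
    · exact hxy h.symm
    · exact hy h
  have p2 : PL G (insert y (insert x D)) x y (m + 1 + 1) :=
    p1.snoc (mem_nb1.1 hb).symm hyx (Finset.mem_insert_self _ _) (Finset.subset_insert _ _)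
  have h1 : Disjoint (insert y (insert x D)) D' := by
    rw [Finset.disjoint_insert_left, Finset.disjoint_insert_left]
    exact ⟨hy', hx', hd⟩
  have h2 := mem_nb1.1 hb'
  have h3 := (mem_nb1.1 ha').symm
  have h4 : 1 ≤ m + 1 + 1 + n := by omega
  have h5 := p2.cycle₂ q.symm h1 h2 h3 h4
  rw [show m + n + 4 = m + 1 + 1 + n + 2 by omega]
  exact h5

theorem Gr.cut {k : ℕ} (hk : k = 4 ∨ k = 5) (g : Gr G k) (h3 : NoTri G) {x y u v : V} (hxy : x ≠ y)
    (hu : u ∉ ({x, y} : Finset V)) (hv : v ∉ ({x, y} : Finset V))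
    (huv : ¬ Reach G (Finset.univ \ {x, y}) u v) : AP k (HasCycleLen G) := by
  have side : ∀ u, u ∉ ({x, y} : Finset V) →
      AP (k - 1) (Lens G (comp G (Finset.univ \ {x, y}) u) (nb G {x}) (nb G {y})) := by
    intro u hu
    obtain ⟨w, hw, s, hs, hsp, hws⟩ := g.att hu (v := x) (z := y) (by simp) (by simp) hxy.symm
    obtain ⟨w', hw', s', hs', hsq, hws'⟩ := g.att hu (v := y) (z := x) (by simp) (by simp) hxy
    have hr := g.ri (P := {x}) (Q := {y}) (u := u) (z := x) (by simp)
      ⟨w', hw', s', by simpa [hsq] using hs', hws'⟩ ⟨w, hw, s, by simpa [hsp] using hs, hws⟩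
      fun w hw x hx hwx => by simpa using hx
    refine th_all h3 (by omega) _ _ _ hr fun w hw => ?_
    have h3 := g.degc hw
    have h4 : dg G {x, y} w ≤ dg G {x} w + dg G {y} w := dg_insert_le
    have h5 := dg_single_lab (G := G) (v := x) (w := w)
    have h6 := dg_single_lab (G := G) (v := y) (w := w)
    unfold ld; omega
  refine (AP.add (c := 4) (by omega) (by omega) (side u hu) (side v hv) ?_).le (by omega)
  intro m hm n hn
  have hd : Disjoint (comp G (Finset.univ \ {x, y}) u) (comp G (Finset.univ \ {x, y}) v) :=
    Finset.disjoint_left.2 fun z hz hz' => huv ((mem_comp.1 hz).trans (mem_comp.1 hz').symm)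
  have hD : ∀ u, ∀ z ∈ ({x, y} : Finset V), z ∉ comp G (Finset.univ \ {x, y}) u :=
    fun u z hz => Finset.disjoint_left.1 disj_comp hz
  exact cycle_two_lens hxy (hD u x (by simp)) (hD u y (by simp)) (hD v x (by simp))
    (hD v y (by simp)) hd hm hn

/-- No two vertices separate the graph. -/
def NoCut (G : SimpleGraph V) : Prop := ∀ x y u v : V, x ≠ y → u ∉ ({x, y} : Finset V) →
  v ∉ ({x, y} : Finset V) → Reach G (Finset.univ \ {x, y}) u v

theorem NoCut.ri (hc : NoCut G) {H P Q : Finset V} {u z e : V} (hz : z ∈ H) (he : e ∈ H)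
    (hze : z ≠ e) (hP : ∃ w ∈ comp G (Finset.univ \ H) u, ∃ p ∈ P, G.Adj w p)
    (hQ : ∃ w ∈ comp G (Finset.univ \ H) u, ∃ p ∈ Q, G.Adj w p)
    (hcov : ∀ w ∈ comp G (Finset.univ \ H) u, ∀ s ∈ H, G.Adj w s → s ∈ P ∨ s ∈ Q ∨ s = e) :
    RI G (comp G (Finset.univ \ H) u) (nb G P) (nb G Q) := by
  have hD : ∀ x ∈ H, x ∉ comp G (Finset.univ \ H) u := fun x hx =>
    Finset.disjoint_left.1 disj_comp hx
  obtain ⟨w, hw, p, hp, hwp⟩ := hP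
  obtain ⟨w', hw', q, hq, hwq⟩ := hQ
  refine ⟨fun x hx y hy => comp_conn hx hy, ⟨w, mem_nb.2 ⟨p, hp, hwp.symm⟩, hw⟩,
    ⟨w', mem_nb.2 ⟨q, hq, hwq.symm⟩, hw'⟩, fun x hx y hy hyx => ?_⟩
  have hxe : x ≠ e := fun h => hD e he (h ▸ hx)
  have hye : y ≠ e := fun h => hD e he (h ▸ hy)
  have hzx : z ≠ x := fun h => hD z hz (h ▸ hx)
  have hr := hc x e y z hxe (by simp [hyx, hye]) (by simp [hzx, hze])
  rcases hr.exit ((comp G (Finset.univ \ H) u).erase x) (by simp [hy, hyx])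
    with h3 | ⟨a, s, h3, h4, h5, h6⟩
  · have := h3.right
    simp only [Finset.mem_inter, Finset.mem_erase] at this
    exact absurd this.2.2 (hD z hz)
  · have h7 := (Finset.mem_inter.1 h3.right).2
    have ha := (Finset.mem_erase.1 h7).2
    simp only [Finset.mem_sdiff, Finset.mem_insert, Finset.mem_singleton, not_or] at h4
    have hsD : s ∉ comp G (Finset.univ \ H) u := fun hh => h5 (Finset.mem_erase.2 ⟨h4.2.1, hh⟩)
    have hsH : s ∈ H := by
      by_contra hsH
      exact hsD (comp_closed ha (by simpa using hsH) h6)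
    refine ⟨a, ?_, h3.mono Finset.inter_subset_right⟩
    rcases hcov a ha s hsH h6 with h | h | h
    · exact .inl (mem_nb.2 ⟨s, h, h6.symm⟩)
    · exact .inr (mem_nb.2 ⟨s, h, h6.symm⟩)
    · exact absurd h h4.2.2

theorem Gr.att₃ (hc : NoCut G) {H : Finset V} {u x y z : V} (hu : u ∉ H) (hx : x ∈ H) (hy : y ∈ H)
    (hz : z ∈ H) (hxy : x ≠ y) (hzx : z ≠ x) (hzy : z ≠ y) :
    ∃ w ∈ comp G (Finset.univ \ H) u, ∃ s ∈ H, s ≠ x ∧ s ≠ y ∧ G.Adj w s := by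
  have hD : ∀ x ∈ H, x ∉ comp G (Finset.univ \ H) u := fun x hx =>
    Finset.disjoint_left.1 disj_comp hx
  have hux : u ≠ x := fun h => hu (h ▸ hx)
  have huy : u ≠ y := fun h => hu (h ▸ hy)
  have hr := hc x y u z hxy (by simp [hux, huy]) (by simp [hzx, hzy])
  rcases hr.exit (comp G (Finset.univ \ H) u) (self_mem_comp (by simpa using hu))
    with h3 | ⟨a, s, h3, h4, h5, h6⟩
  · exact absurd (Finset.mem_inter.1 h3.right).2 (hD z hz)
  · simp only [Finset.mem_sdiff, Finset.mem_insert, Finset.mem_singleton, not_or] at h4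
    have ha := (Finset.mem_inter.1 h3.right).2
    refine ⟨a, ha, s, ?_, h4.2.1, h4.2.2, h6⟩
    by_contra hsH
    exact h5 (comp_closed ha (by simpa using hsH) h6)

theorem Gr.eng {k r : ℕ} (g : Gr G k) (h3 : NoTri G) (hc : NoCut G) {H P Q : Finset V} {u z e : V}
    (hz : z ∈ H) (he : e ∈ H) (hze : z ≠ e)
    (hP : ∃ w ∈ comp G (Finset.univ \ H) u, ∃ p ∈ P, G.Adj w p)
    (hQ : ∃ w ∈ comp G (Finset.univ \ H) u, ∃ p ∈ Q, G.Adj w p)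
    (hcov : ∀ w ∈ comp G (Finset.univ \ H) u, ∀ s ∈ H, G.Adj w s → s ∈ P ∨ s ∈ Q ∨ s = e)
    {K : ℕ → Prop} (hK : AP (r + 2) K) (hr : r + 2 ≤ k) (h1 : ∀ x, K x → 1 ≤ x)
    (hx : ∀ x, K x → ∀ p ∈ P, ∀ q ∈ Q, PL G H p q x)
    (hl : ∀ w ∈ comp G (Finset.univ \ H) u, dg G H w ≤ lab (nb G P) w + lab (nb G Q) w + r) :
    AP k (HasCycleLen G) := by
  have hd := th_all h3 (d := k - r - 1) (by omega) _ _ _ (hc.ri hz he hze hP hQ hcov) fun w hw => by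
    have h1 := g.degc hw
    have h2 := hl w hw
    unfold ld
    omega
  exact (cyc_add disj_comp (by omega) (by omega) hK h1 hx hd).le (by omega)

/-- Two attachments joined by sufficiently many paths in `H` suffice. -/
theorem Gr.easy {k : ℕ} {H : Finset V} {u p q : V} (hk : 1 ≤ k)
    (hp : ∃ w ∈ comp G (Finset.univ \ H) u, G.Adj w p)
    (hq : ∃ w ∈ comp G (Finset.univ \ H) u, G.Adj w q) {K : ℕ → Prop} (hK : AP k K)
    (h1 : ∀ x, K x → 1 ≤ x) (hx : ∀ x, K x → PL G H p q x) : AP k (HasCycleLen G) := by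
  obtain ⟨w, hw, hwp⟩ := hp
  obtain ⟨w', hw', hwq⟩ := hq
  obtain ⟨n, l⟩ := (comp_conn hw hw').path
  refine hK.shift (c := n + 2) fun x hKx => ?_
  have h2 := h1 x hKx
  have := cyc_lens (P := {p}) (Q := {q}) (x := x) disj_comp (fun p' hp' q' hq' => by
    rw [Finset.mem_singleton] at hp' hq'
    subst hp' hq'
    exact hx x hKx)
    ⟨w, mem_nb1.2 hwp.symm, w', mem_nb1.2 hwq.symm, l⟩ (by omega)
  rw [← add_assoc]
  exact this

theorem AP.odds {s : ℕ} : AP s fun m => ∃ j < s, m = 2 * j + 1 :=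
  ⟨1, 2, .inr rfl, fun i hi => ⟨i, hi, by omega⟩⟩

theorem AP.evens₂ {s : ℕ} : AP s fun m => ∃ j, 1 ≤ j ∧ j ≤ s ∧ m = 2 * j :=
  ⟨2, 2, .inr rfl, fun i hi => ⟨i + 1, by omega, by omega, by omega⟩⟩

theorem dg_lab_sub {H P Q : Finset V} {w : V} {a b : ℕ} (h : ∀ s ∈ H, G.Adj w s → s ∈ P ∨ s ∈ Q)
    (hP : dg G P w ≤ a + 1) (hQ : dg G Q w ≤ b + 1) :
    dg G H w ≤ lab (nb G P) w + lab (nb G Q) w + (a + b) := by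
  have h3 : dg G H w ≤ dg G P w + dg G Q w := dg_le h
  have h7 : 1 ≤ dg G P w → lab (nb G P) w = 1 := lab_nb
  have h8 : 1 ≤ dg G Q w → lab (nb G Q) w = 1 := lab_nb
  by_cases h9 : 1 ≤ dg G P w
  · have := h7 h9
    by_cases h10 : 1 ≤ dg G Q w
    · have := h8 h10
      omega
    · omega
  · by_cases h10 : 1 ≤ dg G Q w
    · have := h8 h10
      omega
    · omega

/-- The component `D` of `G - H` touches `H` only in one side `X` of a complete bipartite graph. -/
theorem Gr.one_side {k m : ℕ} (g : Gr G k) (h3 : NoTri G) (hc : NoCut G) {H S X : Finset V} {u : V}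
    (hu : u ∉ H) (hb : Bip G S X) (hS : S ⊆ H) (hX : X ⊆ H) (hXc : X.card = m) (h4 : 4 ≤ m)
    (hmk : m ≤ k + 1) (hSc : m ≤ S.card + 1)
    (honly : ∀ w ∈ comp G (Finset.univ \ H) u, ∀ s ∈ H, G.Adj w s → s ∈ X)
    (hdeg : ∀ w ∈ comp G (Finset.univ \ H) u, ∃ x ∈ X, ¬ G.Adj w x) : AP k (HasCycleLen G) := by
  have hHc : 2 ≤ H.card := by have := Finset.card_le_card hX; omega
  obtain ⟨p, hpH, q, hqH, hpq, ⟨w, hw, hwp⟩, w', hw', hwq⟩ := g.att₂ hu hHc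
  have hp := honly w hw p hpH hwp
  have hq := honly w' hw' q hqH hwq
  obtain ⟨p', hp'⟩ : ((X.erase p).erase q).Nonempty := by
    have h1 := Finset.card_erase_of_mem hp
    have h2 := Finset.card_erase_of_mem (Finset.mem_erase.2 ⟨hpq.symm, hq⟩)
    exact Finset.card_pos.1 (by omega)
  simp only [Finset.mem_erase] at hp'
  have hPX : ({p, p'} : Finset V) ⊆ X := by simp [Finset.insert_subset_iff, hp, hp'.2.2]
  have hPc : ({p, p'} : Finset V).card = 2 := Finset.card_pair hp'.2.1.symm
  have hQc := Finset.card_sdiff_add_card_eq_card hPX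
  have hsplit : ∀ s ∈ X, s ∈ ({p, p'} : Finset V) ∨ s ∈ X \ {p, p'} := fun s hs => by
    by_cases h : s ∈ ({p, p'} : Finset V)
    · exact .inl h
    · exact .inr (Finset.mem_sdiff.2 ⟨hs, h⟩)
  refine g.eng (r := m - 3) (P := {p, p'}) (Q := X \ {p, p'}) (u := u) h3 hc hpH hqH hpq
    ⟨w, hw, p, by simp, hwp⟩ ⟨w', hw', q, by simp [hq, hpq.symm, hp'.1.symm], hwq⟩
    (fun w hw s hs hws => ?_) (AP.evens₂ (s := m - 3 + 2)) (by omega)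
    (by rintro x ⟨j, h1, -, rfl⟩; omega) ?_ fun w hw => ?_
  · rcases hsplit s (honly w hw s hs hws) with h | h
    · exact .inl h
    · exact .inr (.inl h)
  · rintro x ⟨j, hj1, hj2, rfl⟩ a ha b hb'
    rw [Finset.mem_sdiff] at hb'
    exact (hb.even₂ (hPX ha) hb'.1 (fun e => hb'.2 (e ▸ ha)) hj1 (by omega) (by omega)).mono
      (Finset.union_subset hS hX)
  · obtain ⟨x, hx, hwx⟩ := hdeg w hw
    have h2 : dg G H w ≤ dg G X w + dg G ∅ w := dg_le fun s hs hws => .inl (honly w hw s hs hws)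
    have h20 : dg G ∅ w ≤ (∅ : Finset V).card := dg_le_card
    rw [Finset.card_empty] at h20
    have h21 : dg G X w + 1 ≤ X.card := dg_lt_card hx hwx
    have h3 : dg G X w ≤ dg G {p, p'} w + dg G (X \ {p, p'}) w := dg_le fun s hs _ => hsplit s hs
    have h5 : dg G {p, p'} w ≤ _ := dg_le_card
    have h6 : dg G (X \ {p, p'}) w ≤ _ := dg_le_card
    have h7 : 1 ≤ dg G {p, p'} w → lab (nb G {p, p'}) w = 1 := lab_nb
    have h8 : 1 ≤ dg G (X \ {p, p'}) w → lab (nb G (X \ {p, p'})) w = 1 := lab_nb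
    by_cases h9 : 1 ≤ dg G {p, p'} w
    · have := h7 h9
      by_cases h10 : 1 ≤ dg G (X \ {p, p'}) w
      · have := h8 h10
        omega
      · omega
    · by_cases h10 : 1 ≤ dg G (X \ {p, p'}) w
      · have := h8 h10
        omega
      · omega

/-- `U` and `T` are completely joined, except possibly for the pair `a, b`. -/
structure Near (G : SimpleGraph V) (U T : Finset V) (a b : V) : Prop where
  disj : Disjoint U T
  ha : a ∈ U
  hb : b ∈ T
  adj : ∀ σ ∈ U, ∀ τ ∈ T, σ ≠ a ∨ τ ≠ b → G.Adj σ τ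

section
variable {U T : Finset V} {a b : V} {m : ℕ}

theorem Near.symm (h : Near G U T a b) : Near G T U b a :=
  ⟨h.disj.symm, h.hb, h.ha, fun σ hσ τ hτ hne => (h.adj τ hτ σ hσ hne.symm).symm⟩

theorem Near.left (h : Near G U T a b) : Bip G (U.erase a) T := fun σ hσ τ hτ =>
  h.adj σ (Finset.mem_of_mem_erase hσ) τ hτ (.inl (Finset.ne_of_mem_erase hσ))

theorem Near.right (h : Near G U T a b) : Bip G U (T.erase b) := fun σ hσ τ hτ =>
  h.adj σ hσ τ (Finset.mem_of_mem_erase hτ) (.inr (Finset.ne_of_mem_erase hτ))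

theorem Near.odd (h : Near G U T a b) (hU : U.card = m) (hT : T.card = m) (hm : 3 ≤ m) {σ τ : V}
    (hσ : σ ∈ U) (hσa : σ ≠ a) (hτ : τ ∈ T) {j : ℕ} (hj : j < m) :
    PL G (U ∪ T) σ τ (2 * j + 1) := by
  have hσ' : σ ∈ U.erase a := Finset.mem_erase.2 ⟨hσa, hσ⟩
  have hUa := Finset.card_erase_of_mem h.ha
  have hTτ := Finset.card_erase_of_mem hτ
  have haT : a ∉ T := Finset.disjoint_left.1 h.disj h.ha
  have hτU : τ ∉ U := Finset.disjoint_right.1 h.disj hτ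
  by_cases hjm : j + 1 ≤ m - 1
  · refine (h.left.symm.odd₂ hτ hσ' (j := j) (by omega) (by omega)).mono ?_
    rw [Finset.union_comm]
    exact Finset.union_subset_union (Finset.erase_subset _ _) (Finset.Subset.refl _)
  obtain rfl : j = m - 1 := by omega
  by_cases hτb : τ = b
  · subst hτb
    obtain ⟨c, hc⟩ : (T.erase τ).Nonempty := Finset.card_pos.1 (by omega)
    rw [Finset.mem_erase] at hc
    have hTc := Finset.card_erase_of_mem hc.2
    have hτc : τ ∈ T.erase c := Finset.mem_erase.2 ⟨hc.1.symm, hτ⟩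
    obtain ⟨d, hd⟩ : ((T.erase c).erase τ).Nonempty := by
      have := Finset.card_erase_of_mem hτc
      exact Finset.card_pos.1 (by omega)
    simp only [Finset.mem_erase] at hd
    have hUs := Finset.card_erase_of_mem hσ'
    have h1 : PL G ((U.erase a).erase σ ∪ T.erase c) d τ (2 * (m - 2)) :=
      (h.left.mono (Finset.erase_subset _ _) (Finset.erase_subset _ _)).even₂
        (Finset.mem_erase.2 ⟨hd.2.1, hd.2.2⟩) hτc hd.1 (by omega) (by omega) (by omega)
    have h2 : PL G (insert a ((U.erase a).erase σ ∪ T.erase c)) a τ (2 * (m - 2) + 1) :=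
      h1.cons' (h.adj a h.ha d hd.2.2 (.inr hd.1)) (by simp [haT]) (by simp) (by simp)
    have hcU : c ∉ U := Finset.disjoint_right.1 h.disj hc.2
    have h3 : PL G (insert c (insert a ((U.erase a).erase σ ∪ T.erase c))) c τ
        (2 * (m - 2) + 1 + 1) :=
      h2.cons' (h.adj a h.ha c hc.2 (.inr hc.1)).symm
        (by simpa [hcU] using fun e : c = a => haT (e ▸ hc.2)) (by simp) (by simp)
    have hσT : σ ∉ T := Finset.disjoint_left.1 h.disj hσ
    have h4 : PL G (U ∪ T) σ τ (2 * (m - 2) + 1 + 1 + 1) :=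
      h3.cons' (h.adj σ hσ c hc.2 (.inl hσa))
        (by simpa [hσT, hσa] using fun e : σ = c => hσT (e ▸ hc.2)) (by simp [hσ]) (by
          intro z hz
          simp only [Finset.mem_insert, Finset.mem_union, Finset.mem_erase] at hz ⊢
          rcases hz with rfl | rfl | hz | hz
          · exact .inr hc.2
          · exact .inl h.ha
          · exact .inl hz.2.2
          · exact .inr hz.2)
    rwa [show 2 * (m - 1) + 1 = 2 * (m - 2) + 1 + 1 + 1 by omega]
  · have hbτ : b ∈ T.erase τ := Finset.mem_erase.2 ⟨Ne.symm hτb, h.hb⟩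
    obtain ⟨c, hc⟩ : ((T.erase τ).erase b).Nonempty := by
      have := Finset.card_erase_of_mem hbτ
      exact Finset.card_pos.1 (by omega)
    simp only [Finset.mem_erase] at hc
    have h1 : PL G (T.erase τ ∪ U.erase a) σ c (2 * (m - 2) + 1) :=
      (h.left.mono (Finset.Subset.refl _) (Finset.erase_subset _ _)).symm.odd₂
        (Finset.mem_erase.2 ⟨hc.2.1, hc.2.2⟩) hσ' (by omega) (by omega)
    have h2 : PL G (insert a (T.erase τ ∪ U.erase a)) σ a (2 * (m - 2) + 1 + 1) :=
      h1.snoc (h.adj a h.ha c hc.2.2 (.inr hc.1)).symm (by simp [haT]) (by simp) (by simp)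
    have h3 : PL G (U ∪ T) σ τ (2 * (m - 2) + 1 + 1 + 1) :=
      h2.snoc (h.adj a h.ha τ hτ (.inr hτb)) (by simpa [hτU] using fun e : τ = a => haT (e ▸ hτ))
        (by simp [hτ]) (by
          intro z hz
          simp only [Finset.mem_insert, Finset.mem_union, Finset.mem_erase] at hz ⊢
          rcases hz with rfl | hz | hz
          · exact .inl h.ha
          · exact .inr hz.2
          · exact .inl hz.2)
    rwa [show 2 * (m - 1) + 1 = 2 * (m - 2) + 1 + 1 + 1 by omega]

/-- A vertex outside `U ∪ T` sees only one of the two sides, or exactly the exceptional pair. -/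
theorem Near.side (h3 : NoTri G) (h : Near G U T a b) {w σ τ : V} (hσ : σ ∈ U) (hτ : τ ∈ T)
    (h1 : G.Adj w σ) (h2 : G.Adj w τ) : σ = a ∧ τ = b := by
  by_contra hcon
  have : σ ≠ a ∨ τ ≠ b := by tauto
  exact h3 w σ τ h1 (h.adj σ hσ τ hτ this) h2

theorem cycle_link {D₁ D₂ R : Finset V} {a b u v : V} {l x y : ℕ} (hl : PL G R u b l)
    (hx : ∃ p ∈ nb G {a}, ∃ q ∈ nb G {u}, PL G D₁ p q x)
    (hy : ∃ p ∈ nb G {b}, ∃ q ∈ nb G {v}, PL G D₂ p q y)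
    (hav : G.Adj a v) (hd : Disjoint D₁ D₂) (hd₁ : Disjoint D₁ R) (hd₂ : Disjoint D₂ R)
    (ha : a ∉ D₁ ∪ D₂ ∪ R) (hv : v ∉ D₁ ∪ D₂ ∪ R) : HasCycleLen G (l + x + y + 5) := by
  obtain ⟨a₁, ha₁, u₁, hu₁, p⟩ := hx
  obtain ⟨b₂, hb₂, v₂, hv₂, q⟩ := hy
  simp only [Finset.mem_union, not_or] at ha hv
  have h1 : PL G (D₁ ∪ R) a₁ b (x + l + 1) :=
    p.join (mem_nb1.1 hu₁).symm hl hd₁ Finset.subset_union_left Finset.subset_union_right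
  have h2 : PL G (insert v D₂) b₂ v (y + 1) :=
    q.snoc (mem_nb1.1 hv₂).symm hv.1.2 (Finset.mem_insert_self _ _) (Finset.subset_insert _ _)
  have h3 : PL G (insert a (insert v D₂)) b₂ a (y + 1 + 1) :=
    h2.snoc hav.symm (by simp [ha.1.2, hav.ne]) (Finset.mem_insert_self _ _)
      (Finset.subset_insert _ _)
  have hdj : Disjoint (D₁ ∪ R) (insert a (insert v D₂)) := by
    rw [Finset.disjoint_insert_right, Finset.disjoint_insert_right, Finset.disjoint_union_left]
    simp only [Finset.mem_union, not_or]
    exact ⟨⟨ha.1.1, ha.2⟩, ⟨hv.1.1, hv.2⟩, hd, hd₂.symm⟩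
  have h4 : 1 ≤ x + l + 1 + (y + 1 + 1) := by omega
  have h5 := h1.cycle₂ h3 hdj (mem_nb1.1 hb₂) (mem_nb1.1 ha₁) h4
  rw [show l + x + y + 5 = x + l + 1 + (y + 1 + 1) + 2 by omega]
  exact h5
end

theorem Gr.link_side {k : ℕ} (hk : k = 4 ∨ k = 5) (g : Gr G k) (h3 : NoTri G) {H U : Finset V}
    {a u : V} (hu : u ∉ H) (hUH : U ⊆ H) (ha : a ∈ U) (hU : U.card = 3)
    (honly : ∀ w ∈ comp G (Finset.univ \ H) u, ∀ s ∈ H, G.Adj w s → s ∈ U)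
    (hat : ∃ w ∈ comp G (Finset.univ \ H) u, G.Adj w a) :
    AP (k - 2) (Lens G (comp G (Finset.univ \ H) u) (nb G {a}) (nb G (U.erase a))) := by
  obtain ⟨w₀, hw₀, hwa⟩ := hat
  have hUa := Finset.card_erase_of_mem ha
  obtain ⟨z, hz⟩ : (U.erase a).Nonempty := Finset.card_pos.1 (by omega)
  rw [Finset.mem_erase] at hz
  obtain ⟨w₁, hw₁, s, hs, hsa, hws⟩ := g.att hu (hUH ha) (hUH hz.2) hz.1
  have hsplit : ∀ w ∈ comp G (Finset.univ \ H) u, ∀ s ∈ H, G.Adj w s →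
      s ∈ ({a} : Finset V) ∨ s ∈ U.erase a := fun w hw s hs hws => by
    by_cases hsa : s = a
    · exact .inl (by simp [hsa])
    · exact .inr (Finset.mem_erase.2 ⟨hsa, honly w hw s hs hws⟩)
  have hr := g.ri (P := {a}) (Q := U.erase a) (u := u) (hUH ha) ⟨w₀, hw₀, a, by simp, hwa⟩
    ⟨w₁, hw₁, s, Finset.mem_erase.2 ⟨hsa, honly w₁ hw₁ s hs hws⟩, hws⟩ hsplit
  refine th_all h3 (by omega) _ _ _ hr fun w hw => ?_
  have h1 := g.degc hw
  have h2 : dg G {a} w ≤ _ := dg_le_card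
  have h4 : dg G (U.erase a) w ≤ _ := dg_le_card
  rw [Finset.card_singleton] at h2
  have h5 := dg_lab_sub (a := 0) (b := 1) (hsplit w hw) (by omega) (by omega)
  unfold ld
  omega

theorem comp_disj {W : Finset V} {u v w : V} (hw : w ∈ comp G W u) (hnv : w ∉ comp G W v) :
    Disjoint (comp G W u) (comp G W v) := by
  refine Finset.disjoint_left.2 fun z hz hz' => hnv ?_
  exact mem_comp.2 (((mem_comp.1 hz').trans (mem_comp.1 hz).symm).trans (mem_comp.1 hw))

theorem Gr.link {k : ℕ} (hk : k = 4 ∨ k = 5) (g : Gr G k) (h3 : NoTri G) {U T : Finset V}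
    {a b u v : V} (h : Near G U T a b) (hU : U.card = 3) (hT : T.card = 3) (hu : u ∉ U ∪ T)
    (hv : v ∉ U ∪ T)
    (ho₁ : ∀ w ∈ comp G (Finset.univ \ (U ∪ T)) u, ∀ s ∈ U ∪ T, G.Adj w s → s ∈ U)
    (ho₂ : ∀ w ∈ comp G (Finset.univ \ (U ∪ T)) v, ∀ s ∈ U ∪ T, G.Adj w s → s ∈ T)
    (hat₁ : ∃ w ∈ comp G (Finset.univ \ (U ∪ T)) u, G.Adj w a)
    (hat₂ : ∃ w ∈ comp G (Finset.univ \ (U ∪ T)) v, G.Adj w b) : AP k (HasCycleLen G) := by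
  have hl₁ := g.link_side hk h3 hu Finset.subset_union_left h.ha hU ho₁ hat₁
  have hl₂ := g.link_side hk h3 hv Finset.subset_union_right h.hb hT ho₂ hat₂
  obtain ⟨w, hw, hwa⟩ := hat₁
  have hd : Disjoint (comp G (Finset.univ \ (U ∪ T)) u) (comp G (Finset.univ \ (U ∪ T)) v) :=
    comp_disj hw fun hh => Finset.disjoint_left.1 h.disj h.ha
      (ho₂ w hh a (Finset.mem_union_left _ h.ha) hwa)
  have hdH : ∀ z, Disjoint (comp G (Finset.univ \ (U ∪ T)) z) (U ∪ T) := fun z => disj_comp.symm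
  have hK : AP 2 fun l => l = 1 ∨ l = 3 := ⟨1, 2, .inr rfl, fun i hi => by omega⟩
  have hs := AP.add (c := 0) (S' := fun z => ∃ l x, (l = 1 ∨ l = 3) ∧ Lens G
    (comp G (Finset.univ \ (U ∪ T)) u) (nb G {a}) (nb G (U.erase a)) x ∧ z = l + x)
    (by omega) (by omega) hK hl₁ fun l hl x hx => ⟨l, x, hl, hx, rfl⟩
  refine (AP.add (c := 5) (by omega) (by omega) hs hl₂ ?_).le (by omega)
  rintro z ⟨l, x, hl, ⟨p, hp, q, hq, hx⟩, rfl⟩ y ⟨p', hp', q', hq', hy⟩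
  obtain ⟨s, hs, hsq⟩ := mem_nb.1 hq
  obtain ⟨t, ht, htq⟩ := mem_nb.1 hq'
  rw [Finset.mem_erase] at ht
  have hR : T.erase t ∪ U.erase a ⊆ U ∪ T := Finset.union_subset
    ((Finset.erase_subset _ _).trans Finset.subset_union_right)
    ((Finset.erase_subset _ _).trans Finset.subset_union_left)
  have hUa := Finset.card_erase_of_mem h.ha
  have hTt := Finset.card_erase_of_mem ht.2
  have hbip : Bip G (T.erase t) (U.erase a) :=
    (h.left.mono (Finset.Subset.refl _) (Finset.erase_subset _ _)).symm
  have hbt : b ∈ T.erase t := Finset.mem_erase.2 ⟨ht.1.symm, h.hb⟩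
  have hlink : PL G (T.erase t ∪ U.erase a) s b l := by
    rcases hl with rfl | rfl
    · exact hbip.odd₂ (j := 0) hbt hs (by omega) (by omega)
    · exact hbip.odd₂ (j := 1) hbt hs (by omega) (by omega)
  have haT : a ∉ T := Finset.disjoint_left.1 h.disj h.ha
  have htU : t ∉ U := Finset.disjoint_right.1 h.disj ht.2
  have hn : ∀ z r, r ∈ U ∪ T → r ∉ comp G (Finset.univ \ (U ∪ T)) z := fun z r hr =>
    Finset.disjoint_right.1 (hdH z) hr
  refine cycle_link hlink ⟨p, hp, q, mem_nb1.2 hsq, hx⟩ ⟨p', hp', q', mem_nb1.2 htq, hy⟩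
    (h.adj a h.ha t ht.2 (.inr ht.1)) hd ((hdH u).mono_right hR) ((hdH v).mono_right hR) ?_ ?_
  · have haU : a ∈ U ∪ T := Finset.mem_union_left _ h.ha
    simp [hn u a haU, hn v a haU, haT]
  · have htU' : t ∈ U ∪ T := Finset.mem_union_right _ ht.2
    simp [hn u t htU', hn v t htU', htU]

section
variable {k m : ℕ} (g : Gr G k) (h3 : NoTri G) (hc : NoCut G) {U T : Finset V} {a b u : V}
include g h3 hc

theorem Gr.near_core (h : Near G U T a b) (hU : U.card = m) (hT : T.card = m) (hm : 3 ≤ m)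
    (hmk : m ≤ k) (hdU : ∀ w, w ∉ U ∪ T → ∃ x ∈ U, ¬ G.Adj w x)
    (hdT : ∀ w, w ∉ U ∪ T → ∃ x ∈ T, ¬ G.Adj w x)
    (h1 : ∃ w ∈ comp G (Finset.univ \ (U ∪ T)) u, ∃ s ∈ U.erase a, G.Adj w s)
    (h2 : ∃ w ∈ comp G (Finset.univ \ (U ∪ T)) u, ∃ s ∈ T, G.Adj w s) : AP k (HasCycleLen G) := by
  refine g.eng (r := m - 2) (P := U.erase a) (Q := T) (u := u) (z := b) (e := a) h3 hc
    (Finset.mem_union_right _ h.hb) (Finset.mem_union_left _ h.ha)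
    (fun e => Finset.disjoint_left.1 h.disj h.ha (e ▸ h.hb)) h1 h2
    (fun w hw s hs hws => ?_) (AP.odds (s := m - 2 + 2)) (by omega)
    (by rintro x ⟨j, -, rfl⟩; omega) ?_ fun w hw => ?_
  · rcases Finset.mem_union.1 hs with hs | hs
    · by_cases hsa : s = a
      · exact .inr (.inr hsa)
      · exact .inl (Finset.mem_erase.2 ⟨hsa, hs⟩)
    · exact .inr (.inl hs)
  · rintro x ⟨j, hj, rfl⟩ p hp q hq
    rw [Finset.mem_erase] at hp
    exact h.odd hU hT hm hp.2 hp.1 hq (by omega)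
  · have hwH : w ∉ U ∪ T := Finset.disjoint_right.1 disj_comp hw
    obtain ⟨x, hx, hwx⟩ := hdU w hwH
    obtain ⟨y, hy, hwy⟩ := hdT w hwH
    have e1 : dg G U w + 1 ≤ U.card := dg_lt_card hx hwx
    have e2 : dg G T w + 1 ≤ T.card := dg_lt_card hy hwy
    have e3 : dg G (U ∪ T) w ≤ dg G U w + dg G T w := dg_union
    have e4 : dg G U w ≤ dg G (U.erase a) w + dg G {a} w := dg_le fun s hs _ => by
      by_cases hsa : s = a
      · exact .inr (by simp [hsa])
      · exact .inl (Finset.mem_erase.2 ⟨hsa, hs⟩)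
    have e5 : dg G {a} w ≤ _ := dg_le_card
    rw [Finset.card_singleton] at e5
    have e6 : 1 ≤ dg G (U.erase a) w → lab (nb G (U.erase a)) w = 1 := lab_nb
    have e7 : 1 ≤ dg G T w → lab (nb G T) w = 1 := lab_nb
    have e8 : 1 ≤ dg G T w → 1 ≤ dg G (U.erase a) w → False := fun f1 f2 => by
      obtain ⟨τ, hτ, hwτ⟩ := dg_pos f1
      obtain ⟨σ, hσ, hwσ⟩ := dg_pos f2
      rw [Finset.mem_erase] at hσ
      exact hσ.1 (h.side h3 hσ.2 hτ hwσ hwτ).1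
    have e9 : 1 ≤ dg G T w → 1 ≤ dg G U w → dg G T w ≤ 1 := fun _ f2 => by
      obtain ⟨σ, hσ, hwσ⟩ := dg_pos f2
      refine dg_le_one fun p hp q hq hwp hwq => ?_
      rw [(h.side h3 hσ hp hwσ hwp).2, (h.side h3 hσ hq hwσ hwq).2]
    by_cases f1 : 1 ≤ dg G T w
    · have := e7 f1
      have := e8 f1
      by_cases f2 : 1 ≤ dg G U w
      · have := e9 f1 f2
        omega
      · omega
    · by_cases f2 : 1 ≤ dg G (U.erase a) w
      · have := e6 f2
        omega
      · omega

theorem Gr.near_both (h : Near G U T a b) (hU : U.card = m) (hT : T.card = m) (hm : 3 ≤ m)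
    (hmk : m ≤ k) (hdU : ∀ w, w ∉ U ∪ T → ∃ x ∈ U, ¬ G.Adj w x)
    (hdT : ∀ w, w ∉ U ∪ T → ∃ x ∈ T, ¬ G.Adj w x) (hu : u ∉ U ∪ T)
    (h1 : ∃ w ∈ comp G (Finset.univ \ (U ∪ T)) u, ∃ s ∈ U, G.Adj w s)
    (h2 : ∃ w ∈ comp G (Finset.univ \ (U ∪ T)) u, ∃ s ∈ T, G.Adj w s) : AP k (HasCycleLen G) := by
  obtain ⟨z, hz⟩ : (U.erase a).Nonempty := by
    have := Finset.card_erase_of_mem h.ha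
    exact Finset.card_pos.1 (by omega)
  rw [Finset.mem_erase] at hz
  have hzT := Finset.disjoint_left.1 h.disj hz.2
  obtain ⟨w, hw, s, hs, hsa, hsb, hws⟩ := Gr.att₃ hc hu (Finset.mem_union_left T h.ha)
    (Finset.mem_union_right U h.hb) (Finset.mem_union_left T hz.2)
    (fun e => Finset.disjoint_left.1 h.disj h.ha (e ▸ h.hb)) hz.1 (fun e => hzT (e ▸ h.hb))
  rcases Finset.mem_union.1 hs with hs | hs
  · exact g.near_core h3 hc h hU hT hm hmk hdU hdT ⟨w, hw, s, Finset.mem_erase.2 ⟨hsa, hs⟩, hws⟩ h2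
  · refine g.near_core (u := u) h3 hc h.symm hT hU hm hmk ?_ ?_ ?_ ?_
    · rwa [Finset.union_comm]
    · rwa [Finset.union_comm]
    · rw [Finset.union_comm]
      exact ⟨w, hw, s, Finset.mem_erase.2 ⟨hsb, hs⟩, hws⟩
    · rwa [Finset.union_comm]

theorem Gr.near (hk : k = 4 ∨ k = 5) (h : Near G U T a b) (hU : U.card = m) (hT : T.card = m)
    (hm : 3 ≤ m) (hmk : m ≤ k) (hab : G.Adj a b → m < k)
    (hdU : ∀ w, w ∉ U ∪ T → ∃ x ∈ U, ¬ G.Adj w x)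
    (hdT : ∀ w, w ∉ U ∪ T → ∃ x ∈ T, ¬ G.Adj w x) : AP k (HasCycleLen G) := by
  by_contra hcon
  have hone : ∀ u, u ∉ U ∪ T → (∃ w ∈ comp G (Finset.univ \ (U ∪ T)) u, ∃ s ∈ U, G.Adj w s) →
      ∀ w ∈ comp G (Finset.univ \ (U ∪ T)) u, ∀ s ∈ U ∪ T, G.Adj w s → s ∈ U :=
    fun u hu h1 w hw s hs hws => by
      by_contra hsU
      exact hcon (g.near_both h3 hc h hU hT hm hmk hdU hdT hu h1
        ⟨w, hw, s, (Finset.mem_union.1 hs).resolve_left hsU, hws⟩)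
  have hone' : ∀ u, u ∉ U ∪ T → (∃ w ∈ comp G (Finset.univ \ (U ∪ T)) u, ∃ s ∈ T, G.Adj w s) →
      ∀ w ∈ comp G (Finset.univ \ (U ∪ T)) u, ∀ s ∈ U ∪ T, G.Adj w s → s ∈ T :=
    fun u hu h1 w hw s hs hws => by
      by_contra hsU
      exact hcon (g.near_both h3 hc h hU hT hm hmk hdU hdT hu
        ⟨w, hw, s, (Finset.mem_union.1 hs).resolve_right hsU, hws⟩ h1)
  have out : ∀ {U T : Finset V} {a b : V}, Near G U T a b → U.card = m → T.card = m →
      (G.Adj a b → m < k) → ∃ u, u ∉ U ∪ T ∧ G.Adj a u := by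
    intro U T a b h hU hT hab
    by_contra hcon
    push Not at hcon
    have h1 := g.deg a
    have h2 : dg G Finset.univ a ≤ dg G T a + dg G ∅ a := dg_le fun x _ hax => by
      by_contra hx
      simp only [Finset.notMem_empty, or_false] at hx
      have hxU : x ∈ U := by
        by_contra hxU
        exact hcon x (by simp [hx, hxU]) hax
      obtain ⟨τ, hτ⟩ : (T.erase b).Nonempty := by
        have := Finset.card_erase_of_mem h.hb
        exact Finset.card_pos.1 (by omega)
      rw [Finset.mem_erase] at hτ
      exact h3 a x τ hax (h.adj x hxU τ hτ.2 (.inr hτ.1)) (h.adj a h.ha τ hτ.2 (.inr hτ.1))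
    have h4 : dg G ∅ a ≤ (∅ : Finset V).card := dg_le_card
    rw [Finset.card_empty] at h4
    by_cases hadj : G.Adj a b
    · have := hab hadj
      have : dg G T a ≤ T.card := dg_le_card
      omega
    · have : dg G T a + 1 ≤ T.card := dg_lt_card h.hb hadj
      omega
  obtain ⟨u, hu, hau⟩ := out h hU hT hab
  have hucomp := self_mem_comp (G := G) (W := Finset.univ \ (U ∪ T)) (u := u) (by simpa using hu)
  have ho₁ := hone u hu ⟨u, hucomp, a, h.ha, hau.symm⟩
  by_cases h4 : 4 ≤ m
  · refine hcon (g.one_side h3 hc hu h.right.symm ((Finset.erase_subset _ _).trans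
      Finset.subset_union_right) Finset.subset_union_left hU h4 (by omega) ?_ ho₁
      fun w hw => hdU w (Finset.disjoint_right.1 disj_comp hw))
    have := Finset.card_erase_of_mem h.hb
    omega
  obtain rfl : m = 3 := by omega
  obtain ⟨v, hv, hbv⟩ := out h.symm hT hU fun hh => hab hh.symm
  rw [Finset.union_comm] at hv
  have hvcomp := self_mem_comp (G := G) (W := Finset.univ \ (U ∪ T)) (u := v) (by simpa using hv)
  have ho₂ := hone' v hv ⟨v, hvcomp, b, h.hb, hbv.symm⟩
  exact hcon (g.link hk h3 h hU hT hu hv ho₁ ho₂ ⟨u, hucomp, hau.symm⟩ ⟨v, hvcomp, hbv.symm⟩)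
end

theorem Bip.side (h3 : NoTri G) {S T : Finset V} (h : Bip G S T) {w σ τ : V} (hσ : σ ∈ S)
    (hτ : τ ∈ T) (h1 : G.Adj w σ) (h2 : G.Adj w τ) : False :=
  h3 w σ τ h1 (h σ hσ τ hτ) h2

theorem Bip.odd₃ {S T : Finset V} {σ τ : V} {j : ℕ} (h : Bip G S T) (hσ : σ ∈ S) (hτ : τ ∈ T)
    (hS : j + 1 ≤ S.card) (hT : j + 1 ≤ T.card) : PL G (S ∪ T) σ τ (2 * j + 1) := by
  rw [Finset.union_comm]
  exact h.symm.odd₂ hτ hσ hT hS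

section
variable {k s : ℕ} (g : Gr G k) {S T : Finset V} {u : V}
include g

theorem Gr.big_both (hk : 1 ≤ k) (h : Bip G S T) (hS : k ≤ S.card) (hT : k ≤ T.card)
    (h1 : ∃ w ∈ comp G (Finset.univ \ (S ∪ T)) u, ∃ s ∈ S, G.Adj w s)
    (h2 : ∃ w ∈ comp G (Finset.univ \ (S ∪ T)) u, ∃ s ∈ T, G.Adj w s) : AP k (HasCycleLen G) := by
  obtain ⟨w, hw, p, hp, hwp⟩ := h1
  obtain ⟨w', hw', q, hq, hwq⟩ := h2
  refine Gr.easy hk ⟨w, hw, hwp⟩ ⟨w', hw', hwq⟩ (AP.odds (s := k)) ?_ ?_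
  · rintro x ⟨j, -, rfl⟩; omega
  · rintro x ⟨j, hj, rfl⟩
    exact h.odd₃ hp hq (by omega) (by omega)

theorem Gr.big_T (hk : 1 ≤ k) (h : Bip G S T) (hS : k ≤ S.card) (hT : k + 1 ≤ T.card)
    (hu : u ∉ S ∪ T)
    (ho : ∀ w ∈ comp G (Finset.univ \ (S ∪ T)) u, ∀ s ∈ S ∪ T, G.Adj w s → s ∈ T) :
    AP k (HasCycleLen G) := by
  have hc : T.card ≤ (S ∪ T).card := Finset.card_le_card Finset.subset_union_right
  obtain ⟨p, hp, q, hq, hpq, ⟨w, hw, hwp⟩, w', hw', hwq⟩ := g.att₂ hu (by omega)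
  have hpT := ho w hw p hp hwp
  have hqT := ho w' hw' q hq hwq
  refine Gr.easy hk ⟨w, hw, hwp⟩ ⟨w', hw', hwq⟩ (AP.evens₂ (s := k)) ?_ ?_
  · rintro x ⟨j, hj, -, rfl⟩; omega
  · rintro x ⟨j, hj, hj', rfl⟩
    exact h.even₂ hpT hqT hpq hj (by omega) (by omega)

theorem common_spec : Bip G S (Finset.univ.filter fun w => ∀ x ∈ S, G.Adj w x) ∧
    (∀ w, w ∉ S ∪ Finset.univ.filter (fun w => ∀ x ∈ S, G.Adj w x) → ∃ x ∈ S, ¬ G.Adj w x) ∧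
    (Bip G S T → T ⊆ Finset.univ.filter fun w => ∀ x ∈ S, G.Adj w x) := by
  refine ⟨fun σ hσ τ hτ => ((Finset.mem_filter.1 hτ).2 σ hσ).symm, fun w hw => ?_,
    fun h τ hτ => Finset.mem_filter.2 ⟨Finset.mem_univ _, fun x hx => (h x hx τ hτ).symm⟩⟩
  by_contra hcon
  push Not at hcon
  exact hw (Finset.mem_union_right _ (Finset.mem_filter.2 ⟨Finset.mem_univ _, hcon⟩))

theorem Gr.big (hk : k = 4 ∨ k = 5) (h3 : NoTri G) (hc : NoCut G) (h : Bip G S T)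
    (hS : S.card = k) (hT : k ≤ T.card) : AP k (HasCycleLen G) ∨
      ∃ S T : Finset V, Bip G S T ∧ S.card = k ∧ S ∪ T = Finset.univ := by
  by_cases hbig : ∃ S T : Finset V, Bip G S T ∧ S.card = k ∧ k + 1 ≤ T.card
  · obtain ⟨S, T₀, h, hS, hT₀⟩ := hbig
    obtain ⟨hb, hout, hsub⟩ := common_spec g (S := S) (T := T₀)
    have hT := Finset.card_le_card (hsub h)
    generalize (Finset.univ.filter fun w => ∀ x ∈ S, G.Adj w x) = T at hb hout hT
    by_cases hall : S ∪ T = Finset.univ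
    · exact .inr ⟨S, T, hb, hS, hall⟩
    obtain ⟨u, hu⟩ : ∃ u, u ∉ S ∪ T := by
      by_contra hcon
      push Not at hcon
      exact hall (Finset.eq_univ_iff_forall.2 hcon)
    left
    by_cases h1 : ∃ w ∈ comp G (Finset.univ \ (S ∪ T)) u, ∃ s ∈ S, G.Adj w s
    · by_cases h2 : ∃ w ∈ comp G (Finset.univ \ (S ∪ T)) u, ∃ s ∈ T, G.Adj w s
      · exact g.big_both (by omega) hb (by omega) (by omega) h1 h2
      · push Not at h2
        exact g.one_side h3 hc hu hb.symm Finset.subset_union_right Finset.subset_union_left hS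
          (by omega) (by omega) (by omega)
          (fun w hw s hs hws => (Finset.mem_union.1 hs).resolve_right fun hs => h2 w hw s hs hws)
          fun w hw => hout w (Finset.disjoint_right.1 disj_comp hw)
    · push Not at h1
      exact g.big_T (by omega) hb (by omega) (by omega) hu
        fun w hw s hs hws => (Finset.mem_union.1 hs).resolve_left fun hs => h1 w hw s hs hws
  · push Not at hbig
    have hTk : T.card = k := by
      have := hbig S T h hS
      omega
    by_cases hall : S ∪ T = Finset.univ
    · exact .inr ⟨S, T, h, hS, hall⟩
    obtain ⟨u, hu⟩ : ∃ u, u ∉ S ∪ T := by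
      by_contra hcon
      push Not at hcon
      exact hall (Finset.eq_univ_iff_forall.2 hcon)
    left
    have hne : ∀ {S T : Finset V}, Bip G S T → S.card = k → T.card = k → ∀ w, w ∉ S ∪ T →
        ∃ x ∈ S, ¬ G.Adj w x := by
      intro S T h hS hT w hw
      by_contra hcon
      push Not at hcon
      have h5 := hbig S (insert w T) (fun σ hσ τ hτ => by
        rcases Finset.mem_insert.1 hτ with rfl | hτ'
        · exact (hcon σ hσ).symm
        · exact h σ hσ τ hτ') hS
      rw [Finset.card_insert_of_notMem fun hh => hw (Finset.mem_union_right _ hh)] at h5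
      omega
    by_cases h1 : ∃ w ∈ comp G (Finset.univ \ (S ∪ T)) u, ∃ s ∈ S, G.Adj w s
    · by_cases h2 : ∃ w ∈ comp G (Finset.univ \ (S ∪ T)) u, ∃ s ∈ T, G.Adj w s
      · exact g.big_both (by omega) h (by omega) (by omega) h1 h2
      · push Not at h2
        exact g.one_side h3 hc hu h.symm Finset.subset_union_right Finset.subset_union_left hS
          (by omega) (by omega) (by omega)
          (fun w hw s hs hws => (Finset.mem_union.1 hs).resolve_right fun hs => h2 w hw s hs hws)
          fun w hw => hne h hS hTk w (Finset.disjoint_right.1 disj_comp hw)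
    · push Not at h1
      exact g.one_side h3 hc hu h Finset.subset_union_left Finset.subset_union_right hTk
        (by omega) (by omega) (by omega)
        (fun w hw s hs hws => (Finset.mem_union.1 hs).resolve_left fun hs => h1 w hw s hs hws)
        fun w hw => hne h.symm hTk hS w (by
          rw [Finset.union_comm]
          exact Finset.disjoint_right.1 disj_comp hw)

theorem Gr.bip_out (h3 : NoTri G) (h : Bip G S T) (hS : S.Nonempty) (hSk : S.card < k) {τ : V}
    (hτ : τ ∈ T) : ∃ u, u ∉ S ∪ T ∧ G.Adj τ u := by
  by_contra hcon
  push Not at hcon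
  have h1 := g.deg τ
  have h2 : dg G Finset.univ τ ≤ dg G S τ + dg G ∅ τ := dg_le fun x _ hax => by
    by_contra hx
    simp only [Finset.notMem_empty, or_false] at hx
    have hxT : x ∈ T := by
      by_contra hxU
      exact hcon x (by simp [hx, hxU]) hax
    obtain ⟨σ, hσ⟩ := hS
    exact h3 τ x σ hax (h σ hσ x hxT).symm (h σ hσ τ hτ).symm
  have h4 : dg G ∅ τ ≤ (∅ : Finset V).card := dg_le_card
  rw [Finset.card_empty] at h4
  have : dg G S τ ≤ S.card := dg_le_card
  omega

theorem Gr.bip_both (h3 : NoTri G) (hc : NoCut G) (h : Bip G S T) (hs : 2 ≤ s) (hsk : s ≤ k)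
    (hS : s ≤ S.card) (hT : s ≤ T.card)
    (hdS : ∀ w, w ∉ S ∪ T → dg G S w + 1 ≤ s) (hdT : ∀ w, w ∉ S ∪ T → dg G T w + 1 ≤ s)
    (h1 : ∃ w ∈ comp G (Finset.univ \ (S ∪ T)) u, ∃ s ∈ S, G.Adj w s)
    (h2 : ∃ w ∈ comp G (Finset.univ \ (S ∪ T)) u, ∃ s ∈ T, G.Adj w s) : AP k (HasCycleLen G) := by
  obtain ⟨σ, hσ⟩ : S.Nonempty := Finset.card_pos.1 (by omega)
  obtain ⟨τ, hτ⟩ : T.Nonempty := Finset.card_pos.1 (by omega)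
  refine g.eng (r := s - 2) (P := S) (Q := T) (u := u) (z := τ) (e := σ) h3 hc
    (Finset.mem_union_right _ hτ) (Finset.mem_union_left _ hσ) (h σ hσ τ hτ).ne' h1 h2
    (fun w hw s hs hws => ?_) (AP.odds (s := s - 2 + 2)) (by omega)
    (by rintro x ⟨j, -, rfl⟩; omega) ?_ fun w hw => ?_
  · rcases Finset.mem_union.1 hs with hs | hs
    · exact .inl hs
    · exact .inr (.inl hs)
  · rintro x ⟨j, hj, rfl⟩ p hp q hq
    exact h.odd₃ hp hq (by omega) (by omega)
  · have hwH : w ∉ S ∪ T := Finset.disjoint_right.1 disj_comp hw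
    have e1 := hdS w hwH
    have e2 := hdT w hwH
    have e3 : dg G (S ∪ T) w ≤ dg G S w + dg G T w := dg_union
    have e6 : 1 ≤ dg G S w → lab (nb G S) w = 1 := lab_nb
    have e7 : 1 ≤ dg G T w → lab (nb G T) w = 1 := lab_nb
    by_cases f1 : 1 ≤ dg G T w
    · have := e7 f1
      by_cases f2 : 1 ≤ dg G S w
      · obtain ⟨y, hy, hwy⟩ := dg_pos f1
        obtain ⟨x, hx, hwx⟩ := dg_pos f2
        exact (h.side h3 hx hy hwx hwy).elim
      · omega
    · by_cases f2 : 1 ≤ dg G S w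
      · have := e6 f2
        omega
      · omega

theorem Gr.bip_wide (h3 : NoTri G) (hc : NoCut G) (h : Bip G S T) (hs : 2 ≤ s) (hsk : s < k)
    (hS : S.card = s) (hT : s + 1 ≤ T.card)
    (hdS : ∀ w, w ∉ S ∪ T → dg G S w + 1 ≤ s) (hdT : ∀ w, w ∉ S ∪ T → dg G T w + 1 ≤ s) :
    AP k (HasCycleLen G) := by
  obtain ⟨τ, hτ, z, hz, hτz⟩ := Finset.one_lt_card.1 (by omega : 1 < T.card)
  obtain ⟨u, hu, hτu⟩ := g.bip_out h3 h (Finset.card_pos.1 (by omega)) (by omega) hτ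
  have hucomp := self_mem_comp (G := G) (W := Finset.univ \ (S ∪ T)) (u := u) (by simpa using hu)
  by_cases h1 : ∃ w ∈ comp G (Finset.univ \ (S ∪ T)) u, ∃ s ∈ S, G.Adj w s
  · exact g.bip_both h3 hc h hs hsk.le (by omega) (by omega) hdS hdT h1 ⟨u, hucomp, τ, hτ, hτu.symm⟩
  push Not at h1
  have ho : ∀ w ∈ comp G (Finset.univ \ (S ∪ T)) u, ∀ s ∈ S ∪ T, G.Adj w s →
      s ∈ ({τ} : Finset V) ∨ s ∈ T.erase τ := fun w hw s hs hws => by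
    have hsT := (Finset.mem_union.1 hs).resolve_left fun hs => h1 w hw s hs hws
    by_cases hsτ : s = τ
    · exact .inl (by simp [hsτ])
    · exact .inr (Finset.mem_erase.2 ⟨hsτ, hsT⟩)
  have hτH : τ ∈ S ∪ T := Finset.mem_union_right _ hτ
  have hzH : z ∈ S ∪ T := Finset.mem_union_right _ hz
  obtain ⟨w, hw, q, hq, hqτ, hwq⟩ := g.att hu hτH hzH hτz.symm
  refine g.eng (r := s - 2) (P := {τ}) (Q := T.erase τ) (u := u) (z := z) (e := τ) h3 hc
    hzH hτH hτz.symm ⟨u, hucomp, τ, by simp, hτu.symm⟩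
    ⟨w, hw, q, (ho w hw q hq hwq).resolve_left (by simpa using hqτ), hwq⟩
    (fun w hw s hs hws => ?_) (AP.evens₂ (s := s - 2 + 2)) (by omega)
    (by rintro x ⟨j, h1, -, rfl⟩; omega) ?_ fun w hw => ?_
  · rcases ho w hw s hs hws with h | h
    · exact .inl h
    · exact .inr (.inl h)
  · rintro x ⟨j, hj1, hj2, rfl⟩ p hp q hq
    rw [Finset.mem_singleton] at hp
    rw [Finset.mem_erase] at hq
    subst hp
    exact h.even₂ hτ hq.2 hq.1.symm hj1 (by omega) (by omega)
  · have e1 := hdT w (Finset.disjoint_right.1 disj_comp hw)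
    have e2 : dg G {τ} w ≤ _ := dg_le_card
    rw [Finset.card_singleton] at e2
    have e3 : dg G (T.erase τ) w ≤ dg G T w := dg_mono (Finset.erase_subset _ _)
    have := dg_lab_sub (a := 0) (b := s - 2) (ho w hw) (by omega) (by omega)
    omega

theorem Gr.bip_two (hk : 3 ≤ k) (h3 : NoTri G) (hc : NoCut G) (h : Bip G S T)
    (hS : S.card = 2) (hT : T.card = 2)
    (hdS : ∀ w, w ∉ S ∪ T → dg G S w + 1 ≤ 2) (hdT : ∀ w, w ∉ S ∪ T → dg G T w + 1 ≤ 2) :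
    AP k (HasCycleLen G) := by
  obtain ⟨p, q, hpq, rfl⟩ := Finset.card_eq_two.1 hS
  obtain ⟨τ, hτ⟩ : T.Nonempty := Finset.card_pos.1 (by omega)
  obtain ⟨u, hu, hpu⟩ := g.bip_out h3 h.symm (Finset.card_pos.1 (by omega)) (by omega)
    (τ := p) (by simp)
  rw [Finset.union_comm] at hu
  have hucomp := self_mem_comp (G := G) (W := Finset.univ \ ({p, q} ∪ T)) (u := u)
    (by simpa using hu)
  obtain ⟨w, hw, s, hs, hsp, hsq, hws⟩ := Gr.att₃ hc (z := τ) hu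
    (Finset.mem_union_left T (by simp : p ∈ ({p, q} : Finset V)))
    (Finset.mem_union_left T (by simp : q ∈ ({p, q} : Finset V)))
    (Finset.mem_union_right _ hτ) hpq (h p (by simp) τ hτ).ne' (h q (by simp) τ hτ).ne'
  refine g.bip_both h3 hc h le_rfl (by omega) (by omega) (by omega) hdS hdT
    ⟨u, hucomp, p, by simp, hpu.symm⟩ ⟨w, hw, s, ?_, hws⟩
  exact (Finset.mem_union.1 hs).resolve_left (by simp [hsp, hsq])

end

theorem Bip.insert_right {S T : Finset V} {w : V} (h : Bip G S T) (hw : ∀ x ∈ S, G.Adj w x) :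
    Bip G S (insert w T) := fun σ hσ τ hτ => by
  rcases Finset.mem_insert.1 hτ with rfl | hτ'
  · exact (hw σ hσ).symm
  · exact h σ hσ τ hτ'

theorem Gr.square {k : ℕ} (hk : k = 4 ∨ k = 5) (g : Gr G k) (h3 : NoTri G) (hc : NoCut G)
    (hsq : ¬ NoSq G) : AP k (HasCycleLen G) ∨
      ∃ S T : Finset V, Bip G S T ∧ S.card = k ∧ S ∪ T = Finset.univ := by
  by_cases hbig : ∃ S T : Finset V, Bip G S T ∧ S.card = k ∧ k ≤ T.card
  · obtain ⟨S, T, h, hS, hT⟩ := hbig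
    exact g.big hk h3 hc h hS hT
  left
  obtain ⟨s, hs2, hsk, ⟨S, T, h, hS, hT⟩, hmax⟩ : ∃ s, 2 ≤ s ∧ s < k ∧
      (∃ S T : Finset V, Bip G S T ∧ S.card = s ∧ T.card = s) ∧
      ∀ S T : Finset V, Bip G S T → S.card = s + 1 → T.card = s + 1 → False := by
    have h2 : ∃ S T : Finset V, Bip G S T ∧ S.card = 2 ∧ T.card = 2 := by
      unfold NoSq at hsq
      push Not at hsq
      obtain ⟨x, y, u, v, hxy, hxu, hyu, hxv, hyv, huv⟩ := hsq
      exact ⟨{x, y}, {u, v}, fun σ hσ τ hτ => by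
        simp only [Finset.mem_insert, Finset.mem_singleton] at hσ hτ
        rcases hσ with rfl | rfl <;> rcases hτ with rfl | rfl <;> assumption,
        Finset.card_pair hxy, Finset.card_pair huv⟩
    have hk' : ¬ ∃ S T : Finset V, Bip G S T ∧ S.card = k ∧ T.card = k := fun ⟨S, T, h, hS, hT⟩ =>
      hbig ⟨S, T, h, hS, hT.ge⟩
    by_contra hcon
    push Not at hcon
    have step : ∀ s, 2 ≤ s → s < k → (∃ S T : Finset V, Bip G S T ∧ S.card = s ∧ T.card = s) →
        ∃ S T : Finset V, Bip G S T ∧ S.card = s + 1 ∧ T.card = s + 1 := fun s h1 h2 h4 => by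
      obtain ⟨S, T, h5, h6, h7⟩ := hcon s h1 h2 h4
      exact ⟨S, T, h5, h6, h7.1⟩
    have h3 := step 2 le_rfl (by omega) h2
    have h4 := step 3 (by omega) (by omega) h3
    rcases hk with rfl | rfl
    · exact hk' h4
    · exact hk' (step 4 (by omega) (by omega) h4)
  by_cases hnear : ∃ U W a b, Near G U W a b ∧ U.card = s + 1 ∧ W.card = s + 1
  · obtain ⟨U, W, a, b, hn, hU, hW⟩ := hnear
    have key : ∀ {U W : Finset V} {a b : V}, Near G U W a b → U.card = s + 1 → W.card = s + 1 →
        ∀ w, w ∉ U ∪ W → ∃ x ∈ U, ¬ G.Adj w x := by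
      intro U W a b hn hU hW w hw
      by_contra hcon
      push Not at hcon
      refine hmax U (insert w (W.erase b)) (hn.right.insert_right hcon) hU ?_
      rw [Finset.card_insert_of_notMem fun hh =>
        hw (Finset.mem_union_right _ (Finset.mem_of_mem_erase hh)), Finset.card_erase_of_mem hn.hb]
      omega
    refine g.near h3 hc hk hn hU hW (by omega) (by omega) (fun hab => ?_) (key hn hU hW) fun w hw =>
      key hn.symm hW hU w (by rwa [Finset.union_comm])
    exact (hmax U W (fun σ hσ τ hτ => by
      by_cases hh : σ ≠ a ∨ τ ≠ b
      · exact hn.adj σ hσ τ hτ hh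
      · push Not at hh
        obtain ⟨rfl, rfl⟩ := hh
        exact hab) hU hW).elim
  by_cases hwide : ∃ S T : Finset V, Bip G S T ∧ S.card = s ∧ s + 1 ≤ T.card
  · obtain ⟨S, T₀, h, hS, hT₀⟩ := hwide
    obtain ⟨hb, hout, hsub⟩ := common_spec g (S := S) (T := T₀)
    have hT := Finset.card_le_card (hsub h)
    generalize (Finset.univ.filter fun w => ∀ x ∈ S, G.Adj w x) = T at hb hout hT
    refine g.bip_wide h3 hc hb hs2 hsk hS (by omega) (fun w hw => ?_) fun w hw => ?_
    · obtain ⟨x, hx, hwx⟩ := hout w hw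
      rw [← hS]
      exact dg_lt_card hx hwx
    · by_contra hcon
      obtain ⟨N, hN, hNc⟩ := Finset.exists_subset_card_eq
        (by unfold dg at hcon; omega : s ≤ (T.filter (G.Adj w)).card)
      obtain ⟨τ, hτ, hτN⟩ : ∃ τ ∈ T, τ ∉ N := by
        by_contra hh
        push Not at hh
        have := Finset.card_le_card (fun x hx => hh x hx : T ⊆ N)
        omega
      have hNT : ∀ x ∈ N, x ∈ T ∧ G.Adj w x := fun x hx => Finset.mem_filter.1 (hN hx)
      rw [Finset.mem_union, not_or] at hw
      refine hnear ⟨insert w S, insert τ N, w, τ, ⟨?_, by simp, by simp, ?_⟩, ?_, ?_⟩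
      · refine Finset.disjoint_left.2 fun x hx hx' => ?_
        have hxT : x ∈ T := by
          rcases Finset.mem_insert.1 hx' with rfl | hx'
          · exact hτ
          · exact (hNT x hx').1
        rcases Finset.mem_insert.1 hx with rfl | hx
        · exact hw.2 hxT
        · exact (hb x hx x hxT).ne rfl
      · intro a ha b hb' hne
        rcases Finset.mem_insert.1 ha with rfl | ha'
        · rcases Finset.mem_insert.1 hb' with rfl | hb''
          · simp at hne
          · exact (hNT b hb'').2
        · rcases Finset.mem_insert.1 hb' with rfl | hb''
          · exact hb a ha' b hτ
          · exact hb a ha' b (hNT b hb'').1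
      · rw [Finset.card_insert_of_notMem hw.1, hS]
      · rw [Finset.card_insert_of_notMem hτN, hNc]
  · have key : ∀ {S T : Finset V}, Bip G S T → S.card = s → T.card = s →
        ∀ w, w ∉ S ∪ T → ∃ x ∈ S, ¬ G.Adj w x := by
      intro S T h hS hT w hw
      by_contra hcon
      push Not at hcon
      refine hwide ⟨S, insert w T, h.insert_right hcon, hS, ?_⟩
      rw [Finset.card_insert_of_notMem fun hh => hw (Finset.mem_union_right _ hh), hT]
    have k1 := key h hS hT
    have k2 : ∀ w, w ∉ S ∪ T → ∃ x ∈ T, ¬ G.Adj w x := fun w hw =>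
      key h.symm hT hS w (by rwa [Finset.union_comm])
    by_cases h2 : s = 2
    · subst h2
      refine g.bip_two (by omega) h3 hc h hS hT (fun w hw => ?_) fun w hw => ?_
      · obtain ⟨x, hx, hwx⟩ := k1 w hw
        rw [← hS]
        exact dg_lt_card hx hwx
      · obtain ⟨x, hx, hwx⟩ := k2 w hw
        rw [← hT]
        exact dg_lt_card hx hwx
    · obtain ⟨a, ha⟩ : S.Nonempty := Finset.card_pos.1 (by omega)
      obtain ⟨b, hb⟩ : T.Nonempty := Finset.card_pos.1 (by omega)
      exact g.near h3 hc hk ⟨h.disj, ha, hb, fun σ hσ τ hτ _ => h σ hσ τ hτ⟩ hS hT (by omega)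
        hsk.le (fun _ => hsk) k1 k2

/-- A cycle of length `g`, parametrised periodically. -/
structure Cyc (G : SimpleGraph V) (c : ℕ → V) (g : ℕ) : Prop where
  three : 3 ≤ g
  adj : ∀ i, G.Adj (c i) (c (i + 1))
  per : ∀ i, c (i + g) = c i
  inj : ∀ i j, i < j → j < i + g → c i ≠ c j

def img (c : ℕ → V) (g : ℕ) : Finset V := (Finset.range g).image c

def CycIn (G : SimpleGraph V) (W : Finset V) : Prop := ∃ c g, Cyc G c g ∧ ∀ i, c i ∈ W

section
variable {c : ℕ → V} {g : ℕ}

theorem Cyc.mem (h : Cyc G c g) (i : ℕ) : c i ∈ img c g := by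
  have hp : Function.Periodic c g := h.per
  rw [← hp.map_mod_nat i]
  exact Finset.mem_image_of_mem _ (Finset.mem_range.2 (Nat.mod_lt _ (by have := h.three; omega)))

theorem mem_img {x : V} (h : x ∈ img c g) : ∃ i, i < g ∧ c i = x := by
  obtain ⟨i, hi, rfl⟩ := Finset.mem_image.1 h
  exact ⟨i, Finset.mem_range.1 hi, rfl⟩

theorem Cyc.offset (h : Cyc G c g) (i : ℕ) {x : V} (hx : x ∈ img c g) :
    ∃ m < g, c (i + m) = x := by
  obtain ⟨j, hj, rfl⟩ := mem_img hx
  have hp : Function.Periodic c g := h.per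
  have hg : 0 < g := by have := h.three; omega
  refine ⟨(j + g * i - i) % g, Nat.mod_lt _ hg, ?_⟩
  have h1 : i ≤ g * i := Nat.le_mul_of_pos_left _ hg
  have h2 : c (i + (j + g * i - i) % g) = c (i + (j + g * i - i)) := by
    rw [← hp.map_mod_nat, Nat.add_mod_mod, hp.map_mod_nat]
  rw [h2, show i + (j + g * i - i) = j + g * i by omega, ← hp.map_mod_nat, Nat.add_mul_mod_self_left,
    hp.map_mod_nat]

def arc (c : ℕ → V) (i m : ℕ) : Finset V := (Finset.Icc i (i + m)).image c

theorem mem_arc {i m : ℕ} {x : V} : x ∈ arc c i m ↔ ∃ j, j ≤ m ∧ c (i + j) = x := by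
  constructor
  · intro h
    obtain ⟨j, hj, rfl⟩ := Finset.mem_image.1 h
    rw [Finset.mem_Icc] at hj
    exact ⟨j - i, by omega, by congr 1; omega⟩
  · rintro ⟨j, hj, rfl⟩
    exact Finset.mem_image_of_mem _ (Finset.mem_Icc.2 ⟨by omega, by omega⟩)

theorem Cyc.arc_sub (h : Cyc G c g) (i m : ℕ) : arc c i m ⊆ img c g := by
  intro x hx
  obtain ⟨j, -, rfl⟩ := mem_arc.1 hx
  exact h.mem _

theorem Cyc.notMem_arc (h : Cyc G c g) {i m j : ℕ} (h1 : m < j) (h2 : j < g) :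
    c (i + j) ∉ arc c i m := by
  intro hx
  obtain ⟨l, hl, he⟩ := mem_arc.1 hx
  exact h.inj (i + l) (i + j) (by omega) (by omega) he

theorem Cyc.path (h : Cyc G c g) (i : ℕ) : ∀ {m : ℕ}, m < g → PL G (arc c i m) (c i) (c (i + m)) m
  | 0, _ => .nil (mem_arc.2 ⟨0, le_rfl, rfl⟩)
  | m + 1, hm => by
    refine (h.path i (m := m) (by omega)).snoc (h.adj (i + m)) (h.notMem_arc (by omega) hm)
      (mem_arc.2 ⟨m + 1, le_rfl, rfl⟩) fun x hx => ?_
    obtain ⟨j, hj, rfl⟩ := mem_arc.1 hx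
    exact mem_arc.2 ⟨j, by omega, rfl⟩

theorem Cyc.path' (h : Cyc G c g) (i : ℕ) {m : ℕ} (h0 : 1 ≤ m) (hm : m < g) :
    PL G (img c g) (c i) (c (i + m)) (g - m) := by
  have h1 := h.path (i + m) (m := g - m) (by omega)
  rw [show i + m + (g - m) = i + g by omega, h.per] at h1
  exact (h1.mono (h.arc_sub _ _)).symm

end

theorem cyc_of_seq {W : Finset V} {c : ℕ → V} {n : ℕ} (hn : 2 ≤ n) (hW : ∀ i ≤ n, c i ∈ W)
    (hadj : ∀ i < n, G.Adj (c i) (c (i + 1))) (hinj : ∀ i j, i < j → j ≤ n → c i ≠ c j)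
    (hcl : G.Adj (c n) (c 0)) : CycIn G W := by
  have hlt : ∀ i, i % (n + 1) ≤ n := fun i => Nat.lt_succ_iff.1 (Nat.mod_lt i (Nat.succ_pos n))
  refine ⟨fun i => c (i % (n + 1)), n + 1, ⟨by omega, fun i => ?_, fun i => by simp, ?_⟩,
    fun i => hW _ (hlt i)⟩
  · have h1 := hlt i
    rcases h1.lt_or_eq with h2 | h2
    · have h3 : (i + 1) % (n + 1) = i % (n + 1) + 1 := by
        rw [← Nat.mod_add_mod, Nat.mod_eq_of_lt (by omega)]
      simp only [h3]
      exact hadj _ h2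
    · have h3 : (i + 1) % (n + 1) = 0 := by
        rw [Nat.add_mod, h2]; simp
      simp only [h3, h2]
      exact hcl
  · intro i j hij hj he
    have h1 : i % (n + 1) ≠ j % (n + 1) := by
      intro h
      have := (Nat.modEq_iff_dvd' hij.le).1 h
      have := Nat.le_of_dvd (by omega) this
      omega
    rcases lt_or_gt_of_ne h1 with h2 | h2
    · exact hinj _ _ h2 (hlt j) he
    · exact hinj _ _ h2 (hlt i) he.symm

theorem PL.seq {W : Finset V} {a b : V} {n : ℕ} (p : PL G W a b n) :
    ∃ c : ℕ → V, c 0 = a ∧ c n = b ∧ (∀ i ≤ n, c i ∈ W) ∧ (∀ i < n, G.Adj (c i) (c (i + 1))) ∧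
      ∀ i j, i < j → j ≤ n → c i ≠ c j := by
  induction p with
  | @nil W a h =>
    exact ⟨fun _ => a, rfl, rfl, fun _ _ => h, fun i hi => by omega, fun i j _ _ => by omega⟩
  | @cons W a b d n h hab p ih =>
    obtain ⟨c, h0, hn, hW, hadj, hinj⟩ := ih
    refine ⟨fun i => Nat.casesOn i a c, rfl, hn, ?_, ?_, ?_⟩
    · rintro (_ | i) hi
      · exact h
      · exact Finset.mem_of_mem_erase (hW i (by omega))
    · rintro (_ | i) hi
      · show G.Adj a (c 0)
        rwa [h0]
      · exact hadj i (by omega)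
    · rintro (_ | i) (_ | j) hij hj
      · omega
      · exact (Finset.ne_of_mem_erase (hW j (by omega))).symm
      · omega
      · exact hinj i j (by omega) (by omega)

theorem PL.cycIn {W : Finset V} {a b : V} {n : ℕ} (p : PL G W a b n) (h : G.Adj b a)
    (hn : 2 ≤ n) : CycIn G W := by
  obtain ⟨c, h0, h1, hW, hadj, hinj⟩ := p.seq
  exact cyc_of_seq hn hW hadj hinj (by rwa [h0, h1])

theorem CycIn.mono {W W' : Finset V} (h : CycIn G W) (hs : W ⊆ W') : CycIn G W' := by
  obtain ⟨c, g, hc, hW⟩ := h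
  exact ⟨c, g, hc, fun i => hs (hW i)⟩

theorem cycIn_of_deg {W : Finset V} (hne : W.Nonempty) (hd : ∀ w ∈ W, 2 ≤ dg G W w) :
    CycIn G W := by
  by_contra hcon
  have key : ∀ n : ℕ, ∃ c : ℕ → V, (∀ i ≤ n, c i ∈ W) ∧ (∀ i < n, G.Adj (c i) (c (i + 1))) ∧
      ∀ i j, i < j → j ≤ n → c i ≠ c j := by
    intro n
    induction n with
    | zero =>
      obtain ⟨w, hw⟩ := hne
      exact ⟨fun _ => w, fun _ _ => hw, fun i hi => by omega, fun i j _ _ => by omega⟩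
    | succ n ih =>
      obtain ⟨c, hW, hadj, hinj⟩ := ih
      obtain ⟨x, hx, hx1⟩ : ∃ x ∈ W.filter (G.Adj (c 0)), x ≠ c 1 :=
        Finset.exists_mem_ne (hd _ (hW 0 (Nat.zero_le _))) _
      rw [Finset.mem_filter] at hx
      have hnew : ∀ j ≤ n, x ≠ c j := by
        rintro j hj rfl
        have h0 : j ≠ 0 := by rintro rfl; exact G.loopless.irrefl _ hx.2
        have h1 : j ≠ 1 := by rintro rfl; exact hx1 rfl
        exact hcon (cyc_of_seq (n := j) (by omega) (fun i hi => hW i (by omega))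
          (fun i hi => hadj i (by omega)) (fun i l h2 h3 => hinj i l h2 (by omega)) hx.2.symm)
      refine ⟨fun i => Nat.casesOn i x c, ?_, ?_, ?_⟩
      · rintro (_ | i) hi
        · exact hx.1
        · exact hW i (by omega)
      · rintro (_ | i) hi
        · exact hx.2.symm
        · exact hadj i (by omega)
      · rintro (_ | i) (_ | j) hij hj
        · omega
        · exact hnew j (by omega)
        · omega
        · exact hinj i j (by omega) (by omega)
  obtain ⟨c, hW, -, hinj⟩ := key W.card
  have h1 : ((Finset.range (W.card + 1)).image c).card = W.card + 1 := by
    rw [Finset.card_image_of_injOn, Finset.card_range]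
    intro i hi j hj he
    simp only [Finset.coe_range, Set.mem_Iio] at hi hj
    rcases lt_trichotomy i j with h | h | h
    · exact (hinj i j h (by omega) he).elim
    · exact h
    · exact (hinj j i h (by omega) he.symm).elim
  have h2 : (Finset.range (W.card + 1)).image c ⊆ W := by
    intro x hx
    obtain ⟨i, hi, rfl⟩ := Finset.mem_image.1 hx
    exact hW i (by rw [Finset.mem_range] at hi; omega)
  have := Finset.card_le_card h2
  omega

theorem Cyc.five {c : ℕ → V} {g : ℕ} (h : Cyc G c g) (h3 : NoTri G) (h4 : NoSq G) : 5 ≤ g := by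
  by_contra hcon
  have := h.three
  have h5 : g = 3 ∨ g = 4 := by omega
  rcases h5 with rfl | rfl
  · have e := h.adj 2
    rw [show 2 + 1 = 0 + 3 from rfl, h.per] at e
    exact h3 _ _ _ (h.adj 0) (h.adj 1) e.symm
  · have e := h.adj 3
    rw [show 3 + 1 = 0 + 4 from rfl, h.per] at e
    exact h.inj 1 3 (by omega) (by omega)
      (h4 (c 0) (c 2) (c 1) (c 3) (h.inj 0 2 (by omega) (by omega)) (h.adj 0) (h.adj 1).symm e.symm
        (h.adj 2))

/-- An induced non-separating cycle, with the properties of its complement `D`. -/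
structure NS (G : SimpleGraph V) (k : ℕ) (c : ℕ → V) (g : ℕ) (D : Finset V) : Prop where
  cyc : Cyc G c g
  five : 5 ≤ g
  compl : ∀ x, x ∉ D ↔ x ∈ img c g
  ne : D.Nonempty
  conn : ∀ x ∈ D, ∀ y ∈ D, Reach G D x y
  degC : ∀ i, k ≤ dg G D (c i) + 2
  one : ∀ w ∈ D, (∀ x ∈ D, ∀ y ∈ D, x ≠ w → y ≠ w → Reach G (D.erase w) x y) →
    dg G (img c g) w ≤ 1

theorem two_of_dg {H : Finset V} {w : V} (h : ¬ dg G H w ≤ 1) :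
    ∃ s ∈ H, ∃ t ∈ H, s ≠ t ∧ G.Adj w s ∧ G.Adj w t := by
  have h1 : 1 < (H.filter (G.Adj w)).card := by unfold dg at h; omega
  obtain ⟨s, hs, t, ht, hst⟩ := Finset.one_lt_card.1 h1
  rw [Finset.mem_filter] at hs ht
  exact ⟨s, hs.1, t, ht.1, hst, hs.2, ht.2⟩

theorem Cyc.reroute {c : ℕ → V} {g i m : ℕ} {w : V} (h : Cyc G c g) (hw : w ∉ img c g)
    (h0 : 1 ≤ m) (hm : m < g) (h1 : G.Adj w (c i)) (h2 : G.Adj w (c (i + m))) :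
    CycIn G (insert w (arc c i m)) :=
  ((h.path i hm).cons' h1 (fun hx => hw (h.arc_sub _ _ hx)) (Finset.mem_insert_self _ _)
    (Finset.subset_insert _ _)).cycIn h2.symm (by omega)

theorem Cyc.pair {c : ℕ → V} {g : ℕ} (h : Cyc G c g) {s t : V} (hs : s ∈ img c g)
    (ht : t ∈ img c g) (hst : s ≠ t) : ∃ i m, 1 ≤ m ∧ m < g ∧ c i = s ∧ c (i + m) = t := by
  obtain ⟨i, -, rfl⟩ := mem_img hs
  obtain ⟨m, hm, rfl⟩ := h.offset i ht
  refine ⟨i, m, ?_, hm, rfl, rfl⟩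
  rcases m with _ | m
  · exact (hst rfl).elim
  · omega

theorem Cyc.third {c : ℕ → V} {g : ℕ} (h : Cyc G c g) (x y : V) :
    ∃ i, c i ≠ x ∧ c i ≠ y := by
  have h3 := h.three
  have h01 := h.inj 0 1 (by omega) (by omega)
  have h02 := h.inj 0 2 (by omega) (by omega)
  have h12 := h.inj 1 2 (by omega) (by omega)
  by_contra hcon
  push Not at hcon
  have a0 := hcon 0
  have a1 := hcon 1
  have a2 := hcon 2
  by_cases e0 : c 0 = x
  · exact h12 ((a1 fun e => h01 (e0.trans e.symm)).trans (a2 fun e => h02 (e0.trans e.symm)).symm)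
  · by_cases e1 : c 1 = x
    · exact h02 ((a0 e0).trans (a2 fun e => h12 (e1.trans e.symm)).symm)
    · exact h01 ((a0 e0).trans (a1 e1).symm)

theorem conn_insert {D : Finset V} {d v : V} (hD : ∀ x ∈ D, ∀ y ∈ D, Reach G D x y) (hd : d ∈ D)
    (h : G.Adj d v) : ∀ x ∈ insert v D, ∀ y ∈ insert v D, Reach G (insert v D) x y := by
  have key : ∀ x ∈ insert v D, Reach G (insert v D) x d := by
    intro x hx
    rcases Finset.mem_insert.1 hx with e | hx'
    · rw [e]
      exact .edge h.symm (Finset.mem_insert_self _ _) (Finset.mem_insert_of_mem hd)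
    · exact (hD x hx' d hd).mono (Finset.subset_insert _ _)
  exact fun x hx y hy => (key x hx).trans (key y hy).symm

section
variable {k : ℕ}

/-- A connected set that misses a cycle. -/
def Miss (G : SimpleGraph V) (D : Finset V) : Prop :=
  D.Nonempty ∧ (∀ x ∈ D, ∀ y ∈ D, Reach G D x y) ∧ CycIn G (Finset.univ \ D)

theorem Gr.exists_miss (g : Gr G k) (hk : 4 ≤ k) (h3 : NoTri G) (h4 : NoSq G) :
    ∃ D, Miss G D := by
  obtain ⟨v⟩ := g.ne
  have hdeg : ∀ w, 3 ≤ dg G (Finset.univ \ {v}) w := by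
    intro w
    have h1 : dg G Finset.univ w ≤ dg G (Finset.univ \ {v}) w + dg G {v} w :=
      dg_le fun x _ _ => by simp; tauto
    have h2 : dg G {v} w ≤ 1 := dg_le_card.trans (by simp)
    have := g.deg w
    omega
  refine ⟨{v}, Finset.singleton_nonempty v, ?_, cycIn_of_deg ?_ fun w _ => by have := hdeg w; omega⟩
  · intro x hx y hy
    rw [Finset.mem_singleton] at hx hy
    subst hx hy
    exact .refl (Finset.mem_singleton_self _)
  · obtain ⟨x, hx, -⟩ := dg_pos (show 1 ≤ dg G (Finset.univ \ {v}) v by have := hdeg v; omega)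
    exact ⟨x, hx⟩

variable {D : Finset V} (g : Gr G k) (hk : 4 ≤ k) (hc : NoCut G)
  (hD : Miss G D) (hm : ∀ D', Miss G D' → D'.card ≤ D.card)
include hD hm

theorem Miss.ext {d v : V} (hd : d ∈ D) (hv : v ∉ D) (h : G.Adj d v)
    (hcy : CycIn G (Finset.univ \ insert v D)) : False := by
  have := hm _ ⟨⟨v, Finset.mem_insert_self _ _⟩, conn_insert hD.2.1 hd h, hcy⟩
  rw [Finset.card_insert_of_notMem hv] at this
  omega

include g hk hc

theorem Miss.cover {c : ℕ → V} {n : ℕ} (h : Cyc G c n) (hcD : ∀ i, c i ∉ D) {w : V}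
    (hw : w ∉ D) : w ∈ img c n := by
  have hiD : ∀ x ∈ img c n, x ∉ D := by
    intro x hx
    obtain ⟨i, -, rfl⟩ := mem_img hx
    exact hcD i
  have hA : ∀ s, s ∉ D → ∀ d ∈ D, G.Adj d s → s ∈ img c n := by
    intro s hs d hd hds
    by_contra hcon
    refine hD.ext hm hd hs hds ⟨c, n, h, fun i => ?_⟩
    rw [Finset.mem_sdiff, Finset.mem_insert]
    refine ⟨Finset.mem_univ _, ?_⟩
    rintro (e | e)
    · exact hcon (e ▸ h.mem i)
    · exact hcD i e
  have hatt : ∀ x y, x ∉ D → y ∉ D → x ≠ y →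
      ∃ s, s ∉ D ∧ s ≠ x ∧ s ≠ y ∧ ∃ d ∈ D, G.Adj d s := by
    intro x y hx hy hxy
    obtain ⟨i, h1, h2⟩ := h.third x y
    obtain ⟨d, hd⟩ := hD.1
    have hdx : d ≠ x := fun e => hx (e ▸ hd)
    have hdy : d ≠ y := fun e => hy (e ▸ hd)
    have r := hc x y d (c i) hxy (by simp [hdx, hdy]) (by simp [h1, h2])
    rcases r.exit D hd with r' | ⟨e, s, r', hs, hsD, hes⟩
    · exact (hcD i (Finset.mem_inter.1 r'.right).2).elim
    · have hs' := (Finset.mem_sdiff.1 hs).2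
      rw [Finset.mem_insert, Finset.mem_singleton, not_or] at hs'
      exact ⟨s, hsD, hs'.1, hs'.2, e, (Finset.mem_inter.1 r'.right).2, hes⟩
  have hone : ∀ w, w ∉ D → w ∉ img c n → dg G (img c n) w ≤ 1 := by
    intro w hw hwi
    by_contra hcon
    obtain ⟨s, hs, t, ht, hst, h1, h2⟩ := two_of_dg hcon
    obtain ⟨v, hvD, hvs, hvt, d, hd, hdv⟩ := hatt s t (hiD _ hs) (hiD _ ht) hst
    have hvi := hA v hvD d hd hdv
    have hwv : w ≠ v := fun e => hwi (e ▸ hvi)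
    have hfin : ∀ i m, 1 ≤ m → m < n → G.Adj w (c i) → G.Adj w (c (i + m)) →
        v ∉ arc c i m → False := by
      intro i m hm1 hmn a1 a2 hv
      refine hD.ext hm hd hvD hdv ((h.reroute hwi hm1 hmn a1 a2).mono fun x hx => ?_)
      rw [Finset.mem_sdiff, Finset.mem_insert]
      refine ⟨Finset.mem_univ _, ?_⟩
      rcases Finset.mem_insert.1 hx with e | hx'
      · rw [e]
        rintro (e' | e')
        · exact hwv e'
        · exact hw e'
      · rintro (e' | e')
        · exact hv (e' ▸ hx')
        · exact hiD _ (h.arc_sub _ _ hx') e'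
    obtain ⟨i, m, hm1, hmn, rfl, rfl⟩ := h.pair hs ht hst
    obtain ⟨l, hl, rfl⟩ := h.offset i hvi
    have hlm : l ≠ m := fun e => hvt (by rw [e])
    have hl0 : l ≠ 0 := fun e => hvs (by rw [e]; rfl)
    rcases lt_or_gt_of_ne hlm with h5 | h5
    · refine hfin (i + m) (n - m) (by omega) (by omega) h2 ?_ ?_
      · rwa [show i + m + (n - m) = i + n by omega, h.per]
      · have := h.notMem_arc (i := i + m) (m := n - m) (j := l + n - m) (by omega) (by omega)
        rwa [show i + m + (l + n - m) = i + l + n by omega, h.per] at this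
    · exact hfin i m hm1 hmn h1 h2 (h.notMem_arc h5 hl)
  by_contra hwi
  obtain ⟨v, hvD, -, -, d, hd, hdv⟩ := hatt (c 0) (c 1) (hcD 0) (hcD 1)
    (h.inj 0 1 (by omega) (by have := h.three; omega))
  have hvi := hA v hvD d hd hdv
  refine hD.ext hm hd hvD hdv ((cycIn_of_deg (W := Finset.univ \ (D ∪ img c n)) ⟨w, ?_⟩ ?_).mono ?_)
  · simp [hw, hwi]
  · intro x hx
    have hx' := (Finset.mem_sdiff.1 hx).2
    rw [Finset.mem_union, not_or] at hx'
    have h1 : dg G Finset.univ x ≤ dg G (Finset.univ \ (D ∪ img c n)) x + dg G (img c n) x := by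
      refine dg_le fun y _ hxy => ?_
      by_cases hy : y ∈ img c n
      · exact Or.inr hy
      · refine Or.inl (Finset.mem_sdiff.2 ⟨Finset.mem_univ _, ?_⟩)
        rw [Finset.mem_union, not_or]
        exact ⟨fun hyD => hx'.2 (hA x hx'.1 y hyD hxy.symm), hy⟩
    have h2 := hone x hx'.1 hx'.2
    have := g.deg x
    omega
  · intro x hx
    rw [Finset.mem_sdiff, Finset.mem_union, not_or] at hx
    rw [Finset.mem_sdiff, Finset.mem_insert, not_or]
    exact ⟨Finset.mem_univ _, fun e => hx.2.2 (e ▸ hvi), hx.2.1⟩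

end

theorem Gr.ns {k : ℕ} (g : Gr G k) (hk : 4 ≤ k) (hc : NoCut G) (h3 : NoTri G) (h4 : NoSq G) :
    ∃ c n D, NS G k c n D := by
  obtain ⟨D₀, hD₀⟩ := g.exists_miss hk h3 h4
  obtain ⟨D, hD, hm⟩ := Finset.exists_max_image (Finset.univ.filter (Miss G)) Finset.card
    ⟨D₀, by simp [hD₀]⟩
  replace hD : Miss G D := by simpa using hD
  replace hm : ∀ D', Miss G D' → D'.card ≤ D.card := fun D' h' => hm D' (by simpa using h')
  obtain ⟨c, n, h, hcD⟩ := hD.2.2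
  replace hcD : ∀ i, c i ∉ D := fun i => (Finset.mem_sdiff.1 (hcD i)).2
  have hcov : ∀ w, w ∉ D → w ∈ img c n := fun w hw => hD.cover g hk hc hm h hcD hw
  have hiD : ∀ x ∈ img c n, x ∉ D := by
    intro x hx
    obtain ⟨i, -, rfl⟩ := mem_img hx
    exact hcD i
  have h5 := h.five h3 h4
  have hdegC : ∀ i, k ≤ dg G D (c i) + 2 := by
    intro i
    have h1 : dg G Finset.univ (c i) ≤ dg G D (c i) + dg G {c (i + 1), c (i + (n - 1))} (c i) := by
      refine dg_le fun x _ hx => ?_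
      by_cases hxD : x ∈ D
      · exact Or.inl hxD
      · right
        obtain ⟨m, hmn, rfl⟩ := h.offset i (hcov x hxD)
        by_contra hcon
        simp only [Finset.mem_insert, Finset.mem_singleton, not_or] at hcon
        have hm0 : m ≠ 0 := by rintro rfl; exact G.loopless.irrefl _ hx
        have hm1 : m ≠ 1 := by rintro rfl; exact hcon.1 rfl
        have hm2 : m ≠ n - 1 := by rintro rfl; exact hcon.2 rfl
        obtain ⟨c', n', h', hs⟩ := (h.path i hmn).cycIn hx.symm (by omega)
        have := hD.cover g hk hc hm h' (fun j => hiD _ (h.arc_sub _ _ (hs j))) (hcD (i + (m + 1)))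
        obtain ⟨j, -, hj⟩ := mem_img this
        exact h.notMem_arc (i := i) (m := m) (j := m + 1) (by omega) (by omega) (hj ▸ hs j)
    have h2 : dg G {c (i + 1), c (i + (n - 1))} (c i) ≤ 2 := dg_le_card.trans Finset.card_le_two
    have := g.deg (c i)
    omega
  refine ⟨c, n, D, h, h5, fun x => ⟨hcov x, hiD x⟩, hD.1, hD.2.1, hdegC, ?_⟩
  intro w hw hnc
  by_contra hcon
  obtain ⟨s, hs, t, ht, hst, h1, h2⟩ := two_of_dg hcon
  have hwi : w ∉ img c n := fun hx => hiD _ hx hw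
  have hred : ∀ i m, 1 ≤ m → m + 3 ≤ n → G.Adj w (c i) → G.Adj w (c (i + m)) → False := by
    intro i m hm1 hmn a1 a2
    have hX : ∀ x ∈ img c n, ∃ y ∈ D.erase w, G.Adj x y := by
      intro x hx
      obtain ⟨j, -, rfl⟩ := mem_img hx
      have : 1 < (D.filter (G.Adj (c j))).card := by
        have := hdegC j
        unfold dg at this
        omega
      obtain ⟨y, hy, hyw⟩ := Finset.exists_mem_ne this w
      rw [Finset.mem_filter] at hy
      exact ⟨y, Finset.mem_erase.2 ⟨hyw, hy.1⟩, hy.2⟩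
    have hbase : ∀ x ∈ D.erase w ∪ (img c n \ arc c i m), ∃ y ∈ D.erase w,
        Reach G (D.erase w ∪ (img c n \ arc c i m)) x y := by
      intro x hx
      rcases Finset.mem_union.1 hx with hx' | hx'
      · exact ⟨x, hx', .refl hx⟩
      · obtain ⟨y, hy, hxy⟩ := hX x (Finset.mem_sdiff.1 hx').1
        exact ⟨y, hy, .edge hxy hx (Finset.mem_union_left _ hy)⟩
    have hp : ∀ j, m < j → j < n → c (i + j) ∈ img c n \ arc c i m := fun j h6 h7 =>
      Finset.mem_sdiff.2 ⟨h.mem _, h.notMem_arc h6 h7⟩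
    have hmiss : Miss G (D.erase w ∪ (img c n \ arc c i m)) := by
      refine ⟨⟨_, Finset.mem_union_right _ (hp (m + 1) (by omega) (by omega))⟩, ?_, ?_⟩
      · intro x hx y hy
        obtain ⟨x', hx', r1⟩ := hbase x hx
        obtain ⟨y', hy', r2⟩ := hbase y hy
        have r3 := hnc x' (Finset.mem_of_mem_erase hx') y' (Finset.mem_of_mem_erase hy')
          (Finset.ne_of_mem_erase hx') (Finset.ne_of_mem_erase hy')
        exact (r1.trans (r3.mono Finset.subset_union_left)).trans r2.symm
      · refine (h.reroute hwi hm1 (by omega) a1 a2).mono fun x hx => ?_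
        rw [Finset.mem_sdiff]
        refine ⟨Finset.mem_univ _, fun hx' => ?_⟩
        rcases Finset.mem_insert.1 hx with e | hxa
        · rw [e] at hx'
          rcases Finset.mem_union.1 hx' with h6 | h6
          · exact Finset.notMem_erase _ _ h6
          · exact hwi (Finset.mem_sdiff.1 h6).1
        · rcases Finset.mem_union.1 hx' with h6 | h6
          · exact hiD _ (h.arc_sub _ _ hxa) (Finset.mem_of_mem_erase h6)
          · exact (Finset.mem_sdiff.1 h6).2 hxa
    have hle := hm _ hmiss
    rw [Finset.card_union_of_disjoint, Finset.card_erase_of_mem hw] at hle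
    · have h6 : ({c (i + (m + 1)), c (i + (m + 2))} : Finset V) ⊆ img c n \ arc c i m := by
        intro x hx
        rw [Finset.mem_insert, Finset.mem_singleton] at hx
        rcases hx with e | e
        · rw [e]; exact hp _ (by omega) (by omega)
        · rw [e]; exact hp _ (by omega) (by omega)
      have h7 := Finset.card_le_card h6
      rw [Finset.card_pair (h.inj _ _ (by omega) (by omega))] at h7
      have := Finset.card_pos.2 ⟨w, hw⟩
      omega
    · rw [Finset.disjoint_left]
      intro x hx hx'
      exact hiD _ (Finset.mem_sdiff.1 hx').1 (Finset.mem_of_mem_erase hx)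
  obtain ⟨i, m, hm1, hmn, rfl, rfl⟩ := h.pair hs ht hst
  by_cases h6 : m + 3 ≤ n
  · exact hred i m hm1 h6 h1 h2
  · refine hred (i + m) (n - m) (by omega) (by omega) h2 ?_
    rwa [show i + m + (n - m) = i + n by omega, h.per]

def NonCut (G : SimpleGraph V) (D : Finset V) (w : V) : Prop :=
  ∀ x ∈ D, ∀ y ∈ D, x ≠ w → y ≠ w → Reach G (D.erase w) x y

/-- `E` is a component of `D - v`, but not the only one. -/
structure Lobe (G : SimpleGraph V) (D : Finset V) (v : V) (E : Finset V) : Prop where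
  hv : v ∈ D
  isComp : ∃ u ∈ D.erase v, E = comp G (D.erase v) u
  out : ∃ x ∈ D, x ≠ v ∧ x ∉ E

section
variable {D E : Finset V} {v : V}

theorem Lobe.sub (h : Lobe G D v E) : E ⊆ D := by
  obtain ⟨u, hu, rfl⟩ := h.isComp
  exact comp_sub.trans (Finset.erase_subset _ _)

theorem Lobe.notMem (h : Lobe G D v E) : v ∉ E := by
  obtain ⟨u, hu, rfl⟩ := h.isComp
  exact fun hx => Finset.notMem_erase _ _ (comp_sub hx)

theorem Lobe.bdry (h : Lobe G D v E) {e s : V} (he : e ∈ E) (hs : s ∈ D) (hsE : s ∉ E)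
    (ha : G.Adj e s) : s = v := by
  obtain ⟨u, hu, rfl⟩ := h.isComp
  exact comp_bdry he hs hsE ha

theorem Lobe.econn (h : Lobe G D v E) : ∀ x ∈ E, ∀ y ∈ E, Reach G E x y := by
  obtain ⟨u, hu, rfl⟩ := h.isComp
  exact fun x hx y hy => comp_conn hx hy

theorem Lobe.ne (h : Lobe G D v E) : E.Nonempty := by
  obtain ⟨u, hu, rfl⟩ := h.isComp
  exact ⟨u, self_mem_comp hu⟩

theorem Lobe.back (h : Lobe G D v E) (hD : ∀ x ∈ D, ∀ y ∈ D, Reach G D x y) {x : V} (hx : x ∈ D)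
    (hxE : x ∉ E) : Reach G (D \ E) x v := by
  have hv := h.hv
  obtain ⟨u, hu, rfl⟩ := h.isComp
  exact conn_compl hD hv hx hxE

theorem Lobe.to_cut (h : Lobe G D v E) {W : Finset V} (hW : W ⊆ D) {u : V} (hu : u ∈ E)
    (r : Reach G W u v) : ∃ t ∈ E, G.Adj t v ∧ Reach G (W ∩ E) u t := by
  rcases r.exit E hu with r' | ⟨e, s, r', hs, hsE, hes⟩
  · exact (h.notMem (Finset.mem_inter.1 r'.right).2).elim
  · have he := (Finset.mem_inter.1 r'.right).2
    obtain rfl := h.bdry he (hW hs) hsE hes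
    exact ⟨e, he, hes, r'⟩

theorem Lobe.of_cut (hD : ∀ x ∈ D, ∀ y ∈ D, Reach G D x y) (h : Lobe G D v E) {e : V}
    (he : e ∈ E) (hc : ¬ NonCut G D e) : ∃ E', Lobe G D e E' ∧ E' ⊆ E := by
  have hve : v ≠ e := fun e' => h.notMem (e' ▸ he)
  have heD := h.sub he
  have hvD : v ∈ D.erase e := Finset.mem_erase.2 ⟨hve, h.hv⟩
  obtain ⟨z, hz, hzv⟩ : ∃ z ∈ D.erase e, ¬ Reach G (D.erase e) z v := by
    by_contra hcon
    push Not at hcon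
    refine hc fun x hx y hy hxe hye => ?_
    exact (hcon x (Finset.mem_erase.2 ⟨hxe, hx⟩)).trans (hcon y (Finset.mem_erase.2 ⟨hye, hy⟩)).symm
  have hvE : v ∉ comp G (D.erase e) z := fun hx => hzv (mem_comp.1 hx)
  have hl : Lobe G D e (comp G (D.erase e) z) := ⟨heD, ⟨z, hz, rfl⟩, v, h.hv, hve, hvE⟩
  refine ⟨_, hl, fun p hp => ?_⟩
  obtain ⟨t, ht, hte, r⟩ := hl.to_cut (Finset.Subset.refl D) hp (hD p (hl.sub hp) e heD)
  obtain ⟨u, hu, rfl⟩ := h.isComp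
  have r2 : Reach G (D.erase v) p e := by
    refine (r.mono fun x hx => ?_).tail hte (Finset.mem_erase.2 ⟨hve.symm, heD⟩)
    rw [Finset.mem_inter] at hx
    exact Finset.mem_erase.2 ⟨fun e' => hvE (e' ▸ hx.2), hx.1⟩
  exact mem_comp.2 ((mem_comp.1 he).trans r2.symm)

theorem Lobe.shrink (hD : ∀ x ∈ D, ∀ y ∈ D, Reach G D x y) (h : Lobe G D v E) :
    ∃ v' E', Lobe G D v' E' ∧ E' ⊆ E ∧ ∀ e ∈ E', NonCut G D e := by
  induction hn : E.card using Nat.strong_induction_on generalizing v E with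
  | _ n ih =>
    by_cases hall : ∀ e ∈ E, NonCut G D e
    · exact ⟨v, E, h, Finset.Subset.refl _, hall⟩
    · push Not at hall
      obtain ⟨e, he, hec⟩ := hall
      obtain ⟨E', h', hs⟩ := h.of_cut hD he hec
      have hlt : E' ⊂ E := (Finset.ssubset_iff_of_subset hs).2 ⟨e, he, h'.notMem⟩
      obtain ⟨v', E'', h1, h2, h3⟩ := ih E'.card (hn ▸ Finset.card_lt_card hlt) h' rfl
      exact ⟨v', E'', h1, h2.trans hs, h3⟩

theorem Lobe.toward (h : Lobe G D v E) {x u : V} (hx : x ∈ E) (hn : NonCut G D x) (hu : u ∈ E)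
    (hux : u ≠ x) : ∃ t ∈ E, G.Adj t v ∧ Reach G (E.erase x) u t := by
  have hvx : v ≠ x := fun e => h.notMem (e ▸ hx)
  obtain ⟨t, ht, htv, r⟩ := h.to_cut (Finset.erase_subset x D) hu
    (hn u (h.sub hu) v h.hv hux hvx)
  refine ⟨t, ht, htv, r.mono fun y hy => ?_⟩
  rw [Finset.mem_inter] at hy
  exact Finset.mem_erase.2 ⟨Finset.ne_of_mem_erase hy.1, hy.2⟩

theorem Lobe.touch (h : Lobe G D v E) (hD : ∀ x ∈ D, ∀ y ∈ D, Reach G D x y) :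
    ∃ t ∈ E, G.Adj t v := by
  obtain ⟨u, hu⟩ := h.ne
  obtain ⟨t, ht, htv, -⟩ := h.to_cut (Finset.Subset.refl D) hu (hD u (h.sub hu) v h.hv)
  exact ⟨t, ht, htv⟩

theorem Lobe.ri (h : Lobe G D v E) (hD : ∀ x ∈ D, ∀ y ∈ D, Reach G D x y)
    (hn : ∀ e ∈ E, NonCut G D e) {s e : V} (he : e ∈ E) (hs : G.Adj s e) :
    RI G E (nb G {s}) (nb G {v}) := by
  refine ⟨h.econn, ⟨e, mem_nb1.2 hs, he⟩, ?_, ?_⟩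
  · obtain ⟨t, ht, htv⟩ := h.touch hD
    exact ⟨t, mem_nb1.2 htv.symm, ht⟩
  · intro x hx u hu hux
    obtain ⟨t, ht, htv, r⟩ := h.toward hx (hn x hx) hu hux
    exact ⟨t, Or.inr (mem_nb1.2 htv.symm), r⟩

end

section
variable {k n : ℕ} {c : ℕ → V} {D E : Finset V} {v : V}

theorem NS.disj (h : NS G k c n D) : Disjoint (img c n) D :=
  Finset.disjoint_left.2 fun x hx hxD => (h.compl x).2 hx hxD

theorem NS.good (h : NS G k c n D) (i : ℕ) : ∃ m e x, 1 ≤ m ∧ m < n ∧ 1 ≤ x ∧ (e = 1 ∨ e = 4) ∧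
    PL G (img c n) (c i) (c (i + m)) x ∧ PL G (img c n) (c i) (c (i + m)) (x + e) := by
  have h5 := h.five
  rcases Nat.even_or_odd' n with ⟨r, hr | hr⟩
  · refine ⟨r - 2, 4, r - 2, by omega, by omega, by omega, Or.inr rfl,
      (h.cyc.path i (by omega)).mono (h.cyc.arc_sub _ _), ?_⟩
    have := h.cyc.path' i (m := r - 2) (by omega) (by omega)
    rwa [show n - (r - 2) = r - 2 + 4 by omega] at this
  · refine ⟨r, 1, r, by omega, by omega, by omega, Or.inl rfl,
      (h.cyc.path i (by omega)).mono (h.cyc.arc_sub _ _), ?_⟩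
    have := h.cyc.path' i (m := r) (by omega) (by omega)
    rwa [show n - r = r + 1 by omega] at this

theorem cyc_pair {H : Finset V} {a b : V} {x e l : ℕ} (hd : Disjoint H D) (hx : 1 ≤ x)
    (h1 : PL G H a b x) (h2 : PL G H a b (x + e)) (hl : Lens G D (nb G {a}) (nb G {b}) l) :
    HasCycleLen G (x + l + 2) ∧ HasCycleLen G (x + e + l + 2) := by
  constructor
  · exact cyc_lens (P := {a}) (Q := {b}) hd (by simpa using h1) hl (by omega)
  · exact cyc_lens (P := {a}) (Q := {b}) hd (by simpa using h2) hl (by omega)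

theorem four_of_pair {H : Finset V} {a b : V} {x e : ℕ} (hd : Disjoint H D) (hx : 1 ≤ x)
    (he : e = 1 ∨ e = 4) (h1 : PL G H a b x) (h2 : PL G H a b (x + e))
    (hl : Exact2 G D (nb G {a}) (nb G {b})) : AP 4 (HasCycleLen G) := by
  obtain ⟨l, hl0, hl2⟩ := hl
  obtain ⟨a0, a1⟩ := cyc_pair hd hx h1 h2 hl0
  obtain ⟨b0, b1⟩ := cyc_pair hd hx h1 h2 hl2
  rcases he with rfl | rfl
  · refine ⟨x + l + 2, 1, Or.inl rfl, fun i hi => ?_⟩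
    rcases (by omega : i = 0 ∨ i = 1 ∨ i = 2 ∨ i = 3) with rfl | rfl | rfl | rfl
    · exact a0
    · convert a1 using 1; omega
    · convert b0 using 1; omega
    · convert b1 using 1; omega
  · refine ⟨x + l + 2, 2, Or.inr rfl, fun i hi => ?_⟩
    rcases (by omega : i = 0 ∨ i = 1 ∨ i = 2 ∨ i = 3) with rfl | rfl | rfl | rfl
    · exact a0
    · convert b0 using 1; omega
    · convert a1 using 1; omega
    · convert b1 using 1; omega

theorem five_of_pair {H : Finset V} {a b : V} {x e : ℕ} (hd : Disjoint H D) (hx : 1 ≤ x)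
    (he : e = 1 ∨ e = 4) (h1 : PL G H a b x) (h2 : PL G H a b (x + e))
    (hl : Y3 (Lens G D (nb G {a}) (nb G {b}))) : AP 5 (HasCycleLen G) := by
  obtain ⟨l, hl0, hl2, hl4⟩ := hl
  obtain ⟨a0, a1⟩ := cyc_pair hd hx h1 h2 hl0
  obtain ⟨b0, b1⟩ := cyc_pair hd hx h1 h2 hl2
  rcases hl4 with hl4 | ⟨hl1, hl3⟩
  · obtain ⟨c0, c1⟩ := cyc_pair hd hx h1 h2 hl4
    rcases he with rfl | rfl
    · refine ⟨x + l + 2, 1, Or.inl rfl, fun i hi => ?_⟩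
      rcases (by omega : i = 0 ∨ i = 1 ∨ i = 2 ∨ i = 3 ∨ i = 4) with rfl | rfl | rfl | rfl | rfl
      · exact a0
      · convert a1 using 1; omega
      · convert b0 using 1; omega
      · convert b1 using 1; omega
      · convert c0 using 1; omega
    · refine ⟨x + l + 2, 2, Or.inr rfl, fun i hi => ?_⟩
      rcases (by omega : i = 0 ∨ i = 1 ∨ i = 2 ∨ i = 3 ∨ i = 4) with rfl | rfl | rfl | rfl | rfl
      · exact a0
      · convert b0 using 1; omega
      · convert a1 using 1; omega
      · convert b1 using 1; omega
      · convert c1 using 1; omega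
  · obtain ⟨c0, c1⟩ := cyc_pair hd hx h1 h2 hl1
    obtain ⟨d0, d1⟩ := cyc_pair hd hx h1 h2 hl3
    refine ⟨x + l + 2, 1, Or.inl rfl, fun i hi => ?_⟩
    rcases (by omega : i = 0 ∨ i = 1 ∨ i = 2 ∨ i = 3 ∨ i = 4) with rfl | rfl | rfl | rfl | rfl
    · exact a0
    · convert c0 using 1; omega
    · convert b0 using 1; omega
    · convert d0 using 1; omega
    · rcases he with rfl | rfl
      · convert d1 using 1; omega
      · convert a1 using 1; omega

theorem NS.two (h : NS G k c n D) (hk : 4 ≤ k) (i : ℕ) (x : V) :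
    ∃ y ∈ D, y ≠ x ∧ G.Adj (c i) y := by
  have h1 : 1 < (D.filter (G.Adj (c i))).card := by
    have := h.degC i
    unfold dg at this
    omega
  obtain ⟨y, hy, hyx⟩ := Finset.exists_mem_ne h1 x
  rw [Finset.mem_filter] at hy
  exact ⟨y, hy.1, hyx, hy.2⟩

theorem NS.deg (g : Gr G k) (h : NS G k c n D) {w : V} (hw : w ∈ D) (hn : NonCut G D w) :
    k ≤ dg G D w + 1 := by
  have h1 : dg G Finset.univ w ≤ dg G D w + dg G (img c n) w :=
    dg_le fun x _ _ => (em (x ∈ D)).imp id (h.compl x).1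
  have := h.one w hw hn
  have := g.deg w
  omega

theorem NS.lobe_deg (g : Gr G k) (h : NS G k c n D) (hl : Lobe G D v E) {w s : V} (hw : w ∈ E)
    (hn : NonCut G D w) : k ≤ ld G E (nb G {s}) (nb G {v}) w + 1 := by
  have h1 := h.deg g (hl.sub hw) hn
  have h2 : dg G D w ≤ dg G E w + dg G {v} w := by
    refine dg_le fun x hx hwx => ?_
    by_cases hxE : x ∈ E
    · exact Or.inl hxE
    · exact Or.inr (Finset.mem_singleton.2 (hl.bdry hw hx hxE hwx))
  have h3 : dg G {v} w ≤ lab (nb G {v}) w := dg_single_lab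
  unfold ld
  omega

theorem NS.lobe_nb (h : NS G k c n D) (hc : NoCut G) (hl : Lobe G D v E) {s : V}
    (hs : s ∈ img c n) : ∃ t ∈ img c n, t ≠ s ∧ ∃ e ∈ E, G.Adj t e := by
  have hsD := (h.compl s).2 hs
  obtain ⟨x, hx, hxv, hxE⟩ := hl.out
  obtain ⟨u, hu⟩ := hl.ne
  have hvs : v ≠ s := fun e => hsD (e ▸ hl.hv)
  have huv : u ≠ v := fun e => hl.notMem (e ▸ hu)
  have hus : u ≠ s := fun e => hsD (e ▸ hl.sub hu)
  have hxs : x ≠ s := fun e => hsD (e ▸ hx)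
  have r := hc v s u x hvs (by simp [huv, hus]) (by simp [hxv, hxs])
  rcases r.exit E hu with r' | ⟨e, t, r', ht, htE, het⟩
  · exact (hxE (Finset.mem_inter.1 r'.right).2).elim
  · have ht' := (Finset.mem_sdiff.1 ht).2
    rw [Finset.mem_insert, Finset.mem_singleton, not_or] at ht'
    have he := (Finset.mem_inter.1 r'.right).2
    exact ⟨t, (h.compl t).1 fun htD => ht'.1 (hl.bdry he htD htE het), ht'.2, e, he, het.symm⟩

theorem NS.no_cut (h : NS G k c n D) (g : Gr G k) (hk : k = 4 ∨ k = 5) (h3 : NoTri G)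
    (h4 : NoSq G) (hn : ∀ w ∈ D, NonCut G D w) : AP k (HasCycleLen G) := by
  obtain ⟨m, e, x, hm1, hmn, hx, he, p1, p2⟩ := h.good 0
  have hD : c (0 + m) ∉ D := (h.compl _).2 (h.cyc.mem _)
  have hr : RI G D (nb G {c 0}) (nb G {c (0 + m)}) := by
    refine ⟨h.conn, ?_, ?_, ?_⟩
    · obtain ⟨y, hy, -, ha⟩ := h.two (by omega) 0 (c 0)
      exact ⟨y, mem_nb1.2 ha, hy⟩
    · obtain ⟨y, hy, -, ha⟩ := h.two (by omega) (0 + m) (c 0)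
      exact ⟨y, mem_nb1.2 ha, hy⟩
    · intro w hw u hu huw
      obtain ⟨y, hy, hyw, ha⟩ := h.two (by omega) 0 w
      exact ⟨y, Or.inl (mem_nb1.2 ha), hn w hw u hu y hy huw hyw⟩
  have hdeg : ∀ w ∈ D, k ≤ ld G D (nb G {c 0}) (nb G {c (0 + m)}) w + 1 := by
    intro w hw
    have := h.deg g hw (hn w hw)
    unfold ld
    omega
  rcases hk with rfl | rfl
  · exact four_of_pair h.disj hx he p1 p2 (exact2_of_three h3 h4 hr
      (fun w hw => by have := hdeg w hw; omega) (sparse_nb h3 h4 hD))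
  · exact five_of_pair h.disj hx he p1 p2 (y3_of_four h3 h4 hr
      (fun w hw => by have := hdeg w hw; omega) (sparse_nb h3 h4 hD))

theorem NS.four (h : NS G 4 c n D) (g : Gr G 4) (hc : NoCut G) (h3 : NoTri G)
    (h4 : NoSq G) (hl : Lobe G D v E) (hn : ∀ e ∈ E, NonCut G D e) : AP 4 (HasCycleLen G) := by
  obtain ⟨s, hs, -, e₀, he₀, hse⟩ := h.lobe_nb hc hl (h.cyc.mem 0)
  obtain ⟨i, -, rfl⟩ := mem_img hs
  obtain ⟨m, e, x, hm1, hmn, hx, he, p1, p2⟩ := h.good i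
  have htD : c (i + m) ∉ D := (h.compl _).2 (h.cyc.mem _)
  refine four_of_pair h.disj hx he p1 p2 ?_
  by_cases hy : ∃ y ∈ D, y ∉ E ∧ G.Adj (c (i + m)) y
  · obtain ⟨y, hyD, hyE, hty⟩ := hy
    obtain ⟨l, l1, l2⟩ := exact2_of_three h3 h4 (hl.ri h.conn hn he₀ hse)
      (fun w hw => by have := h.lobe_deg (s := c i) g hl hw (hn w hw); omega)
      (sparse_nb h3 h4 hl.notMem)
    obtain ⟨r, q⟩ := (hl.back h.conn hyD hyE).symm.path
    have hK : ∀ t ∈ ({v} : Finset V), ∃ b ∈ nb G {c (i + m)}, PL G (D \ E) t b r := by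
      intro t ht
      rw [Finset.mem_singleton] at ht
      subst ht
      exact ⟨y, mem_nb1.2 hty, q⟩
    refine ⟨l + (r + 1), l1.joinR hK Finset.sdiff_disjoint Finset.sdiff_subset hl.sub, ?_⟩
    have := l2.joinR hK Finset.sdiff_disjoint Finset.sdiff_subset hl.sub
    rwa [show l + 2 + (r + 1) = l + (r + 1) + 2 by omega] at this
  · push Not at hy
    have htE : ∀ y ∈ D, G.Adj (c (i + m)) y → y ∈ E := fun y h1 h2 => by
      by_contra h3
      exact hy y h1 h3 h2
    have hWD : insert v E ⊆ D := Finset.insert_subset hl.hv hl.sub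
    have hr : RI G (insert v E) (nb G {c i}) (nb G {c (i + m)}) := by
      obtain ⟨t, ht, htv⟩ := hl.touch h.conn
      refine ⟨conn_insert hl.econn ht htv, ⟨e₀, mem_nb1.2 hse, Finset.mem_insert_of_mem he₀⟩, ?_, ?_⟩
      · obtain ⟨y, hy, -, ha⟩ := h.two le_rfl (i + m) (c 0)
        exact ⟨y, mem_nb1.2 ha, Finset.mem_insert_of_mem (htE y hy ha)⟩
      · intro w hw u hu huw
        obtain ⟨y, hy, hyw, ha⟩ := h.two le_rfl (i + m) w
        have hyE := htE y hy ha
        refine ⟨y, Or.inr (mem_nb1.2 ha), ?_⟩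
        rcases Finset.mem_insert.1 hw with e' | hwE
        · subst e'
          rw [Finset.erase_insert hl.notMem]
          exact hl.econn u ((Finset.mem_insert.1 hu).resolve_left huw) y hyE
        · have hvw : v ≠ w := fun e' => hl.notMem (e' ▸ hwE)
          have key : ∀ z ∈ insert v E, z ≠ w → Reach G ((insert v E).erase w) z v := by
            intro z hz hzw
            have hvm : v ∈ (insert v E).erase w :=
              Finset.mem_erase.2 ⟨hvw, Finset.mem_insert_self _ _⟩
            rcases Finset.mem_insert.1 hz with e' | hzE
            · rw [e']
              exact .refl hvm
            · obtain ⟨t, -, htv, r⟩ := hl.toward hwE (hn w hwE) hzE hzw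
              exact (r.mono (Finset.erase_subset_erase _ (Finset.subset_insert _ _))).tail htv hvm
          exact (key u hu huw).trans (key y (Finset.mem_insert_of_mem hyE) hyw).symm
    suffices hex : Exact2 G (insert v E) (nb G {c i}) (nb G {c (i + m)}) by
      obtain ⟨l, a0, a1⟩ := hex
      exact ⟨l, a0.mono hWD (fun _ ha _ => ha) fun _ hb _ => hb, a1.mono hWD (fun _ ha _ => ha) fun _ hb _ => hb⟩
    refine exact2_of_three' (z := v) h3 h4 hr
      ⟨e₀, Finset.mem_insert_of_mem he₀, fun e' => hl.notMem (e' ▸ he₀)⟩ ?_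
      (sparse_nb h3 h4 fun hx => htD (hWD hx)) ?_
    · intro w hw hwv
      have hwE := (Finset.mem_insert.1 hw).resolve_left hwv
      have h1 := h.deg g (hl.sub hwE) (hn w hwE)
      have h2 : dg G D w ≤ dg G (insert v E) w + dg G (∅ : Finset V) w := by
        refine dg_le fun x hx hwx => Or.inl ?_
        by_cases hxE : x ∈ E
        · exact Finset.mem_insert_of_mem hxE
        · rw [hl.bdry hwE hx hxE hwx]
          exact Finset.mem_insert_self _ _
      have h3 : dg G (∅ : Finset V) w = 0 := dg_zero (by simp)
      unfold ld
      omega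
    · rintro ⟨b, -, -, hb, hz, hbz, -⟩
      exact h3 _ _ _ (mem_nb1.1 hb) hbz (mem_nb1.1 hz)

theorem NS.two_lobes (h : NS G k c n D) (hl : Lobe G D v E) :
    ∃ v₁ E₁ v₂ E₂, Lobe G D v₁ E₁ ∧ Lobe G D v₂ E₂ ∧ Disjoint E₁ E₂ ∧ v₁ ∉ E₂ ∧ v₂ ∉ E₁ ∧
      (∀ e ∈ E₁, NonCut G D e) ∧ ∀ e ∈ E₂, NonCut G D e := by
  obtain ⟨v₁, E₁, h1, -, hn1⟩ := hl.shrink h.conn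
  obtain ⟨x, hx, hxv, hxE⟩ := h1.out
  obtain ⟨u, hu, rfl⟩ := h1.isComp
  have hxm : x ∈ D.erase v₁ := Finset.mem_erase.2 ⟨hxv, hx⟩
  have hux : u ∉ comp G (D.erase v₁) x := fun hh => hxE (mem_comp.2 (mem_comp.1 hh).symm)
  have hF : Lobe G D v₁ (comp G (D.erase v₁) x) :=
    ⟨h1.hv, ⟨x, hxm, rfl⟩, u, Finset.mem_of_mem_erase hu, Finset.ne_of_mem_erase hu, hux⟩
  obtain ⟨v₂, E₂, h2, hs, hn2⟩ := hF.shrink h.conn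
  refine ⟨v₁, _, v₂, E₂, h1, h2, ?_, fun hh => hF.notMem (hs hh), fun hh => ?_, hn1, hn2⟩
  · rw [Finset.disjoint_left]
    intro y hy hy2
    exact hxE (mem_comp.2 ((mem_comp.1 hy).trans (mem_comp.1 (hs hy2)).symm))
  · obtain ⟨y, hy, hyv, hyE⟩ := h2.out
    obtain ⟨z, hz, rfl⟩ := h2.isComp
    exact hyE (mem_comp.2 (hn1 v₂ hh z (Finset.mem_of_mem_erase hz) y hy
      (Finset.ne_of_mem_erase hz) hyv))

theorem NS.five' (h : NS G 5 c n D) (g : Gr G 5) (hc : NoCut G) (h3 : NoTri G)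
    (hl : Lobe G D v E) : AP 5 (HasCycleLen G) := by
  obtain ⟨v₁, E₁, v₂, E₂, l1, l2, hdis, hv1, hv2, hn1, hn2⟩ := h.two_lobes hl
  obtain ⟨s, hs, -, e₁, he₁, hs1⟩ := h.lobe_nb hc l1 (h.cyc.mem 0)
  obtain ⟨t, ht, hts, e₂, he₂, ht2⟩ := h.lobe_nb hc l2 hs
  have hth : Th G 3 := th_all h3 (by norm_num)
  have A1 : AP 3 (Lens G E₁ (nb G {s}) (nb G {v₁})) := hth _ _ _ (l1.ri h.conn hn1 he₁ hs1)
    fun w hw => by have := h.lobe_deg (s := s) g l1 hw (hn1 w hw); omega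
  have A2 : AP 3 (Lens G E₂ (nb G {t}) (nb G {v₂})) := hth _ _ _ (l2.ri h.conn hn2 he₂ ht2)
    fun w hw => by have := h.lobe_deg (s := t) g l2 hw (hn2 w hw); omega
  obtain ⟨i, m, hm1, hmn, rfl, rfl⟩ := h.cyc.pair hs ht hts.symm
  have p := (h.cyc.path i hmn).mono (h.cyc.arc_sub _ _)
  have r : Reach G ((D \ E₂) \ E₁) v₂ v₁ := by
    have r0 := (l2.back h.conn l1.hv hv1).symm
    have hv2' : v₂ ∈ (D \ E₂) \ E₁ :=
      Finset.mem_sdiff.2 ⟨Finset.mem_sdiff.2 ⟨l2.hv, l2.notMem⟩, hv2⟩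
    have hv1' : v₁ ∈ (D \ E₂) \ E₁ :=
      Finset.mem_sdiff.2 ⟨Finset.mem_sdiff.2 ⟨l1.hv, hv1⟩, l1.notMem⟩
    by_cases hvv : v₂ = v₁
    · rw [hvv]
      exact .refl hv1'
    obtain ⟨e, he, s', hs', hsD, hes⟩ := attach (S := insert v₁ E₁) r0
      (by simp [hvv, hv2]) (Finset.mem_insert_self _ _)
    have he' := Finset.mem_sdiff.1 (comp_sub he)
    have heD := (Finset.mem_sdiff.1 he'.1).1
    rw [Finset.mem_insert, not_or] at he'
    rcases Finset.mem_insert.1 hs' with e' | hsE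
    · rw [e'] at hes
      refine ((mem_comp.1 he).mono fun y hy => ?_).tail hes hv1'
      rw [Finset.mem_sdiff, Finset.mem_insert, not_or] at hy
      exact Finset.mem_sdiff.2 ⟨hy.1, hy.2.2⟩
    · exact (he'.2.1 (l1.bdry hsE heD he'.2.2 hes.symm)).elim
  obtain ⟨ρ, q⟩ := r.path
  have hCD : ∀ x ∈ img c n, x ∉ D := fun x hx => (h.compl x).2 hx
  have hsub₂ := l2.sub
  have hK : AP 3 fun x => 1 ≤ x ∧ PL G (Finset.univ \ E₁) (c i) v₁ x := by
    refine A2.shift (c := m + 1 + (ρ + 1)) fun y hy => ⟨by omega, ?_⟩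
    obtain ⟨a, ha, b, hb, py⟩ := hy
    have d1 : Disjoint (img c n) E₂ :=
      Finset.disjoint_left.2 fun x hx hx2 => hCD x hx (hsub₂ hx2)
    have j1 := p.join (mem_nb1.1 ha) py d1 Finset.subset_union_left Finset.subset_union_right
    have d2 : Disjoint (img c n ∪ E₂) ((D \ E₂) \ E₁) := by
      rw [Finset.disjoint_left]
      intro x hx hx2
      rw [Finset.mem_sdiff, Finset.mem_sdiff] at hx2
      rcases Finset.mem_union.1 hx with hx' | hx'
      · exact hCD x hx' hx2.1.1
      · exact hx2.1.2 hx'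
    have j2 := j1.join (W := Finset.univ \ E₁) (mem_nb1.1 hb).symm q d2 ?_ ?_
    · convert j2 using 1; omega
    · intro x hx
      refine Finset.mem_sdiff.2 ⟨Finset.mem_univ _, fun hx1 => ?_⟩
      rcases Finset.mem_union.1 hx with hx' | hx'
      · exact hCD x hx' (l1.sub hx1)
      · exact Finset.disjoint_left.1 hdis hx1 hx'
    · exact fun x hx => Finset.mem_sdiff.2 ⟨Finset.mem_univ _, (Finset.mem_sdiff.1 hx).2⟩
  exact cyc_add (P := {c i}) (Q := {v₁}) (m := 3) (n := 3) Finset.sdiff_disjoint (by norm_num)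
    (by norm_num) hK (fun x hx => hx.1) (fun x hx => by simpa using hx.2) A1

theorem Gr.girth_five {k : ℕ} (hk : k = 4 ∨ k = 5) (g : Gr G k) (hc : NoCut G) (h3 : NoTri G)
    (h4 : NoSq G) : AP k (HasCycleLen G) := by
  obtain ⟨c, n, D, h⟩ := g.ns (by omega) hc h3 h4
  by_cases hn : ∀ w ∈ D, NonCut G D w
  · exact h.no_cut g hk h3 h4 hn
  obtain ⟨w, hw, hwc⟩ : ∃ w ∈ D, ¬ NonCut G D w := by
    by_contra hcon
    push Not at hcon
    exact hn hcon
  obtain ⟨v, E, hl⟩ : ∃ v E, Lobe G D v E := by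
    unfold NonCut at hwc
    push Not at hwc
    obtain ⟨x, hx, y, hy, hxw, hyw, hr⟩ := hwc
    exact ⟨w, _, hw, ⟨x, Finset.mem_erase.2 ⟨hxw, hx⟩, rfl⟩, y, hy, hyw, fun hh =>
      hr (mem_comp.1 hh)⟩
  rcases hk with rfl | rfl
  · obtain ⟨v', E', hl', -, hn'⟩ := hl.shrink h.conn
    exact h.four g hc h3 h4 hl' hn'
  · exact h.five' g hc h3 hl

end

theorem Gr.trichotomy {k : ℕ} (hk : k = 4 ∨ k = 5) (g : Gr G k) :
    AP k (HasCycleLen G) ∨ (Clq G Finset.univ ∧ Fintype.card V = k + 1) ∨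
      NoTri G ∧ ∃ S T : Finset V, Bip G S T ∧ S.card = k ∧ S ∪ T = Finset.univ := by
  by_cases hbig : ∃ K, Clq G K ∧ K.card = k + 1
  · obtain ⟨K, hK, hKc⟩ := hbig
    by_cases hu : ∃ u, u ∉ K
    · obtain ⟨u, hu⟩ := hu
      exact Or.inl (g.big_clique (by omega) hK hKc hu)
    · push Not at hu
      obtain rfl : K = Finset.univ := Finset.eq_univ_iff_forall.2 hu
      exact Or.inr (Or.inl ⟨hK, hKc⟩)
  obtain ⟨K, hK, hmax⟩ := Finset.exists_max_image (Finset.univ.filter (Clq G)) Finset.card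
    ⟨∅, by simp [Clq]⟩
  replace hK : Clq G K := by simpa using hK
  replace hmax : ∀ K', Clq G K' → K'.card ≤ K.card := fun K' h' => hmax K' (by simpa using h')
  have hKk : K.card ≤ k := by
    by_contra hcon
    obtain ⟨K', hs, hc⟩ := Finset.exists_subset_card_eq (show k + 1 ≤ K.card by omega)
    exact hbig ⟨K', hK.mono hs, hc⟩
  by_cases h4 : 4 ≤ K.card
  · exact Or.inl (g.clique hk hK h4 hmax hKk)
  replace h4 : ∀ K', Clq G K' → K'.card ≤ 3 := fun K' h' => by have := hmax K' h'; omega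
  by_cases hd : ∀ x y z w, G.Adj x y → G.Adj x z → G.Adj y z → G.Adj x w → G.Adj y w → z = w
  swap
  · push Not at hd
    obtain ⟨x, y, z, w, h1, h2, h3, h5, h6, h7⟩ := hd
    exact Or.inl (g.diamond hk h4 h1 h2 h3 h5 h6 h7)
  by_cases h3 : NoTri G
  swap
  · unfold NoTri at h3
    push Not at h3
    obtain ⟨x, y, z, h1, h2, h5, -⟩ := h3
    exact Or.inl (g.triangle hk h4 hd h1 h5 h2)
  by_cases hc : NoCut G
  swap
  · unfold NoCut at hc
    push Not at hc
    obtain ⟨x, y, u, v, h1, h2, h5, h6⟩ := hc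
    exact Or.inl (g.cut hk h3 h1 h2 h5 h6)
  by_cases hs : NoSq G
  · exact Or.inl (g.girth_five hk hc h3 hs)
  · exact (g.square hk h3 hc hs).imp id fun h => Or.inr ⟨h3, h⟩

theorem Clq.iso_top {k : ℕ} (h : Clq G Finset.univ) (hc : Fintype.card V = k + 1) :
    Nonempty (G ≃g (⊤ : SimpleGraph (Fin (k + 1)))) := by
  refine ⟨⟨Fintype.equivFinOfCardEq hc, fun {a b} => ?_⟩⟩
  rw [SimpleGraph.top_adj, ne_eq, EmbeddingLike.apply_eq_iff_eq]
  exact ⟨fun hab => h a (Finset.mem_univ _) b (Finset.mem_univ _) hab, fun hab => hab.ne⟩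

theorem Bip.iso {k : ℕ} {S T : Finset V} (h : Bip G S T) (h3 : NoTri G) (hS : S.card = k)
    (hST : S ∪ T = Finset.univ) (hSn : S.Nonempty) (hTn : T.Nonempty) :
    Nonempty (G ≃g completeBipartiteGraph (Fin k) (Fin (Fintype.card V - k))) := by
  have hT : ∀ x, x ∉ S → x ∈ T := fun x hx =>
    (Finset.mem_union.1 (hST ▸ Finset.mem_univ x)).resolve_left hx
  have hSS : ∀ x ∈ S, ∀ y ∈ S, ¬ G.Adj x y := fun x hx y hy hxy => by
    obtain ⟨τ, hτ⟩ := hTn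
    exact h3 _ _ _ hxy (h y hy τ hτ) (h x hx τ hτ)
  have hTT : ∀ x ∈ T, ∀ y ∈ T, ¬ G.Adj x y := fun x hx y hy hxy => by
    obtain ⟨σ, hσ⟩ := hSn
    exact h3 _ _ _ (h σ hσ x hx) hxy (h σ hσ y hy)
  have e₁ : {x // x ∈ S} ≃ Fin k := Fintype.equivFinOfCardEq (by simpa using hS)
  have e₂ : {x // x ∉ S} ≃ Fin (Fintype.card V - k) := Fintype.equivFinOfCardEq (by
    rw [Fintype.card_subtype_compl]
    simp [hS])
  refine ⟨SimpleGraph.Iso.symm ⟨(Equiv.sumCongr e₁.symm e₂.symm).trans (Equiv.sumCompl (· ∈ S)),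
    fun {a b} => ?_⟩⟩
  rcases a with a | a <;> rcases b with b | b
  · simpa using hSS _ (e₁.symm a).2 _ (e₁.symm b).2
  · simpa using h _ (e₁.symm a).2 _ (hT _ (e₂.symm b).2)
  · simpa using (h _ (e₁.symm b).2 _ (hT _ (e₂.symm a).2)).symm
  · simpa using hTT _ (hT _ (e₂.symm a).2) _ (hT _ (e₂.symm b).2)

end Rooted

/-- Let `k ∈ {4,5}` and let `G` be a 2-connected graph with minimum
degree at least `k`. Then `G` contains `k` admissible cycles, unless `G` is `K_{k+1}`
or `K_{k,n-k}`. -/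
theorem stmt14 {V : Type*} [Fintype V] [DecidableEq V] (G : SimpleGraph V)
    [DecidableRel G.Adj] (k : ℕ) (hk : k = 4 ∨ k = 5)
    (h2 : KConnected G 2) (hδ : ∀ v : V, k ≤ G.degree v) :
    HasAdmissibleCycles G k ∨
      Nonempty (G ≃g (⊤ : SimpleGraph (Fin (k + 1)))) ∨
      Nonempty (G ≃g completeBipartiteGraph (Fin k) (Fin (Fintype.card V - k))) := by
  have g := Rooted.Gr.of h2 hδ
  rcases g.trichotomy hk with h | ⟨h, hc⟩ | ⟨h3, S, T, h, hS, hST⟩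
  · exact Or.inl h
  · exact Or.inr (Or.inl (h.iso_top hc))
  · obtain ⟨u, hu⟩ := g.exists_notMem hS.le
    exact Or.inr (Or.inr (h.iso h3 hS hST (Finset.card_pos.1 (by omega))
      ⟨u, (Finset.mem_union.1 (hST ▸ Finset.mem_univ u)).resolve_left hu⟩))
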